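/- Let γ ⊂ ℂ̂ be a Weil–Petersson quasicircle with complementary components Ω, Ω*, and let γ_n = f_n(S¹) be its equipotential approximations, where f : 𝔻 → Ω is conformal with f(0)=0, f'(0)=1, f''(0)=0, and f_n(z) = (n/(n−1)) f((n−1)z/n). Then the total mean curvatures of the Epstein–Poincaré surfaces converge: ∫_𝔻 |𝒮(f_n)|² ρ_𝔻⁻¹ d²z → ∫_𝔻 |𝒮(f)|² ρ_𝔻⁻¹ d²z as n → ∞, and similarly ∫_{𝔻*} |𝒮(g_n)|² ρ_{𝔻*}⁻¹ d²z → ∫_{𝔻*} |𝒮(g)|² ρ_{𝔻*}⁻¹ d²z for conformal maps g_n : 𝔻* → ℂ̂\f_n(𝔻)̄ and g : 𝔻* → Ω*. -/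

import Mathlib

open Complex Metric Set MeasureTheory Filter

/-- A Jordan curve in `ℂ`: an injective continuous image of the circle `ℝ/ℤ`. -/
def IsJordanCurve (γ : Set ℂ) : Prop :=
  ∃ φ : AddCircle (1 : ℝ) → ℂ, Continuous φ ∧ Function.Injective φ ∧ Set.range φ = γ

/-- The exterior of the closed unit disk in `ℂ` (the finite part of `𝔻*`). -/
def extDisk : Set ℂ := {z : ℂ | 1 < ‖z‖}

/-- The Schwarzian derivative `𝒮(f) = f'''/f' - (3/2)(f''/f')²`. -/
noncomputable def schwarzian (f : ℂ → ℂ) (z : ℂ) : ℂ :=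
  deriv (deriv (deriv f)) z / deriv f z - (3 / 2) * (deriv (deriv f) z / deriv f z) ^ 2


lemma univ_nhds_le {f : ℂ → ℂ} {U : Set ℂ} (hU : IsOpen U) (hf : DifferentiableOn ℂ f U)
    (hi : InjOn f U) {z : ℂ} (hz : z ∈ U) : nhds (f z) ≤ map f (nhds z) := by
  have ha : AnalyticAt ℂ f z := hf.analyticAt (hU.mem_nhds hz)
  refine ha.eventually_constant_or_nhds_le_map_nhds.resolve_left ?_
  intro h
  have h2 : ∀ᶠ w in nhds z, w = z := by
    filter_upwards [h, hU.mem_nhds hz] with w hw hwU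
    exact hi hwU hz hw
  have h3 : ∀ᶠ w in nhdsWithin z {z}ᶜ, False := by
    filter_upwards [h2.filter_mono nhdsWithin_le_nhds, self_mem_nhdsWithin] with w h1 h4
    exact h4 h1
  simp at h3
  exact (NormedField.nhdsNE_neBot z).ne h3

lemma univ_image_open {f : ℂ → ℂ} {U : Set ℂ} (hU : IsOpen U) (hf : DifferentiableOn ℂ f U)
    (hi : InjOn f U) {V : Set ℂ} (hV : IsOpen V) (hVU : V ⊆ U) : IsOpen (f '' V) := by
  rw [isOpen_iff_mem_nhds]
  rintro _ ⟨z, hz, rfl⟩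
  exact univ_nhds_le hU hf hi (hVU hz) (image_mem_map (hV.mem_nhds hz))

/-- the inverse of an injective holomorphic map is continuous -/
lemma univ_inv_continuousAt {f q : ℂ → ℂ} {U : Set ℂ} (hU : IsOpen U)
    (hf : DifferentiableOn ℂ f U) (hi : InjOn f U) (hq : ∀ z ∈ U, q (f z) = z) {z : ℂ}
    (hz : z ∈ U) : ContinuousAt q (f z) := by
  unfold ContinuousAt
  rw [hq z hz]
  refine (Filter.map_mono (m := q) (univ_nhds_le hU hf hi hz)).trans ?_
  rw [Filter.map_map]
  refine Tendsto.congr' (f₁ := id) ?_ tendsto_id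
  filter_upwards [hU.mem_nhds hz] with w hw
  simp [hq w hw]

lemma univ_inv_deriv {f q : ℂ → ℂ} {U : Set ℂ} (hU : IsOpen U)
    (hf : DifferentiableOn ℂ f U) (hi : InjOn f U) (hq : ∀ z ∈ U, q (f z) = z) {z : ℂ}
    (hz : z ∈ U) : deriv f z ≠ 0 ∧ HasDerivAt q (deriv f z)⁻¹ (f z) := by
  have key : ∀ w ∈ U, deriv f w ≠ 0 → HasDerivAt q (deriv f w)⁻¹ (f w) := by
    intro w hw h0
    refine HasDerivAt.of_local_left_inverse (univ_inv_continuousAt hU hf hi hq hw) (f := f) ?_ h0 ?_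
    · rw [hq w hw]
      exact (hf.differentiableAt (hU.mem_nhds hw)).hasDerivAt
    · have : f '' U ∈ nhds (f w) :=
        univ_nhds_le hU hf hi hw (image_mem_map (hU.mem_nhds hw))
      filter_upwards [this]
      rintro _ ⟨x, hx, rfl⟩
      rw [hq x hx]
  have hne : deriv f z ≠ 0 := by
    intro h0
    have ha : AnalyticAt ℂ f z := hf.analyticAt (hU.mem_nhds hz)
    have hnz : ∀ᶠ w in nhdsWithin z {z}ᶜ, deriv f w ≠ 0 := by
      refine ha.deriv.eventually_eq_zero_or_eventually_ne_zero.resolve_left ?_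
      intro hz0
      obtain ⟨r, hr, hball⟩ := Metric.eventually_nhds_iff_ball.1 (hz0.and (hU.mem_nhds hz))
      have hc : ∀ w ∈ ball z r, f w = f z := by
        intro w hw
        refine (convex_ball z r).is_const_of_fderivWithin_eq_zero (𝕜 := ℂ) (f := f)
          (hf.mono fun x hx => (hball x hx).2) ?_ hw (mem_ball_self hr)
        intro x hx
        rw [fderivWithin_of_isOpen isOpen_ball hx]
        ext
        simp [(hball x hx).1]
      have hw : z + (r/2 : ℝ) ∈ ball z r := by
        simp [abs_of_pos hr]; linarith
      have := hi (hball _ hw).2 hz (hc _ hw)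
      simp at this
      exact hr.ne' this
    have hdq : AnalyticAt ℂ q (f z) := by
      refine analyticAt_of_differentiable_on_punctured_nhds_of_continuousAt ?_
        (univ_inv_continuousAt hU hf hi hq hz)
      rw [eventually_nhdsWithin_iff] at hnz ⊢
      have h1 := univ_nhds_le hU hf hi hz (image_mem_map (hnz.and (hU.mem_nhds hz)))
      filter_upwards [h1]
      rintro _ ⟨x, ⟨hx, hxU⟩, rfl⟩ hne
      refine (key x hxU (hx ?_)).differentiableAt
      rintro rfl
      exact hne rfl
    have h2 : HasDerivAt (q ∘ f) (deriv q (f z) * deriv f z) z :=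
      hdq.differentiableAt.hasDerivAt.comp z (hf.differentiableAt (hU.mem_nhds hz)).hasDerivAt
    have h3 : HasDerivAt (q ∘ f) 1 z := by
      refine (hasDerivAt_id z).congr_of_eventuallyEq ?_
      filter_upwards [hU.mem_nhds hz] with w hw
      simp [hq w hw]
    have := h2.unique h3
    simp [h0] at this
  exact ⟨hne, key z hz hne⟩

lemma univ_deriv_ne {f : ℂ → ℂ} {U : Set ℂ} (hU : IsOpen U)
    (hf : DifferentiableOn ℂ f U) (hi : InjOn f U) {z : ℂ}
    (hz : z ∈ U) : deriv f z ≠ 0 :=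
  (univ_inv_deriv hU hf hi (q := Function.invFunOn f U)
    (fun _ hx => hi.leftInvOn_invFunOn hx) hz).1

lemma univ_exists_inv {f : ℂ → ℂ} {U : Set ℂ} (hU : IsOpen U)
    (hf : DifferentiableOn ℂ f U) (hi : InjOn f U) :
    ∃ q : ℂ → ℂ, DifferentiableOn ℂ q (f '' U) ∧ (∀ z ∈ U, q (f z) = z) ∧
      (∀ z ∈ U, HasDerivAt q (deriv f z)⁻¹ (f z)) ∧ InjOn q (f '' U) := by
  refine ⟨Function.invFunOn f U, ?_, fun _ hx => hi.leftInvOn_invFunOn hx, fun z hz =>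
    (univ_inv_deriv hU hf hi (fun _ hx => hi.leftInvOn_invFunOn hx) hz).2, ?_⟩
  · rintro _ ⟨z, hz, rfl⟩
    exact (univ_inv_deriv hU hf hi (fun _ hx => hi.leftInvOn_invFunOn hx)
      hz).2.differentiableAt.differentiableWithinAt
  · rintro _ ⟨z, hz, rfl⟩ _ ⟨w, hw, rfl⟩ h
    rw [hi.leftInvOn_invFunOn hz, hi.leftInvOn_invFunOn hw] at h
    rw [h]

/-- Schwarzian from explicit derivatives. -/
lemma schwarzian_eq {f f1 f2 f3 : ℂ → ℂ} {z : ℂ} (h1 : ∀ᶠ w in nhds z, HasDerivAt f (f1 w) w)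
    (h2 : ∀ᶠ w in nhds z, HasDerivAt f1 (f2 w) w) (h3 : HasDerivAt f2 (f3 z) z) :
    schwarzian f z = f3 z / f1 z - 3 / 2 * (f2 z / f1 z) ^ 2 := by
  have e1 : deriv f =ᶠ[nhds z] f1 := by filter_upwards [h1] with w hw using hw.deriv
  have e2 : deriv (deriv f) =ᶠ[nhds z] f2 := by
    filter_upwards [e1.eventuallyEq_nhds, h2] with w hw hw2
    rw [hw.deriv_eq, hw2.deriv]
  rw [schwarzian, e2.deriv_eq, h3.deriv, e2.eq_of_nhds, e1.eq_of_nhds]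

lemma schwarzian_congr {f h : ℂ → ℂ} {z : ℂ} (e : f =ᶠ[nhds z] h) :
    schwarzian f z = schwarzian h z := by
  have e1 := e.deriv
  have e2 := e1.deriv
  rw [schwarzian, schwarzian, e2.deriv_eq, e2.eq_of_nhds, e1.eq_of_nhds]

lemma analytic_derivs {f : ℂ → ℂ} {z : ℂ} (hf : AnalyticAt ℂ f z) :
    (∀ᶠ w in nhds z, HasDerivAt f (deriv f w) w) ∧
    (∀ᶠ w in nhds z, HasDerivAt (deriv f) (deriv (deriv f) w) w) ∧
    HasDerivAt (deriv (deriv f)) (deriv (deriv (deriv f)) z) z := by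
  refine ⟨?_, ?_, hf.deriv.deriv.differentiableAt.hasDerivAt⟩
  · filter_upwards [hf.eventually_analyticAt] with w hw using hw.differentiableAt.hasDerivAt
  · filter_upwards [hf.deriv.eventually_analyticAt] with w hw using hw.differentiableAt.hasDerivAt

lemma schwarzian_comp {f h : ℂ → ℂ} {z : ℂ} (hh : AnalyticAt ℂ h z) (hf : AnalyticAt ℂ f (h z))
    (hf0 : deriv f (h z) ≠ 0) (hh0 : deriv h z ≠ 0) :
    schwarzian (fun w => f (h w)) z = schwarzian f (h z) * deriv h z ^ 2 + schwarzian h z := by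
  obtain ⟨a1, a2, a3⟩ := analytic_derivs hh
  obtain ⟨b1, b2, b3⟩ := analytic_derivs hf
  have c1 := hh.continuousAt.eventually b1
  have c2 := hh.continuousAt.eventually b2
  rw [schwarzian_eq (f1 := fun w => deriv f (h w) * deriv h w)
    (f2 := fun w => deriv (deriv f) (h w) * deriv h w * deriv h w + deriv f (h w) *
       deriv (deriv h) w)
    (f3 := fun w => (deriv (deriv (deriv f)) (h w) * deriv h w * deriv h w +
       deriv (deriv f) (h w) * deriv (deriv h) w) * deriv h w +
       deriv (deriv f) (h w) * deriv h w * deriv (deriv h) w +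
        (deriv (deriv f) (h w) * deriv h w * deriv (deriv h) w +
        deriv f (h w) * deriv (deriv (deriv h)) w))]
  · simp only [schwarzian]
    field_simp
    ring
  · filter_upwards [a1, c1] with w hw hw2
    exact hw2.comp w hw
  · filter_upwards [a1, a2, c2] with w h1 h2 h3
    exact (h3.comp w h1).mul h2
  · have a1' := a1.self_of_nhds
    have a2' := a2.self_of_nhds
    have b2' := b2.self_of_nhds
    have := (((b3.comp z a1').mul a2').mul a2').add ((b2'.comp z a1').mul a3)
    refine this.congr_deriv ?_
    simp only [Function.comp, Pi.mul_apply]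

lemma schwarzian_const_mul {f : ℂ → ℂ} {c : ℂ} (hc : c ≠ 0) (z : ℂ) :
    schwarzian (fun w => c * f w) z = schwarzian f z := by
  have e1 : deriv (fun w => c * f w) = fun w => c * deriv f w := by
    ext w; exact deriv_const_mul_field c
  have e2 : deriv (fun w => c * deriv f w) = fun w => c * deriv (deriv f) w := by
    ext w; exact deriv_const_mul_field c
  have e3 : deriv (fun w => c * deriv (deriv f) w) = fun w => c * deriv (deriv (deriv f)) w := by
    ext w; exact deriv_const_mul_field c
  rw [schwarzian, schwarzian, e1, e2, e3]
  simp only [mul_div_mul_left _ _ hc]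

lemma schwarzian_mul_left (c : ℂ) (z : ℂ) : schwarzian (fun w => c * w) z = 0 := by
  by_cases hc : c = 0
  · subst hc
    simp [schwarzian]
  · rw [schwarzian_eq (f1 := fun _ => c) (f2 := fun _ => 0) (f3 := fun _ => 0)]
    · simp
    · exact Eventually.of_forall fun w => by simpa using (hasDerivAt_id w).const_mul c
    · exact Eventually.of_forall fun w => hasDerivAt_const _ _
    · exact hasDerivAt_const _ _

lemma schwarzian_inv {z : ℂ} (hz : z ≠ 0) : schwarzian (fun w => w⁻¹) z = 0 := by
  have hne : ∀ᶠ w in nhds z, w ≠ 0 := isOpen_ne.mem_nhds hz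
  have p2 : ∀ w : ℂ, w ≠ 0 → HasDerivAt (fun w : ℂ => (w^2)⁻¹) (-(2 * w)/(w^2)^2) w := by
    intro w hw
    have := (hasDerivAt_pow 2 w).inv (pow_ne_zero 2 hw)
    exact this.congr_deriv (by simp)
  have p3 : ∀ w : ℂ, w ≠ 0 → HasDerivAt (fun w : ℂ => (w^3)⁻¹) (-(3 * w^2)/(w^3)^2) w := by
    intro w hw
    have := (hasDerivAt_pow 3 w).inv (pow_ne_zero 3 hw)
    exact this.congr_deriv (by simp)
  rw [schwarzian_eq (f1 := fun w => -(w^2)⁻¹) (f2 := fun w => 2 * (w^3)⁻¹)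
    (f3 := fun w => -6 * (w^4)⁻¹)]
  · field_simp
    ring
  · filter_upwards [hne] with w hw using hasDerivAt_inv hw
  · filter_upwards [hne] with w hw
    have := (p2 w hw).neg
    refine this.congr_deriv ?_
    field_simp
  · have := (p3 z hz).const_mul 2
    refine this.congr_deriv ?_
    field_simp
    ring

lemma schwarzian_inv_comp {f : ℂ → ℂ} {z : ℂ} (hf : AnalyticAt ℂ f z) (h0 : f z ≠ 0)
    (hd : deriv f z ≠ 0) : schwarzian (fun w => (f w)⁻¹) z = schwarzian f z := by
  have := schwarzian_comp (f := fun w => w⁻¹) hf (analyticAt_inv h0) (by simp [h0]) hd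
  rw [this, schwarzian_inv h0]; ring

/-- `S(f(c·))`. -/
lemma schwarzian_comp_mul {f : ℂ → ℂ} {z c : ℂ} (hc : c ≠ 0) (hf : AnalyticAt ℂ f (c * z))
    (hd : deriv f (c * z) ≠ 0) :
    schwarzian (fun w => f (c * w)) z = schwarzian f (c * z) * c ^ 2 := by
  have hh : AnalyticAt ℂ (fun w => c * w) z := by fun_prop
  have e : deriv (fun w => c * w) z = c := by
    have := ((hasDerivAt_id z).const_mul c).deriv
    simpa using this
  rw [schwarzian_comp hh hf hd (by rw [e]; exact hc), e, schwarzian_mul_left]; ring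

/-- `S(f(1/z)) = S(f)(1/z) z^{-4}`. -/
lemma schwarzian_comp_inv {f : ℂ → ℂ} {z : ℂ} (hz : z ≠ 0) (hf : AnalyticAt ℂ f z⁻¹)
    (hd : deriv f z⁻¹ ≠ 0) :
    schwarzian (fun w => f w⁻¹) z = schwarzian f z⁻¹ * (z ^ 4)⁻¹ := by
  rw [schwarzian_comp (h := fun w => w⁻¹) (analyticAt_inv hz) hf hd (by simp [hz]),
    schwarzian_inv hz, deriv_inv]
  field_simp
  ring

lemma schwarzian_analyticAt {f : ℂ → ℂ} {z : ℂ} (hf : AnalyticAt ℂ f z) (hd : deriv f z ≠ 0) :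
    AnalyticAt ℂ (schwarzian f) z := by
  unfold schwarzian
  have h1 := hf.deriv
  have h2 := h1.deriv
  exact (h2.deriv.div h1 hd).sub (analyticAt_const.mul ((h2.div h1 hd).pow 2))

/-- First conjunct. -/
lemma part1_scale {f : ℂ → ℂ} (hf : DifferentiableOn ℂ f (ball (0:ℂ) 1))
    (hfinj : InjOn f (ball (0:ℂ) 1)) {r : ℝ} (hr0 : 0 < r) (hr1 : r < 1) {c : ℂ} (hc : c ≠ 0) :
    ∫ z in ball (0:ℂ) 1, ‖schwarzian (fun z => c * f (r * z)) z‖ ^ 2 * (1 - ‖z‖ ^ 2) ^ 2 / 4 =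
    ∫ z in ball (0:ℂ) 1, (ball (0:ℂ) r).indicator
      (fun z => ‖schwarzian f z‖ ^ 2 * (r^2 - ‖z‖ ^ 2) ^ 2 / (4 * r^2)) z := by
  have hrc : (r:ℂ) ≠ 0 := by exact_mod_cast hr0.ne'
  have e1 : ∀ z ∈ ball (0:ℂ) 1, ‖schwarzian (fun z => c * f (r * z)) z‖ ^ 2 *
      (1 - ‖z‖ ^ 2) ^ 2 / 4 = (fun w => ‖schwarzian f w‖ ^ 2 * (r^2 - ‖w‖ ^ 2) ^ 2 / 4)
        (r • z) := by
    intro z hz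
    have hz1 : ‖z‖ < 1 := by simpa using hz
    have hm : (r:ℂ) * z ∈ ball (0:ℂ) 1 := by
      simp only [mem_ball, dist_zero_right, norm_mul, Complex.norm_real, Real.norm_eq_abs,
        abs_of_pos hr0]
      nlinarith [norm_nonneg z]
    rw [schwarzian_const_mul hc, schwarzian_comp_mul hrc
      (hf.analyticAt (isOpen_ball.mem_nhds hm)) (univ_deriv_ne isOpen_ball hf hfinj hm)]
    simp only [real_smul, norm_mul, norm_pow, Complex.norm_real, Real.norm_eq_abs,
        abs_of_pos hr0]
    ring
  rw [setIntegral_congr_fun measurableSet_ball e1,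
    Measure.setIntegral_comp_smul volume
      (fun w => ‖schwarzian f w‖ ^ 2 * (r^2 - ‖w‖ ^ 2) ^ 2 / 4) (ball (0:ℂ) 1) hr0.ne', setIntegral_indicator measurableSet_ball,
    smul_unitBall hr0.ne', inter_eq_right.2 (ball_subset_ball _), Complex.finrank_real_complex,
    Real.norm_eq_abs, abs_of_pos hr0, smul_eq_mul, ← integral_const_mul]
  · refine integral_congr_ae (Eventually.of_forall fun z => ?_)
    simp only
    rw [abs_of_pos (by positivity)]
    field_simp
  · exact hr1.le

lemma rn_tendsto : Tendsto (fun n : ℕ => ((n:ℝ) - 1) / n) atTop (nhds 1) := by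
  have : Tendsto (fun n : ℕ => 1 - ((n:ℝ))⁻¹) atTop (nhds (1 - 0)) :=
    tendsto_const_nhds.sub tendsto_inv_atTop_nhds_zero_nat
  rw [sub_zero] at this
  refine this.congr' ?_
  filter_upwards [eventually_ge_atTop 1] with n hn
  have : (n:ℝ) ≠ 0 := by positivity
  field_simp

lemma rn_pos {n : ℕ} (hn : 2 ≤ n) : 0 < ((n:ℝ) - 1) / n := by
  have : (2:ℝ) ≤ n := by exact_mod_cast hn
  apply div_pos <;> linarith

lemma rn_lt {n : ℕ} (hn : 2 ≤ n) : ((n:ℝ) - 1) / n < 1 := by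
  have : (2:ℝ) ≤ n := by exact_mod_cast hn
  rw [div_lt_one] <;> linarith

lemma part1 {f : ℂ → ℂ} {fn : ℕ → ℂ → ℂ}
    (hf : DifferentiableOn ℂ f (ball (0:ℂ) 1))
    (hfinj : InjOn f (ball (0:ℂ) 1))
    (hWP : IntegrableOn (fun z => ‖schwarzian f z‖ ^ 2 * (1 - ‖z‖ ^ 2) ^ 2 / 4)
      (ball (0:ℂ) 1))
    (hfn : ∀ n : ℕ, 2 ≤ n →
      fn n = fun z => ((n : ℂ) / ((n : ℂ) - 1)) * f ((((n : ℂ) - 1) / (n : ℂ)) * z)) :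
    Tendsto (fun n =>
        ∫ z in ball (0:ℂ) 1, ‖schwarzian (fn n) z‖ ^ 2 * (1 - ‖z‖ ^ 2) ^ 2 / 4)
      atTop (nhds (∫ z in ball (0:ℂ) 1, ‖schwarzian f z‖ ^ 2 * (1 - ‖z‖ ^ 2) ^ 2 / 4)) := by
  set r : ℕ → ℝ := fun n => ((n:ℝ) - 1) / n with hr
  have hcont : ContinuousOn (schwarzian f) (ball 0 1) := fun z hz =>
    (schwarzian_analyticAt (hf.analyticAt (isOpen_ball.mem_nhds hz))
      (univ_deriv_ne isOpen_ball hf hfinj hz)).continuousAt.continuousWithinAt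
  have hmain : Tendsto (fun n => ∫ z in ball (0:ℂ) 1, (ball (0:ℂ) (r n)).indicator
      (fun z => ‖schwarzian f z‖ ^ 2 * ((r n)^2 - ‖z‖ ^ 2) ^ 2 / (4 * (r n)^2)) z) atTop
      (nhds (∫ z in ball (0:ℂ) 1, ‖schwarzian f z‖ ^ 2 * (1 - ‖z‖ ^ 2) ^ 2 / 4)) := by
    refine tendsto_integral_filter_of_dominated_convergence _ ?_ ?_ hWP ?_
    · filter_upwards [eventually_ge_atTop 2] with n hn
      refine AEStronglyMeasurable.indicator ?_ measurableSet_ball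
      refine ContinuousOn.aestronglyMeasurable ?_ measurableSet_ball
      refine ContinuousOn.div_const ?_ _
      refine ContinuousOn.mul (hcont.norm.pow 2) ?_
      fun_prop
    · filter_upwards [eventually_ge_atTop 2] with n hn
      have h0 := rn_pos hn
      have h1 := rn_lt hn
      change 0 < r n at h0
      change r n < 1 at h1
      filter_upwards [ae_restrict_mem measurableSet_ball] with z hz
      have hz1 : ‖z‖ < 1 := by simpa using hz
      by_cases hzr : z ∈ ball (0:ℂ) (r n)
      · rw [indicator_of_mem hzr, Real.norm_eq_abs, abs_of_nonneg (by positivity)]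
        have hz2 : ‖z‖ < r n := by simpa using hzr
        rw [mul_div_assoc, mul_div_assoc]
        refine mul_le_mul_of_nonneg_left ?_ (by positivity)
        rw [div_le_div_iff₀ (by positivity) (by positivity)]
        have h3 : (r n)^2 - ‖z‖^2 ≤ (1 - ‖z‖^2) * r n := by
          nlinarith [norm_nonneg z]
        have h4 : 0 ≤ (r n)^2 - ‖z‖^2 := by nlinarith [norm_nonneg z]
        have := pow_le_pow_left₀ h4 h3 2
        nlinarith
      · rw [indicator_of_notMem hzr, norm_zero]; positivity
    · filter_upwards [ae_restrict_mem measurableSet_ball] with z hz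
      have hz1 : ‖z‖ < 1 := by simpa using hz
      have ht : Tendsto (fun n => ‖schwarzian f z‖ ^ 2 * ((r n)^2 - ‖z‖ ^ 2) ^ 2 / (4 * (r n)^2))
          atTop (nhds (‖schwarzian f z‖ ^ 2 * (1^2 - ‖z‖ ^ 2) ^ 2 / (4 * 1^2))) := by
        have := rn_tendsto
        refine Tendsto.div (Tendsto.const_mul _ (((this.pow 2).sub_const _).pow 2))
          ((this.pow 2).const_mul _) (by norm_num)
      simp only [one_pow, mul_one] at ht
      refine ht.congr' ?_
      filter_upwards [(tendsto_order.1 rn_tendsto).1 ‖z‖ hz1] with n hn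
      rw [indicator_of_mem]
      simpa using hn
  refine hmain.congr' ?_
  filter_upwards [eventually_ge_atTop 2] with n hn
  have hn2 : (2:ℝ) ≤ n := by exact_mod_cast hn
  rw [hfn n hn, ← part1_scale hf hfinj (rn_pos hn) (rn_lt hn) (c := (n:ℂ)/((n:ℂ)-1))]
  · push_cast; rfl
  · have h1 : (n:ℂ) ≠ 0 := by exact_mod_cast (by linarith : (n:ℝ) ≠ 0)
    have h2 : (n:ℂ) - 1 ≠ 0 := by
      have : ((n:ℝ) - 1) ≠ 0 := by linarith
      exact_mod_cast this
    exact div_ne_zero h1 h2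

/-- the real linear map `v ↦ a v + b conj v` -/
noncomputable def abL (a b : ℂ) : ℂ →L[ℝ] ℂ :=
  a • (ContinuousLinearMap.id ℝ ℂ) + b • (conjCLE : ℂ →L[ℝ] ℂ)

lemma abL_apply (a b v : ℂ) : abL a b v = a * v + b * (starRingEnd ℂ) v := by
  simp [abL]

lemma abL_det (a b : ℂ) : (abL a b).det = ‖a‖ ^ 2 - ‖b‖ ^ 2 := by
  rw [ContinuousLinearMap.det, ← LinearMap.det_toMatrix basisOneI, Matrix.det_fin_two]
  simp only [LinearMap.toMatrix_apply, ContinuousLinearMap.coe_coe, abL_apply,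
    coe_basisOneI_repr, coe_basisOneI]
  rw [← Complex.normSq_eq_norm_sq, ← Complex.normSq_eq_norm_sq, Complex.normSq_apply,
    Complex.normSq_apply]
  simp
  ring

lemma hasFDerivAt_abL_of_hasDerivAt {f : ℂ → ℂ} {f' z : ℂ} (h : HasDerivAt f f' z) :
    HasFDerivAt f (abL f' 0) z := by
  have := h.hasFDerivAt.restrictScalars ℝ
  refine this.congr_fderiv ?_
  refine ContinuousLinearMap.ext fun v => ?_
  rw [abL_apply]
  simp [mul_comm]

lemma det_abL_zero (a : ℂ) : |(abL a 0).det| = ‖a‖ ^ 2 := by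
  rw [abL_det]; simp

lemma cov_lintegral {f : ℂ → ℂ} {U : Set ℂ} (hU : IsOpen U) (hf : DifferentiableOn ℂ f U)
    (hi : InjOn f U) (F : ℂ → ENNReal) :
    ∫⁻ w in f '' U, F w = ∫⁻ z in U, ENNReal.ofReal (‖deriv f z‖ ^ 2) * F (f z) := by
  rw [lintegral_image_eq_lintegral_abs_det_fderiv_mul volume hU.measurableSet
    (f' := fun z => abL (deriv f z) 0) ?_ hi]
  · simp only [det_abL_zero]
  · intro z hz
    exact (hasFDerivAt_abL_of_hasDerivAt
      (hf.differentiableAt (hU.mem_nhds hz)).hasDerivAt).hasFDerivWithinAt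

lemma cov_integral {f : ℂ → ℂ} {U : Set ℂ} (hU : IsOpen U) (hf : DifferentiableOn ℂ f U)
    (hi : InjOn f U) (F : ℂ → ℝ) :
    ∫ w in f '' U, F w = ∫ z in U, ‖deriv f z‖ ^ 2 * F (f z) := by
  rw [integral_image_eq_integral_abs_det_fderiv_smul volume hU.measurableSet
    (f' := fun z => abL (deriv f z) 0) ?_ hi]
  · simp only [det_abL_zero, smul_eq_mul]
  · intro z hz
    exact (hasFDerivAt_abL_of_hasDerivAt
      (hf.differentiableAt (hU.mem_nhds hz)).hasDerivAt).hasFDerivWithinAt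

lemma inv_image_extDisk : (fun z : ℂ => z⁻¹) '' (ball 0 1 \ {0}) = extDisk := by
  ext w
  constructor
  · rintro ⟨z, ⟨hz, h0⟩, rfl⟩
    have hz1 : ‖z‖ < 1 := by simpa using hz
    have h0' : z ≠ 0 := h0
    simp only [extDisk, mem_ofPred_eq, norm_inv]
    exact (one_lt_inv₀ (norm_pos_iff.2 h0')).2 hz1
  · intro hw
    have hw1 : 1 < ‖w‖ := hw
    have : w ≠ 0 := by rintro rfl; simp at hw1; linarith
    refine ⟨w⁻¹, ⟨?_, ?_⟩, by simp⟩
    · simp only [mem_ball, dist_zero_right, norm_inv]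
      exact inv_lt_one_of_one_lt₀ hw1
    · simpa using this

lemma inv_mem_extDisk {z : ℂ} (hz : z ∈ ball (0:ℂ) 1) (h0 : z ≠ 0) : z⁻¹ ∈ extDisk := by
  rw [← inv_image_extDisk]
  exact ⟨z, ⟨hz, h0⟩, rfl⟩

lemma isOpen_extDisk : IsOpen extDisk := isOpen_lt continuous_const continuous_norm

/-- Passing to `G(z) = 1/g(1/z)`. -/
lemma exists_gt {g : ℂ → ℂ} {Om : Set ℂ} (hOm : IsOpen Om) (h0 : (0:ℂ) ∈ Om)
    (hg : DifferentiableOn ℂ g extDisk) (hginj : InjOn g extDisk)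
    (hgim : g '' extDisk = (closure Om)ᶜ) :
    ∃ G : ℂ → ℂ, DifferentiableOn ℂ G (ball 0 1) ∧ InjOn G (ball 0 1) ∧ G 0 = 0 ∧
      (∀ z ∈ ball (0:ℂ) 1, z ≠ 0 → G z = (g z⁻¹)⁻¹ ∧ g z⁻¹ ≠ 0) := by
  obtain ⟨c0, hc0, hball⟩ := Metric.isOpen_iff.1 hOm 0 h0
  have hlow : ∀ z ∈ ball (0:ℂ) 1, z ≠ 0 → c0 ≤ ‖g z⁻¹‖ := by
    intro z hz hz0
    by_contra! h
    have h1 : g z⁻¹ ∈ (closure Om)ᶜ := hgim ▸ ⟨_, inv_mem_extDisk hz hz0, rfl⟩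
    exact h1 (subset_closure (hball (by simpa using h)))
  have hgne : ∀ z ∈ ball (0:ℂ) 1, z ≠ 0 → g z⁻¹ ≠ 0 := by
    intro z hz hz0 h
    have := hlow z hz hz0
    rw [h, norm_zero] at this
    linarith
  set G0 : ℂ → ℂ := fun z => (g z⁻¹)⁻¹ with hG0
  set G : ℂ → ℂ := Function.update G0 0 (limUnder (nhdsWithin 0 {0}ᶜ) G0) with hG
  have hGeq : ∀ z, z ≠ 0 → G z = G0 z := fun z hz => by rw [hG, Function.update_of_ne hz]
  have hGd : DifferentiableOn ℂ G (ball 0 1) := by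
    refine differentiableOn_update_limUnder_of_bddAbove (ball_mem_nhds 0 one_pos) ?_ ?_
    · intro z hz
      have hz0 : z ≠ 0 := hz.2
      refine DifferentiableAt.differentiableWithinAt ?_
      refine DifferentiableAt.inv ?_ (hgne z hz.1 hz0)
      exact (hg.differentiableAt (isOpen_extDisk.mem_nhds (inv_mem_extDisk hz.1 hz0))).comp z
        (differentiableAt_inv hz0)
    · refine ⟨c0⁻¹, ?_⟩
      rintro _ ⟨z, hz, rfl⟩
      simp only [Function.comp, hG0, norm_inv]
      exact inv_anti₀ hc0 (hlow z hz.1 hz.2)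
  have hGinj0 : ∀ z ∈ ball (0:ℂ) 1, z ≠ 0 → ∀ w ∈ ball (0:ℂ) 1, w ≠ 0 → G z = G w → z = w := by
    intro z hz hz0 w hw hw0 h
    rw [hGeq z hz0, hGeq w hw0, hG0] at h
    simp only [inv_inj] at h
    exact inv_inj.1 (hginj (inv_mem_extDisk hz hz0) (inv_mem_extDisk hw hw0) h)
  have hopen0 : nhds (G 0) ≤ map G (nhds 0) := by
    have ha : AnalyticAt ℂ G 0 := hGd.analyticAt (ball_mem_nhds 0 one_pos)
    refine ha.eventually_constant_or_nhds_le_map_nhds.resolve_left ?_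
    intro h
    obtain ⟨r, hr, hrb⟩ := Metric.eventually_nhds_iff_ball.1 (h.and (ball_mem_nhds (0:ℂ) one_pos))
    have a1 : ((r/2:ℝ):ℂ) ∈ ball (0:ℂ) r := by
      rw [mem_ball_zero_iff, Complex.norm_real, Real.norm_eq_abs, abs_of_pos (by positivity)]
      linarith
    have a2 : ((r/3:ℝ):ℂ) ∈ ball (0:ℂ) r := by
      rw [mem_ball_zero_iff, Complex.norm_real, Real.norm_eq_abs, abs_of_pos (by positivity)]
      linarith
    have b1 : ((r/2:ℝ):ℂ) ≠ 0 := by exact_mod_cast (by positivity : r/2 ≠ 0)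
    have b2 : ((r/3:ℝ):ℂ) ≠ 0 := by exact_mod_cast (by positivity : r/3 ≠ 0)
    have := hGinj0 _ (hrb _ a1).2 b1 _ (hrb _ a2).2 b2 ((hrb _ a1).1.trans (hrb _ a2).1.symm)
    have : r/2 = r/3 := by exact_mod_cast this
    linarith
  have hG0ne : ∀ z ∈ ball (0:ℂ) 1, z ≠ 0 → G z ≠ G 0 := by
    intro z hz hz0 h
    obtain ⟨U, V, hU, hV, zU, oV, hUV⟩ := t2_separation hz0
    have hVi : G '' (V ∩ ball 0 1) ∈ nhds (G z) := by
      rw [h]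
      exact hopen0 (image_mem_map (inter_mem (hV.mem_nhds oV) (ball_mem_nhds _ one_pos)))
    have hcz : ContinuousAt G z :=
      (hGd.differentiableAt (isOpen_ball.mem_nhds hz)).continuousAt
    have hev : ∀ᶠ w in nhds z, w = z := by
      filter_upwards [hcz.eventually hVi, hU.mem_nhds zU, isOpen_ball.mem_nhds hz,
        isOpen_ne.mem_nhds hz0] with w h1 h2 h3 h4
      obtain ⟨x, ⟨hxV, hxb⟩, hx⟩ := h1
      by_cases hx0 : x = 0
      · subst hx0
        exact hGinj0 w h3 h4 z hz hz0 (by rw [← hx, h])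
      · have := hGinj0 x hxb hx0 w h3 h4 hx
        subst this
        exact absurd hxV (disjoint_left.1 hUV h2)
    have h3 : ∀ᶠ w in nhdsWithin z {z}ᶜ, False := by
      filter_upwards [hev.filter_mono nhdsWithin_le_nhds, self_mem_nhdsWithin] with w h1 h4
      exact h4 h1
    simp at h3
    exact (NormedField.nhdsNE_neBot z).ne h3
  have hG00 : G 0 = 0 := by
    by_contra hc
    set p := (G 0)⁻¹ with hp
    have hpn : ∀ᶠ w in nhds p, w ≠ p → w ∈ (closure Om)ᶜ := by
      have hci : ContinuousAt (fun w : ℂ => w⁻¹) p := continuousAt_inv₀ (inv_ne_zero hc)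
      have h1 : G '' (ball 0 1) ∈ nhds (p⁻¹) := by
        rw [hp, inv_inv]
        exact hopen0 (image_mem_map (ball_mem_nhds _ one_pos))
      filter_upwards [hci.eventually h1] with w hw hwp
      obtain ⟨x, hx, hxw⟩ := hw
      have hx0 : x ≠ 0 := by
        rintro rfl
        exact hwp (by rw [hp, hxw, inv_inv])
      rw [hGeq x hx0, hG0] at hxw
      simp only [inv_inj] at hxw
      rw [← hgim, ← hxw]
      exact ⟨_, inv_mem_extDisk hx hx0, rfl⟩
    have hpc : p ∈ closure Om := by
      by_contra hpc
      have : p ∈ g '' extDisk := by rw [hgim]; exact hpc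
      obtain ⟨ζ, hζ, hζp⟩ := this
      rw [← inv_image_extDisk] at hζ
      obtain ⟨x, ⟨hx, hx0⟩, rfl⟩ := hζ
      refine hG0ne x hx hx0 ?_
      rw [hGeq x hx0, hG0]
      simp only [hζp, hp, inv_inv]
    by_cases hpO : p ∈ Om
    · have h3 : ∀ᶠ w in nhdsWithin p {p}ᶜ, False := by
        filter_upwards [hpn.filter_mono nhdsWithin_le_nhds,
          nhdsWithin_le_nhds (hOm.mem_nhds hpO), self_mem_nhdsWithin] with w h1 h2 h4
        exact h1 h4 (subset_closure h2)
      simp at h3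
      exact (NormedField.nhdsNE_neBot p).ne h3
    · have := mem_closure_iff_frequently.1 hpc
      refine this ?_
      filter_upwards [hpn] with w hw hwO
      exact hw (fun e => hpO (e ▸ hwO)) (subset_closure hwO)
  refine ⟨G, hGd, ?_, hG00, fun z hz hz0 => ⟨hGeq z hz0, hgne z hz hz0⟩⟩
  intro z hz w hw h
  by_cases hz0 : z = 0
  · by_cases hw0 : w = 0
    · rw [hz0, hw0]
    · exact absurd (by rw [← h, hz0]) (hG0ne w hw hw0)
  · by_cases hw0 : w = 0
    · exact absurd (by rw [h, hw0]) (hG0ne z hz hz0)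
    · exact hGinj0 z hz hz0 w hw hw0 h

lemma gt_schwarzian {g G : ℂ → ℂ}
    (hg : DifferentiableOn ℂ g extDisk) (hginj : InjOn g extDisk)
    (hGg : ∀ z ∈ ball (0:ℂ) 1, z ≠ 0 → G z = (g z⁻¹)⁻¹ ∧ g z⁻¹ ≠ 0) {z : ℂ}
    (hz : z ∈ ball (0:ℂ) 1) (hz0 : z ≠ 0) :
    schwarzian G z = schwarzian g z⁻¹ * (z ^ 4)⁻¹ := by
  have hm := inv_mem_extDisk hz hz0
  have ha := hg.analyticAt (isOpen_extDisk.mem_nhds hm)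
  have hd := univ_deriv_ne isOpen_extDisk hg hginj hm
  rw [← schwarzian_comp_inv hz0 ha hd]
  have hac : AnalyticAt ℂ (fun w => g w⁻¹) z :=
    AnalyticAt.fun_comp (g := g) (f := fun w => w⁻¹) ha (analyticAt_inv hz0)
  have hdc : deriv (fun w => g w⁻¹) z ≠ 0 := by
    have : HasDerivAt (fun w => g w⁻¹) (deriv g z⁻¹ * (-(z^2)⁻¹)) z :=
      ha.differentiableAt.hasDerivAt.comp z (hasDerivAt_inv hz0)
    rw [this.deriv]
    simp [hd, hz0]
  rw [← schwarzian_inv_comp hac (hGg z hz hz0).2 hdc]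
  refine schwarzian_congr ?_
  filter_upwards [isOpen_ball.mem_nhds hz, isOpen_ne.mem_nhds hz0] with w h1 h2
  exact (hGg w h1 h2).1

lemma gt_integral {g G : ℂ → ℂ}
    (hg : DifferentiableOn ℂ g extDisk) (hginj : InjOn g extDisk)
    (hGg : ∀ z ∈ ball (0:ℂ) 1, z ≠ 0 → G z = (g z⁻¹)⁻¹ ∧ g z⁻¹ ≠ 0) :
    ∫ z in extDisk, ‖schwarzian g z‖ ^ 2 * (‖z‖ ^ 2 - 1) ^ 2 / 4 =
    ∫ z in ball (0:ℂ) 1, ‖schwarzian G z‖ ^ 2 * (1 - ‖z‖ ^ 2) ^ 2 / 4 := by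
  have hU : IsOpen (ball (0:ℂ) 1 \ {0}) := isOpen_ball.sdiff isClosed_singleton
  have e2 : ∫ z in ball (0:ℂ) 1, ‖schwarzian G z‖ ^ 2 * (1 - ‖z‖ ^ 2) ^ 2 / 4 =
     ∫ z in ball (0:ℂ) 1 \ {0}, ‖schwarzian G z‖ ^ 2 * (1 - ‖z‖ ^ 2) ^ 2 / 4 := by
    refine setIntegral_congr_set ?_
    exact (sdiff_null_ae_eq_self (by simp)).symm
  rw [e2, ← inv_image_extDisk, cov_integral hU]
  · refine setIntegral_congr_fun hU.measurableSet ?_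
    intro z hz
    have hz0 : z ≠ 0 := hz.2
    have hn : ‖z‖ ≠ 0 := by simpa using hz0
    simp only
    rw [gt_schwarzian hg hginj hGg hz.1 hz0, deriv_inv]
    simp only [norm_mul, norm_inv, norm_pow, norm_neg]
    field_simp
  · intro z hz
    exact (differentiableAt_inv hz.2).differentiableWithinAt
  · intro z _ w _ h
    exact inv_inj.1 h

lemma polar_lintegral (F : ℂ → ENNReal) (hF : Measurable F) (c : ℂ) :
    ∫⁻ z, F z = ∫⁻ t in Ioi (0:ℝ), ENNReal.ofReal t *
      ∫⁻ θ in Ioo (-Real.pi) Real.pi, F (circleMap c t θ) := by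
  have e0 : ∫⁻ z, F z = ∫⁻ z, F (c + z) := (lintegral_add_left_eq_self F c).symm
  rw [e0, ← Complex.lintegral_comp_polarCoord_symm, polarCoord_target,
    Measure.volume_eq_prod, ← Measure.prod_restrict]
  have hm : Measurable fun p : ℝ × ℝ => circleMap c p.1 p.2 := by
    refine Continuous.measurable ?_
    simp only [circleMap]
    fun_prop
  have e1 : ∀ p : ℝ × ℝ, ENNReal.ofReal p.1 • F (c + Complex.polarCoord.symm p) =
      ENNReal.ofReal p.1 * F (circleMap c p.1 p.2) := by
    intro p
    rw [smul_eq_mul, Complex.polarCoord_symm_apply, circleMap, Complex.exp_mul_I]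
    push_cast
    rfl
  simp_rw [e1]
  rw [lintegral_prod]
  · refine lintegral_congr fun t => ?_
    simp only
    rw [lintegral_const_mul]
    exact hF.comp (by fun_prop)
  · refine Measurable.aemeasurable ?_
    refine Measurable.mul (by fun_prop) (hF.comp hm)

lemma submean_circle {h : ℂ → ℂ} {c : ℂ} {t : ℝ} (ht : 0 < t)
    (hh : DifferentiableOn ℂ h (closedBall c t)) :
    ENNReal.ofReal (2 * Real.pi * ‖h c‖ ^ 2) ≤
      ∫⁻ θ in Ioo (-Real.pi) Real.pi, ENNReal.ofReal (‖h (circleMap c t θ)‖ ^ 2) := by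
  have hd : DiffContOnCl ℂ (fun z => h z ^ 2) (ball c |t|) := by
    rw [abs_of_pos ht]
    refine DifferentiableOn.diffContOnCl ?_
    rw [closure_ball c ht.ne']
    exact hh.pow 2
  have h1 := hd.circleAverage
  rw [Real.circleAverage_eq_integral_add (-Real.pi)] at h1
  have hcont : Continuous fun θ : ℝ => h (circleMap c t θ) := by
    refine hh.continuousOn.comp_continuous (continuous_circleMap c t) ?_
    intro θ
    exact sphere_subset_closedBall (circleMap_mem_sphere c ht.le θ)
  have h2 : ‖h c‖ ^ 2 * (2 * Real.pi) ≤ ∫ θ in (-Real.pi)..Real.pi, ‖h (circleMap c t θ)‖ ^ 2 := by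
    have e : ∫ θ in (-Real.pi)..Real.pi, h (circleMap c t θ) ^ 2 =
       ∫ θ in (0:ℝ)..2 * Real.pi, h (circleMap c t (θ + -Real.pi)) ^ 2 := by
      rw [intervalIntegral.integral_comp_add_right (fun θ => h (circleMap c t θ) ^ 2)]
      congr 1 <;> ring
    rw [← e] at h1
    have h3 : ‖∫ θ in (-Real.pi)..Real.pi, h (circleMap c t θ) ^ 2‖ ≤
        ∫ θ in (-Real.pi)..Real.pi, ‖h (circleMap c t θ) ^ 2‖ :=
      intervalIntegral.norm_integral_le_integral_norm (by linarith [Real.pi_pos])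
    have h4 : ‖h c‖ ^ 2 = (2 * Real.pi)⁻¹ * ‖∫ θ in (-Real.pi)..Real.pi, h (circleMap c t θ) ^ 2‖ := by
      rw [← norm_pow, ← h1, norm_smul, Real.norm_eq_abs, abs_of_pos (by positivity)]
    simp only [norm_pow] at h3
    rw [h4]
    have := Real.pi_pos
    calc _ = ‖∫ θ in (-Real.pi)..Real.pi, h (circleMap c t θ) ^ 2‖ := by field_simp
      _ ≤ _ := h3
  rw [intervalIntegral.integral_of_le (by linarith [Real.pi_pos]),
    integral_Ioc_eq_integral_Ioo] at h2
  rw [← ofReal_integral_eq_lintegral_ofReal]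
  · exact ENNReal.ofReal_le_ofReal (by linarith)
  · exact ((hcont.norm.pow 2).integrableOn_Icc (a := -Real.pi) (b := Real.pi)).mono_set
      Ioo_subset_Icc_self
  · exact Eventually.of_forall fun _ => by positivity

lemma measurable_indicator_cont {X : Type*} [TopologicalSpace X] [MeasurableSpace X]
    [OpensMeasurableSpace X] {s : Set X} (hs : MeasurableSet s) {F : X → ENNReal}
    (hF : ContinuousOn F s) : Measurable (s.indicator F) := by
  classical
  rw [← piecewise_eq_indicator]
  exact ContinuousOn.measurable_piecewise hF continuousOn_const hs

lemma submean_area {h : ℂ → ℂ} {c : ℂ} {ρ : ℝ} (hρ : 0 < ρ)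
    (hh : DifferentiableOn ℂ h (ball c ρ)) :
    ENNReal.ofReal (Real.pi * ρ ^ 2 * ‖h c‖ ^ 2) ≤
      ∫⁻ z in ball c ρ, ENNReal.ofReal (‖h z‖ ^ 2) := by
  have hm : Measurable ((ball c ρ).indicator fun z => ENNReal.ofReal (‖h z‖ ^ 2)) := by
    refine measurable_indicator_cont measurableSet_ball ?_
    exact ENNReal.continuous_ofReal.comp_continuousOn (hh.continuousOn.norm.pow 2)
  rw [← lintegral_indicator measurableSet_ball, polar_lintegral _ hm c]
  calc ENNReal.ofReal (Real.pi * ρ ^ 2 * ‖h c‖ ^ 2)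
      = ∫⁻ t in Ioo 0 ρ, ENNReal.ofReal (t * (2 * Real.pi * ‖h c‖ ^ 2)) := by
        rw [← ofReal_integral_eq_lintegral_ofReal]
        · congr 1
          rw [← integral_Ioc_eq_integral_Ioo, ← intervalIntegral.integral_of_le hρ.le,
            intervalIntegral.integral_mul_const, integral_id]
          ring
        · exact (Continuous.integrableOn_Icc (by fun_prop) (a := 0) (b := ρ)).mono_set
            Ioo_subset_Icc_self
        · filter_upwards [ae_restrict_mem measurableSet_Ioo] with t ht
          have := ht.1
          have := Real.pi_pos
          simp only [Pi.zero_apply]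
          positivity
    _ ≤ ∫⁻ t in Ioo 0 ρ, ENNReal.ofReal t * ∫⁻ θ in Ioo (-Real.pi) Real.pi,
          (ball c ρ).indicator (fun z => ENNReal.ofReal (‖h z‖ ^ 2)) (circleMap c t θ) := by
        refine setLIntegral_mono' measurableSet_Ioo fun t ht => ?_
        rw [ENNReal.ofReal_mul ht.1.le]
        gcongr
        refine (submean_circle ht.1 (hh.mono (closedBall_subset_ball ht.2))).trans_eq ?_
        refine lintegral_congr fun θ => ?_
        rw [indicator_of_mem]
        have : circleMap c t θ ∈ closedBall c t :=
          sphere_subset_closedBall (circleMap_mem_sphere c ht.1.le θ)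
        exact closedBall_subset_ball ht.2 this
    _ ≤ _ := lintegral_mono_set Ioo_subset_Ioi_self

/-- tails of integrable functions on the disc -/
lemma tail_small {F : ℂ → ℝ} (hF : IntegrableOn F (ball (0:ℂ) 1)) {ε : ℝ} (hε : 0 < ε) :
    ∃ R : ℝ, 0 < R ∧ R < 1 ∧ ∀ R', R ≤ R' →
     ∫⁻ z in ball (0:ℂ) 1 \ ball 0 R', ENNReal.ofReal (F z) ≤ ENNReal.ofReal ε := by
  have hfin : ∫⁻ z in ball (0:ℂ) 1, ENNReal.ofReal (F z) ≠ ⊤ := by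
    refine ne_top_of_le_ne_top hF.2.ne ?_
    exact lintegral_mono fun z => by
      rw [← ofReal_norm]; exact ENNReal.ofReal_le_ofReal (Real.le_norm_self _)
  set μ := (volume.restrict (ball (0:ℂ) 1)).withDensity (fun z => ENNReal.ofReal (F z)) with hμ
  have hmono : Antitone fun n : ℕ => ball (0:ℂ) 1 \ ball 0 (1 - 1/((n:ℝ)+2)) := by
    intro n m hnm
    refine sdiff_subset_sdiff_right (ball_subset_ball ?_)
    have : ((n:ℝ)+2) ≤ m + 2 := by
      have : (n:ℝ) ≤ m := by exact_mod_cast hnm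
      linarith
    have := one_div_le_one_div_of_le (by positivity) this
    linarith
  have hint : ⋂ n : ℕ, (ball (0:ℂ) 1 \ ball 0 (1 - 1/((n:ℝ)+2))) = ∅ := by
    rw [eq_empty_iff_forall_notMem]
    intro z hz
    rw [mem_iInter] at hz
    have h1 : ‖z‖ < 1 := by simpa using (hz 0).1
    obtain ⟨n, hn⟩ := exists_nat_one_div_lt (sub_pos.2 h1)
    refine (hz n).2 ?_
    have h2 : 1/((n:ℝ)+2) ≤ 1/((n:ℝ)+1) := one_div_le_one_div_of_le (by positivity) (by linarith)
    rw [mem_ball_zero_iff]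
    linarith
  have hmeas : ∀ n : ℕ, MeasurableSet (ball (0:ℂ) 1 \ ball 0 (1 - 1/((n:ℝ)+2))) :=
    fun n => measurableSet_ball.diff measurableSet_ball
  have ht := tendsto_measure_iInter_atTop (μ := μ) (fun n => (hmeas n).nullMeasurableSet) hmono
    ⟨0, by
      refine ne_top_of_le_ne_top hfin ?_
      rw [hμ, withDensity_apply _ (hmeas 0)]
      exact setLIntegral_le_lintegral _ _⟩
  rw [hint, measure_empty] at ht
  obtain ⟨n, hn⟩ := ((tendsto_order.1 ht).2 (ENNReal.ofReal ε) (by simpa using hε)).exists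
  refine ⟨1 - 1/((n:ℝ)+2), ?_, ?_, ?_⟩
  · have : 1/((n:ℝ)+2) < 1 := by rw [div_lt_one] <;> linarith [(Nat.cast_nonneg n : (0:ℝ) ≤ n)]
    linarith
  · have : 0 < 1/((n:ℝ)+2) := by positivity
    linarith
  · intro R' hR'
    simp only [Function.comp] at hn
    rw [hμ, withDensity_apply _ (hmeas n), Measure.restrict_restrict (hmeas n),
      inter_eq_left.2 sdiff_subset] at hn
    refine le_trans ?_ hn.le
    exact lintegral_mono_set (sdiff_subset_sdiff_right (ball_subset_ball hR'))

lemma schw_small {f : ℂ → ℂ} (hf : DifferentiableOn ℂ f (ball (0:ℂ) 1))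
    (hfinj : InjOn f (ball (0:ℂ) 1))
    (hWP : IntegrableOn (fun z => ‖schwarzian f z‖ ^ 2 * (1 - ‖z‖ ^ 2) ^ 2 / 4)
      (ball (0:ℂ) 1)) {ε : ℝ} (hε : 0 < ε) :
    ∃ R : ℝ, 0 < R ∧ R < 1 ∧ ∀ z : ℂ, R ≤ ‖z‖ → ‖z‖ < 1 →
      (1 - ‖z‖ ^ 2) ^ 2 * ‖schwarzian f z‖ ≤ ε := by
  obtain ⟨R, hR0, hR1, hR⟩ := tail_small hWP (ε := ε ^ 2 / 1024) (by positivity)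
  refine ⟨(1 + 2 * R) / 3, by linarith, by linarith, fun z hz hz1 => ?_⟩
  set ρ := (1 - ‖z‖) / 2 with hρ
  have hρ0 : 0 < ρ := by rw [hρ]; linarith
  have hsub : ball z ρ ⊆ ball (0:ℂ) 1 \ ball 0 ((3 * ‖z‖ - 1) / 2) := by
    intro w hw
    rw [mem_ball, dist_eq_norm] at hw
    have h1 : ‖w‖ ≤ ‖w - z‖ + ‖z‖ := by simpa using norm_add_le (w - z) z
    have h2 : ‖z‖ ≤ ‖w - z‖ + ‖w‖ := by
      have := norm_sub_le w (w - z); simp at this; linarith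
    refine ⟨by rw [mem_ball_zero_iff]; linarith, ?_⟩
    rw [mem_ball_zero_iff]; linarith
  have hd : DifferentiableOn ℂ (schwarzian f) (ball z ρ) := by
    intro w hw
    have hw1 := (hsub hw).1
    exact (schwarzian_analyticAt (hf.analyticAt (isOpen_ball.mem_nhds hw1))
      (univ_deriv_ne isOpen_ball hf hfinj hw1)).differentiableAt.differentiableWithinAt
  have h1 := submean_area hρ0 hd
  have h2 : ∫⁻ w in ball z ρ, ENNReal.ofReal (‖schwarzian f w‖ ^ 2) ≤
      ENNReal.ofReal (4 / ρ ^ 2) * ENNReal.ofReal (ε ^ 2 / 1024) := by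
    calc _ ≤ ∫⁻ w in ball z ρ, ENNReal.ofReal (4 / ρ ^ 2) *
          ENNReal.ofReal (‖schwarzian f w‖ ^ 2 * (1 - ‖w‖ ^ 2) ^ 2 / 4) := by
          refine setLIntegral_mono' measurableSet_ball fun w hw => ?_
          rw [← ENNReal.ofReal_mul (by positivity)]
          refine ENNReal.ofReal_le_ofReal ?_
          have h3 : ρ ≤ 1 - ‖w‖ ^ 2 := by
            rw [mem_ball, dist_eq_norm] at hw
            have h1 : ‖w‖ ≤ ‖w - z‖ + ‖z‖ := by simpa using norm_add_le (w - z) z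
            nlinarith [norm_nonneg w]
          have h4 : ρ ^ 2 ≤ (1 - ‖w‖ ^ 2) ^ 2 := pow_le_pow_left₀ hρ0.le h3 2
          calc ‖schwarzian f w‖ ^ 2 = ‖schwarzian f w‖ ^ 2 * ρ ^ 2 / ρ ^ 2 := by field_simp
            _ ≤ ‖schwarzian f w‖ ^ 2 * (1 - ‖w‖ ^ 2) ^ 2 / ρ ^ 2 := by gcongr
            _ = _ := by ring
      _ ≤ ENNReal.ofReal (4 / ρ ^ 2) * ∫⁻ w in ball (0:ℂ) 1 \ ball 0 ((3 * ‖z‖ - 1) / 2),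
          ENNReal.ofReal (‖schwarzian f w‖ ^ 2 * (1 - ‖w‖ ^ 2) ^ 2 / 4) := by
          rw [lintegral_const_mul' _ _ ENNReal.ofReal_ne_top]
          gcongr
      _ ≤ _ := by
          gcongr
          exact hR _ (by linarith)
  have h3 := h1.trans h2
  rw [← ENNReal.ofReal_mul (by positivity),
    ENNReal.ofReal_le_ofReal_iff (by positivity)] at h3
  have h4 : Real.pi * ρ ^ 4 * ‖schwarzian f z‖ ^ 2 ≤ ε ^ 2 / 256 := by
    have := mul_le_mul_of_nonneg_left h3 (by positivity : 0 ≤ ρ ^ 2)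
    calc _ = ρ ^ 2 * (Real.pi * ρ ^ 2 * ‖schwarzian f z‖ ^ 2) := by ring
      _ ≤ _ := this
      _ = _ := by field_simp; norm_num
  have hpi := Real.pi_gt_three
  have h5 : ρ ^ 4 * ‖schwarzian f z‖ ^ 2 ≤ (ε / 16) ^ 2 := by
    have : 0 ≤ ρ ^ 4 * ‖schwarzian f z‖ ^ 2 := by positivity
    nlinarith
  have h6 : ρ ^ 2 * ‖schwarzian f z‖ ≤ ε / 16 := by
    refine le_of_sq_le_sq ?_ (by positivity)
    calc _ = ρ ^ 4 * ‖schwarzian f z‖ ^ 2 := by ring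
      _ ≤ _ := h5
  have h7 : (1 - ‖z‖ ^ 2) ≤ 4 * ρ := by rw [hρ]; nlinarith [norm_nonneg z]
  have h8 : 0 ≤ 1 - ‖z‖ ^ 2 := by nlinarith [norm_nonneg z]
  have h9 := pow_le_pow_left₀ h8 h7 2
  calc (1 - ‖z‖ ^ 2) ^ 2 * ‖schwarzian f z‖ ≤ (4 * ρ) ^ 2 * ‖schwarzian f z‖ := by gcongr
    _ = 16 * (ρ ^ 2 * ‖schwarzian f z‖) := by ring
    _ ≤ ε := by linarith

noncomputable def phiw (t : ℝ) : ℝ := 2 - Real.log (1 - t)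

lemma phiw_hasDerivAt {t : ℝ} (ht : t < 1) : HasDerivAt phiw (1 / (1 - t)) t := by
  have h1 : HasDerivAt (fun t : ℝ => 1 - t) (-1) t := by
    simpa using (hasDerivAt_id t).const_sub 1
  have := (h1.log (by linarith)).const_sub 2
  refine this.congr_deriv ?_
  ring

lemma phiw_ge {t : ℝ} (h0 : 0 ≤ t) (ht : t < 1) : 2 ≤ phiw t := by
  have := Real.log_nonpos (x := 1 - t) (by linarith) (by linarith)
  unfold phiw; linarith

lemma phiw_mono {s t : ℝ} (h : s ≤ t) (ht : t < 1) : phiw s ≤ phiw t := by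
  unfold phiw
  have := Real.log_le_log (x := 1 - t) (y := 1 - s) (by linarith) (by linarith)
  linarith

lemma phiw_large (C R : ℝ) (hR1 : R < 1) : ∃ R', R ≤ R' ∧ 0 < R' ∧ R' < 1 ∧ C < phiw R' := by
  have hpos := Real.exp_pos (-|C|)
  have hle : Real.exp (-|C|) ≤ 1 := Real.exp_le_one_iff.2 (by simp)
  set R' := max R (1 - Real.exp (-|C|) / 2)
  have h1 : R' < 1 := max_lt hR1 (by linarith)
  refine ⟨R', le_max_left _ _, lt_of_lt_of_le (by linarith) (le_max_right _ _), h1, ?_⟩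
  have h2 := phiw_mono (le_max_right R (1 - Real.exp (-|C|) / 2)) h1
  refine lt_of_lt_of_le ?_ h2
  unfold phiw
  have h3 : Real.log (1 - (1 - Real.exp (-|C|) / 2)) ≤ -|C| := by
    rw [show 1 - (1 - Real.exp (-|C|) / 2) = Real.exp (-|C|) / 2 by ring]
    calc Real.log (Real.exp (-|C|) / 2) ≤ Real.log (Real.exp (-|C|)) :=
          Real.log_le_log (by positivity) (by linarith)
      _ = _ := Real.log_exp _
  have := le_abs_self C
  linarith

lemma monoOn_of_hasDeriv {F F' : ℝ → ℝ} {s : Set ℝ} (hs : Convex ℝ s)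
    (h : ∀ t ∈ s, HasDerivAt F (F' t) t) (h' : ∀ t ∈ s, 0 ≤ F' t) : MonotoneOn F s := by
  refine monotoneOn_of_deriv_nonneg hs (fun t ht => (h t ht).continuousAt.continuousWithinAt)
    (fun t ht => (h t (interior_subset ht)).differentiableAt.differentiableWithinAt) ?_
  intro t ht
  rw [(h t (interior_subset ht)).deriv]
  exact h' t (interior_subset ht)

lemma antiOn_of_hasDeriv {F F' : ℝ → ℝ} {s : Set ℝ} (hs : Convex ℝ s)
    (h : ∀ t ∈ s, HasDerivAt F (F' t) t) (h' : ∀ t ∈ s, F' t ≤ 0) : AntitoneOn F s := by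
  refine antitoneOn_of_deriv_nonpos hs (fun t ht => (h t ht).continuousAt.continuousWithinAt)
    (fun t ht => (h t (interior_subset ht)).differentiableAt.differentiableWithinAt) ?_
  intro t ht
  rw [(h t (interior_subset ht)).deriv]
  exact h' t (interior_subset ht)

lemma ode_AB {A B A' B' : ℝ → ℝ} {ε R R1 R2 M K : ℝ} (hε0 : 0 < ε) (hε : ε ≤ 1/4)
    (hR : 0 ≤ R) (hR1 : R ≤ R1) (hR2 : R1 ≤ R2)  (hR21 : R2 < 1) (hM : 0 < M) (hK : 0 ≤ K)
    (hA : ∀ t ∈ Ico R 1, HasDerivAt A (A' t) t) (hB : ∀ t ∈ Ico R 1, HasDerivAt B (B' t) t)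
    (hA' : ∀ t ∈ Ico R 1, 2 * A t - ε * (3 * A t + B t) / 2 ≤ (1 - t ^ 2) * A' t)
    (hB' : ∀ t ∈ Ico R 1, (1 - t ^ 2) * B' t ≤ -2 * B t + ε * (A t + 3 * B t) / 2)
    (hA0 : ∀ t ∈ Ico R 1, 0 ≤ A t) (hB0 : ∀ t ∈ Ico R 1, 0 ≤ B t)
    (hAB : ∀ t ∈ Ico R 1, 1 / M ≤ (A t + B t) / 2) (hBR : B R ≤ K)
    (hp1 : M * K * phiw R < phiw R1) (hp2 : phiw R1 ≤ ε * phiw R2) :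
    ∀ t ∈ Ico R2 1, B t ≤ 2 * ε * A t := by
  have hsq : ∀ t ∈ Ico R 1, 0 < 1 - t ^ 2 := fun t ht => by
    nlinarith [ht.1, ht.2]
  have pos_of : ∀ t ∈ Ico R 1, ∀ x, 0 ≤ (1 - t^2) * x → 0 ≤ x := fun t ht x hx =>
    nonneg_of_mul_nonneg_right hx (hsq t ht)
  have neg_of : ∀ t ∈ Ico R 1, ∀ x, (1 - t^2) * x ≤ 0 → x ≤ 0 := fun t ht x hx => by
    by_contra! h
    have := mul_pos (hsq t ht) h
    linarith
  have mono1 : MonotoneOn (fun t => A t - B t) (Ico R 1) := by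
    refine monoOn_of_hasDeriv (convex_Ico R 1) (fun t ht => (hA t ht).sub (hB t ht)) ?_
    intro t ht
    refine pos_of t ht _ ?_
    have h1 := hA' t ht
    have h2 := hB' t ht
    have := hA0 t ht
    have := hB0 t ht
    nlinarith
  have hR1m : R1 ∈ Ico R 1 := ⟨hR1, by linarith⟩
  have key : ∀ t ∈ Ico R 1, (1 - t^2) * (1 / (1 - t)) = 1 + t := fun t ht => by
    have : 1 - t ≠ 0 := by linarith [ht.2]
    field_simp
    ring
  have hcl : B R1 < A R1 := by
    by_contra! hc
    have hsub : Icc R R1 ⊆ Ico R 1 := fun t ht => ⟨ht.1, lt_of_le_of_lt ht.2 hR1m.2⟩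
    have hle : ∀ t ∈ Icc R R1, A t ≤ B t := by
      intro t ht
      have := mono1 (hsub ht) hR1m ht.2
      simp only at this
      linarith
    have anti : AntitoneOn (fun t => B t * phiw t) (Icc R R1) := by
      refine antiOn_of_hasDeriv (convex_Icc R R1) (fun t ht => (hB t (hsub ht)).mul
        (phiw_hasDerivAt (hsub ht).2)) ?_
      intro t ht
      refine neg_of t (hsub ht) _ ?_
      have h2 := hB' t (hsub ht)
      have h3 := hA0 t (hsub ht)
      have h4 := hB0 t (hsub ht)
      have h5 := hle t ht
      have h6 := phiw_ge (hR.trans ht.1) (hsub ht).2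
      have h7 : (1 - t ^ 2) * B' t ≤ - B t := by nlinarith
      have h8 : (1 - t ^ 2) * B' t * phiw t ≤ - B t * phiw t := by
        apply mul_le_mul_of_nonneg_right h7; linarith
      have h9 := (hsub ht).2
      calc (1 - t^2) * (B' t * phiw t + B t * (1 / (1 - t)))
          = (1 - t^2) * B' t * phiw t + B t * ((1 - t^2) * (1 / (1 - t))) := by ring
        _ ≤ - B t * phiw t + B t * (1 + t) := by rw [key t (hsub ht)]; linarith
        _ ≤ 0 := by nlinarith
    have h1 := anti (left_mem_Icc.2 hR1) (right_mem_Icc.2 hR1) hR1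
    simp only at h1
    have h2 := hAB R1 hR1m
    have h3 : 1 / M ≤ B R1 := by linarith
    have h4 := phiw_ge hR (lt_of_le_of_lt hR1 hR1m.2)
    have h5 := phiw_ge (hR.trans hR1) hR1m.2
    have h6 : 1 / M * phiw R1 ≤ K * phiw R := by
      calc _ ≤ B R1 * phiw R1 := by gcongr
        _ ≤ B R * phiw R := h1
        _ ≤ _ := by gcongr
    have h7 : phiw R1 ≤ M * K * phiw R := by
      have := mul_le_mul_of_nonneg_left h6 hM.le
      calc _ = M * (1 / M * phiw R1) := by field_simp
        _ ≤ _ := this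
        _ = _ := by ring
    linarith
  have hsub : Ico R1 1 ⊆ Ico R 1 := Ico_subset_Ico_left hR1
  have hBA : ∀ t ∈ Ico R1 1, B t ≤ A t := by
    intro t ht
    have := mono1 hR1m (hsub ht) ht.1
    simp only at this
    linarith
  have mono2 : MonotoneOn A (Ico R1 1) := by
    refine monoOn_of_hasDeriv (convex_Ico R1 1) (fun t ht => hA t (hsub ht)) ?_
    intro t ht
    refine pos_of t (hsub ht) _ ?_
    have h1 := hA' t (hsub ht)
    have := hA0 t (hsub ht)
    have := hBA t ht
    nlinarith
  have anti2 : AntitoneOn (fun t => (B t - ε * A t) * phiw t) (Ico R1 1) := by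
    refine antiOn_of_hasDeriv (convex_Ico R1 1) (fun t ht => ((hB t (hsub ht)).sub
      ((hA t (hsub ht)).const_mul ε)).mul (phiw_hasDerivAt ht.2)) ?_
    intro t ht
    refine neg_of t (hsub ht) _ ?_
    have h1 := hA' t (hsub ht)
    have h2 := hB' t (hsub ht)
    have h3 := hA0 t (hsub ht)
    have h4 := hB0 t (hsub ht)
    have h6 := phiw_ge (hR.trans (hsub ht).1) ht.2
    have h7 : (1 - t ^ 2) * (B' t - ε * A' t) ≤ - B t - ε * A t := by
      have := mul_le_mul_of_nonneg_left h1 hε0.le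
      have e1 : ε * ε * A t ≤ ε * A t * (1/4) := by
        nlinarith [mul_nonneg hε0.le h3]
      have e2 : ε * ε * B t ≤ B t * (1/4) := by nlinarith [mul_nonneg hε0.le h4]
      have e3 : ε * B t ≤ B t * (1/4) := by nlinarith [mul_nonneg hε0.le h4]
      have e4 : 0 ≤ ε * A t := by positivity
      nlinarith
    have h8 := mul_le_mul_of_nonneg_right h7 (by linarith : 0 ≤ phiw t)
    have h9 := ht.2
    calc (1 - t^2) * ((B' t - ε * A' t) * phiw t + (B t - ε * A t) * (1 / (1 - t)))
        = (1 - t^2) * (B' t - ε * A' t) * phiw t + (B t - ε * A t) *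
          ((1 - t^2) * (1 / (1 - t))) := by ring
      _ ≤ (- B t - ε * A t) * phiw t + (B t - ε * A t) * (1 + t) := by
          rw [key t (hsub ht)]; linarith
      _ ≤ 0 := by
        have e4 : 0 ≤ ε * A t := by positivity
        have e5 : 0 ≤ ε * A t * (1 + t + phiw t) := by
          refine mul_nonneg e4 ?_
          linarith [(hR.trans (hsub ht).1)]
        nlinarith
  intro t ht
  have htm : t ∈ Ico R1 1 := ⟨hR2.trans ht.1, ht.2⟩
  have h1 := anti2 (left_mem_Ico.2 hR1m.2) htm htm.1
  simp only at h1
  have h2 := mono2 (left_mem_Ico.2 hR1m.2) htm htm.1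
  have h3 := phiw_mono ht.1 ht.2
  have h4 := phiw_ge (hR.trans (hR1.trans htm.1)) ht.2
  have h5 := phiw_ge (hR.trans hR1) hR1m.2
  have h6 := hA0 R1 hR1m
  have h7 : (B t - ε * A t) * phiw t ≤ ε * A t * phiw t := by
    calc _ ≤ _ := h1
      _ ≤ A R1 * phiw R1 := by
        gcongr
        nlinarith
      _ ≤ A t * phiw R1 := by gcongr
      _ ≤ A t * (ε * phiw t) := by
        have := hA0 t (hsub htm)
        gcongr
        exact hp2.trans (by gcongr)
      _ = _ := by ring
  have := le_of_mul_le_mul_right h7 (by linarith)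
  linarith

lemma hasDerivAt_normSq_curve {F : ℝ → ℂ} {F' : ℂ} {t : ℝ} (h : HasDerivAt F F' t) :
    HasDerivAt (fun t => ‖F t‖ ^ 2) (2 * ((starRingEnd ℂ) (F t) * F').re) t := by
  have := h.norm_sq
  refine this.congr_deriv ?_
  simp [Complex.inner, mul_comm]

lemma hasDerivAt_norm_curve {F : ℝ → ℂ} {F' : ℂ} {t : ℝ} (h : HasDerivAt F F' t) (h0 : F t ≠ 0) :
    HasDerivAt (fun t => ‖F t‖) (‖F t‖ * (F' / F t).re) t := by
  have h1 := (hasDerivAt_normSq_curve h).sqrt (by positivity)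
  have h2 : (fun t => ‖F t‖) = fun t => √(‖F t‖ ^ 2) := by
    funext t; rw [Real.sqrt_sq (norm_nonneg _)]
  rw [h2]
  refine h1.congr_deriv ?_
  rw [Real.sqrt_sq (norm_nonneg _)]
  have hn : ‖F t‖ ≠ 0 := by positivity
  have h3 : F' / F t = ((starRingEnd ℂ) (F t) * F') / ((‖F t‖ ^ 2 : ℝ) : ℂ) := by
    have : ((‖F t‖ ^ 2 : ℝ) : ℂ) = F t * (starRingEnd ℂ) (F t) := by
      rw [Complex.mul_conj, Complex.normSq_eq_norm_sq]
    rw [this]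
    have h4 : (starRingEnd ℂ) (F t) ≠ 0 := by simpa using h0
    field_simp
  rw [h3, Complex.div_ofReal_re]
  field_simp

lemma ode_A_aux {v : ℝ → ℂ} {W : ℝ → ℝ} {v' η : ℂ} {W' t : ℝ} (hv : HasDerivAt v v' t)
    (hW : HasDerivAt W W' t) (hW0 : W t ≠ 0) (h1 : ((1 - t^2 : ℝ) : ℂ) * v' = v t ^ 2 - 1 + η)
    (h2 : (1 - t ^ 2) * W' = 2 * (v t).re * W t) :
    (∃ A', HasDerivAt (fun t => ‖1 - v t‖ ^ 2 / W t) A' t ∧ (1 - t^2) * A' =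
      2 * (‖1 - v t‖ ^ 2 / W t) - 2 * ((starRingEnd ℂ) (1 - v t) * η).re / W t) ∧
    (∃ B', HasDerivAt (fun t => ‖1 + v t‖ ^ 2 / W t) B' t ∧ (1 - t^2) * B' =
      -2 * (‖1 + v t‖ ^ 2 / W t) + 2 * ((starRingEnd ℂ) (1 + v t) * η).re / W t) := by
  have e1 := congrArg Complex.re h1
  have e2 := congrArg Complex.im h1
  simp only [ofReal_re, ofReal_im, add_re, sub_re, add_im, sub_im, one_re,
    one_im, pow_two, mul_re, mul_im] at e1 e2
  constructor
  · refine ⟨_, (hasDerivAt_normSq_curve (hv.const_sub 1)).div hW hW0, ?_⟩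
    rw [← Complex.normSq_eq_norm_sq, Complex.normSq_apply]
    simp only [map_sub, map_one, mul_re, sub_re, sub_im, neg_re, neg_im, one_re, one_im, conj_re,
      conj_im]
    field_simp
    set a := (v t).re
    set b := (v t).im
    linear_combination 2 * (a - 1) * W t * e1 + 2 * b * W t * e2 -
      ((1 - a) * (1 - a) + (0 - b) * (0 - b)) * h2
  · refine ⟨_, (hasDerivAt_normSq_curve (hv.const_add 1)).div hW hW0, ?_⟩
    rw [← Complex.normSq_eq_norm_sq, Complex.normSq_apply]
    simp only [map_add, map_one, mul_re, add_re, add_im, neg_re, neg_im, one_re, one_im, conj_re,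
      conj_im]
    field_simp
    set a := (v t).re
    set b := (v t).im
    linear_combination 2 * (a + 1) * W t * e1 + 2 * b * W t * e2 -
      ((1 + a) * (1 + a) + (0 + b) * (0 + b)) * h2

lemma aux_v_bound {v : ℂ} : 1 ≤ (‖1 - v‖^2 + ‖1 + v‖^2)/2 ∧
   ‖1 - v‖ ≤ (3 * ‖1 - v‖^2 + ‖1 + v‖^2)/4 ∧ ‖1 + v‖ ≤ (‖1 - v‖^2 + 3 * ‖1 + v‖^2)/4 := by
  have h : ‖1 - v‖^2 + ‖1 + v‖^2 = 2 + 2 * ‖v‖^2 := by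
    simp only [← Complex.normSq_eq_norm_sq, Complex.normSq_apply]
    simp; ring
  have := sq_nonneg ‖v‖
  refine ⟨by linarith, ?_, ?_⟩
  · nlinarith [sq_nonneg (‖1 - v‖ - 1)]
  · nlinarith [sq_nonneg (‖1 + v‖ - 1)]

lemma aux_re_le (a η : ℂ) {ε : ℝ} (h : ‖η‖ ≤ ε) : |((starRingEnd ℂ) a * η).re| ≤ ε * ‖a‖ := by
  calc _ ≤ ‖(starRingEnd ℂ) a * η‖ := Complex.abs_re_le_norm _
    _ = ‖a‖ * ‖η‖ := by simp
    _ ≤ _ := by rw [mul_comm]; gcongr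

lemma prenorm_hasDerivAt {f : ℂ → ℂ} {z : ℂ} (hf : AnalyticAt ℂ f z) (hd : deriv f z ≠ 0) :
    HasDerivAt (fun w => deriv (deriv f) w / deriv f w)
      (schwarzian f z + (1/2) * (deriv (deriv f) z / deriv f z) ^ 2) z := by
  have h1 := hf.deriv.differentiableAt.hasDerivAt
  have h2 := hf.deriv.deriv.differentiableAt.hasDerivAt
  refine (h2.div h1 hd).congr_deriv ?_
  unfold schwarzian
  field_simp
  ring

lemma cauchy_half {f : ℂ → ℂ} (hf : DifferentiableOn ℂ f (ball (0:ℂ) 1)) {M : ℝ}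
    (hM : ∀ z ∈ ball (0:ℂ) 1, ‖f z‖ ≤ M) {z : ℂ} (hz : ‖z‖ < 1) :
    (1 - ‖z‖) * ‖deriv f z‖ ≤ 2 * M := by
  have hr : 0 < (1 - ‖z‖) / 2 := by linarith
  have hsub : closedBall z ((1 - ‖z‖)/2) ⊆ ball 0 1 := by
    intro w hw
    rw [mem_closedBall, dist_eq_norm] at hw
    rw [mem_ball_zero_iff]
    have := norm_add_le (w - z) z
    rw [sub_add_cancel] at this
    linarith
  have := Complex.norm_deriv_le_of_forall_mem_sphere_norm_le (f := f) (c := z) hr (C := M)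
    (DifferentiableOn.diffContOnCl (by
      rw [closure_ball _ hr.ne']; exact hf.mono hsub))
    (fun w hw => hM w (hsub (sphere_subset_closedBall hw)))
  rw [le_div_iff₀ hr] at this
  linarith

lemma ray_bound {f : ℂ → ℂ} (hf : DifferentiableOn ℂ f (ball (0:ℂ) 1))
    (hfinj : InjOn f (ball (0:ℂ) 1)) {M : ℝ} (hM0 : 0 < M) (hM : ∀ z ∈ ball (0:ℂ) 1, ‖f z‖ ≤ M)
    {ε R R1 R2 K C c : ℝ} (hε0 : 0 < ε) (hε : ε ≤ 1/4)
    (hR : 0 ≤ R) (hR1 : R ≤ R1) (hR2 : R1 ≤ R2)  (hR21 : R2 < 1) (hc0 : 0 < c) (hC0 : 0 ≤ C)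
    (hS : ∀ z, R ≤ ‖z‖ → ‖z‖ < 1 → (1-‖z‖^2)^2*‖schwarzian f z‖ ≤ ε)
    (hC : ∀ z, ‖z‖ = R → ‖deriv (deriv f) z / deriv f z‖ ≤ C)
    (hc : ∀ z, ‖z‖ = R → c ≤ ‖deriv f z‖)
    (hK : K = (2 + C) ^ 2 / ((1 - R^2) * c))
    (hp1 : (4 * M) * K * phiw R < phiw R1) (hp2 : phiw R1 ≤ ε * phiw R2)
    {e : ℂ} (he : ‖e‖ = 1) : ∀ t ∈ Ico R2 1,
     ‖1 + ((1/2 : ℂ) * (1 - (t:ℂ)^2) * (deriv (deriv f) (t * e) / deriv f (t*e)) * e - t)‖^2 ≤ 2 * ε *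
     ‖1 - ((1/2 : ℂ) * (1 - (t:ℂ)^2) * (deriv (deriv f) (t * e) / deriv f (t*e)) * e - t)‖^2 := by
  set N : ℂ → ℂ := fun z => deriv (deriv f) z / deriv f z with hN
  set v : ℝ → ℂ := fun t => (1/2 : ℂ) * (1 - (t:ℂ)^2) * N (t * e) * e - t with hv
  set W : ℝ → ℝ := fun t => (1 - t^2) * ‖deriv f (t * e)‖ with hW
  have hnorm : ∀ t ∈ Ico R 1, ‖(t:ℂ) * e‖ = t := fun t ht => by
    rw [norm_mul, he, mul_one, Complex.norm_real, Real.norm_of_nonneg (hR.trans ht.1)]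
  have hmem : ∀ t ∈ Ico R 1, (t:ℂ) * e ∈ ball (0:ℂ) 1 := fun t ht => by
    rw [mem_ball_zero_iff, hnorm t ht]; exact ht.2
  have hd : ∀ t ∈ Ico R 1, deriv f (t * e) ≠ 0 := fun t ht =>
    univ_deriv_ne isOpen_ball hf hfinj (hmem t ht)
  have han : ∀ t ∈ Ico R 1, AnalyticAt ℂ f (t * e) := fun t ht =>
    hf.analyticAt (isOpen_ball.mem_nhds (hmem t ht))
  have hsq : ∀ t ∈ Ico R 1, 0 < 1 - t ^ 2 := fun t ht => by
    nlinarith [ht.1, ht.2]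
  have hW0 : ∀ t ∈ Ico R 1, 0 < W t := fun t ht =>
    mul_pos (hsq t ht) (norm_pos_iff.2 (hd t ht))
  have hline : ∀ t : ℝ, HasDerivAt (fun t : ℝ => (t:ℂ) * e) e t := fun t => by
    simpa using (hasDerivAt_id t).ofReal_comp.mul_const e
  have hη : ∀ t ∈ Ico R 1, ‖(1/2 : ℂ) * (1 - (t:ℂ)^2)^2 * schwarzian f (t * e) * e^2‖ ≤ ε := by
    intro t ht
    have h1 := hS (t * e) (by rw [hnorm t ht]; exact ht.1) (by rw [hnorm t ht]; exact ht.2)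
    rw [hnorm t ht] at h1
    have h2 : ‖(1 - (t:ℂ)^2)‖ = 1 - t^2 := by
      rw [show (1 - (t:ℂ)^2) = ((1 - t^2 : ℝ) : ℂ) by push_cast; ring, Complex.norm_real,
        Real.norm_of_nonneg (hsq t ht).le]
    simp only [norm_mul, norm_pow, h2, he]
    norm_num
    nlinarith [norm_nonneg (schwarzian f (t * e)), sq_nonneg (1 - t^2)]
  have hvd : ∀ t ∈ Ico R 1, ∃ v', HasDerivAt v v' t ∧ ((1 - t^2 : ℝ) : ℂ) * v' =
      v t ^ 2 - 1 + (1/2 : ℂ) * (1 - (t:ℂ)^2)^2 * schwarzian f (t * e) * e^2 := by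
    intro t ht
    have h1 := (prenorm_hasDerivAt (han t ht) (hd t ht)).scomp (𝕜 := ℝ) t (hline t)
    have h2 : HasDerivAt (fun t : ℝ => (t:ℂ)) 1 t := by
      simpa using (hasDerivAt_id t).ofReal_comp
    have h3 := (((((h2.pow 2).const_sub 1).const_mul (1/2 : ℂ)).mul h1).mul_const e).sub h2
    refine ⟨_, h3, ?_⟩
    simp only [hv, hN, smul_eq_mul, Function.comp, Pi.mul_apply, Pi.pow_apply]
    push_cast
    ring
  have hWd : ∀ t ∈ Ico R 1, ∃ W', HasDerivAt W W' t ∧ (1 - t^2) * W' =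
      2 * (v t).re * W t := by
    intro t ht
    have h1 := ((han t ht).deriv.differentiableAt.hasDerivAt).scomp (𝕜 := ℝ) t (hline t)
    have h2 := hasDerivAt_norm_curve h1 (hd t ht)
    have h3 := (((hasDerivAt_id t).pow 2).const_sub 1).mul h2
    refine ⟨_, h3, ?_⟩
    have h4 : (v t).re = (1 - t^2)/2 * (N (t * e) * e).re - t := by
      have : v t = ((1 - t^2)/2 : ℝ) * (N (t * e) * e) - (t:ℝ) := by
        simp only [hv]; push_cast; ring
      rw [this, Complex.sub_re, Complex.re_ofReal_mul, Complex.ofReal_re]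
    have h5 : e * deriv (deriv f) (t * e) / deriv f (t * e) = N (t * e) * e := by
      simp only [hN]; ring
    rw [h4]
    simp only [hW, smul_eq_mul, Function.comp, Pi.pow_apply, id]
    rw [h5]
    push_cast
    ring
  choose! v' hv1 hv2 using hvd
  choose! W' hW1 hW2 using hWd
  have hAB := fun t (ht : t ∈ Ico R 1) => ode_A_aux (hv1 t ht) (hW1 t ht) (hW0 t ht).ne' (hv2 t ht) (hW2 t ht)
  choose! A' hA1 hA2 using fun t ht => (hAB t ht).1
  choose! B' hB1 hB2 using fun t ht => (hAB t ht).2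
  have hW4 : ∀ t ∈ Ico R 1, W t ≤ 4 * M := by
    intro t ht
    have h1 := cauchy_half hf hM (z := t * e) (by rw [hnorm t ht]; exact ht.2)
    rw [hnorm t ht] at h1
    have h2 := ht.2
    have h3 := hR.trans ht.1
    simp only [hW]
    have : 0 ≤ (1 - t) * ‖deriv f (t * e)‖ := mul_nonneg (by linarith) (norm_nonneg _)
    nlinarith
  have main := ode_AB (A := fun t => ‖1 - v t‖ ^ 2 / W t) (B := fun t => ‖1 + v t‖ ^ 2 / W t)
    (A' := A') (B' := B') (M := 4 * M) (K := K) hε0 hε hR hR1 hR2 hR21 (by positivity) (by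
      rw [hK]
      have := hsq R ⟨le_rfl, by linarith⟩
      positivity) hA1 hB1 ?_ ?_ ?_ ?_ ?_ ?_ hp1 hp2
  · intro t ht
    have htR : t ∈ Ico R 1 := ⟨by linarith [ht.1], ht.2⟩
    have h1 := main t ht
    have h2 := hW0 t htR
    rw [div_le_iff₀ h2] at h1
    have h3 : 2 * ε * (‖1 - v t‖ ^ 2 / W t) * W t = 2 * ε * ‖1 - v t‖ ^ 2 := by
      field_simp
    rw [h3] at h1
    exact h1
  · intro t ht
    rw [hA2 t ht]
    have h1 := (abs_le.1 (aux_re_le (1 - v t) _ (hη t ht))).2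
    have h2 := (aux_v_bound (v := v t)).2.1
    have h3 := hW0 t ht
    rw [← sub_nonneg]
    have : 0 ≤ (ε * (3 * ‖1 - v t‖ ^ 2 + ‖1 + v t‖ ^ 2) / 2 - 2 * ((starRingEnd ℂ) (1 - v t) *
      (1 / 2 * (1 - (t:ℂ) ^ 2) ^ 2 * schwarzian f ((t:ℂ) * e) * e ^ 2)).re) / W t := by
      refine div_nonneg ?_ h3.le
      nlinarith
    refine this.trans (le_of_eq ?_)
    field_simp
    ring
  · intro t ht
    rw [hB2 t ht]
    have h1 := (abs_le.1 (aux_re_le (1 + v t) _ (hη t ht))).2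
    have h2 := (aux_v_bound (v := v t)).2.2
    have h3 := hW0 t ht
    rw [← sub_nonneg]
    have : 0 ≤ (ε * (‖1 - v t‖ ^ 2 + 3 * ‖1 + v t‖ ^ 2) / 2 - 2 * ((starRingEnd ℂ) (1 + v t) *
      (1 / 2 * (1 - (t:ℂ) ^ 2) ^ 2 * schwarzian f ((t:ℂ) * e) * e ^ 2)).re) / W t := by
      refine div_nonneg ?_ h3.le
      nlinarith
    refine this.trans (le_of_eq ?_)
    field_simp
    ring
  · intro t ht
    have h3 := hW0 t ht
    positivity
  · intro t ht
    have h3 := hW0 t ht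
    positivity
  · intro t ht
    have h2 := (aux_v_bound (v := v t)).1
    have h3 := hW0 t ht
    calc 1 / (4 * M) ≤ 1 / W t := one_div_le_one_div_of_le h3 (hW4 t ht)
      _ ≤ ((‖1 - v t‖^2 + ‖1 + v t‖^2)/2) / W t := by gcongr
      _ = _ := by ring
  · have hRm : R ∈ Ico R 1 := ⟨le_rfl, by linarith⟩
    have h1 := hC (R * e) (hnorm R hRm)
    have h2 := hc (R * e) (hnorm R hRm)
    have h3 := hsq R hRm
    rw [hK]
    have h4 : ‖v R‖ ≤ C + 1 := by
      simp only [hv]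
      refine (norm_sub_le _ _).trans ?_
      have h5 : ‖(1 - (R:ℂ)^2)‖ = 1 - R^2 := by
        rw [show (1 - (R:ℂ)^2) = ((1 - R^2 : ℝ) : ℂ) by push_cast; ring, Complex.norm_real,
          Real.norm_of_nonneg h3.le]
      have h6 : ‖(R:ℂ)‖ = R := by rw [Complex.norm_real, Real.norm_of_nonneg hR]
      rw [h6]
      simp only [norm_mul, h5, he]
      norm_num
      have : ‖N (R * e)‖ ≤ C := h1
      nlinarith [norm_nonneg (N (R * e)), sq_nonneg R]
    have h5 : ‖1 + v R‖ ≤ 2 + C := by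
      refine (norm_add_le _ _).trans ?_
      rw [norm_one]; linarith
    simp only [hW]
    gcongr

lemma prenorm_continuousOn {f : ℂ → ℂ} (hf : DifferentiableOn ℂ f (ball (0:ℂ) 1))
    (hfinj : InjOn f (ball (0:ℂ) 1)) :
    ContinuousOn (fun z => deriv (deriv f) z / deriv f z) (ball (0:ℂ) 1) := fun z hz =>
  (prenorm_hasDerivAt (hf.analyticAt (isOpen_ball.mem_nhds hz))
    (univ_deriv_ne isOpen_ball hf hfinj hz)).continuousAt.continuousWithinAt

lemma deriv_continuousOn_ball {f : ℂ → ℂ} (hf : DifferentiableOn ℂ f (ball (0:ℂ) 1)) :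
    ContinuousOn (deriv f) (ball (0:ℂ) 1) := fun z hz =>
  (hf.analyticAt (isOpen_ball.mem_nhds hz)).deriv.continuousAt.continuousWithinAt

lemma little_bloch {f : ℂ → ℂ} (hf : DifferentiableOn ℂ f (ball (0:ℂ) 1))
    (hfinj : InjOn f (ball (0:ℂ) 1)) {M : ℝ} (hM : ∀ z ∈ ball (0:ℂ) 1, ‖f z‖ ≤ M)
    (hWP : IntegrableOn (fun z => ‖schwarzian f z‖ ^ 2 * (1 - ‖z‖ ^ 2) ^ 2 / 4)
      (ball (0:ℂ) 1)) {ε : ℝ} (hε : 0 < ε) :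
    ∃ R, 0 < R ∧ R < 1 ∧ ∀ z, R ≤ ‖z‖ → ‖z‖ < 1 →
      (1 - ‖z‖) * ‖deriv (deriv f) z / deriv f z‖ ≤ ε := by
  set δ := min (ε / 16) (1/2)
  have hδ0 : 0 < δ := lt_min (by linarith) (by norm_num)
  have hδ1 : δ ≤ ε / 16 := min_le_left _ _
  have hδ2 : δ ≤ 1/2 := min_le_right _ _
  have hδ3 : δ^2 ≤ 1/4 := by nlinarith
  obtain ⟨R, hR0, hR1, hS⟩ := schw_small hf hfinj hWP (ε := δ^2/2) (by positivity)
  have hsub : sphere (0:ℂ) R ⊆ ball 0 1 := fun z hz => by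
    rw [mem_sphere_zero_iff_norm] at hz; rw [mem_ball_zero_iff, hz]; exact hR1
  obtain ⟨C, hC⟩ := (isCompact_sphere (0:ℂ) R).exists_bound_of_continuousOn
    ((prenorm_continuousOn hf hfinj).mono hsub)
  obtain ⟨C', hC'⟩ := (isCompact_sphere (0:ℂ) R).exists_bound_of_continuousOn
    (((deriv_continuousOn_ball hf).mono hsub).inv₀
      (fun z hz => univ_deriv_ne isOpen_ball hf hfinj (hsub hz)))
  set c := (max C' 1)⁻¹
  have hc1 : 0 < max C' 1 := lt_of_lt_of_le one_pos (le_max_right _ _)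
  have hc0 : 0 < c := inv_pos.2 hc1
  set C1 := max C 0
  set K := (2 + C1) ^ 2 / ((1 - R^2) * c) with hK
  set M1 := max M 1
  have hM1 : 0 < M1 := lt_of_lt_of_le one_pos (le_max_right _ _)
  obtain ⟨R1, hRR1, -, hR11, hp1⟩ := phiw_large (4 * M1 * K * phiw R) R hR1
  obtain ⟨R2, hRR2, hR20, hR21, hp2⟩ := phiw_large (phiw R1 / (δ^2/2)) R1 hR11
  have hR3 : max R2 (1 - ε/4) < 1 := max_lt hR21 (by linarith)
  refine ⟨max R2 (1 - ε/4), lt_max_of_lt_left hR20, hR3, ?_⟩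
  intro z hz1 hz2
  have hz1' := (le_max_left _ _).trans hz1
  have hz1'' := (le_max_right _ _).trans hz1
  have hzp : 0 < ‖z‖ := lt_of_lt_of_le hR20 hz1'
  have main := ray_bound hf hfinj hM1 (fun z hz => (hM z hz).trans (le_max_left _ _))
    (ε := δ^2/2) (R := R) (R1 := R1) (R2 := R2) (K := K) (C := C1) (c := c) (by positivity)
    (by linarith) hR0.le hRR1 hRR2 hR21 hc0 (le_max_right _ _) hS
    (fun z hz => (hC z (by simpa using hz)).trans (le_max_left _ _))
    (fun z hz => by
      have h1 := (hC' z (by simpa using hz)).trans (le_max_left _ 1)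
      rw [Pi.inv_apply, norm_inv] at h1
      have : 0 < ‖deriv f z‖ := norm_pos_iff.2 (univ_deriv_ne isOpen_ball hf hfinj (hsub (by simpa using hz)))
      exact (inv_le_comm₀ this hc1).1 h1) hK hp1
    (by
      rw [div_lt_iff₀ (by positivity)] at hp2
      linarith)
    (e := z / ‖z‖) (by simp [hzp.ne']) ‖z‖ ⟨hz1', hz2⟩
  have hze : (‖z‖ : ℂ) * (z / ‖z‖) = z := by
    have : (‖z‖ : ℂ) ≠ 0 := by exact_mod_cast hzp.ne'
    field_simp
  rw [hze] at main
  set N := deriv (deriv f) z / deriv f z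
  set v := (1/2 : ℂ) * (1 - (‖z‖:ℂ)^2) * N * (z / ‖z‖) - ‖z‖ with hv
  have h1 : ‖1 + v‖ ≤ δ * ‖1 - v‖ := by
    refine (sq_le_sq₀ (norm_nonneg _) (by positivity)).1 ?_
    rw [mul_pow]; linarith
  have h2 : ‖1 - v‖ ≤ 2 + ‖1 + v‖ := by
    have := norm_sub_le 2 (1 + v)
    rw [show 2 - (1 + v) = 1 - v by ring] at this
    simpa using this
  have h3 : ‖1 + v‖ ≤ 4 * δ := by nlinarith [norm_nonneg (1 + v)]
  have h4 : ‖(1/2 : ℂ) * (1 - (‖z‖:ℂ)^2) * N * (z / ‖z‖)‖ ≤ 4 * δ + (1 - ‖z‖) := by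
    have e1 : (1/2 : ℂ) * (1 - (‖z‖:ℂ)^2) * N * (z / ‖z‖) = (1 + v) - ((1 - ‖z‖ : ℝ) : ℂ) := by
      rw [hv]; push_cast; ring
    rw [e1]
    refine (norm_sub_le _ _).trans ?_
    rw [Complex.norm_real, Real.norm_of_nonneg (by linarith)]
    linarith
  have h5 : ‖(1 - (‖z‖:ℂ)^2)‖ = 1 - ‖z‖^2 := by
    rw [show (1 - (‖z‖:ℂ)^2) = ((1 - ‖z‖^2 : ℝ) : ℂ) by push_cast; ring, Complex.norm_real,
      Real.norm_of_nonneg (by nlinarith)]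
  have h6 : ‖z / (‖z‖ : ℂ)‖ = 1 := by simp [hzp.ne']
  rw [norm_mul, norm_mul, norm_mul, h5, h6] at h4
  norm_num at h4
  have h7 : 0 ≤ ‖N‖ * (1 - ‖z‖) := mul_nonneg (norm_nonneg _) (by linarith)
  nlinarith

lemma lint_ray {a b F F' : ℝ → ℝ} {R : ℝ} (hR : R < 1) (ha : ContinuousOn a (Ico R 1))
    (hb : ContinuousOn b (Ico R 1)) (ha0 : ∀ t ∈ Ico R 1, 0 ≤ a t) (hb0 : ∀ t ∈ Ico R 1, 0 ≤ b t)
    (hF : ∀ t ∈ Ico R 1, HasDerivAt F (F' t) t) (hF0 : ∀ t ∈ Ico R 1, 0 ≤ F t)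
    (h : ∀ t ∈ Ico R 1, a t - b t ≤ - F' t) :
    ∫⁻ t in Ico R 1, ENNReal.ofReal (a t) ≤
      ENNReal.ofReal (F R) + ∫⁻ t in Ico R 1, ENNReal.ofReal (b t) := by
  have hU : Ico R 1 = ⋃ n : ℕ, Icc R (1 - (1 - R) / (n + 1)) := by
    ext t
    simp only [mem_Ico, mem_iUnion, mem_Icc]
    constructor
    · rintro ⟨h1, h2⟩
      obtain ⟨n, hn⟩ := exists_nat_gt ((1 - R) / (1 - t))
      refine ⟨n, h1, ?_⟩
      have h3 : 0 < 1 - t := by linarith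
      rw [div_lt_iff₀ h3] at hn
      have : (1 - R) / (n + 1) ≤ 1 - t := by
        rw [div_le_iff₀ (by positivity)]
        nlinarith
      linarith
    · rintro ⟨n, h1, h2⟩
      refine ⟨h1, lt_of_le_of_lt h2 ?_⟩
      have : 0 < (1 - R) / ((n:ℝ) + 1) := div_pos (by linarith) (by positivity)
      linarith
  have hdir : Directed (· ⊆ ·) fun n : ℕ => Icc R (1 - (1 - R) / (n + 1)) := by
    refine Monotone.directed_le ?_
    intro m n hmn
    refine Icc_subset_Icc_right ?_
    have : (m:ℝ) ≤ n := by exact_mod_cast hmn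
    have : (1 - R) / ((n:ℝ) + 1) ≤ (1 - R) / (m + 1) := by
      apply div_le_div_of_nonneg_left <;> first | linarith | positivity
    linarith
  conv_lhs => rw [hU, setLIntegral_iUnion_of_directed _ hdir]
  refine iSup_le fun n => ?_
  have hT0 : 0 < (1 - R) / ((n:ℝ) + 1) := div_pos (by linarith) (by positivity)
  have hT1 : (1 - R) / ((n:ℝ) + 1) ≤ 1 - R := by
    apply div_le_self (by linarith)
    have : (0:ℝ) ≤ n := by positivity
    linarith
  set T := 1 - (1 - R) / ((n:ℝ) + 1)
  have hRT : R ≤ T := by simp only [T]; linarith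
  have hT : T < 1 := by simp only [T]; linarith
  have hsub : Icc R T ⊆ Ico R 1 := fun t ht => ⟨ht.1, lt_of_le_of_lt ht.2 hT⟩
  have ia : IntegrableOn a (Icc R T) := (ha.mono hsub).integrableOn_Icc
  have ib : IntegrableOn b (Icc R T) := (hb.mono hsub).integrableOn_Icc
  have h1 := intervalIntegral.integral_le_sub_of_hasDeriv_right_of_le (g := fun t => - F t)
    (g' := fun t => - F' t) (φ := fun t => a t - b t) hRT
    (fun t ht => (hF t (hsub ht)).continuousAt.neg.continuousWithinAt)
    (fun t ht => (hF t (hsub (Ioo_subset_Icc_self ht))).neg.hasDerivWithinAt)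
    (ia.sub ib) (fun t ht => h t (hsub (Ioo_subset_Icc_self ht)))
  rw [intervalIntegral.integral_of_le hRT, ← integral_Icc_eq_integral_Ioc, integral_sub ia ib] at h1
  have h2 := hF0 T (hsub (right_mem_Icc.2 hRT))
  have h3 : ∫ t in Icc R T, a t ≤ F R + ∫ t in Icc R T, b t := by linarith
  have ea : ENNReal.ofReal (∫ t in Icc R T, a t) = ∫⁻ t in Icc R T, ENNReal.ofReal (a t) :=
    ofReal_integral_eq_lintegral_ofReal ia
      ((ae_restrict_iff' measurableSet_Icc).2 (Eventually.of_forall fun t ht => ha0 t (hsub ht)))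
  have eb : ENNReal.ofReal (∫ t in Icc R T, b t) = ∫⁻ t in Icc R T, ENNReal.ofReal (b t) :=
    ofReal_integral_eq_lintegral_ofReal ib
      ((ae_restrict_iff' measurableSet_Icc).2 (Eventually.of_forall fun t ht => hb0 t (hsub ht)))
  rw [← ea]
  refine (ENNReal.ofReal_le_ofReal h3).trans ?_
  refine ENNReal.ofReal_add_le.trans ?_
  rw [eb]
  gcongr

lemma ray_N {f : ℂ → ℂ} (hf : DifferentiableOn ℂ f (ball (0:ℂ) 1))
    (hfinj : InjOn f (ball (0:ℂ) 1)) {R : ℝ} (hR0 : 0 < R) (hR : R < 1)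
    (hB : ∀ z, R ≤ ‖z‖ → ‖z‖ < 1 → (1 - ‖z‖) * ‖deriv (deriv f) z / deriv f z‖ ≤ 1/4) (e : ℂ)
    (he : ‖e‖ = 1) :
    ∫⁻ t in Ico R 1, ENNReal.ofReal (1/2 * ‖deriv (deriv f) (t*e) / deriv f (t*e)‖^2) ≤
      ENNReal.ofReal ((1 - R) * ‖deriv (deriv f) (R*e) / deriv f (R*e)‖^2) +
      ∫⁻ t in Ico R 1, ENNReal.ofReal (4 * (1 - t)^2 * ‖schwarzian f (t * e)‖^2) := by
  set N : ℂ → ℂ := fun z => deriv (deriv f) z / deriv f z with hN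
  have hnorm : ∀ t ∈ Ico R 1, ‖(t:ℂ) * e‖ = t := fun t ht => by
    rw [norm_mul, he, mul_one, Complex.norm_real, Real.norm_of_nonneg (hR0.le.trans ht.1)]
  have hmem : ∀ t ∈ Ico R 1, (t:ℂ) * e ∈ ball (0:ℂ) 1 := fun t ht => by
    rw [mem_ball_zero_iff, hnorm t ht]; exact ht.2
  have hd : ∀ t ∈ Ico R 1, deriv f (t * e) ≠ 0 := fun t ht =>
    univ_deriv_ne isOpen_ball hf hfinj (hmem t ht)
  have han : ∀ t ∈ Ico R 1, AnalyticAt ℂ f (t * e) := fun t ht =>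
    hf.analyticAt (isOpen_ball.mem_nhds (hmem t ht))
  have hline : ∀ t : ℝ, HasDerivAt (fun t : ℝ => (t:ℂ) * e) e t := fun t => by
    simpa using (hasDerivAt_id t).ofReal_comp.mul_const e
  have hNd : ∀ t ∈ Ico R 1, HasDerivAt (fun t : ℝ => N (t * e))
      (e * (schwarzian f (t * e) + (1/2) * (N (t * e)) ^ 2)) t := fun t ht => by
    have h1 := (prenorm_hasDerivAt (han t ht) (hd t ht)).scomp (𝕜 := ℝ) t (hline t)
    rw [smul_eq_mul] at h1
    exact h1
  have h1t : ∀ t : ℝ, HasDerivAt (fun t : ℝ => 1 - t) (-1) t := fun t => by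
    simpa using (hasDerivAt_id t).const_sub 1
  refine lint_ray (F := fun t => (1 - t) * ‖N (t * e)‖^2) hR ?_ ?_ ?_ ?_
    (fun t ht => (h1t t).mul (hasDerivAt_normSq_curve (hNd t ht))) ?_ ?_
  · intro t ht
    exact (continuousAt_const.mul ((hNd t ht).continuousAt.norm.pow 2)).continuousWithinAt
  · intro t ht
    have hS : ContinuousAt (fun t : ℝ => schwarzian f (t * e)) t :=
      ContinuousAt.comp (f := fun t : ℝ => (t:ℂ) * e) (g := schwarzian f)
       ((schwarzian_analyticAt (han t ht) (hd t ht)).continuousAt) (hline t).continuousAt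
    exact ((continuousAt_const.mul ((continuousAt_const.sub continuousAt_id).pow 2)).mul
      (hS.norm.pow 2)).continuousWithinAt
  · intro t ht; positivity
  · intro t ht; positivity
  · intro t ht
    have := ht.2
    have : 0 ≤ 1 - t := by linarith
    positivity
  · intro t ht
    have h1 := hB (t * e) (by rw [hnorm t ht]; exact ht.1) (by rw [hnorm t ht]; exact ht.2)
    rw [hnorm t ht] at h1
    have h2 : |((starRingEnd ℂ) (N (t * e)) *
        (e * (schwarzian f (t * e) + (1/2) * (N (t * e)) ^ 2))).re| ≤
        ‖N (t * e)‖ * (‖schwarzian f (t * e)‖ + 1/2 * ‖N (t * e)‖^2) := by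
      refine (Complex.abs_re_le_norm _).trans ?_
      rw [norm_mul, norm_mul, he, RCLike.norm_conj, one_mul]
      gcongr
      refine (norm_add_le _ _).trans ?_
      simp
    have h3 := (abs_le.1 h2).2
    have h4 : 0 ≤ 1 - t := by linarith [ht.2]
    change (1 - t) * ‖N (t * e)‖ ≤ 1/4 at h1
    change 1/2 * ‖N (t*e)‖^2 - _ ≤ _
    set x := ‖N (t * e)‖
    set s := ‖schwarzian f (t * e)‖
    have hx : 0 ≤ x := norm_nonneg _
    have hs : 0 ≤ s := norm_nonneg _
    have h5 := mul_le_mul_of_nonneg_left h3 h4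
    have h6 : (1 - t) * x * x^2 ≤ 1/4 * x^2 := by gcongr
    nlinarith [sq_nonneg (x/2 - 2 * ((1-t) * s))]

lemma N_L2 {f : ℂ → ℂ} (hf : DifferentiableOn ℂ f (ball (0:ℂ) 1))
    (hfinj : InjOn f (ball (0:ℂ) 1)) {M : ℝ} (hM : ∀ z ∈ ball (0:ℂ) 1, ‖f z‖ ≤ M)
    (hWP : IntegrableOn (fun z => ‖schwarzian f z‖ ^ 2 * (1 - ‖z‖ ^ 2) ^ 2 / 4)
      (ball (0:ℂ) 1)) :
    IntegrableOn (fun z => ‖deriv (deriv f) z / deriv f z‖^2) (ball (0:ℂ) 1) := by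
  obtain ⟨R, hR0, hR1, hB⟩ := little_bloch hf hfinj hM hWP (ε := 1/4) (by norm_num)
  set N : ℂ → ℂ := fun z => deriv (deriv f) z / deriv f z with hN
  have hNc : ContinuousOn N (ball 0 1) := prenorm_continuousOn hf hfinj
  have hSc : ContinuousOn (schwarzian f) (ball 0 1) := fun z hz =>
    (schwarzian_analyticAt (hf.analyticAt (isOpen_ball.mem_nhds hz))
      (univ_deriv_ne isOpen_ball hf hfinj hz)).continuousAt.continuousWithinAt
  have hmeas : MeasurableSet (ball (0:ℂ) 1 \ ball 0 R) := measurableSet_ball.diff measurableSet_ball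
  have hsplit : ball (0:ℂ) 1 = closedBall 0 R ∪ (ball 0 1 \ ball 0 R) := by
    ext z
    simp only [mem_ball_zero_iff, mem_union, mem_closedBall_zero_iff, Set.mem_sdiff, not_lt]
    constructor
    · intro h
      rcases le_total ‖z‖ R with h' | h'
      · exact Or.inl h'
      · exact Or.inr ⟨h, h'⟩
    · rintro (h | h)
      · exact lt_of_le_of_lt h hR1
      · exact h.1
  rw [hsplit]
  refine IntegrableOn.union ?_ ?_
  · refine ContinuousOn.integrableOn_compact (isCompact_closedBall _ _) ?_
    exact (hNc.mono (closedBall_subset_ball hR1)).norm.pow 2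
  refine ⟨?_, ?_⟩
  · exact ((hNc.mono sdiff_subset).norm.pow 2).aestronglyMeasurable hmeas
  rw [hasFiniteIntegral_iff_norm]
  have e0 : ∀ z, ENNReal.ofReal ‖‖deriv (deriv f) z / deriv f z‖^2‖ = ENNReal.ofReal (‖N z‖^2) := by
    intro z; rw [norm_pow, norm_norm]
  simp only [e0]
  set F : ℂ → ENNReal := (ball (0:ℂ) 1 \ ball 0 R).indicator fun z => ENNReal.ofReal (‖N z‖^2) with hF
  set G : ℂ → ENNReal := (ball (0:ℂ) 1 \ ball 0 R).indicator
    fun z => ENNReal.ofReal (‖schwarzian f z‖ ^ 2 * (1 - ‖z‖ ^ 2) ^ 2 / 4) with hG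
  have hFm : Measurable F := measurable_indicator_cont hmeas
    (ENNReal.continuous_ofReal.comp_continuousOn ((hNc.mono sdiff_subset).norm.pow 2))
  have hGm : Measurable G := measurable_indicator_cont hmeas
    (ENNReal.continuous_ofReal.comp_continuousOn
      ((((hSc.mono sdiff_subset).norm.pow 2).mul (by fun_prop)).div_const 4))
  have hGfin : ∫⁻ z, G z ≠ ⊤ := by
    rw [hG, lintegral_indicator hmeas]
    have := (hWP.mono_set (sdiff_subset (t := ball (0:ℂ) R))).2
    rw [hasFiniteIntegral_iff_norm] at this
    refine ne_top_of_le_ne_top this.ne ?_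
    exact lintegral_mono fun z => ENNReal.ofReal_le_ofReal (Real.le_norm_self _)
  rw [← lintegral_indicator hmeas]
  change ∫⁻ z, F z < ⊤
  have swap : ∀ H : ℂ → ENNReal, Measurable H → ∫⁻ z, H z =
      ∫⁻ θ in Ioo (-Real.pi) Real.pi, ∫⁻ t in Ioi (0:ℝ), ENNReal.ofReal t * H (circleMap 0 t θ) := by
    intro H hH
    have hm : Measurable fun p : ℝ × ℝ => circleMap 0 p.1 p.2 := by
      unfold circleMap; fun_prop
    rw [polar_lintegral H hH 0]
    have e1 : ∀ t : ℝ, ENNReal.ofReal t * ∫⁻ θ in Ioo (-Real.pi) Real.pi, H (circleMap 0 t θ) =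
        ∫⁻ θ in Ioo (-Real.pi) Real.pi, ENNReal.ofReal t * H (circleMap 0 t θ) := fun t => by
      rw [lintegral_const_mul]
      exact hH.comp (hm.comp (by fun_prop : Measurable fun θ : ℝ => (t, θ)))
    simp only [e1]
    rw [lintegral_lintegral_swap]
    exact ((ENNReal.measurable_ofReal.comp measurable_fst).mul (hH.comp hm)).aemeasurable
  have hsub : sphere (0:ℂ) R ⊆ ball 0 1 := fun z hz => by
    rw [mem_sphere_zero_iff_norm] at hz; rw [mem_ball_zero_iff, hz]; exact hR1
  obtain ⟨C, hC⟩ := (isCompact_sphere (0:ℂ) R).exists_bound_of_continuousOn (hNc.mono hsub)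
  have ray : ∀ θ : ℝ, ∫⁻ t in Ioi (0:ℝ), ENNReal.ofReal t * F (circleMap 0 t θ) ≤
      ENNReal.ofReal (2 * C^2) + ENNReal.ofReal (32 / R) *
        ∫⁻ t in Ioi (0:ℝ), ENNReal.ofReal t * G (circleMap 0 t θ) := by
    intro θ
    set e : ℂ := exp (θ * I)
    have he : ‖e‖ = 1 := Complex.norm_exp_ofReal_mul_I θ
    have hcm : ∀ t : ℝ, circleMap 0 t θ = t * e := fun t => by simp [circleMap, e]
    simp only [hcm]
    have key := ray_N hf hfinj hR0 hR1 hB e he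
    have hmemiff : ∀ t : ℝ, 0 < t → ((t:ℂ) * e ∈ ball (0:ℂ) 1 \ ball 0 R ↔ t ∈ Ico R 1) := by
      intro t ht
      have : ‖(t:ℂ) * e‖ = t := by
        rw [norm_mul, he, mul_one, Complex.norm_real, Real.norm_of_nonneg ht.le]
      simp only [Set.mem_sdiff, mem_ball_zero_iff, this, mem_Ico, not_lt]
      tauto
    have toIco : ∀ P : ℂ → ENNReal, ∫⁻ t in Ioi (0:ℝ), ENNReal.ofReal t *
        (ball (0:ℂ) 1 \ ball 0 R).indicator P (t * e) =
        ∫⁻ t in Ico R 1, ENNReal.ofReal t * P (t * e) := by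
      intro P
      rw [← lintegral_indicator measurableSet_Ioi, ← lintegral_indicator measurableSet_Ico]
      refine lintegral_congr fun t => ?_
      by_cases ht : 0 < t
      · rw [indicator_of_mem (by exact ht : t ∈ Ioi (0:ℝ))]
        by_cases h : t ∈ Ico R 1
        · rw [indicator_of_mem h, indicator_of_mem ((hmemiff t ht).2 h)]
        · rw [indicator_of_notMem h, indicator_of_notMem (fun h' => h ((hmemiff t ht).1 h')), mul_zero]
      · rw [indicator_of_notMem (by exact ht), indicator_of_notMem]
        exact fun h => ht (lt_of_lt_of_le hR0 h.1)
    rw [hF, hG, toIco, toIco]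
    calc ∫⁻ t in Ico R 1, ENNReal.ofReal t * ENNReal.ofReal (‖N (t * e)‖^2)
        ≤ ∫⁻ t in Ico R 1, 2 * ENNReal.ofReal (1/2 * ‖N (t * e)‖^2) := by
          refine setLIntegral_mono' measurableSet_Ico fun t ht => ?_
          rw [← ENNReal.ofReal_mul (hR0.le.trans ht.1), ← ENNReal.ofReal_ofNat 2,
            ← ENNReal.ofReal_mul (by norm_num)]
          refine ENNReal.ofReal_le_ofReal ?_
          have := ht.2
          nlinarith [sq_nonneg ‖N (t * e)‖]
      _ = 2 * ∫⁻ t in Ico R 1, ENNReal.ofReal (1/2 * ‖N (t * e)‖^2) :=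
          lintegral_const_mul' _ _ (by norm_num)
      _ ≤ 2 * (ENNReal.ofReal ((1 - R) * ‖N (R*e)‖^2) +
            ∫⁻ t in Ico R 1, ENNReal.ofReal (4 * (1 - t)^2 * ‖schwarzian f (t * e)‖^2)) := by
          gcongr
      _ = 2 * ENNReal.ofReal ((1 - R) * ‖N (R*e)‖^2) +
            ∫⁻ t in Ico R 1, 2 * ENNReal.ofReal (4 * (1 - t)^2 * ‖schwarzian f (t * e)‖^2) := by
          rw [mul_add, lintegral_const_mul' _ _ (by norm_num)]
      _ ≤ _ := by
          rw [← lintegral_const_mul' _ _ ENNReal.ofReal_ne_top]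
          refine add_le_add ?_ (setLIntegral_mono' measurableSet_Ico fun t ht => ?_)
          · rw [← ENNReal.ofReal_ofNat 2, ← ENNReal.ofReal_mul (by norm_num)]
            refine ENNReal.ofReal_le_ofReal ?_
            have h1 : ‖N (R * e)‖ ≤ C := hC _ (by
              rw [mem_sphere_zero_iff_norm, norm_mul, he, mul_one, Complex.norm_real,
                Real.norm_of_nonneg hR0.le])
            have h2 : ‖N (R * e)‖^2 ≤ C^2 := by gcongr
            nlinarith [sq_nonneg ‖N (R * e)‖]
          · have ht0 : 0 ≤ t := hR0.le.trans ht.1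
            have hnt : ‖(t:ℂ) * e‖ = t := by
              rw [norm_mul, he, mul_one, Complex.norm_real, Real.norm_of_nonneg ht0]
            rw [hnt, ← ENNReal.ofReal_mul ht0, ← ENNReal.ofReal_mul (by positivity),
              ← ENNReal.ofReal_ofNat 2, ← ENNReal.ofReal_mul (by norm_num)]
            refine ENNReal.ofReal_le_ofReal ?_
            have h1 : (1 - t)^2 ≤ (1 - t^2)^2 := by
              have := ht.2
              have : 1 - t ≤ 1 - t^2 := by nlinarith
              gcongr
            have h2 : 1 ≤ t / R := (one_le_div hR0).2 ht.1
            calc 2 * (4 * (1 - t)^2 * ‖schwarzian f (t * e)‖^2)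
                = 1 * (8 * (1 - t)^2 * ‖schwarzian f (t * e)‖^2) := by ring
              _ ≤ (t / R) * (8 * (1 - t^2)^2 * ‖schwarzian f (t * e)‖^2) := by gcongr
              _ = _ := by field_simp; ring
  rw [swap F hFm]
  calc _ ≤ ∫⁻ θ in Ioo (-Real.pi) Real.pi, (ENNReal.ofReal (2 * C^2) + ENNReal.ofReal (32 / R) *
        ∫⁻ t in Ioi (0:ℝ), ENNReal.ofReal t * G (circleMap 0 t θ)) := lintegral_mono ray
    _ = ENNReal.ofReal (2 * C^2) * volume (Ioo (-Real.pi) Real.pi) + ENNReal.ofReal (32 / R) *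
        ∫⁻ z, G z := by
      rw [swap G hGm, lintegral_add_left measurable_const, lintegral_const_mul' _ _ ENNReal.ofReal_ne_top]
      simp
    _ < ⊤ := by
      refine ENNReal.add_lt_top.2 ⟨ENNReal.mul_lt_top ENNReal.ofReal_lt_top (by simp),
        ENNReal.mul_lt_top ENNReal.ofReal_lt_top (lt_top_iff_ne_top.2 hGfin)⟩

structure GoodMap (f : ℂ → ℂ) (ε R0 : ℝ) : Prop where
  diff : DifferentiableOn ℂ f (ball (0:ℂ) 1)
  inj : InjOn f (ball (0:ℂ) 1)
  hε0 : 0 < ε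
  hε : ε ≤ 1/1000
  hR0 : 1/2 ≤ R0
  hR1 : R0 < 1
  bound : ∀ z, R0 ≤ ‖z‖ → ‖z‖ < 1 → (1 - ‖z‖) * ‖deriv (deriv f) z / deriv f z‖ ≤ ε

namespace GoodMap

variable {f : ℂ → ℂ} {ε R0 : ℝ}

lemma an (G : GoodMap f ε R0) {z : ℂ} (hz : ‖z‖ < 1) : AnalyticAt ℂ f z :=
  G.diff.analyticAt (isOpen_ball.mem_nhds (by simpa using hz))

lemma hd (G : GoodMap f ε R0) {z : ℂ} (hz : ‖z‖ < 1) : HasDerivAt f (deriv f z) z :=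
  (G.an hz).differentiableAt.hasDerivAt

lemma hd2 (G : GoodMap f ε R0) {z : ℂ} (hz : ‖z‖ < 1) :
    HasDerivAt (deriv f) (deriv (deriv f) z) z :=
  (G.an hz).deriv.differentiableAt.hasDerivAt

lemma ne (G : GoodMap f ε R0) {z : ℂ} (hz : ‖z‖ < 1) : deriv f z ≠ 0 :=
  univ_deriv_ne isOpen_ball G.diff G.inj (by simpa using hz)

lemma pos (G : GoodMap f ε R0) {z : ℂ} (hz : ‖z‖ < 1) : 0 < ‖deriv f z‖ :=
  norm_pos_iff.2 (G.ne hz)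

lemma bound2 (G : GoodMap f ε R0) {z : ℂ} (h1 : R0 ≤ ‖z‖) (hz : ‖z‖ < 1) :
    ‖deriv (deriv f) z‖ ≤ ε / (1 - ‖z‖) * ‖deriv f z‖ := by
  have h := G.bound z h1 hz
  have h2 := G.pos hz
  have h3 : 0 < 1 - ‖z‖ := by linarith
  rw [norm_div, ← mul_div_assoc, div_le_iff₀ h2] at h
  rw [div_mul_eq_mul_div, le_div_iff₀ h3]
  linarith

lemma ray (G : GoodMap f ε R0) {e : ℂ} (he : ‖e‖ = 1) {t0 t : ℝ} (h0 : R0 ≤ t0) (h : t0 ≤ t)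
    (ht : t < 1) :
    ‖deriv f (t * e) - deriv f (t0 * e)‖ ≤ 4 * ε * ‖deriv f (t0 * e)‖ * (1 / √((1 - t)/(1-t0)) - 1) ∧
    ‖f (t * e) - f (t0 * e) - deriv f (t0 * e) * ((t - t0) * e)‖ ≤
      8 * ε * ‖deriv f (t0 * e)‖ * (1 - t0) := by
  have hε0 := G.hε0
  have hε := G.hε
  have hR0 := G.hR0
  have hnorm : ∀ τ ∈ Icc t0 t, ‖(τ:ℂ) * e‖ = τ := fun τ hτ => by
    rw [norm_mul, he, mul_one, Complex.norm_real, Real.norm_of_nonneg (by linarith [hτ.1])]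
  have hlt : ∀ τ ∈ Icc t0 t, ‖(τ:ℂ) * e‖ < 1 := fun τ hτ => by
    rw [hnorm τ hτ]; exact lt_of_le_of_lt hτ.2 ht
  have hline : ∀ t : ℝ, HasDerivAt (fun t : ℝ => (t:ℂ) * e) e t := fun t => by
    simpa using (hasDerivAt_id t).ofReal_comp.mul_const e
  set c := ‖deriv f (t0 * e)‖ with hc
  have ht01 : 0 < 1 - t0 := by linarith
  have hc0 : 0 < c := G.pos (hlt t0 (left_mem_Icc.2 h))
  set p : ℝ → ℝ := fun τ => √((1 - τ)/(1-t0)) with hp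
  have hp0 : ∀ τ ∈ Icc t0 t, 0 < p τ := fun τ hτ =>
    Real.sqrt_pos.2 (div_pos (by linarith [hτ.2]) ht01)
  have hp1 : ∀ τ ∈ Icc t0 t, p τ ≤ 1 := fun τ hτ => by
    rw [hp]
    refine Real.sqrt_le_one.2 ?_
    rw [div_le_one ht01]; linarith [hτ.1]
  have hpsq : ∀ τ ∈ Icc t0 t, 1 - τ = (1 - t0) * p τ ^ 2 := fun τ hτ => by
    rw [hp]
    simp only
    rw [Real.sq_sqrt (div_nonneg (by linarith [hτ.2]) ht01.le)]
    field_simp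
  have hpt0 : p t0 = 1 := by
    simp only [hp]; rw [div_self ht01.ne', Real.sqrt_one]
  have hpd : ∀ τ ∈ Icc t0 t, HasDerivAt p (-1 / (2 * (1 - t0) * p τ)) τ := fun τ hτ => by
    have h1 : HasDerivAt (fun t : ℝ => (1 - t)/(1 - t0)) (-1 / (1 - t0)) τ := by
      simpa using ((hasDerivAt_id τ).const_sub 1).div_const (1 - t0)
    have h2 := h1.sqrt (div_pos (by linarith [hτ.2]) ht01).ne'
    refine h2.congr_deriv ?_
    have : √((1 - τ) / (1 - t0)) = p τ := rfl
    rw [this]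
    have := (hp0 τ hτ).ne'
    field_simp
  have hud : ∀ τ ∈ Icc t0 t, HasDerivAt (fun τ : ℝ => deriv f (τ * e) - deriv f (t0 * e))
      (e * deriv (deriv f) (τ * e)) τ := fun τ hτ => by
    have := (G.hd2 (hlt τ hτ)).scomp (𝕜 := ℝ) τ (hline τ)
    rw [smul_eq_mul] at this
    exact this.sub_const _
  have first : ∀ ⦃τ⦄, τ ∈ Icc t0 t →
      ‖deriv f (τ * e) - deriv f (t0 * e)‖ ≤ 4 * ε * c * (1 / p τ - 1) := by
    refine image_norm_le_of_norm_deriv_right_lt_deriv_boundary' (a := t0) (b := t)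
      (f' := fun τ => e * deriv (deriv f) (τ * e))
      (B' := fun τ => 2 * ε * c / ((1 - τ) * p τ))
      (fun τ hτ => (hud τ hτ).continuousAt.continuousWithinAt)
      (fun τ hτ => (hud τ (Ico_subset_Icc_self hτ)).hasDerivWithinAt) ?_ ?_ ?_ ?_
    · rw [hpt0]; simp
    · intro τ hτ
      exact (continuousAt_const.mul ((continuousAt_const.div (hpd τ hτ).continuousAt
        (hp0 τ hτ).ne').sub continuousAt_const)).continuousWithinAt
    · intro τ hτ
      have hτ' := Ico_subset_Icc_self hτ
      have h1 := ((((hasDerivAt_const τ (1:ℝ)).div (hpd τ hτ') (hp0 τ hτ').ne').sub_const 1).const_mul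
        (4 * ε * c))
      refine (h1.congr_deriv ?_).hasDerivWithinAt
      rw [hpsq τ hτ']
      have := (hp0 τ hτ').ne'
      field_simp
      ring
    · intro τ hτ heq
      have hτ' := Ico_subset_Icc_self hτ
      have h1 := G.bound2 (z := τ * e) (by rw [hnorm τ hτ']; linarith [hτ.1]) (hlt τ hτ')
      rw [hnorm τ hτ'] at h1
      have h2 : ‖deriv f (τ * e)‖ ≤ c + 4 * ε * c * (1 / p τ - 1) := by
        rw [← heq, hc]
        have := norm_add_le (deriv f (t0 * e)) (deriv f (τ * e) - deriv f (t0 * e))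
        rwa [add_sub_cancel] at this
      have h3 : 0 < 1 - τ := by linarith [hτ'.2]
      have h4 := hp0 τ hτ'
      have h5 := hp1 τ hτ'
      rw [norm_mul, he, one_mul]
      calc _ ≤ ε / (1 - τ) * ‖deriv f (τ * e)‖ := h1
        _ ≤ ε / (1 - τ) * (c + 4 * ε * c * (1 / p τ - 1)) := by gcongr
        _ = (ε * c / ((1 - τ) * p τ)) * (p τ + 4 * ε * (1 - p τ)) := by field_simp
        _ < (ε * c / ((1 - τ) * p τ)) * 2 := by
          refine mul_lt_mul_of_pos_left ?_ (by positivity)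
          nlinarith
        _ = _ := by ring
  refine ⟨first (right_mem_Icc.2 h), ?_⟩
  have hgd : ∀ τ ∈ Icc t0 t, HasDerivAt
      (fun τ : ℝ => f (τ * e) - f (t0 * e) - deriv f (t0 * e) * ((τ - t0) * e))
      (e * (deriv f (τ * e) - deriv f (t0 * e))) τ := fun τ hτ => by
    have h1 := (G.hd (hlt τ hτ)).scomp (𝕜 := ℝ) τ (hline τ)
    rw [smul_eq_mul] at h1
    have h2 : HasDerivAt (fun τ : ℝ => ((τ:ℂ) - t0) * e) e τ := by
      simpa using ((hasDerivAt_id τ).ofReal_comp.sub_const (t0 : ℂ)).mul_const e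
    refine ((h1.sub_const _).sub (h2.const_mul (deriv f (t0 * e)))).congr_deriv ?_
    ring
  have second : ∀ ⦃τ⦄, τ ∈ Icc t0 t →
      ‖f (τ * e) - f (t0 * e) - deriv f (t0 * e) * ((τ - t0) * e)‖ ≤
        8 * ε * c * (1 - t0) * (1 - p τ) := by
    refine image_norm_le_of_norm_deriv_right_le_deriv_boundary' (a := t0) (b := t)
      (f' := fun τ => e * (deriv f (τ * e) - deriv f (t0 * e)))
      (B' := fun τ => 4 * ε * c / p τ)
      (fun τ hτ => (hgd τ hτ).continuousAt.continuousWithinAt)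
      (fun τ hτ => (hgd τ (Ico_subset_Icc_self hτ)).hasDerivWithinAt) ?_ ?_ ?_ ?_
    · rw [hpt0]; simp
    · intro τ hτ
      exact (continuousAt_const.mul (continuousAt_const.sub (hpd τ hτ).continuousAt)).continuousWithinAt
    · intro τ hτ
      have hτ' := Ico_subset_Icc_self hτ
      have h1 := ((hpd τ hτ').const_sub 1).const_mul (8 * ε * c * (1 - t0))
      refine (h1.congr_deriv ?_).hasDerivWithinAt
      have := (hp0 τ hτ').ne'
      field_simp
      ring
    · intro τ hτ
      have hτ' := Ico_subset_Icc_self hτ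
      rw [norm_mul, he, one_mul]
      refine (first hτ').trans ?_
      rw [mul_sub, mul_one_div]
      have : 0 < 4 * ε * c := by positivity
      linarith
  refine (second (right_mem_Icc.2 h)).trans ?_
  have := hp0 t (right_mem_Icc.2 h)
  have h2 : 0 < 8 * ε * c * (1 - t0) := by positivity
  nlinarith

lemma ray' (G : GoodMap f ε R0) {e : ℂ} (he : ‖e‖ = 1) {t0 t : ℝ} (h0 : R0 ≤ t0) (h : t0 ≤ t)
    (ht : t < 1) : (1 - t) * ‖deriv f (t * e) - deriv f (t0 * e)‖ ≤
      4 * ε * ‖deriv f (t0 * e)‖ * (1 - t0) := by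
  have h1 := (G.ray he h0 h ht).1
  have ht01 : 0 < 1 - t0 := by linarith
  set p := √((1 - t)/(1-t0)) with hp
  have hp0 : 0 < p := Real.sqrt_pos.2 (div_pos (by linarith) ht01)
  have hp1 : p ≤ 1 := by
    refine Real.sqrt_le_one.2 ?_
    rw [div_le_one ht01]; linarith
  have hpsq : 1 - t = (1 - t0) * p ^ 2 := by
    rw [hp, Real.sq_sqrt (div_nonneg (by linarith) ht01.le)]
    field_simp
  have hε0 := G.hε0
  have : 0 ≤ ‖deriv f (t0 * e)‖ := norm_nonneg _
  calc _ ≤ (1 - t) * (4 * ε * ‖deriv f (t0 * e)‖ * (1 / p - 1)) := by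
        refine mul_le_mul_of_nonneg_left h1 (by linarith)
    _ = 4 * ε * ‖deriv f (t0 * e)‖ * (1 - t0) * (p * (1 - p)) := by
        rw [hpsq]; field_simp
    _ ≤ 4 * ε * ‖deriv f (t0 * e)‖ * (1 - t0) * 1 := by
        gcongr; nlinarith
    _ = _ := by ring

lemma horiz (G : GoodMap f ε R0) {m m' : ℂ} {H : ℝ} (hH : 0 < H) (hH3 : R0 ≤ 1 - 3 * H)
    (hm : ‖m‖ = 1 - H) (hm' : ‖m'‖ = 1 - H) (hmm : ‖m' - m‖ ≤ 4 * H) :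
    ‖deriv f m' - deriv f m‖ ≤ 8 * ε * ‖deriv f m‖ ∧
    ‖f m' - f m - deriv f m * (m' - m)‖ ≤ 32 * ε * H * ‖deriv f m‖ := by
  have hε0 := G.hε0
  have hε := G.hε
  have hR0 := G.hR0
  set l : ℝ → ℂ := fun x => m + x * (m' - m) with hl
  have hle : ∀ x ∈ Icc (0:ℝ) 1, ‖l x‖ ≤ 1 - H := fun x hx => by
    have : l x = ((1 - x : ℝ) : ℂ) * m + (x : ℂ) * m' := by simp only [hl]; push_cast; ring
    rw [this]
    refine (norm_add_le _ _).trans ?_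
    rw [norm_mul, norm_mul, Complex.norm_real, Complex.norm_real, Real.norm_of_nonneg hx.1,
      Real.norm_of_nonneg (by linarith [hx.2]), hm, hm']
    linarith
  have hge : ∀ x ∈ Icc (0:ℝ) 1, R0 ≤ ‖l x‖ := fun x hx => by
    rcases le_total x (1/2) with h | h
    · have h1 : ‖m‖ ≤ ‖l x‖ + ‖(x : ℂ) * (m' - m)‖ := by
        have := norm_sub_le (l x) ((x : ℂ) * (m' - m))
        simpa [hl] using this
      rw [norm_mul, Complex.norm_real, Real.norm_of_nonneg hx.1] at h1
      nlinarith [norm_nonneg (m' - m)]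
    · have h1 : ‖m'‖ ≤ ‖l x‖ + ‖((1 - x : ℝ) : ℂ) * (m' - m)‖ := by
        have := norm_add_le (l x) (((1 - x : ℝ) : ℂ) * (m' - m))
        have e : l x + ((1 - x : ℝ) : ℂ) * (m' - m) = m' := by simp only [hl]; push_cast; ring
        rwa [e] at this
      rw [norm_mul, Complex.norm_real, Real.norm_of_nonneg (by linarith [hx.2])] at h1
      nlinarith [norm_nonneg (m' - m), hx.2]
  have hlt : ∀ x ∈ Icc (0:ℝ) 1, ‖l x‖ < 1 := fun x hx => by linarith [hle x hx]
  have hline : ∀ x : ℝ, HasDerivAt l (m' - m) x := fun t => by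
    exact (((hasDerivAt_id t).ofReal_comp.mul_const (m' - m)).const_add m).congr_deriv (by simp)
  have hl0 : l 0 = m := by simp [hl]
  have hl1 : l 1 = m' := by simp [hl]
  set c := ‖deriv f m‖ with hc
  have hc0 : 0 < c := G.pos (by linarith)
  have hud : ∀ x ∈ Icc (0:ℝ) 1, HasDerivAt (fun x : ℝ => deriv f (l x) - deriv f m)
      ((m' - m) * deriv (deriv f) (l x)) x := fun x hx => by
    have := (G.hd2 (hlt x hx)).scomp (𝕜 := ℝ) x (hline x)
    rw [smul_eq_mul] at this
    exact this.sub_const _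
  have first : ∀ ⦃x⦄, x ∈ Icc (0:ℝ) 1 → ‖deriv f (l x) - deriv f m‖ ≤ (8 * ε * c) * x := by
    refine image_norm_le_of_norm_deriv_right_lt_deriv_boundary'
      (B' := fun x => 8 * ε * c) (fun x hx => (hud x hx).continuousAt.continuousWithinAt)
      (fun x hx => (hud x (Ico_subset_Icc_self hx)).hasDerivWithinAt) ?_ (by fun_prop) ?_ ?_
    · rw [hl0]; simp
    · intro x hx
      simpa using ((hasDerivAt_id x).const_mul (8 * ε * c)).hasDerivWithinAt
    · intro x hx heq
      have hx' := Ico_subset_Icc_self hx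
      have h1 := G.bound2 (hge x hx') (hlt x hx')
      have h2 : ‖deriv f (l x)‖ ≤ c + 8 * ε * c * x := by
        rw [← heq, hc]
        have := norm_add_le (deriv f m) (deriv f (l x) - deriv f m)
        rwa [add_sub_cancel] at this
      have h3 : ε / (1 - ‖l x‖) ≤ ε / H := by
        apply div_le_div_of_nonneg_left hε0.le hH; linarith [hle x hx']
      rw [norm_mul]
      calc _ ≤ (4 * H) * (ε / (1 - ‖l x‖) * ‖deriv f (l x)‖) := by gcongr
        _ ≤ (4 * H) * (ε / H * (c + 8 * ε * c * x)) := by gcongr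
        _ = 4 * ε * c * (1 + 8 * ε * x) := by field_simp
        _ < 4 * ε * c * 2 := by
          refine mul_lt_mul_of_pos_left ?_ (by positivity)
          nlinarith [hx.1, hx.2]
        _ = _ := by ring
  refine ⟨by simpa [hl1] using first (right_mem_Icc.2 zero_le_one), ?_⟩
  have hgd : ∀ x ∈ Icc (0:ℝ) 1, HasDerivAt (fun x : ℝ => f (l x) - f m - deriv f m * (l x - m))
      ((m' - m) * (deriv f (l x) - deriv f m)) x := fun x hx => by
    have h1 := (G.hd (hlt x hx)).scomp (𝕜 := ℝ) x (hline x)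
    rw [smul_eq_mul] at h1
    refine ((h1.sub_const _).sub (((hline x).sub_const m).const_mul (deriv f m))).congr_deriv ?_
    ring
  have second : ∀ ⦃x⦄, x ∈ Icc (0:ℝ) 1 →
      ‖f (l x) - f m - deriv f m * (l x - m)‖ ≤ (32 * ε * H * c) * x := by
    refine image_norm_le_of_norm_deriv_right_le_deriv_boundary'
      (B' := fun x => 32 * ε * H * c) (fun x hx => (hgd x hx).continuousAt.continuousWithinAt)
      (fun x hx => (hgd x (Ico_subset_Icc_self hx)).hasDerivWithinAt) ?_ (by fun_prop) ?_ ?_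
    · rw [hl0]; simp
    · intro x hx
      simpa using ((hasDerivAt_id x).const_mul (32 * ε * H * c)).hasDerivWithinAt
    · intro x hx
      have hx' := Ico_subset_Icc_self hx
      rw [norm_mul]
      calc _ ≤ (4 * H) * ((8 * ε * c) * x) := by gcongr; exact first hx'
        _ = (32 * ε * H * c) * x := by ring
        _ ≤ (32 * ε * H * c) * 1 := by gcongr; exact hx'.2
        _ = _ := by ring
  simpa [hl1] using second (right_mem_Icc.2 zero_le_one)

end GoodMap

/-- the reflected extension -/
noncomputable def Eext (f : ℂ → ℂ) (z : ℂ) : ℂ :=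
  f z + (((starRingEnd ℂ) z)⁻¹ - z) * deriv f z

structure NearPt (f : ℂ → ℂ) (ε H : ℝ) (e x V : ℂ) : Prop where
  he : ‖e‖ = 1
  est : ‖V - f ((1 - H : ℝ) * e) - deriv f ((1 - H : ℝ) * e) * (x - (1 - H : ℝ) * e)‖ ≤
    24 * ε * H * ‖deriv f ((1 - H : ℝ) * e)‖
  dist : ‖x - (1 - H : ℝ) * e‖ ≤ 3 * H

namespace GoodMap

variable {f : ℂ → ℂ} {ε R0 : ℝ}

lemma unit_dir {z : ℂ} (hz : z ≠ 0) : ‖z / (‖z‖ : ℂ)‖ = 1 ∧ ((‖z‖ : ℝ) : ℂ) * (z / (‖z‖ : ℂ)) = z ∧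
    ((starRingEnd ℂ) z)⁻¹ = ((1 / ‖z‖ : ℝ) : ℂ) * (z / (‖z‖ : ℂ)) := by
  have h0 : ‖z‖ ≠ 0 := by simpa using hz
  have h1 : (‖z‖ : ℂ) ≠ 0 := by exact_mod_cast h0
  refine ⟨by simp [h0], by field_simp, ?_⟩
  have h2 : (starRingEnd ℂ) z ≠ 0 := by simpa using hz
  have h3 : z * (starRingEnd ℂ) z = (‖z‖ : ℂ)^2 := by
    rw [Complex.mul_conj, Complex.normSq_eq_norm_sq]; push_cast; ring
  push_cast
  field_simp
  rw [← h3]; ring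

lemma near_in (G : GoodMap f ε R0) {z : ℂ} {H : ℝ} (hH : 0 < H) (hHR : R0 ≤ 1 - H)
    (h1 : 1 - H ≤ ‖z‖) (h2 : ‖z‖ < 1) : NearPt f ε H (z / (‖z‖ : ℂ)) z (f z) := by
  have hR0 := G.hR0
  have hε0 := G.hε0
  have hz : z ≠ 0 := fun h => by rw [h, norm_zero] at h1; linarith
  obtain ⟨he, hez, -⟩ := unit_dir hz
  set e := z / (‖z‖ : ℂ)
  have h3 := (G.ray he hHR h1 h2).2
  have h4 : (((‖z‖ : ℝ) : ℂ) - ((1 - H : ℝ) : ℂ)) * e = z - (1 - H : ℝ) * e := by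
    rw [sub_mul, hez]
  rw [h4, hez] at h3
  refine ⟨he, h3.trans ?_, ?_⟩
  · have : 0 ≤ ε * H * ‖deriv f ((1 - H : ℝ) * e)‖ := by positivity
    rw [show 1 - (1 - H) = H by ring]
    linarith
  · rw [← h4, norm_mul, he, mul_one, ← Complex.ofReal_sub, Complex.norm_real,
      Real.norm_of_nonneg (by linarith)]
    linarith

lemma near_out (G : GoodMap f ε R0) {z : ℂ} {H : ℝ} (hH : 0 < H) (hHR : R0 ≤ 1 - H)
    (h1 : 1 - H ≤ ‖z‖) (h2 : ‖z‖ < 1) :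
    NearPt f ε H (z / (‖z‖ : ℂ)) ((starRingEnd ℂ) z)⁻¹ (Eext f z) := by
  have hR0 := G.hR0
  have hε0 := G.hε0
  have hz0 : 1/2 ≤ ‖z‖ := by linarith
  have hz : z ≠ 0 := fun h => by rw [h, norm_zero] at h1; linarith
  obtain ⟨he, hez, hinv⟩ := unit_dir hz
  have h3 := (G.ray he hHR h1 h2).2
  have h5 := G.ray' he hHR h1 h2
  unfold Eext
  set x := ((starRingEnd ℂ) z)⁻¹
  set e := z / (‖z‖ : ℂ)
  have h4 : (((‖z‖ : ℝ) : ℂ) - ((1 - H : ℝ) : ℂ)) * e = z - (1 - H : ℝ) * e := by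
    rw [sub_mul, hez]
  rw [h4, hez] at h3
  rw [hez] at h5
  set m := ((1 - H : ℝ) : ℂ) * e with hm
  have hinvle : 1 / ‖z‖ ≤ 1 + 2 * (1 - ‖z‖) := by
    rw [div_le_iff₀ (by linarith)]; nlinarith
  have hxz : ‖x - z‖ ≤ 4 * (1 - ‖z‖) := by
    have : x - z = ((1 / ‖z‖ - ‖z‖ : ℝ) : ℂ) * e := by
      rw [hinv]; nth_rewrite 2 [← hez]; push_cast; ring
    rw [this, norm_mul, he, mul_one, Complex.norm_real, Real.norm_of_nonneg]
    · linarith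
    · have : 1 ≤ 1 / ‖z‖ := by rw [le_div_iff₀ (by linarith)]; linarith
      linarith
  refine ⟨he, ?_, ?_⟩
  · have e1 : f z + (x - z) * deriv f z - f m - deriv f m * (x - m) =
      (f z - f m - deriv f m * (z - m)) + (x - z) * (deriv f z - deriv f m) := by ring
    rw [e1]
    refine (norm_add_le _ _).trans ?_
    rw [norm_mul]
    have h6 : ‖x - z‖ * ‖deriv f z - deriv f m‖ ≤ 16 * ε * ‖deriv f m‖ * H := by
      calc _ ≤ 4 * (1 - ‖z‖) * ‖deriv f z - deriv f m‖ := by gcongr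
        _ = 4 * ((1 - ‖z‖) * ‖deriv f z - deriv f m‖) := by ring
        _ ≤ 4 * (4 * ε * ‖deriv f m‖ * (1 - (1 - H))) := by gcongr
        _ = _ := by ring
    rw [show 1 - (1 - H) = H by ring] at h3
    linarith
  · have : x - m = ((1 / ‖z‖ - (1 - H) : ℝ) : ℂ) * e := by
      rw [hinv, hm]; push_cast; ring
    rw [this, norm_mul, he, mul_one, Complex.norm_real, Real.norm_of_nonneg]
    · linarith
    · have : 1 ≤ 1 / ‖z‖ := by rw [le_div_iff₀ (by linarith)]; linarith
      linarith

lemma comb (G : GoodMap f ε R0) {H : ℝ} {e x V e' x' V' : ℂ} (hH : 0 < H) (hH3 : R0 ≤ 1 - 3 * H)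
    (N1 : NearPt f ε H e x V) (N2 : NearPt f ε H e' x' V') (hee : ‖e' - e‖ ≤ 4 * H) :
    ‖V' - V - deriv f ((1 - H : ℝ) * e) * (x' - x)‖ ≤
      130 * ε * H * ‖deriv f ((1 - H : ℝ) * e)‖ := by
  have hR0 := G.hR0
  have hε0 := G.hε0
  have hε := G.hε
  have a1 := N1.est
  have a2 := N2.est
  have a3 := N2.dist
  set m := ((1 - H : ℝ) : ℂ) * e with hm
  set m' := ((1 - H : ℝ) : ℂ) * e' with hm'
  have nm : ‖m‖ = 1 - H := by
    rw [hm, norm_mul, N1.he, mul_one, Complex.norm_real, Real.norm_of_nonneg (by linarith)]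
  have nm' : ‖m'‖ = 1 - H := by
    rw [hm', norm_mul, N2.he, mul_one, Complex.norm_real, Real.norm_of_nonneg (by linarith)]
  have nmm : ‖m' - m‖ ≤ 4 * H := by
    rw [hm, hm', ← mul_sub, norm_mul, Complex.norm_real, Real.norm_of_nonneg (by linarith)]
    nlinarith [norm_nonneg (e' - e)]
  obtain ⟨b1, b2⟩ := G.horiz hH hH3 nm nm' nmm
  set c := ‖deriv f m‖
  have hc : 0 ≤ c := norm_nonneg _
  have b3 : ‖deriv f m'‖ ≤ 2 * c := by
    have := norm_add_le (deriv f m) (deriv f m' - deriv f m)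
    rw [add_sub_cancel] at this
    have : 8 * ε * c ≤ c := by nlinarith
    linarith
  have e1 : V' - V - deriv f m * (x' - x) = (V' - f m' - deriv f m' * (x' - m')) +
    (deriv f m' - deriv f m) * (x' - m') + (f m' - f m - deriv f m * (m' - m)) -
    (V - f m - deriv f m * (x - m)) := by ring
  rw [e1]
  refine (norm_sub_le _ _).trans ?_
  refine (add_le_add (norm_add₃_le) a1).trans ?_
  rw [norm_mul]
  have h1 : ‖deriv f m' - deriv f m‖ * ‖x' - m'‖ ≤ (8 * ε * c) * (3 * H) := by gcongr
  have h2 : 24 * ε * H * ‖deriv f m'‖ ≤ 24 * ε * H * (2 * c) := by gcongr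
  have : 0 ≤ ε * H * c := by positivity
  linarith

lemma dir_dist {x x' : ℂ} (hx : 1/2 ≤ ‖x‖) (hx' : x' ≠ 0) :
    ‖x' / (‖x'‖ : ℂ) - x / (‖x‖ : ℂ)‖ ≤ 4 * ‖x' - x‖ := by
  have h0 : ‖x'‖ ≠ 0 := by simpa using hx'
  have h1 : (‖x'‖ : ℂ) ≠ 0 := by exact_mod_cast h0
  have h2 : ‖x‖ ≠ 0 := by linarith
  have h3 : (‖x‖ : ℂ) ≠ 0 := by exact_mod_cast h2
  have e1 : x' / (‖x'‖ : ℂ) - x / (‖x‖ : ℂ) =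
    ((x' - x) + (x' / (‖x'‖ : ℂ)) * ((‖x‖ - ‖x'‖ : ℝ) : ℂ)) / (‖x‖ : ℂ) := by
    push_cast
    field_simp
    ring
  rw [e1, norm_div, Complex.norm_real, norm_norm, div_le_iff₀ (by linarith)]
  refine (norm_add_le _ _).trans ?_
  rw [norm_mul, (unit_dir hx').1, one_mul, Complex.norm_real, Real.norm_eq_abs]
  have := abs_norm_sub_norm_le x x'
  rw [norm_sub_rev x x'] at this
  nlinarith [norm_nonneg (x' - x)]

lemma conj_inv_dir {z : ℂ} (hz : z ≠ 0) :
    ((starRingEnd ℂ) z)⁻¹ / (‖((starRingEnd ℂ) z)⁻¹‖ : ℂ) = z / (‖z‖ : ℂ) := by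
  rw [(unit_dir hz).2.2]
  have h0 : ‖z‖ ≠ 0 := by simpa using hz
  have h1 : (‖z‖ : ℂ) ≠ 0 := by exact_mod_cast h0
  rw [norm_mul, (unit_dir hz).1, mul_one, Complex.norm_real, Real.norm_of_nonneg (by positivity)]
  push_cast
  field_simp

/-- two interior points -/
lemma comb_in_in (G : GoodMap f ε R0) {H : ℝ} {z w : ℂ} (hH : 0 < H) (hH3 : R0 ≤ 1 - 3 * H)
    (hz : 1 - H ≤ ‖z‖) (hz1 : ‖z‖ < 1) (hw : 1 - H ≤ ‖w‖) (hw1 : ‖w‖ < 1) (hzw : ‖w - z‖ ≤ H) :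
    ‖f w - f z - deriv f ((1 - H : ℝ) * (z / (‖z‖ : ℂ))) * (w - z)‖ ≤
      130 * ε * H * ‖deriv f ((1 - H : ℝ) * (z / (‖z‖ : ℂ)))‖ := by
  have hR0 := G.hR0
  refine G.comb hH hH3 (G.near_in hH (by linarith) hz hz1) (G.near_in hH (by linarith) hw hw1) ?_
  refine (dir_dist (by linarith) ?_).trans (by linarith)
  rintro rfl
  rw [norm_zero] at hw; linarith

/-- reflected point and interior point -/
lemma comb_out_in (G : GoodMap f ε R0) {H : ℝ} {z w : ℂ} (hH : 0 < H) (hH3 : R0 ≤ 1 - 3 * H)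
    (hz : 1 - H ≤ ‖z‖) (hz1 : ‖z‖ < 1) (hw : 1 - H ≤ ‖w‖) (hw1 : ‖w‖ < 1)
    (hzw : ‖w - ((starRingEnd ℂ) z)⁻¹‖ ≤ H) :
    ‖f w - Eext f z - deriv f ((1 - H : ℝ) * (z / (‖z‖ : ℂ))) * (w - ((starRingEnd ℂ) z)⁻¹)‖ ≤
      130 * ε * H * ‖deriv f ((1 - H : ℝ) * (z / (‖z‖ : ℂ)))‖ := by
  have hR0 := G.hR0
  have hz0 : z ≠ 0 := by
    rintro rfl
    rw [norm_zero] at hz; linarith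
  refine G.comb hH hH3 (G.near_out hH (by linarith) hz hz1) (G.near_in hH (by linarith) hw hw1) ?_
  rw [← conj_inv_dir hz0]
  refine (dir_dist ?_ ?_).trans (by linarith)
  · rw [norm_inv, RCLike.norm_conj]
    have : 1 ≤ ‖z‖⁻¹ := (one_le_inv₀ (by linarith)).2 hz1.le
    linarith
  · rintro rfl
    rw [norm_zero] at hw; linarith

/-- two reflected points -/
lemma comb_out_out (G : GoodMap f ε R0) {H : ℝ} {z w : ℂ} (hH : 0 < H) (hH3 : R0 ≤ 1 - 3 * H)
    (hz : 1 - H ≤ ‖z‖) (hz1 : ‖z‖ < 1) (hw : 1 - H ≤ ‖w‖) (hw1 : ‖w‖ < 1)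
    (hzw : ‖((starRingEnd ℂ) w)⁻¹ - ((starRingEnd ℂ) z)⁻¹‖ ≤ H) :
    ‖Eext f w - Eext f z - deriv f ((1 - H : ℝ) * (z / (‖z‖ : ℂ))) *
      (((starRingEnd ℂ) w)⁻¹ - ((starRingEnd ℂ) z)⁻¹)‖ ≤
      130 * ε * H * ‖deriv f ((1 - H : ℝ) * (z / (‖z‖ : ℂ)))‖ := by
  have hR0 := G.hR0
  have hz0 : z ≠ 0 := by
    rintro rfl
    rw [norm_zero] at hz; linarith
  have hw0 : w ≠ 0 := by
    rintro rfl
    rw [norm_zero] at hw; linarith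
  refine G.comb hH hH3 (G.near_out hH (by linarith) hz hz1) (G.near_out hH (by linarith) hw hw1) ?_
  rw [← conj_inv_dir hz0, ← conj_inv_dir hw0]
  refine (dir_dist ?_ (by simpa using hw0)).trans (by linarith)
  rw [norm_inv, RCLike.norm_conj]
  have : 1 ≤ ‖z‖⁻¹ := (one_le_inv₀ (by linarith)).2 hz1.le
  linarith

end GoodMap

namespace GoodMap

variable {f : ℂ → ℂ} {ε R0 : ℝ}

lemma mono (G : GoodMap f ε R0) {R1 : ℝ} (h1 : R0 ≤ R1) (h2 : R1 < 1) : GoodMap f ε R1 :=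
  ⟨G.diff, G.inj, G.hε0, G.hε, G.hR0.trans h1, h2, fun z hz hz1 => G.bound z (h1.trans hz) hz1⟩

lemma scale (G : GoodMap f ε R0) {R1 s : ℝ} (hs0 : 0 < s) (hs1 : s ≤ 1) (h1 : R0 ≤ s * R1)
    (h2 : R1 < 1) : GoodMap (fun z => f (s * z)) ε R1 := by
  have hR0 := G.hR0
  have hlt : ∀ z : ℂ, ‖z‖ < 1 → ‖(s:ℂ) * z‖ < 1 := fun z hz => by
    rw [norm_mul, Complex.norm_real, Real.norm_of_nonneg hs0.le]
    nlinarith [norm_nonneg z]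
  have hR1 : 1/2 ≤ R1 := by
    by_contra h
    push Not at h
    rcases le_or_gt R1 0 with h3 | h3
    · nlinarith
    · nlinarith
  have hsc : (s:ℂ) ≠ 0 := by exact_mod_cast hs0.ne'
  have hmul : ∀ z : ℂ, HasDerivAt (fun z : ℂ => (s:ℂ) * z) s z := fun z => by
    simpa using (hasDerivAt_id z).const_mul (s:ℂ)
  have d1 : ∀ z : ℂ, ‖z‖ < 1 → HasDerivAt (fun z => f (s * z)) (s * deriv f (s * z)) z := fun z hz => by
    have := (G.hd (hlt z hz)).comp z (hmul z)
    exact this.congr_deriv (by ring)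
  refine ⟨fun z hz => (d1 z (by simpa using hz)).differentiableAt.differentiableWithinAt, ?_,
    G.hε0, G.hε, hR1, h2, ?_⟩
  · intro z hz w hw h
    have := G.inj (by simpa using hlt z (by simpa using hz)) (by simpa using hlt w (by simpa using hw)) h
    exact mul_left_cancel₀ hsc this
  · intro z hz hz1
    have e1 : deriv (fun z => f (s * z)) =ᶠ[nhds z] fun z => s * deriv f (s * z) := by
      filter_upwards [isOpen_ball.mem_nhds (show z ∈ ball (0:ℂ) 1 by simpa using hz1)] with w hw
      exact (d1 w (by simpa using hw)).deriv
    have d2 : HasDerivAt (fun z => (s:ℂ) * deriv f (s * z)) (s * (deriv (deriv f) (s * z) * s)) z :=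
      ((G.hd2 (hlt z hz1)).comp z (hmul z)).const_mul (s:ℂ)
    rw [e1.deriv_eq, d2.deriv, (d1 z hz1).deriv]
    have hne := G.ne (hlt z hz1)
    rw [show (s:ℂ) * (deriv (deriv f) (s * z) * s) / (s * deriv f (s * z)) =
      s * (deriv (deriv f) (s * z) / deriv f (s * z)) by field_simp]
    have hn : ‖(s:ℂ) * z‖ = s * ‖z‖ := by
      rw [norm_mul, Complex.norm_real, Real.norm_of_nonneg hs0.le]
    have h3 := G.bound (s * z) (by rw [hn]; nlinarith) (hlt z hz1)
    rw [hn] at h3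
    rw [norm_mul, Complex.norm_real, Real.norm_of_nonneg hs0.le]
    refine le_trans ?_ h3
    rw [← mul_assoc]
    gcongr
    nlinarith

lemma deriv_growth (G : GoodMap f ε R0) : ∃ K, 0 < K ∧ ∀ e : ℂ, ‖e‖ = 1 → ∀ t : ℝ, R0 ≤ t → t < 1 →
    ‖deriv f (t * e)‖ ≤ K / √(1 - t) := by
  have hR1 := G.hR1
  have hR0 := G.hR0
  have hc : ContinuousOn (fun z => ‖deriv f z‖) (closedBall 0 R0) :=
    ((deriv_continuousOn_ball G.diff).mono (closedBall_subset_ball hR1)).norm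
  obtain ⟨K, hK⟩ := (isCompact_closedBall (0:ℂ) R0).bddAbove_image hc
  have hK' : ∀ z, ‖z‖ ≤ R0 → ‖deriv f z‖ ≤ K := fun z hz => hK ⟨z, by simpa using hz, rfl⟩
  have hK0 : 0 ≤ K := (norm_nonneg _).trans (hK' 0 (by simp; linarith))
  refine ⟨K + 1, by linarith, fun e he t ht ht1 => ?_⟩
  have h1 := (G.ray he le_rfl ht ht1).1
  set p := √((1 - t)/(1-R0)) with hp
  have hp0 : 0 < p := Real.sqrt_pos.2 (div_pos (by linarith) (by linarith))
  have hp1 : p ≤ 1 := by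
    refine Real.sqrt_le_one.2 ?_
    rw [div_le_one (by linarith)]; linarith
  have hpq : √(1 - t) ≤ p := by
    refine Real.sqrt_le_sqrt ?_
    rw [le_div_iff₀ (by linarith)]
    nlinarith
  have hq0 : 0 < √(1 - t) := Real.sqrt_pos.2 (by linarith)
  have hA : ‖deriv f (R0 * e)‖ ≤ K := hK' _ (by
    rw [norm_mul, he, mul_one, Complex.norm_real, Real.norm_of_nonneg (by linarith)])
  have h2 : ‖deriv f (t * e)‖ ≤ ‖deriv f (R0 * e)‖ + ‖deriv f (t * e) - deriv f (R0 * e)‖ := by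
    have := norm_add_le (deriv f (R0 * e)) (deriv f (t * e) - deriv f (R0 * e))
    simpa using this
  have h3 : 4 * ε * ‖deriv f (R0 * e)‖ * (1 / p - 1) ≤ ‖deriv f (R0 * e)‖ * (1 / p - 1) := by
    have h4 : 0 ≤ 1 / p - 1 := by
      rw [sub_nonneg, le_div_iff₀ hp0]; linarith
    have h5 := G.hε
    have h6 : 0 ≤ ‖deriv f (R0 * e)‖ * (1 / p - 1) := by positivity
    nlinarith
  have h4 : ‖deriv f (t * e)‖ ≤ ‖deriv f (R0 * e)‖ * (1 / p) := by nlinarith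
  refine h4.trans ?_
  rw [mul_one_div]
  gcongr
  linarith

lemma osc (G : GoodMap f ε R0) : ∃ K, 0 < K ∧ ∀ H : ℝ, 0 < H → R0 ≤ 1 - 3 * H → ∀ z w : ℂ,
    1 - H ≤ ‖z‖ → ‖z‖ < 1 → 1 - H ≤ ‖w‖ → ‖w‖ < 1 → ‖w - z‖ ≤ H → ‖f w - f z‖ ≤ K * √H := by
  obtain ⟨K, hK0, hK⟩ := G.deriv_growth
  refine ⟨2 * K, by linarith, fun H hH hHR z w hz hz1 hw hw1 hzw => ?_⟩
  have h1 := G.comb_in_in hH hHR hz hz1 hw hw1 hzw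
  have hR0 := G.hR0
  have hz0 : z ≠ 0 := by
    rintro rfl
    rw [norm_zero] at hz; linarith
  have h2 := hK _ (unit_dir hz0).1 (1 - H) (by linarith) (by linarith)
  rw [sub_sub_cancel] at h2
  set D := deriv f ((1 - H : ℝ) * (z / (‖z‖ : ℂ)))
  have h3 : ‖f w - f z‖ ≤ ‖f w - f z - D * (w - z)‖ + ‖D * (w - z)‖ := by
    have := norm_add_le (f w - f z - D * (w - z)) (D * (w - z))
    simpa using this
  rw [norm_mul] at h3
  have hε := G.hε
  have h4 : ‖D‖ * ‖w - z‖ ≤ ‖D‖ * H := by gcongr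
  have h5 : 130 * ε * H * ‖D‖ ≤ H * ‖D‖ := by
    have : 0 ≤ H * ‖D‖ := by positivity
    nlinarith
  have hs := Real.sqrt_pos.2 hH
  have h6 : ‖D‖ * H ≤ K * √H := by
    rw [le_div_iff₀ hs] at h2
    calc ‖D‖ * H = ‖D‖ * √H * √H := by rw [mul_assoc, Real.mul_self_sqrt hH.le]
      _ ≤ K * √H := by gcongr
  linarith

lemma exists_ext (G : GoodMap f ε R0) : ∃ F : ℂ → ℂ, ContinuousOn F (closedBall 0 1) ∧
    EqOn F f (ball 0 1) := by
  obtain ⟨K, hK0, hK⟩ := G.osc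
  have hR1 := G.hR1
  have hR0 := G.hR0
  refine ⟨extendFrom (ball 0 1) f, ?_, ?_⟩
  · refine continuousOn_extendFrom (by rw [closure_ball _ one_ne_zero]) ?_
    intro a ha
    have hne : (nhdsWithin a (ball (0:ℂ) 1)).NeBot := by
      rw [← mem_closure_iff_nhdsWithin_neBot, closure_ball _ one_ne_zero]; exact ha
    rcases lt_or_ge ‖a‖ 1 with h1 | h1
    · exact ⟨f a, ((G.diff.continuousOn a (by simpa using h1)))⟩
    · have ha1 : ‖a‖ = 1 := le_antisymm (by simpa using ha) h1
      suffices h : Cauchy (map f (nhdsWithin a (ball (0:ℂ) 1))) from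
        ⟨_, (CompleteSpace.complete h).choose_spec⟩
      rw [Metric.cauchy_iff]
      refine ⟨inferInstance, fun η hη => ?_⟩
      have ht : Tendsto (fun H : ℝ => K * √H) (nhdsWithin 0 (Ioi 0)) (nhds 0) := by
        have : Tendsto (fun H : ℝ => K * √H) (nhds 0) (nhds (K * √0)) :=
          (continuous_const.mul Real.continuous_sqrt).tendsto 0
        rw [Real.sqrt_zero, mul_zero] at this
        exact this.mono_left nhdsWithin_le_nhds
      have hsm : ∀ᶠ H : ℝ in nhdsWithin 0 (Ioi 0), H < (1 - R0)/3 :=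
        nhdsWithin_le_nhds (Iio_mem_nhds (by linarith))
      obtain ⟨H, hH1, hH2, hH3⟩ := ((ht.eventually (Iio_mem_nhds hη)).and
        (hsm.and self_mem_nhdsWithin)).exists
      have hH3 : 0 < H := hH3
      refine ⟨f '' (ball a (H/2) ∩ ball 0 1), image_mem_map ?_, ?_⟩
      · exact inter_mem (mem_nhdsWithin_of_mem_nhds (ball_mem_nhds _ (by linarith))) self_mem_nhdsWithin
      rintro _ ⟨x, ⟨hxa, hx1⟩, rfl⟩ _ ⟨y, ⟨hya, hy1⟩, rfl⟩
      rw [mem_ball, dist_eq_norm] at hxa hya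
      rw [mem_ball_zero_iff] at hx1 hy1
      have key : ∀ u : ℂ, ‖u - a‖ < H/2 → 1 - H ≤ ‖u‖ := fun u hu => by
        have := norm_sub_norm_le a u
        rw [norm_sub_rev] at this
        linarith
      rw [dist_eq_norm]
      refine lt_of_le_of_lt (hK H hH3 (by linarith) y x (key y hya) hy1 (key x hxa) hx1 ?_) hH1
      have := norm_sub_le (x - a) (y - a)
      rw [sub_sub_sub_cancel_right] at this
      linarith
  · exact extendFrom_extends G.diff.continuousOn

/-- lower bound at small scale for interior points -/
lemma low_in (G : GoodMap f ε R0) {F : ℂ → ℂ} (hF : ContinuousOn F (closedBall 0 1))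
    (hFf : EqOn F f (ball 0 1)) {a b : ℂ} (ha : ‖a‖ = 1) (hb : ‖b‖ = 1) (hab : a ≠ b)
    (hs : R0 ≤ 1 - 3 * ‖b - a‖) : F a ≠ F b := by
  have hH : 0 < ‖b - a‖ := by rw [norm_pos_iff, sub_ne_zero]; exact hab.symm
  set H := ‖b - a‖ with hHd
  set D := deriv f ((1 - H : ℝ) * a) with hD
  have hR0 := G.hR0
  have hD0 : 0 < ‖D‖ := G.pos (by
    rw [norm_mul, ha, mul_one, Complex.norm_real, Real.norm_of_nonneg (by linarith)]; linarith)
  have key : ∀ t : ℝ, 1 - H ≤ t → t < 1 →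
      ‖F (t * b) - F (t * a) - D * (t * b - t * a)‖ ≤ 130 * ε * H * ‖D‖ := by
    intro t ht ht1
    have hn : ∀ u : ℂ, ‖u‖ = 1 → ‖(t:ℂ) * u‖ = t := fun u hu => by
      rw [norm_mul, hu, mul_one, Complex.norm_real, Real.norm_of_nonneg (by linarith)]
    have h := G.comb_in_in (z := t * a) (w := t * b) hH hs (by rw [hn a ha]; exact ht)
      (by rw [hn a ha]; exact ht1) (by rw [hn b hb]; exact ht) (by rw [hn b hb]; exact ht1)
      (by rw [← mul_sub, norm_mul, Complex.norm_real, Real.norm_of_nonneg (by linarith)]; nlinarith)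
    rw [hFf (by rw [mem_ball_zero_iff, hn b hb]; exact ht1),
      hFf (by rw [mem_ball_zero_iff, hn a ha]; exact ht1)]
    have he : (t:ℂ) * a / (‖(t:ℂ) * a‖ : ℂ) = a := by
      rw [hn a ha]
      have : (t:ℂ) ≠ 0 := by
        have : t ≠ 0 := by intro h0; linarith
        exact_mod_cast this
      field_simp
    rw [he] at h
    exact h
  have hlim : ∀ u : ℂ, ‖u‖ = 1 → Tendsto (fun t : ℝ => F (t * u)) (nhdsWithin 1 (Iio 1)) (nhds (F u)) := by
    intro u hu
    have h1 : Tendsto F (nhdsWithin u (closedBall 0 1)) (nhds (F u)) := hF u (by simp [hu])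
    refine h1.comp (tendsto_nhdsWithin_iff.2 ⟨?_, ?_⟩)
    · have : Tendsto (fun t : ℝ => (t:ℂ) * u) (nhds 1) (nhds (((1:ℝ):ℂ) * u)) :=
        (Complex.continuous_ofReal.mul continuous_const).tendsto 1
      rw [Complex.ofReal_one, one_mul] at this
      exact this.mono_left nhdsWithin_le_nhds
    · have hpos : ∀ᶠ t : ℝ in nhdsWithin 1 (Iio 1), 0 < t :=
        nhdsWithin_le_nhds (Ioi_mem_nhds one_pos)
      filter_upwards [hpos, self_mem_nhdsWithin] with t h0 h1
      rw [mem_closedBall_zero_iff, norm_mul, hu, mul_one, Complex.norm_real, Real.norm_of_nonneg h0.le]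
      exact (mem_Iio.1 h1).le
  have hlim2 : Tendsto (fun t : ℝ => ‖F (t * b) - F (t * a) - D * (t * b - t * a)‖)
      (nhdsWithin 1 (Iio 1)) (nhds ‖F b - F a - D * (b - a)‖) := by
    refine ((((hlim b hb).sub (hlim a ha))).sub ?_).norm
    have : Tendsto (fun t : ℝ => D * ((t:ℂ) * b - t * a)) (nhds 1) (nhds (D * (((1:ℝ):ℂ) * b - ((1:ℝ):ℂ) * a))) := by
      refine Continuous.tendsto ?_ 1
      fun_prop
    rw [Complex.ofReal_one, one_mul, one_mul] at this
    exact this.mono_left nhdsWithin_le_nhds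
  have hfin : ‖F b - F a - D * (b - a)‖ ≤ 130 * ε * H * ‖D‖ := by
    refine le_of_tendsto hlim2 ?_
    have hpos : ∀ᶠ t : ℝ in nhdsWithin 1 (Iio 1), 1 - H < t :=
        nhdsWithin_le_nhds (Ioi_mem_nhds (by linarith))
    filter_upwards [hpos, self_mem_nhdsWithin] with t h0 h1
    exact key t h0.le h1
  intro h
  rw [h, sub_self, zero_sub, norm_neg, norm_mul, ← hHd] at hfin
  have := G.hε
  have : 0 < ‖D‖ * H := by positivity
  nlinarith

end GoodMap

lemma exists_log_lift {X : Type*} [TopologicalSpace X] [SimplyConnectedSpace X]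
    [LocallyPathConnectedSpace X] {g : X → ℂ} (hg : Continuous g) (h0 : ∀ x, g x ≠ 0) :
    ∃ L : X → ℂ, Continuous L ∧ ∀ x, exp (L x) = g x := by
  obtain ⟨F, hF, -⟩ := Complex.isCoveringMapOn_exp.existsUnique_continuousMap_lifts
    (⟨g, hg⟩ : C(X, ℂ)) (a₀ := Classical.arbitrary X) (e₀ := Complex.log (g (Classical.arbitrary X)))
    (Complex.exp_log (h0 _)) (fun a => h0 a)
  exact ⟨F, F.continuous, fun x => congrFun hF.2 x⟩

lemma const_of_exp_const {D : ℝ → ℂ} (hD : Continuous D) {c : ℂ} (h : ∀ t, exp (D t) = c) (s t : ℝ) :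
    D s = D t := by
  have key : ∀ x ∈ (univ : Set ℝ), ∀ᶠ y in nhdsWithin x univ, D x = D y := by
    intro x _
    rw [nhdsWithin_univ]
    have h1 : ∀ᶠ y in nhds x, dist (D y) (D x) < 1 := (hD.tendsto x).eventually (ball_mem_nhds _ one_pos)
    filter_upwards [h1] with y hy
    obtain ⟨n, hn⟩ := Complex.exp_eq_exp_iff_exists_int.1 ((h y).trans (h x).symm)
    rw [hn, dist_eq_norm, add_sub_cancel_left, norm_mul] at hy
    have h2 : ‖(2 * (Real.pi:ℂ) * I)‖ = 2 * Real.pi := by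
      simp [abs_of_pos Real.pi_pos]
    rw [h2, Complex.norm_intCast] at hy
    have h3 : n = 0 := by
      by_contra h0
      have : (1:ℝ) ≤ |(n:ℝ)| := by exact_mod_cast Int.one_le_abs h0
      nlinarith [Real.pi_gt_three]
    rw [hn, h3]; simp
  exact isPreconnected_univ.induction₂ (fun x y => D x = D y) key
    (fun x y z _ _ _ h1 h2 => h1.trans h2) (fun x y _ _ h => h.symm) (mem_univ _) (mem_univ _)

lemma log_jump {θ : ℝ} (h0 : 0 < θ) (h1 : θ < 2 * Real.pi) :
    Complex.log (1 - exp (θ * I)) - Complex.log (1 - exp (-(θ * I))) = (θ - Real.pi) * I := by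
  have hs : 0 < 2 * Real.sin (θ/2) := by
    have := Real.sin_pos_of_pos_of_lt_pi (x := θ/2) (by linarith) (by linarith)
    linarith
  have hsin : (2 * Real.sin (θ/2) : ℝ) = (exp (-(θ/2 * I)) - exp (θ/2 * I)) * I := by
    push_cast
    rw [Complex.sin]
    ring_nf
  have hI : exp (Real.pi / 2 * I) = I := Complex.exp_pi_div_two_mul_I
  have e1 : 1 - exp (θ * I) = ((2 * Real.sin (θ/2) : ℝ) : ℂ) * exp (((θ - Real.pi)/2 : ℝ) * I) := by
    have : exp ((((θ - Real.pi)/2 : ℝ):ℂ) * I) = exp (θ/2 * I) * (-I) := by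
      have h3 : exp (-(Real.pi / 2 * I)) = -I := by rw [Complex.exp_neg, hI, Complex.inv_I]
      rw [← h3, ← Complex.exp_add]
      congr 1; push_cast; ring
    rw [this, hsin]
    have e2 : exp (θ * I) = exp (θ/2 * I) * exp (θ/2*I) := by rw [← Complex.exp_add]; congr 1; ring
    have e3 : exp (-(θ/2 * I)) * exp (θ/2*I) = 1 := by rw [← Complex.exp_add]; simp
    rw [e2]
    linear_combination (-1) * e3 + (exp (-(θ/2 * I)) - exp (θ/2*I)) * exp (θ/2*I) * I_sq
  have e4 : 1 - exp (-(θ * I)) = ((2 * Real.sin (θ/2) : ℝ) : ℂ) * exp ((-((θ - Real.pi)/2) : ℝ) * I) := by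
    have h5 := congrArg (starRingEnd ℂ) e1
    rw [map_sub, map_one, map_mul, Complex.conj_ofReal, ← Complex.exp_conj, ← Complex.exp_conj, map_mul,
      map_mul, Complex.conj_I, Complex.conj_ofReal, Complex.conj_ofReal] at h5
    rw [show -((θ:ℂ) * I) = θ * -I by ring, h5]
    congr 2
    push_cast; ring
  have hlog : ∀ x : ℝ, -Real.pi < x → x < Real.pi →
      Complex.log (((2 * Real.sin (θ/2) : ℝ) : ℂ) * exp ((x : ℂ) * I)) =
        Real.log (2 * Real.sin (θ/2)) + x * I := by
    intro x hx1 hx2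
    rw [Complex.log_ofReal_mul hs (Complex.exp_ne_zero _), Complex.log_exp]
    · simpa using hx1
    · simpa using hx2.le
  rw [e1, e4, hlog _ (by linarith [Real.pi_pos]) (by linarith), hlog _ (by linarith) (by linarith [Real.pi_pos])]
  push_cast; ring

noncomputable def Psi (f F : ℂ → ℂ) (z c : ℂ) : ℂ :=
  if z = c then deriv f z else (F z - F c) / (z - c)

lemma Psi_cont {f F : ℂ → ℂ} (hf : DifferentiableOn ℂ f (ball 0 1)) (hF : ContinuousOn F (closedBall 0 1))
    (hFf : EqOn F f (ball 0 1)) {X : Type*} [TopologicalSpace X] {z c : X → ℂ} (hz : Continuous z)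
    (hc : Continuous c) (hz1 : ∀ x, ‖z x‖ ≤ 1) (hc1 : ∀ x, ‖c x‖ ≤ 1)
    (hzc : ∀ x, z x = c x → ‖z x‖ < 1) : Continuous fun x => Psi f F (z x) (c x) := by
  rw [continuous_iff_continuousAt]
  intro x
  by_cases h : z x = c x
  · have hx := hzc x h
    have hxb : z x ∈ ball (0:ℂ) 1 := by simpa using hx
    have hxc : c x ∈ ball (0:ℂ) 1 := by rw [← h]; exact hxb
    have han : AnalyticAt ℂ f (z x) := hf.analyticAt (isOpen_ball.mem_nhds hxb)
    have hst : HasStrictDerivAt f (deriv f (z x)) (z x) := han.hasStrictDerivAt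
    rw [hasStrictDerivAt_iff_hasStrictFDerivAt, hasStrictFDerivAt_iff_isLittleO] at hst
    rw [ContinuousAt, Metric.tendsto_nhds]
    intro η hη
    have h1 : Tendsto (fun y => (z y, c y)) (nhds x) (nhds (z x, z x)) := by
      have := (hz.prodMk hc).tendsto x
      rwa [← h] at this
    have h2 := h1.eventually (hst.def (half_pos hη))
    have h3 : ∀ᶠ y in nhds x, dist (deriv f (z y)) (deriv f (z x)) < η :=
      ((han.deriv.continuousAt.tendsto.comp (hz.tendsto x))).eventually (ball_mem_nhds _ hη)
    have h4 : ∀ᶠ y in nhds x, z y ∈ ball (0:ℂ) 1 := (hz.tendsto x).eventually (isOpen_ball.mem_nhds hxb)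
    have h5 : ∀ᶠ y in nhds x, c y ∈ ball (0:ℂ) 1 := (hc.tendsto x).eventually (isOpen_ball.mem_nhds hxc)
    filter_upwards [h2, h3, h4, h5] with y g2 g3 g4 g5
    rw [Psi, Psi, if_pos h]
    by_cases hy : z y = c y
    · rwa [if_pos hy]
    · rw [if_neg hy, dist_eq_norm, hFf g4, hFf g5]
      have hne : z y - c y ≠ 0 := sub_ne_zero.2 hy
      have e : (f (z y) - f (c y)) / (z y - c y) - deriv f (z x) =
        (f (z y) - f (c y) - (z y - c y) * deriv f (z x)) / (z y - c y) := by
        field_simp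
      rw [e, norm_div, div_lt_iff₀ (norm_pos_iff.2 hne)]
      simp at g2
      have := norm_pos_iff.2 hne
      nlinarith
  · have hev : ∀ᶠ y in nhds x, z y ≠ c y := (isClosed_eq hz hc).isOpen_compl.mem_nhds h
    have hcF : ∀ {u : X → ℂ}, Continuous u → (∀ x, ‖u x‖ ≤ 1) → Continuous fun x => F (u x) := fun hu hu1 =>
      hF.comp_continuous hu (fun x => by simpa using hu1 x)
    have : ContinuousAt (fun x => (F (z x) - F (c x)) / (z x - c x)) x :=
      ((hcF hz hz1).continuousAt.sub (hcF hc hc1).continuousAt).div (hz.sub hc).continuousAt (sub_ne_zero.2 h)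
    refine this.congr ?_
    filter_upwards [hev] with y hy
    rw [Psi, if_neg hy]

/-- broken path from b through 0 to a -/
noncomputable def vpath (a b : ℂ) (t : ℝ) : ℂ :=
  ((max 0 (min t 1) : ℝ) : ℂ) * a + ((max 0 (min (-t) 1) : ℝ) : ℂ) * b

lemma vpath_cont (a b : ℂ) : Continuous (vpath a b) := by unfold vpath; fun_prop

lemma vpath_one (a b : ℂ) : vpath a b 1 = a := by
  unfold vpath; norm_num

lemma vpath_neg_one (a b : ℂ) : vpath a b (-1) = b := by
  unfold vpath; norm_num

lemma vpath_cases (a b : ℂ) (ha : ‖a‖ = 1) (hb : ‖b‖ = 1) (t : ℝ) :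
    vpath a b t = a ∨ vpath a b t = b ∨ ‖vpath a b t‖ < 1 := by
  rcases le_or_gt 0 t with h | h
  · have e : vpath a b t = ((min t 1 : ℝ):ℂ) * a := by
      unfold vpath
      rw [max_eq_right (le_min h zero_le_one), max_eq_left ((min_le_left _ _).trans (by linarith))]
      simp
    rcases le_or_gt 1 t with h1 | h1
    · left; rw [e, min_eq_right h1]; simp
    · right; right; rw [e, norm_mul, ha, min_eq_left h1.le, Complex.norm_real, Real.norm_of_nonneg h, mul_one]
      exact h1
  · have e : vpath a b t = ((min (-t) 1 : ℝ):ℂ) * b := by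
      unfold vpath
      rw [max_eq_right (le_min (by linarith : 0 ≤ -t) zero_le_one), max_eq_left ((min_le_left _ _).trans (by linarith))]
      simp
    rcases le_or_gt 1 (-t) with h1 | h1
    · right; left; rw [e, min_eq_right h1]; simp
    · right; right; rw [e, norm_mul, hb, min_eq_left h1.le, Complex.norm_real, Real.norm_of_nonneg (by linarith), mul_one]
      exact h1

lemma vpath_norm (a b : ℂ) (ha : ‖a‖ = 1) (hb : ‖b‖ = 1) (t : ℝ) : ‖vpath a b t‖ ≤ 1 := by
  rcases vpath_cases a b ha hb t with h | h | h
  · rw [h, ha]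
  · rw [h, hb]
  · exact h.le

lemma slit_of {z c : ℂ} (hz : ‖z‖ ≤ 1) (hc : ‖c‖ = 1) (h : z ≠ c) : 1 - z / c ∈ slitPlane := by
  have hc0 : c ≠ 0 := by rintro rfl; simp at hc
  have hn : ‖z / c‖ ≤ 1 := by rw [norm_div, hc, div_one]; exact hz
  have hne : z / c ≠ 1 := by rwa [Ne, div_eq_one_iff_eq hc0]
  left
  rw [sub_re, one_re, sub_pos]
  by_contra h1
  push Not at h1
  apply hne
  have h2 : ‖z/c‖^2 = (z/c).re^2 + (z/c).im^2 := by rw [Complex.sq_norm, normSq_apply]; ring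
  have h3 : ‖z/c‖^2 ≤ 1 := by nlinarith [norm_nonneg (z/c)]
  have h4 : (z/c).re ≤ 1 := (Complex.re_le_norm _).trans hn
  have h5 : (z/c).im = 0 := by nlinarith
  apply Complex.ext
  · simp; linarith
  · simpa using h5

section bdry

lemma radial_tendsto {F : ℂ → ℂ} (hF : ContinuousOn F (closedBall 0 1)) {u : ℂ} (hu : ‖u‖ = 1) :
    Tendsto (fun t : ℝ => F (t * u)) (nhdsWithin 1 (Iio 1)) (nhds (F u)) := by
  have h1 : Tendsto F (nhdsWithin u (closedBall 0 1)) (nhds (F u)) := hF u (by simp [hu])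
  refine h1.comp (tendsto_nhdsWithin_iff.2 ⟨?_, ?_⟩)
  · have : Tendsto (fun t : ℝ => (t:ℂ) * u) (nhds 1) (nhds (((1:ℝ):ℂ) * u)) :=
      (Complex.continuous_ofReal.mul continuous_const).tendsto 1
    rw [Complex.ofReal_one, one_mul] at this
    exact this.mono_left nhdsWithin_le_nhds
  · have hpos : ∀ᶠ t : ℝ in nhdsWithin 1 (Iio 1), 0 < t :=
      nhdsWithin_le_nhds (Ioi_mem_nhds one_pos)
    filter_upwards [hpos, self_mem_nhdsWithin] with t h0 h1
    rw [mem_closedBall_zero_iff, norm_mul, hu, mul_one, Complex.norm_real, Real.norm_of_nonneg h0.le]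
    exact (mem_Iio.1 h1).le


lemma bdry_notin {f F : ℂ → ℂ} (hf : DifferentiableOn ℂ f (ball 0 1)) (hi : InjOn f (ball 0 1))
    (hF : ContinuousOn F (closedBall 0 1)) (hFf : EqOn F f (ball 0 1))
    {a : ℂ} (ha : ‖a‖ = 1) : F a ∉ f '' ball 0 1 := by
  rintro ⟨z, hz, hza⟩
  have hz1 : ‖z‖ < 1 := by simpa using hz
  set ρ := (1 - ‖z‖)/2 with hρ
  have hρ0 : 0 < ρ := by rw [hρ]; linarith
  have hsub : ball z ρ ⊆ ball 0 1 := by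
    intro w hw
    rw [mem_ball, dist_eq_norm] at hw
    rw [mem_ball_zero_iff]
    have := norm_le_norm_add_norm_sub' w z
    linarith
  have ho := univ_image_open isOpen_ball hf hi isOpen_ball hsub
  have hm : f '' ball z ρ ∈ nhds (F a) := by
    rw [← hza]
    exact ho.mem_nhds ⟨z, mem_ball_self hρ0, rfl⟩
  have h1 := (radial_tendsto hF ha).eventually hm
  have h2 : ∀ᶠ t : ℝ in nhdsWithin 1 (Iio 1), 1 - ρ < t :=
    nhdsWithin_le_nhds (Ioi_mem_nhds (by linarith))
  obtain ⟨t, ht1, ht2, ht3⟩ := (h1.and (h2.and self_mem_nhdsWithin)).exists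
  have ht3 : t < 1 := ht3
  have hn : ‖(t:ℂ) * a‖ = t := by
    rw [norm_mul, ha, mul_one, Complex.norm_real, Real.norm_of_nonneg (by linarith [norm_nonneg z])]
  have htb : (t:ℂ) * a ∈ ball (0:ℂ) 1 := by rw [mem_ball_zero_iff, hn]; exact ht3
  rw [hFf htb] at ht1
  obtain ⟨w, hw, hw2⟩ := ht1
  have := hi (hsub hw) htb hw2
  rw [this, mem_ball, dist_eq_norm] at hw
  have h5 := norm_sub_norm_le ((t:ℂ) * a) z
  rw [hn] at h5
  linarith

lemma bdry_frontier {f F : ℂ → ℂ} (hf : DifferentiableOn ℂ f (ball 0 1)) (hi : InjOn f (ball 0 1))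
    (hF : ContinuousOn F (closedBall 0 1)) (hFf : EqOn F f (ball 0 1))
    {a : ℂ} (ha : ‖a‖ = 1) : F a ∈ frontier (f '' ball 0 1) := by
  refine ⟨?_, ?_⟩
  · refine mem_closure_of_tendsto (radial_tendsto hF ha) ?_
    have h2 : ∀ᶠ t : ℝ in nhdsWithin 1 (Iio 1), 0 < t :=
      nhdsWithin_le_nhds (Ioi_mem_nhds (by linarith))
    filter_upwards [h2, self_mem_nhdsWithin] with t ht ht1
    have htb : (t:ℂ) * a ∈ ball (0:ℂ) 1 := by
      rw [mem_ball_zero_iff, norm_mul, ha, mul_one, Complex.norm_real, Real.norm_of_nonneg ht.le]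
      exact ht1
    exact ⟨_, htb, (hFf htb).symm⟩
  · intro h
    exact bdry_notin hf hi hF hFf ha (interior_subset h)

lemma F_ne {f F : ℂ → ℂ} (hf : DifferentiableOn ℂ f (ball 0 1)) (hi : InjOn f (ball 0 1))
    (hF : ContinuousOn F (closedBall 0 1)) (hFf : EqOn F f (ball 0 1))
    {z w : ℂ} (hz : ‖z‖ ≤ 1) (hw : ‖w‖ ≤ 1) (hzw : z ≠ w)
    (h : ‖z‖ = 1 → ‖w‖ = 1 → F z ≠ F w) : F z ≠ F w := by
  rcases hz.lt_or_eq with h1 | h1 <;> rcases hw.lt_or_eq with h2 | h2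
  · have h1 : z ∈ ball (0:ℂ) 1 := by simpa using h1
    have h2 : w ∈ ball (0:ℂ) 1 := by simpa using h2
    rw [hFf h1, hFf h2]
    exact fun h => hzw (hi h1 h2 h)
  · have h1 : z ∈ ball (0:ℂ) 1 := by simpa using h1
    intro h
    exact bdry_notin hf hi hF hFf h2 ⟨z, h1, by rw [← hFf h1, h]⟩
  · have h2 : w ∈ ball (0:ℂ) 1 := by simpa using h2
    intro h
    exact bdry_notin hf hi hF hFf h1 ⟨w, h2, by rw [← hFf h2, h]⟩
  · exact h h1 h2

end bdry

/-- total log change of t ↦ c t - q -/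
def Wind (c : ℝ → ℂ) (q v : ℂ) : Prop :=
  ∃ L : ℝ → ℂ, Continuous L ∧ (∀ t, exp (L t) = c t - q) ∧ L 1 - L (-1) = v

lemma Wind.unique {c : ℝ → ℂ} {q v v' : ℂ} (h : Wind c q v) (h' : Wind c q v') : v = v' := by
  obtain ⟨L, hL, hLe, rfl⟩ := h
  obtain ⟨L', hL', hLe', rfl⟩ := h'
  have := const_of_exp_const (hL.sub hL') (c := 1) (fun t => by
    have h0 : c t - q ≠ 0 := by rw [← hLe]; exact exp_ne_zero _
    simp only [Pi.sub_apply]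
    rw [Complex.exp_sub, hLe, hLe', div_self h0]) 1 (-1)
  simp only [Pi.sub_apply] at this
  linear_combination this

lemma Wind.exists {c : ℝ → ℂ} (hc : Continuous c) {q : ℂ} (h : ∀ t, c t ≠ q) : ∃ v, Wind c q v := by
  obtain ⟨L, hL, hLe⟩ := exists_log_lift (hc.sub continuous_const) (fun t => sub_ne_zero.2 (h t))
  exact ⟨_, L, hL, hLe, rfl⟩

lemma Wind.near {c : ℝ → ℂ} (hc : Continuous c) {q q' v : ℂ} (h : Wind c q v)
    (hcl : c 1 = c (-1)) (hq : ∀ t, ‖q' - q‖ < ‖c t - q‖) : Wind c q' v := by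
  obtain ⟨L, hL, hLe, rfl⟩ := h
  have h0 : ∀ t, c t - q ≠ 0 := fun t => by rw [← hLe]; exact exp_ne_zero _
  have hs : ∀ t, (c t - q') / (c t - q) ∈ slitPlane := fun t => by
    have : (c t - q') / (c t - q) = 1 + -((q' - q)/(c t - q)) := by
      have := h0 t
      field_simp; ring
    rw [this]
    refine Complex.mem_slitPlane_of_norm_lt_one ?_
    rw [norm_neg, norm_div, div_lt_one (norm_pos_iff.2 (h0 t))]
    exact hq t
  refine ⟨fun t => L t + Complex.log ((c t - q') / (c t - q)), ?_, fun t => ?_, ?_⟩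
  · refine hL.add (Continuous.clog ?_ hs)
    exact (hc.sub continuous_const).div (hc.sub continuous_const) h0
  · rw [Complex.exp_add, hLe, Complex.exp_log (slitPlane_ne_zero (hs t))]
    have := h0 t
    field_simp
  · simp only [hcl]; ring

lemma AddCircle_compl_image (φ : AddCircle (1:ℝ) → ℂ) (hφ : Continuous φ) (hinj : Function.Injective φ)
    {p : ℂ} (hp : p ∈ Set.range φ) : IsPreconnected (Set.range φ \ {p}) := by
  obtain ⟨x, rfl⟩ := hp
  obtain ⟨x0, rfl⟩ := QuotientAddGroup.mk_surjective x
  have : Set.range φ \ {φ (x0 : AddCircle (1:ℝ))} = (fun t : ℝ => φ (t : AddCircle (1:ℝ))) '' Ioo x0 (x0+1) := by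
    ext y
    constructor
    · rintro ⟨⟨u, rfl⟩, hu⟩
      obtain ⟨t, ht, rfl⟩ : ∃ t ∈ Ico x0 (x0+1), (t : AddCircle (1:ℝ)) = u := by
        have := AddCircle.coe_image_Ico_eq (1:ℝ) x0
        have h2 : u ∈ ((↑) : ℝ → AddCircle (1:ℝ)) '' Ico x0 (x0+1) := by rw [this]; trivial
        exact h2
      refine ⟨t, ⟨lt_of_le_of_ne ht.1 ?_, ht.2⟩, rfl⟩
      rintro rfl
      exact hu rfl
    · rintro ⟨t, ht, rfl⟩
      refine ⟨⟨_, rfl⟩, fun h => ?_⟩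
      have h2 := hinj h
      have h3 : t = x0 := (AddCircle.coe_eq_coe_iff_of_mem_Ico (a := x0) ⟨ht.1.le, ht.2⟩ ⟨le_rfl, by linarith⟩).1 h2
      exact ht.1.ne' h3
  rw [this]
  exact isPreconnected_Ioo.image _ (hφ.comp (AddCircle.continuous_mk' 1)).continuousOn

section jordan

lemma wind_const {f F : ℂ → ℂ} (hf : DifferentiableOn ℂ f (ball 0 1)) (hi : InjOn f (ball 0 1))
    (hF : ContinuousOn F (closedBall 0 1)) (hFf : EqOn F f (ball 0 1))
    (hJ : IsJordanCurve (frontier (f '' ball (0:ℂ) 1)))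
    {a b q q' : ℂ} (ha : ‖a‖ = 1) (hb : ‖b‖ = 1) (hab : F a = F b)
    (hq : q ∈ frontier (f '' ball (0:ℂ) 1)) (hq' : q' ∈ frontier (f '' ball (0:ℂ) 1))
    (hqa : q ≠ F a) (hqa' : q' ≠ F a) {v v' : ℂ} (hv : Wind (fun t => F (vpath a b t)) q v)
    (hv' : Wind (fun t => F (vpath a b t)) q' v') : v = v' := by
  set c : ℝ → ℂ := fun t => F (vpath a b t) with hcd
  have hc : Continuous c := hF.comp_continuous (vpath_cont a b) (fun t => by
    simpa using vpath_norm a b ha hb t)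
  have hfo : IsOpen (f '' ball 0 1) := univ_image_open isOpen_ball hf hi isOpen_ball subset_rfl
  have hcl : c 1 = c (-1) := by rw [hcd]; simp only [vpath_one, vpath_neg_one, hab]
  have hne : ∀ q ∈ frontier (f '' ball (0:ℂ) 1) \ {F a}, ∀ t, c t ≠ q := by
    rintro q ⟨hq1, hq2⟩ t rfl
    rcases vpath_cases a b ha hb t with h | h | h
    · apply hq2; rw [hcd]; simp [h]
    · apply hq2; rw [hcd]; simp [h, hab]
    · have hm : vpath a b t ∈ ball (0:ℂ) 1 := by simpa using h
      apply hq1.2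
      rw [hfo.interior_eq, hcd]
      exact ⟨_, hm, (hFf hm).symm⟩
  obtain ⟨φ, hφ, hφi, hφr⟩ := hJ
  have hpc := AddCircle_compl_image φ hφ hφi (p := F a) (by rw [hφr]; exact bdry_frontier hf hi hF hFf ha)
  rw [hφr] at hpc
  have key := hpc.induction₂ (fun q q' => ∀ v, Wind c q v ↔ Wind c q' v) ?_
    (fun x y z _ _ _ h1 h2 v => (h1 v).trans (h2 v)) (fun x y _ _ h v => (h v).symm)
    ⟨hq, hqa⟩ ⟨hq', hqa'⟩
  · exact ((key v).1 hv).unique hv'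
  · intro q hq
    have hd : ∃ δ > 0, ∀ t, δ ≤ ‖c t - q‖ := by
      have hcl : IsCompact (F '' (vpath a b '' Icc (-1) 1)) := by
        refine (isCompact_Icc.image (vpath_cont a b)).image_of_continuousOn (hF.mono ?_)
        rintro _ ⟨t, -, rfl⟩
        simpa using vpath_norm a b ha hb t
      have hmem : ∀ t, c t ∈ F '' (vpath a b '' Icc (-1) 1) := by
        intro t
        refine ⟨_, ⟨max (-1) (min t 1), ⟨le_max_left _ _, max_le (by norm_num) (min_le_right _ _)⟩, rfl⟩, ?_⟩
        rw [hcd]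
        simp only
        congr 1
        unfold vpath
        rcases le_or_gt t (-1) with h | h
        · rw [min_eq_left (by linarith : t ≤ 1), max_eq_left h, min_eq_right (by linarith : 1 ≤ -t)]
          rw [max_eq_left (by linarith : t ≤ 0)]
          norm_num
        · rcases le_or_gt t 1 with h1 | h1
          · rw [min_eq_left h1, max_eq_right h.le, min_eq_left h1]
          · rw [min_eq_right h1.le]
            rw [max_eq_left ((min_le_left (-t) 1).trans (by linarith : -t ≤ 0))]
            norm_num
      have hqn : q ∉ F '' (vpath a b '' Icc (-1) 1) := by
        rintro ⟨_, ⟨t, -, rfl⟩, h⟩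
        exact hne q hq t h
      have hnh := hcl.isClosed.isOpen_compl.mem_nhds hqn
      obtain ⟨δ, hδ, hδ2⟩ := Metric.mem_nhds_iff.1 hnh
      refine ⟨δ, hδ, fun t => ?_⟩
      by_contra h
      push Not at h
      exact hδ2 (by rw [mem_ball, dist_eq_norm]; exact h : c t ∈ ball q δ) (hmem t)
    obtain ⟨δ, hδ, hδ2⟩ := hd
    obtain ⟨v0, hv0⟩ := Wind.exists hc (hne q hq)
    filter_upwards [mem_nhdsWithin_of_mem_nhds (ball_mem_nhds q hδ), self_mem_nhdsWithin] with y hy hys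
    have hy0 : Wind c y v0 := hv0.near hc hcl (fun t => by
      rw [mem_ball, dist_eq_norm] at hy
      exact hy.trans_le (hδ2 t))
    intro v
    exact ⟨fun h => by rw [h.unique hv0]; exact hy0, fun h => by rw [h.unique hy0]; exact hv0⟩

lemma jump_eq {f F : ℂ → ℂ} (hf : DifferentiableOn ℂ f (ball 0 1)) (hi : InjOn f (ball 0 1))
    (hF : ContinuousOn F (closedBall 0 1)) (hFf : EqOn F f (ball 0 1))
    (hJ : IsJordanCurve (frontier (f '' ball (0:ℂ) 1)))
    {a b c1 c2 : ℂ} (ha : ‖a‖ = 1) (hb : ‖b‖ = 1) (hab : F a = F b) (h1 : ‖c1‖ = 1)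
    (h2 : ‖c2‖ = 1) (hc1 : F c1 ≠ F a) (hc2 : F c2 ≠ F a) :
    Complex.log (1 - c1 / b) - Complex.log (1 - c1 / a) + Complex.log (1 - a / c1) - Complex.log (1 - b / c1) =
    Complex.log (1 - c2 / b) - Complex.log (1 - c2 / a) + Complex.log (1 - a / c2) - Complex.log (1 - b / c2) := by
  have hbd : ∀ c, c = c1 ∨ c = c2 → ‖c‖ = 1 ∧ F c ≠ F a ∧ c ≠ a ∧ c ≠ b := by
    rintro c (rfl | rfl)
    · exact ⟨h1, hc1, fun h => hc1 (by rw [h]), fun h => hc1 (by rw [h, hab])⟩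
    · exact ⟨h2, hc2, fun h => hc2 (by rw [h]), fun h => hc2 (by rw [h, hab])⟩
  have hn0 : ∀ {u : ℂ}, ‖u‖ = 1 → u ≠ 0 := fun h h0 => by rw [h0] at h; simp at h
  have hva : ∀ t, ‖vpath a b t‖ = 1 → vpath a b t = a ∨ vpath a b t = b := fun t h => by
    rcases vpath_cases a b ha hb t with g | g | g
    · exact Or.inl g
    · exact Or.inr g
    · linarith
  have hvc : ∀ t, ‖vpath c1 c2 t‖ = 1 → vpath c1 c2 t = c1 ∨ vpath c1 c2 t = c2 := fun t h => by
    rcases vpath_cases c1 c2 h1 h2 t with g | g | g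
    · exact Or.inl g
    · exact Or.inr g
    · linarith
  have hza := vpath_norm a b ha hb
  have hcc := vpath_norm c1 c2 h1 h2
  have hFne : ∀ t s, ‖vpath a b t‖ = 1 → ‖vpath c1 c2 s‖ = 1 → F (vpath a b t) ≠ F (vpath c1 c2 s) := by
    intro t s ht hs
    have e1 : F (vpath a b t) = F a := by
      rcases hva t ht with g | g
      · rw [g]
      · rw [g, hab]
    rw [e1]
    exact (hbd _ (hvc s hs)).2.1.symm
  have hPc : Continuous fun x : ℝ × ℝ => Psi f F (vpath a b x.1) (vpath c1 c2 x.2) := by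
    refine Psi_cont hf hF hFf ((vpath_cont a b).comp continuous_fst) ((vpath_cont c1 c2).comp continuous_snd)
      (fun x => hza x.1) (fun x => hcc x.2) ?_
    intro x hx
    rcases (hza x.1).lt_or_eq with h | h
    · exact h
    · exfalso
      exact hFne x.1 x.2 h (by rw [← hx]; exact h) (by rw [← hx])
  have hP0 : ∀ x : ℝ × ℝ, Psi f F (vpath a b x.1) (vpath c1 c2 x.2) ≠ 0 := by
    intro x
    rw [Psi]
    split_ifs with h
    · have : ‖vpath a b x.1‖ < 1 := by
        rcases (hza x.1).lt_or_eq with h' | h'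
        · exact h'
        · exfalso
          exact hFne x.1 x.2 h' (by rw [← h]; exact h') (by rw [← h])
      exact univ_deriv_ne isOpen_ball hf hi (by simpa using this)
    · refine div_ne_zero (sub_ne_zero.2 ?_) (sub_ne_zero.2 h)
      exact F_ne hf hi hF hFf (hza _) (hcc _) h (hFne _ _)
  obtain ⟨M, hM, hMe⟩ := exists_log_lift hPc hP0
  -- windings
  have hw : ∀ s, (vpath c1 c2 s = c1 ∨ vpath c1 c2 s = c2) →
      Wind (fun t => F (vpath a b t)) (F (vpath c1 c2 s))
      (M (1, s) - M (-1, s) + Complex.log (1 - a / vpath c1 c2 s) - Complex.log (1 - b / vpath c1 c2 s)) := by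
    intro s hs
    obtain ⟨n1, g1, g2, g3⟩ := hbd _ hs
    set c := vpath c1 c2 s with hc
    have hzc : ∀ t, vpath a b t ≠ c := fun t h => by
      rw [← h] at n1 g2 g3
      rcases hva t n1 with k | k
      · exact g2 k
      · exact g3 k
    have hc0 := hn0 n1
    refine ⟨fun t => M (t, s) + Complex.log (1 - vpath a b t / c) + Complex.log (-c), ?_, fun t => ?_, ?_⟩
    · refine ((hM.comp (continuous_id.prodMk continuous_const)).add (Continuous.clog ?_ ?_)).add continuous_const
      · exact continuous_const.sub ((vpath_cont a b).div_const _)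
      · exact fun t => slit_of (hza t) n1 (hzc t)
    · rw [Complex.exp_add, Complex.exp_add, hMe, Complex.exp_log (slitPlane_ne_zero (slit_of (hza t) n1 (hzc t))),
        Complex.exp_log (neg_ne_zero.2 hc0)]
      simp only
      rw [← hc, Psi, if_neg (hzc t)]
      have := sub_ne_zero.2 (hzc t)
      field_simp
      ring
    · simp only [vpath_one, vpath_neg_one]
      ring
  have hw1 := hw 1 (Or.inl (vpath_one _ _))
  have hw2 := hw (-1) (Or.inr (vpath_neg_one _ _))
  rw [vpath_one] at hw1
  rw [vpath_neg_one] at hw2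
  have hv := wind_const hf hi hF hFf hJ ha hb hab (bdry_frontier hf hi hF hFf h1)
    (bdry_frontier hf hi hF hFf h2) hc1 hc2 hw1 hw2
  -- compare the two branches in s
  have hca : ∀ s, vpath c1 c2 s ≠ a := fun s h => by
    have h3 := hvc s (by rw [h, ha])
    exact (hbd _ h3).2.2.1 h
  have hcb : ∀ s, vpath c1 c2 s ≠ b := fun s h => by
    have h3 := hvc s (by rw [h, hb])
    exact (hbd _ h3).2.2.2 h
  have hD := const_of_exp_const (D := fun s => M (1, s) - M (-1, s) -
      (Complex.log (1 - vpath c1 c2 s / b) - Complex.log (1 - vpath c1 c2 s / a))) (c := b / a) ?_ ?_ 1 (-1)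
  · simp only [vpath_one, vpath_neg_one] at hD
    linear_combination hv - hD
  · refine ((hM.comp (continuous_const.prodMk continuous_id)).sub
      (hM.comp (continuous_const.prodMk continuous_id))).sub ((Continuous.clog ?_ ?_).sub (Continuous.clog ?_ ?_))
    · exact continuous_const.sub ((vpath_cont _ _).div_const _)
    · exact fun s => slit_of (hcc s) hb (hcb s)
    · exact continuous_const.sub ((vpath_cont _ _).div_const _)
    · exact fun s => slit_of (hcc s) ha (hca s)
  · intro s
    have sa := slitPlane_ne_zero (slit_of (hcc s) ha (hca s))
    have sb := slitPlane_ne_zero (slit_of (hcc s) hb (hcb s))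
    rw [Complex.exp_sub, Complex.exp_sub, Complex.exp_sub, hMe, hMe, Complex.exp_log sa, Complex.exp_log sb]
    simp only [vpath_one, vpath_neg_one]
    rw [Psi, Psi, if_neg (hca s).symm, if_neg (hcb s).symm, hab]
    have hF0 : F b - F (vpath c1 c2 s) ≠ 0 := by
      refine sub_ne_zero.2 (F_ne hf hi hF hFf hb.le (hcc s) (hcb s).symm ?_)
      intro _ h
      rw [← hab]
      exact (hbd _ (hvc s h)).2.1.symm
    have a0 := hn0 ha
    have b0 := hn0 hb
    have q1 := sub_ne_zero.2 (hca s).symm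
    have q2 := sub_ne_zero.2 (hcb s).symm
    have e1 : 1 - vpath c1 c2 s / a = (a - vpath c1 c2 s) / a := by field_simp
    have e2 : 1 - vpath c1 c2 s / b = (b - vpath c1 c2 s) / b := by field_simp
    rw [e1, e2]
    field_simp

lemma jordan_contra {f F : ℂ → ℂ} (hf : DifferentiableOn ℂ f (ball 0 1)) (hi : InjOn f (ball 0 1))
    (hF : ContinuousOn F (closedBall 0 1)) (hFf : EqOn F f (ball 0 1))
    (hJ : IsJordanCurve (frontier (f '' ball (0:ℂ) 1)))
    {δ : ℝ} (hδ : 0 < δ)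
    (hloc : ∀ a b : ℂ, ‖a‖ = 1 → ‖b‖ = 1 → a ≠ b → ‖b - a‖ < δ → F a ≠ F b)
    {α β : ℝ} (h1 : α < β) (h2 : β < α + 2 * Real.pi) (hab : F (exp (α * I)) = F (exp (β * I))) : False := by
  have hu : ∀ x : ℝ, ‖exp (x * I)‖ = 1 := Complex.norm_exp_ofReal_mul_I
  have harc : ∀ x y : ℝ, x < y → ∃ t ∈ Ioo x y, F (exp (t * I)) ≠ F (exp (α * I)) := by
    intro x y hxy
    set m := (x+y)/2 with hm
    have hc : Tendsto (fun t : ℝ => ‖exp (t * I) - exp (m * I)‖) (nhdsWithin m (Ioi m)) (nhds 0) := by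
      have : Continuous (fun t : ℝ => ‖exp (t * I) - exp (m * I)‖) := by fun_prop
      have := this.tendsto m
      rw [sub_self, norm_zero] at this
      exact this.mono_left nhdsWithin_le_nhds
    have hy : ∀ᶠ t in nhdsWithin m (Ioi m), t < y := nhdsWithin_le_nhds (Iio_mem_nhds (by rw [hm]; linarith))
    have hy2 : ∀ᶠ t in nhdsWithin m (Ioi m), t < m + 1 := nhdsWithin_le_nhds (Iio_mem_nhds (by linarith))
    obtain ⟨t, ht1, ht2, ht4, ht3⟩ := ((hc.eventually (Iio_mem_nhds hδ)).and (hy.and (hy2.and self_mem_nhdsWithin))).exists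
    have ht3 : m < t := ht3
    have hne : exp (m * I) ≠ exp (t * I) := by
      intro h
      obtain ⟨n, hn⟩ := Complex.exp_eq_exp_iff_exists_int.1 h
      have hn2 : (m:ℂ) = (t:ℂ) + n * (2 * Real.pi) := by
        have := mul_right_cancel₀ I_ne_zero (show (m:ℂ) * I = ((t:ℂ) + n * (2 * Real.pi)) * I by rw [hn]; ring)
        exact this
      have hn3 : m = t + n * (2 * Real.pi) := by exact_mod_cast hn2
      have hn4 : (n:ℝ) < 0 := by
        by_contra h
        push Not at h
        nlinarith [Real.pi_pos]
      have hn5 : (n:ℝ) ≤ -1 := by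
        have : n < 0 := by exact_mod_cast hn4
        have : n ≤ -1 := by omega
        exact_mod_cast this
      nlinarith [Real.pi_gt_three]
    have hF := hloc _ _ (hu m) (hu t) hne ht1
    by_cases hk : F (exp (m * I)) = F (exp (α * I))
    · exact ⟨t, ⟨by linarith, ht2⟩, fun h => hF (by rw [hk, h])⟩
    · exact ⟨m, ⟨by linarith, by linarith⟩, hk⟩
  obtain ⟨κ, hκ, hκF⟩ := harc α β h1
  obtain ⟨l, hl, hlF⟩ := harc β (α + 2 * Real.pi) h2
  have hj := jump_eq hf hi hF hFf hJ (hu α) (hu β) hab (hu κ) (hu l) hκF hlF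
  have L : ∀ x y θ : ℝ, ∀ n : ℤ, θ = x - y + n * (2 * Real.pi) → 0 < θ → θ < 2 * Real.pi →
      Complex.log (1 - exp (x * I) / exp (y * I)) - Complex.log (1 - exp (y * I) / exp (x * I)) =
      (θ - Real.pi) * I := by
    intro x y θ n hθ h0 h1
    rw [← log_jump h0 h1, ← Complex.exp_sub, ← Complex.exp_sub]
    have e : exp (θ * I) = exp (x * I - y * I) := by
      rw [Complex.exp_eq_exp_iff_exists_int]
      exact ⟨n, by rw [hθ]; push_cast; ring⟩
    have e' : exp (-(θ * I)) = exp (y * I - x * I) := by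
      rw [show (y:ℂ) * I - x * I = -(x * I - y * I) by ring, Complex.exp_neg, Complex.exp_neg, e]
    rw [e, e']
  have k1 := L α κ (α - κ + 2 * Real.pi) 1 (by push_cast; ring) (by linarith [hκ.1, hκ.2]) (by linarith [hκ.1, hκ.2])
  have k2 := L β κ (β - κ) 0 (by push_cast; ring) (by linarith [hκ.1, hκ.2]) (by linarith [hκ.1, hκ.2])
  have k3 := L α l (α - l + 2 * Real.pi) 1 (by push_cast; ring) (by linarith [hl.1, hl.2]) (by linarith [hl.1, hl.2])
  have k4 := L β l (β - l + 2 * Real.pi) 1 (by push_cast; ring) (by linarith [hl.1, hl.2]) (by linarith [hl.1, hl.2])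
  have hfin : (2 * Real.pi : ℂ) * I = 0 := by
    push_cast at k1 k2 k3 k4
    linear_combination hj - k1 + k2 + k3 - k4
  have : (2 * Real.pi : ℂ) * I ≠ 0 := Complex.two_pi_I_ne_zero
  exact this hfin

lemma jordan_inj {f F : ℂ → ℂ} (hf : DifferentiableOn ℂ f (ball 0 1)) (hi : InjOn f (ball 0 1))
    (hF : ContinuousOn F (closedBall 0 1)) (hFf : EqOn F f (ball 0 1))
    (hJ : IsJordanCurve (frontier (f '' ball (0:ℂ) 1)))
    {δ : ℝ} (hδ : 0 < δ)
    (hloc : ∀ a b : ℂ, ‖a‖ = 1 → ‖b‖ = 1 → a ≠ b → ‖b - a‖ < δ → F a ≠ F b) :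
    InjOn F (closedBall 0 1) := by
  intro z hz w hw h
  by_contra hzw
  refine F_ne hf hi hF hFf (by simpa using hz) (by simpa using hw) hzw (fun hz1 hw1 hab => ?_) h
  have e : ∀ u : ℂ, ‖u‖ = 1 → exp (u.arg * I) = u := fun u hu => by
    have := Complex.norm_mul_exp_arg_mul_I u
    rwa [hu, ofReal_one, one_mul] at this
  have hz2 := e z hz1
  have hw2 := e w hw1
  have p1 := Complex.neg_pi_lt_arg z
  have p2 := Complex.arg_le_pi z
  have p3 := Complex.neg_pi_lt_arg w
  have p4 := Complex.arg_le_pi w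
  rcases lt_trichotomy z.arg w.arg with g | g | g
  · exact jordan_contra hf hi hF hFf hJ hδ hloc g (by linarith) (by rw [hz2, hw2]; exact hab)
  · apply hzw; rw [← hz2, ← hw2, g]
  · exact jordan_contra hf hi hF hFf hJ hδ hloc g (by linarith) (by rw [hz2, hw2]; exact hab.symm)

end jordan

lemma separation {F : ℂ → ℂ} (hF : ContinuousOn F (closedBall 0 1)) (hi : InjOn F (closedBall 0 1))
    {δ : ℝ} (hδ : 0 < δ) : ∃ c > 0, ∀ z w, ‖z‖ ≤ 1 → ‖w‖ ≤ 1 → δ ≤ ‖z - w‖ → c ≤ ‖F z - F w‖ := by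
  set K : Set (ℂ × ℂ) := (closedBall 0 1 ×ˢ closedBall 0 1) ∩ {p | δ ≤ ‖p.1 - p.2‖} with hK
  have hKc : IsCompact K := ((isCompact_closedBall _ _).prod (isCompact_closedBall _ _)).inter_right
    (isClosed_le continuous_const (by fun_prop))
  have hc : ContinuousOn (fun p : ℂ × ℂ => ‖F p.1 - F p.2‖) K := by
    refine ContinuousOn.norm (ContinuousOn.sub ?_ ?_)
    · exact hF.comp continuousOn_fst (fun p hp => hp.1.1)
    · exact hF.comp continuousOn_snd (fun p hp => hp.1.2)
  rcases K.eq_empty_or_nonempty with h | h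
  · refine ⟨1, one_pos, fun z w hz hw hzw => ?_⟩
    have : (z, w) ∈ K := ⟨⟨by simpa using hz, by simpa using hw⟩, hzw⟩
    rw [h] at this
    exact this.elim
  · obtain ⟨p, hp, hmin⟩ := hKc.exists_isMinOn h hc
    refine ⟨‖F p.1 - F p.2‖, norm_pos_iff.2 (sub_ne_zero.2 fun hh => ?_), fun z w hz hw hzw => ?_⟩
    · have h1 := hi hp.1.1 hp.1.2 hh
      have h2 := hp.2
      simp only [mem_ofPred_eq, h1, sub_self, norm_zero] at h2
      linarith
    · exact hmin (show (z, w) ∈ K from ⟨⟨by simpa using hz, by simpa using hw⟩, hzw⟩)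

lemma GoodMap.full {f : ℂ → ℂ} {ε R0 : ℝ} (G : GoodMap f ε R0)
    (hJ : IsJordanCurve (frontier (f '' ball (0:ℂ) 1))) : ∃ F : ℂ → ℂ, ContinuousOn F (closedBall 0 1) ∧
    EqOn F f (ball 0 1) ∧ InjOn F (closedBall 0 1) := by
  obtain ⟨F, hF, hFf⟩ := G.exists_ext
  have := G.hR1
  refine ⟨F, hF, hFf, jordan_inj G.diff G.inj hF hFf hJ (δ := (1 - R0)/3) (by linarith) ?_⟩
  intro a b ha hb hab h
  exact G.low_in hF hFf ha hb hab (by linarith)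

namespace GoodMap

variable {f : ℂ → ℂ} {ε R0 : ℝ}

lemma local_lin (G : GoodMap f ε R0) {z1 z2 : ℂ} {h : ℝ} (hh : h = 1 - ‖z1‖) (h0 : 0 < h)
    (hR : R0 ≤ 1 - 2 * h) (hz : ‖z2 - z1‖ ≤ h / 10) :
    ‖deriv f z2 - deriv f z1‖ ≤ 4 * ε / h * ‖z2 - z1‖ * ‖deriv f z1‖ ∧
    ‖f z2 - f z1 - deriv f z1 * (z2 - z1)‖ ≤ ε * ‖z2 - z1‖ * ‖deriv f z1‖ := by
  have hε0 := G.hε0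
  have hε := G.hε
  set B := closedBall z1 ‖z2 - z1‖ with hB
  have hBn : ∀ z ∈ B, ‖z - z1‖ ≤ h/10 ∧ ‖z‖ < 1 ∧ h/2 ≤ 1 - ‖z‖ ∧ R0 ≤ ‖z‖ := by
    intro z hz'
    have h1 : ‖z - z1‖ ≤ h/10 := by
      rw [hB, mem_closedBall, dist_eq_norm] at hz'
      exact hz'.trans hz
    have h2 := norm_le_norm_add_norm_sub' z z1
    have h3 := norm_le_norm_add_norm_sub' z1 z
    rw [norm_sub_rev] at h3
    exact ⟨h1, by linarith, by linarith, by linarith⟩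
  have hcB : ContinuousOn (fun z => ‖deriv f z‖) B := fun z hz' =>
    ((G.hd2 (hBn z hz').2.1).continuousAt.norm).continuousWithinAt
  have hz1B : z1 ∈ B := mem_closedBall_self (norm_nonneg _)
  have hz2B : z2 ∈ B := by rw [hB, mem_closedBall, dist_eq_norm]
  obtain ⟨zs, hzs, hmax⟩ := (isCompact_closedBall z1 ‖z2 - z1‖).exists_isMaxOn ⟨z1, hz1B⟩ hcB
  set m := ‖deriv f zs‖ with hm
  have hm0 : 0 ≤ m := norm_nonneg _
  have hle : ∀ z ∈ B, ‖deriv f z‖ ≤ m := fun z hz' => hmax hz'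
  have hd2 : ∀ z ∈ B, ‖deriv (deriv f) z‖ ≤ 2 * ε / h * m := by
    intro z hz'
    obtain ⟨-, a2, a3, a4⟩ := hBn z hz'
    refine (G.bound2 a4 a2).trans ?_
    have h5 : ε / (1 - ‖z‖) ≤ 2 * ε / h := by
      rw [div_le_div_iff₀ (by linarith) h0]; nlinarith
    exact mul_le_mul h5 (hle z hz') (norm_nonneg _) (by positivity)
  have hmv : ∀ z ∈ B, ‖deriv f z - deriv f z1‖ ≤ 2 * ε / h * m * ‖z - z1‖ := by
    intro z hz'
    exact (convex_closedBall z1 _).norm_image_sub_le_of_norm_hasDerivWithin_le (𝕜 := ℂ)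
      (fun w hw => (G.hd2 (hBn w hw).2.1).hasDerivWithinAt) hd2 hz1B hz'
  have hm2 : m ≤ 2 * ‖deriv f z1‖ := by
    have h1 := hmv zs hzs
    have h2 := norm_le_norm_add_norm_sub' (deriv f zs) (deriv f z1)
    have h3 : 2 * ε / h * m * ‖zs - z1‖ ≤ 2 * ε / h * m * (h/10) := by
      have := (hBn zs hzs).1
      gcongr
    have h4 : 2 * ε / h * m * (h/10) = ε / 5 * m := by field_simp; ring
    have h5 : ε / 5 * m ≤ m / 2 := by nlinarith
    linarith
  have hmv2 : ∀ z ∈ B, ‖deriv f z - deriv f z1‖ ≤ 4 * ε / h * ‖z - z1‖ * ‖deriv f z1‖ := by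
    intro z hz'
    refine (hmv z hz').trans ?_
    calc 2 * ε / h * m * ‖z - z1‖ ≤ 2 * ε / h * (2 * ‖deriv f z1‖) * ‖z - z1‖ := by gcongr
      _ = _ := by ring
  refine ⟨hmv2 z2 hz2B, ?_⟩
  have hg : ∀ z ∈ B, HasDerivWithinAt (fun z => f z - deriv f z1 * z) (deriv f z - deriv f z1) B z := by
    intro z hz'
    have := (G.hd (hBn z hz').2.1).sub ((hasDerivAt_id z).const_mul (deriv f z1))
    exact (this.congr_deriv (by simp)).hasDerivWithinAt
  have hfin := (convex_closedBall z1 _).norm_image_sub_le_of_norm_hasDerivWithin_le (𝕜 := ℂ)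
    (C := ε * ‖deriv f z1‖) hg (fun z hz' => by
      refine (hmv2 z hz').trans ?_
      have h1 : 4 * ε / h * ‖z - z1‖ ≤ 4 * ε / h * (h/10) := by
        have := (hBn z hz').1
        gcongr
      have h2 : 4 * ε / h * (h/10) ≤ ε := by
        rw [show 4 * ε / h * (h/10) = 4/10 * ε by field_simp]; linarith
      gcongr
      linarith) hz1B hz2B
  rw [show f z2 - f z1 - deriv f z1 * (z2 - z1) = f z2 - deriv f z1 * z2 - (f z1 - deriv f z1 * z1) by ring]
  refine hfin.trans (le_of_eq ?_)
  ring

lemma refl_norm {z : ℂ} (h1 : 1/2 ≤ ‖z‖) (h2 : ‖z‖ < 1) :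
    ‖((starRingEnd ℂ) z)⁻¹‖ = ‖z‖⁻¹ ∧ 1 - ‖z‖ ≤ ‖z‖⁻¹ - 1 ∧ ‖((starRingEnd ℂ) z)⁻¹ - z‖ ≤ 4 * (1 - ‖z‖) := by
  have hz0 : z ≠ 0 := by intro h; rw [h, norm_zero] at h1; linarith
  have hp : 0 < ‖z‖ := by linarith
  have hi : ‖z‖ * ‖z‖⁻¹ = 1 := mul_inv_cancel₀ hp.ne'
  have hi1 : 1 < ‖z‖⁻¹ := (one_lt_inv₀ hp).2 h2
  have hi2 : ‖z‖⁻¹ ≤ 2 := by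
    rw [inv_le_comm₀ hp (by norm_num)]; linarith
  refine ⟨by rw [norm_inv, RCLike.norm_conj], by nlinarith, ?_⟩
  obtain ⟨he, hez, hinv⟩ := unit_dir hz0
  have : ((starRingEnd ℂ) z)⁻¹ - z = ((1/‖z‖ - ‖z‖ : ℝ):ℂ) * (z / (‖z‖ : ℂ)) := by
    rw [hinv, Complex.ofReal_sub, sub_mul, hez]
  rw [this, norm_mul, he, mul_one, Complex.norm_real, one_div, Real.norm_of_nonneg (by linarith)]
  nlinarith

/-- small scale lower bound: interior against reflected -/
lemma low_out_in (G : GoodMap f ε R0) {z w : ℂ} (hz : R0 ≤ ‖z‖) (hz1 : ‖z‖ < 1) (hw1 : ‖w‖ < 1)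
    (hd : R0 ≤ 1 - 3 * ‖w - ((starRingEnd ℂ) z)⁻¹‖) :
    ∃ m : ℂ, ‖m‖ ≤ ‖z‖ ∧ (1 - ‖z‖) / 2 * ‖deriv f m‖ ≤ ‖f w - Eext f z‖ := by
  have hR0 := G.hR0
  have hε := G.hε
  obtain ⟨r1, r2, r3⟩ := refl_norm (hR0.trans hz) hz1
  set x := ((starRingEnd ℂ) z)⁻¹ with hx
  have h1 : ‖x‖ ≤ ‖w‖ + ‖w - x‖ := by
    have := norm_le_norm_add_norm_sub' x w
    rwa [norm_sub_rev] at this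
  set H := ‖w - x‖ with hH
  have hz0 : z ≠ 0 := by intro h; rw [h, norm_zero] at hz; linarith
  have hH0 : 0 < H := by linarith
  have hc := G.comb_out_in (H := H) hH0 hd (by linarith) hz1 (by linarith) hw1 le_rfl
  set m := ((1 - H : ℝ) : ℂ) * (z / (‖z‖ : ℂ)) with hm
  have hmn : ‖m‖ = 1 - H := by
    rw [hm, norm_mul, (unit_dir hz0).1, mul_one, Complex.norm_real, Real.norm_of_nonneg (by linarith)]
  refine ⟨m, by rw [hmn]; linarith, ?_⟩
  have h2 : ‖deriv f m * (w - x)‖ ≤ ‖f w - Eext f z‖ + ‖f w - Eext f z - deriv f m * (w - x)‖ := by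
    have := norm_sub_le (f w - Eext f z) (f w - Eext f z - deriv f m * (w - x))
    rwa [sub_sub_cancel] at this
  rw [norm_mul, ← hH] at h2
  have hD := norm_nonneg (deriv f m)
  have h3 : 0 ≤ H * ‖deriv f m‖ := by positivity
  have h4 : 130 * ε * H * ‖deriv f m‖ ≤ 1/2 * (H * ‖deriv f m‖) := by nlinarith
  have h5 : (1 - ‖z‖)/2 * ‖deriv f m‖ ≤ H / 2 * ‖deriv f m‖ := by
    gcongr
    linarith
  linarith

/-- small scale injectivity of the reflection -/
lemma out_inj (G : GoodMap f ε R0) (hε' : ε ≤ 1/3000) {z w : ℂ} (hz : R0 ≤ ‖z‖) (hz1 : ‖z‖ < 1)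
    (hw1 : ‖w‖ < 1) (hzw : ‖z‖ ≤ ‖w‖) (hne : z ≠ w) (hz3 : R0 ≤ 1 - 3 * (1 - ‖z‖))
    (hd : R0 ≤ 1 - 3 * ‖((starRingEnd ℂ) w)⁻¹ - ((starRingEnd ℂ) z)⁻¹‖) :
    Eext f z ≠ Eext f w := by
  have hR0 := G.hR0
  have hε0 := G.hε0
  have hz0 : z ≠ 0 := by intro h; rw [h, norm_zero] at hz; linarith
  have hw0 : w ≠ 0 := by intro h; rw [h, norm_zero] at hzw; linarith
  obtain ⟨r1, r2, r3⟩ := refl_norm (hR0.trans hz) hz1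
  obtain ⟨s1, s2, s3⟩ := refl_norm (hR0.trans (hz.trans hzw)) hw1
  set x := ((starRingEnd ℂ) z)⁻¹ with hx
  set y := ((starRingEnd ℂ) w)⁻¹ with hy
  have hxy : w - z = (starRingEnd ℂ) ((x - y)) * (w * z) := by
    rw [hx, hy, map_sub, map_inv₀, map_inv₀, Complex.conj_conj, Complex.conj_conj]
    field_simp
  have hwz : ‖w - z‖ ≤ ‖y - x‖ := by
    rw [hxy, norm_mul, RCLike.norm_conj, norm_mul, norm_sub_rev]
    have : ‖w‖ * ‖z‖ ≤ 1 := by nlinarith [norm_nonneg w, norm_nonneg z]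
    nlinarith [norm_nonneg (y - x)]
  have hd0 : 0 < ‖y - x‖ := lt_of_lt_of_le (norm_pos_iff.2 (sub_ne_zero.2 hne.symm)) hwz
  set d := ‖y - x‖ with hdd
  have hh0 : 0 < 1 - ‖z‖ := by linarith
  rcases lt_or_ge d ((1 - ‖z‖)/10) with hlt | hge
  · have hl := G.local_lin (z1 := z) (z2 := w) (h := 1 - ‖z‖) rfl hh0 (by linarith) (by linarith)
    intro heq
    have hD := G.pos hz1
    have e : (y - x) * deriv f z = -(f w - f z - deriv f z * (w - z)) - (y - w) * (deriv f w - deriv f z) := by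
      have : Eext f w - Eext f z = 0 := by rw [heq, sub_self]
      unfold Eext at this
      rw [← hx, ← hy] at this
      linear_combination this
    have e2 : d * ‖deriv f z‖ ≤ ‖f w - f z - deriv f z * (w - z)‖ + ‖y - w‖ * ‖deriv f w - deriv f z‖ := by
      rw [hdd, ← norm_mul, e, ← norm_mul, ← norm_neg (f w - f z - deriv f z * (w - z))]
      exact norm_sub_le _ _
    have e3 : ‖y - w‖ * ‖deriv f w - deriv f z‖ ≤ (4 * (1 - ‖z‖)) * (4 * ε / (1 - ‖z‖) * d * ‖deriv f z‖) := by
      have : ‖y - w‖ ≤ 4 * (1 - ‖z‖) := by linarith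
      have h2 : ‖deriv f w - deriv f z‖ ≤ 4 * ε / (1 - ‖z‖) * d * ‖deriv f z‖ := by
        refine hl.1.trans ?_
        gcongr
      gcongr
    have e4 : (4 * (1 - ‖z‖)) * (4 * ε / (1 - ‖z‖) * d * ‖deriv f z‖) = 16 * ε * (d * ‖deriv f z‖) := by
      field_simp; ring
    have e5 : ε * ‖w - z‖ * ‖deriv f z‖ ≤ ε * (d * ‖deriv f z‖) := by
      rw [mul_assoc]; gcongr
    have h6 : 0 < d * ‖deriv f z‖ := by positivity
    have := hl.2
    nlinarith
  · set H := max d (1 - ‖z‖) with hH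
    have hH0 : 0 < H := lt_max_of_lt_left hd0
    have hHd : H ≤ 10 * d := max_le (by linarith) (by linarith)
    have hH1 : 1 - ‖z‖ ≤ H := le_max_right _ _
    have hH2 : d ≤ H := le_max_left _ _
    have hH3 : R0 ≤ 1 - 3 * H := by
      rcases max_choice d (1 - ‖z‖) with h | h
      · rw [hH, h]; exact hd
      · rw [hH, h]; exact hz3
    have hc := G.comb_out_out (H := H) hH0 hH3 (by linarith) hz1 (by linarith) hw1 hH2
    intro heq
    rw [heq, sub_self, zero_sub, norm_neg, norm_mul] at hc
    have hmn : ‖((1 - H : ℝ) : ℂ) * (z / (‖z‖ : ℂ))‖ < 1 := by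
      rw [norm_mul, (unit_dir hz0).1, mul_one, Complex.norm_real, Real.norm_of_nonneg (by linarith)]
      linarith
    have hD := G.pos hmn
    set D := ‖deriv f (((1 - H : ℝ) : ℂ) * (z / (‖z‖ : ℂ)))‖
    change D * d ≤ 130 * ε * H * D at hc
    have h6 : 0 < D * d := by positivity
    have h7 : 130 * ε * H * D ≤ 130 * ε * (10 * d) * D := by gcongr
    nlinarith

end GoodMap

structure CollarMap (φ : ℂ → ℂ) (ε R : ℝ) : Prop where
  good : GoodMap φ ε R
  out : ∀ z, R ≤ ‖z‖ → ‖z‖ < 1 → ∃ c > 0, ∀ ζ : ℂ, ‖ζ‖ < 1 → c ≤ ‖φ ζ - Eext φ z‖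
  inj : InjOn (Eext φ) {z | R ≤ ‖z‖ ∧ ‖z‖ < 1}
  koebe : ∀ z, R ≤ ‖z‖ → ‖z‖ < 1 → ∀ w, w ∉ φ '' ball 0 1 → (1 - ‖z‖) / 40 * ‖deriv φ z‖ ≤ ‖φ z - w‖

namespace GoodMap

variable {f : ℂ → ℂ} {ε R0 : ℝ}

lemma koebe_low (G : GoodMap f ε R0) {z : ℂ} (hz : R0 ≤ 1 - 2 * (1 - ‖z‖)) (hz1 : ‖z‖ < 1) {w : ℂ}
    (hw : w ∉ f '' ball 0 1) : (1 - ‖z‖) / 40 * ‖deriv f z‖ ≤ ‖f z - w‖ := by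
  have hε := G.hε
  have hε0 := G.hε0
  by_contra hlt
  push Not at hlt
  have hh : 0 < 1 - ‖z‖ := by linarith
  set h := 1 - ‖z‖ with hhd
  have hsub : closedBall z (h/10) ⊆ ball 0 1 := by
    intro y hy
    rw [mem_closedBall, dist_eq_norm] at hy
    rw [mem_ball_zero_iff]
    have := norm_le_norm_add_norm_sub' y z
    linarith
  have hr : 0 < h / 10 := by positivity
  have hdc : DiffContOnCl ℂ f (ball z (h/10)) := by
    apply DifferentiableOn.diffContOnCl
    rw [closure_ball _ hr.ne']
    exact G.diff.mono hsub
  have hfr : ∀ y ∈ sphere z (h/10), h / 20 * ‖deriv f z‖ ≤ ‖f y - f z‖ := by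
    intro y hy
    rw [mem_sphere, dist_eq_norm] at hy
    have hl := (G.local_lin (z1 := z) (z2 := y) hhd hh hz (by rw [hy])).2
    rw [hy] at hl
    have h2 : ‖deriv f z * (y - z)‖ ≤ ‖f y - f z‖ + ‖f y - f z - deriv f z * (y - z)‖ := by
      have := norm_sub_le (f y - f z) (f y - f z - deriv f z * (y - z))
      rwa [sub_sub_cancel] at this
    rw [norm_mul, hy] at h2
    have hp : 0 ≤ h * ‖deriv f z‖ := by positivity
    nlinarith
  have hne : ∃ᶠ y in nhds z, f y ≠ f z := by
    have hzb : z ∈ ball (0:ℂ) 1 := by simpa using hz1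
    have h1 : ∀ᶠ y in nhdsWithin z {z}ᶜ, f y ≠ f z := by
      filter_upwards [self_mem_nhdsWithin, nhdsWithin_le_nhds (isOpen_ball.mem_nhds hzb)] with y hy hy'
      exact fun h => hy (G.inj hy' hzb h)
    exact h1.frequently.filter_mono nhdsWithin_le_nhds
  have := hdc.ball_subset_image_closedBall hr hfr hne
  have hwb : w ∈ ball (f z) (h / 20 * ‖deriv f z‖ / 2) := by
    rw [mem_ball, dist_eq_norm, norm_sub_rev]
    linarith
  obtain ⟨y, hy, rfl⟩ := this hwb
  exact hw ⟨y, hsub hy, rfl⟩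

lemma collar (G : GoodMap f ε R0) (hε' : ε ≤ 1/3000) {F : ℂ → ℂ}
    (hF : ContinuousOn F (closedBall 0 1)) (hFf : EqOn F f (ball 0 1)) (hFi : InjOn F (closedBall 0 1)) :
    ∃ R1 s0 : ℝ, R0 ≤ R1 ∧ R1 < 1 ∧ 1/2 ≤ s0 ∧ s0 < 1 ∧ ∀ R, R1 ≤ R → R < 1 → ∀ s, s0 ≤ s → s ≤ 1 →
      CollarMap (fun z => f (s * z)) ε R := by
  have hR1 := G.hR1
  have hR0 := G.hR0
  set Ra := (1 + R0)/2 with hRa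
  set δ := (1 - Ra)/3 with hδ
  have hδ0 : 0 < δ := by rw [hδ, hRa]; linarith
  obtain ⟨c, hc0, hc⟩ := separation hF hFi (δ := δ/4) (by positivity)
  obtain ⟨K, hK0, hK⟩ := G.deriv_growth
  set κ := (c / (16 * K))^2 with hκ
  have hκ0 : 0 < κ := by positivity
  have hs01 : R0 / Ra < 1 := by rw [div_lt_one (by rw [hRa]; linarith), hRa]; linarith
  have hs02 : 1/2 ≤ R0 / Ra := by rw [le_div_iff₀ (by rw [hRa]; linarith), hRa]; linarith
  refine ⟨max (1 - κ) (1 - δ/16), R0 / Ra, ?_, ?_, hs02, hs01, ?_⟩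
  · refine le_trans ?_ (le_max_right _ _); rw [hδ, hRa]; linarith
  · refine max_lt ?_ ?_ <;> linarith
  intro R hRR hRl s hs hs1
  have hRκ : 1 - κ ≤ R := (le_max_left _ _).trans hRR
  have hRδ : 1 - δ/16 ≤ R := (le_max_right _ _).trans hRR
  have hRaR : Ra ≤ R := by rw [hδ, hRa] at *; linarith
  have hs0 : 0 < s := by linarith
  have hsR : R0 ≤ s * Ra := by
    rw [div_le_iff₀ (by rw [hRa]; linarith)] at hs; exact hs
  have G1 := G.scale hs0 hs1 hsR (by rw [hRa]; linarith)
  set φ : ℂ → ℂ := fun z => f (s * z) with hφ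
  have hsn : ∀ z : ℂ, ‖(s:ℂ) * z‖ = s * ‖z‖ := fun z => by
    rw [norm_mul, Complex.norm_real, Real.norm_of_nonneg hs0.le]
  have hlt : ∀ z : ℂ, ‖z‖ < 1 → ‖(s:ℂ) * z‖ < 1 := fun z hz => by
    rw [hsn]; nlinarith [norm_nonneg z]
  have hFφ : ∀ z : ℂ, ‖z‖ < 1 → F (s * z) = φ z := fun z hz => hFf (by simpa using hlt z hz)
  have hsep : ∀ z w : ℂ, ‖z‖ < 1 → ‖w‖ < 1 → δ/2 ≤ ‖z - w‖ → c ≤ ‖φ z - φ w‖ := by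
    intro z w hz hw hzw
    rw [← hFφ z hz, ← hFφ w hw]
    refine hc _ _ (hlt z hz).le (hlt w hw).le ?_
    rw [← mul_sub, hsn]
    nlinarith [norm_nonneg (z - w)]
  have hE : ∀ z : ℂ, R ≤ ‖z‖ → ‖z‖ < 1 → ‖Eext φ z - φ z‖ ≤ c/4 := by
    intro z hz hz1
    have hz2 : 1/2 ≤ ‖z‖ := by linarith
    have hz0 : z ≠ 0 := by intro h; rw [h, norm_zero] at hz2; linarith
    have hd : deriv φ z = s * deriv f (s * z) := by
      have := ((G.hd (hlt z hz1)).comp z ((hasDerivAt_id z).const_mul (s:ℂ))).deriv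
      rw [mul_one, mul_comm] at this
      exact this
    have h1 : ‖deriv φ z‖ ≤ K / √(1 - ‖z‖) := by
      rw [hd, norm_mul, Complex.norm_real, Real.norm_of_nonneg hs0.le]
      obtain ⟨he, hez, -⟩ := unit_dir hz0
      have h2 := hK _ he (s * ‖z‖) (by nlinarith) (by nlinarith)
      have h3 : (((s * ‖z‖ : ℝ)):ℂ) * (z / ‖z‖) = s * z := by
        push_cast; rw [mul_assoc, hez]
      rw [h3] at h2
      have h4 : K / √(1 - s * ‖z‖) ≤ K / √(1 - ‖z‖) := by
        apply div_le_div_of_nonneg_left hK0.le (Real.sqrt_pos.2 (by linarith))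
        apply Real.sqrt_le_sqrt; nlinarith
      nlinarith [norm_nonneg (deriv f (s*z))]
    have h5 : Eext φ z - φ z = (((starRingEnd ℂ) z)⁻¹ - z) * deriv φ z := by unfold Eext; ring
    have h6 := (refl_norm hz2 hz1).2.2
    rw [h5, norm_mul]
    have hq : 0 < √(1 - ‖z‖) := Real.sqrt_pos.2 (by linarith)
    have hq2 : √(1 - ‖z‖) * √(1 - ‖z‖) = 1 - ‖z‖ := Real.mul_self_sqrt (by linarith)
    have hq3 : √(1 - ‖z‖) ≤ c / (16 * K) := by
      apply Real.sqrt_le_iff.2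
      exact ⟨by positivity, by linarith⟩
    calc _ ≤ 4 * (1 - ‖z‖) * (K / √(1 - ‖z‖)) := by gcongr
      _ = 4 * K * √(1 - ‖z‖) := by
        rw [mul_div_assoc', div_eq_iff hq.ne']
        linear_combination (-4 * K) * hq2
      _ ≤ 4 * K * (c / (16 * K)) := by gcongr
      _ = c / 4 := by field_simp; ring
  refine ⟨G1.mono hRaR hRl, ?_, ?_, ?_⟩
  · intro z hz hz1
    have hz2 : 1/2 ≤ ‖z‖ := by linarith
    have hcont : ContinuousOn (fun z => ‖deriv φ z‖) (closedBall 0 ‖z‖) :=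
      ((deriv_continuousOn_ball G1.diff).mono (closedBall_subset_ball hz1)).norm
    obtain ⟨ms, hms, hmin⟩ := (isCompact_closedBall (0:ℂ) ‖z‖).exists_isMinOn ⟨0, by simp⟩ hcont
    have hmp : 0 < ‖deriv φ ms‖ := G1.pos (lt_of_le_of_lt (by simpa using hms) hz1)
    refine ⟨min (c/2) ((1 - ‖z‖)/2 * ‖deriv φ ms‖), by
      have : 0 < 1 - ‖z‖ := by linarith
      positivity, fun ζ hζ => ?_⟩
    have h6 := (refl_norm hz2 hz1).2.2
    rcases le_or_gt ‖ζ - ((starRingEnd ℂ) z)⁻¹‖ δ with hd | hd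
    · obtain ⟨m, hm1, hm2⟩ := G1.low_out_in (by linarith) hz1 hζ (by rw [hδ] at hd; linarith)
      refine (min_le_right _ _).trans (le_trans ?_ hm2)
      have h7 : ‖deriv φ ms‖ ≤ ‖deriv φ m‖ := hmin (show m ∈ closedBall (0:ℂ) ‖z‖ by simpa using hm1)
      have : 0 < 1 - ‖z‖ := by linarith
      gcongr
    · refine (min_le_left _ _).trans ?_
      have h8 : δ/2 ≤ ‖z - ζ‖ := by
        have := norm_sub_le_norm_sub_add_norm_sub ζ z ((starRingEnd ℂ) z)⁻¹
        rw [norm_sub_rev z ζ]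
        rw [norm_sub_rev z] at this
        linarith
      have h9 := hsep z ζ hz1 hζ h8
      have h10 := hE z hz hz1
      have := norm_sub_le_norm_sub_add_norm_sub (φ z) (Eext φ z) (φ ζ)
      rw [norm_sub_rev (φ z) (Eext φ z), norm_sub_rev (Eext φ z) (φ ζ)] at this
      linarith
  · have key : ∀ z w : ℂ, R ≤ ‖z‖ → ‖z‖ < 1 → ‖w‖ < 1 → ‖z‖ ≤ ‖w‖ → z ≠ w → Eext φ z ≠ Eext φ w := by
      intro z w hz hz1 hw1 hzw hne
      have h6 := (refl_norm (by linarith : 1/2 ≤ ‖z‖) hz1).2.2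
      have h7 := (refl_norm (by linarith : 1/2 ≤ ‖w‖) hw1).2.2
      rcases le_or_gt ‖((starRingEnd ℂ) w)⁻¹ - ((starRingEnd ℂ) z)⁻¹‖ δ with hd | hd
      · exact G1.out_inj hε' (by linarith) hz1 hw1 hzw hne (by rw [hδ] at hRδ; linarith)
          (by rw [hδ] at hd; linarith)
      · intro heq
        have h8 : δ/2 ≤ ‖z - w‖ := by
          have := norm_sub_le_norm_sub_add_norm_sub ((starRingEnd ℂ) w)⁻¹ w ((starRingEnd ℂ) z)⁻¹
          have h9 := norm_sub_le_norm_sub_add_norm_sub w z ((starRingEnd ℂ) z)⁻¹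
          rw [norm_sub_rev z ((starRingEnd ℂ) z)⁻¹, norm_sub_rev w z] at h9
          linarith
        have h9 := hsep z w hz1 hw1 h8
        have h10 := hE z hz hz1
        have h11 := hE w (hz.trans hzw) hw1
        have := norm_sub_le_norm_sub_add_norm_sub (φ z) (Eext φ z) (φ w)
        rw [norm_sub_rev (φ z) (Eext φ z), heq] at this
        rw [heq] at h10
        linarith
    intro z hz w hw heq
    by_contra hne
    rcases le_total ‖z‖ ‖w‖ with h | h
    · exact key z w hz.1 hz.2 hw.2 h hne heq
    · exact key w z hw.1 hw.2 hz.2 h (Ne.symm hne) heq.symm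
  · intro z hz hz1 w hw
    exact G1.koebe_low (by rw [hδ] at hRδ; linarith) hz1 hw

end GoodMap

lemma dslope_derivs {U : Set ℂ} (hU : IsOpen U) {g : ℂ → ℂ} (hg : DifferentiableOn ℂ g U) {z0 : ℂ}
    (hz0 : z0 ∈ U) : DifferentiableOn ℂ (dslope g z0) U ∧
    (∀ z ∈ U, deriv g z = dslope g z0 z + (z - z0) * deriv (dslope g z0) z) ∧
    dslope g z0 z0 = deriv g z0 ∧
    deriv (dslope g z0) z0 = deriv (deriv g) z0 / 2 ∧
    deriv (deriv (dslope g z0)) z0 = deriv (deriv (deriv g)) z0 / 3 := by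
  have hD : DifferentiableOn ℂ (dslope g z0) U :=
    (Complex.differentiableOn_dslope (hU.mem_nhds hz0)).2 hg
  set D := dslope g z0 with hDd
  have hD' : DifferentiableOn ℂ (deriv D) U := hD.deriv hU
  have hD'' : DifferentiableOn ℂ (deriv (deriv D)) U := hD'.deriv hU
  have hda : ∀ {h : ℂ → ℂ}, DifferentiableOn ℂ h U → ∀ z ∈ U, HasDerivAt h (deriv h z) z :=
    fun hh z hz => ((hh z hz).differentiableAt (hU.mem_nhds hz)).hasDerivAt
  have hx : ∀ z : ℂ, HasDerivAt (fun z => z - z0) 1 z := fun z => (hasDerivAt_id z).sub_const z0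
  have e0 : ∀ z, g z = g z0 + (z - z0) * D z := fun z => by
    have := sub_smul_dslope g z0 z
    rw [smul_eq_mul] at this
    rw [hDd, this]; ring
  have h1 : ∀ z ∈ U, HasDerivAt g (D z + (z - z0) * deriv D z) z := fun z hz => by
    have := ((hx z).mul (hda hD z hz)).const_add (g z0)
    refine HasDerivAt.congr_of_eventuallyEq (this.congr_deriv (by ring)) ?_
    exact Eventually.of_forall fun y => by simpa using e0 y
  have e1 : ∀ z ∈ U, deriv g z = D z + (z - z0) * deriv D z := fun z hz => (h1 z hz).deriv
  have h2 : ∀ z ∈ U, HasDerivAt (deriv g) (2 * deriv D z + (z - z0) * deriv (deriv D) z) z := fun z hz => by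
    have := (hda hD z hz).add ((hx z).mul (hda hD' z hz))
    refine HasDerivAt.congr_of_eventuallyEq (this.congr_deriv (by ring)) ?_
    filter_upwards [hU.mem_nhds hz] with y hy
    simpa using e1 y hy
  have e2 : ∀ z ∈ U, deriv (deriv g) z = 2 * deriv D z + (z - z0) * deriv (deriv D) z :=
    fun z hz => (h2 z hz).deriv
  have h3 : HasDerivAt (deriv (deriv g)) (3 * deriv (deriv D) z0) z0 := by
    have := ((hda hD' z0 hz0).const_mul 2).add ((hx z0).mul (hda hD'' z0 hz0))
    refine HasDerivAt.congr_of_eventuallyEq (this.congr_deriv (by ring)) ?_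
    filter_upwards [hU.mem_nhds hz0] with y hy
    simpa using e2 y hy
  refine ⟨hD, e1, dslope_same _ _, ?_, ?_⟩
  · rw [e2 z0 hz0]; ring
  · rw [h3.deriv]; ring

lemma k_decomp {g : ℂ → ℂ} (hg : DifferentiableOn ℂ g (ball 0 1)) (hi : InjOn g (ball 0 1)) {z0 : ℂ}
    (hz0 : z0 ∈ ball (0:ℂ) 1) : ∃ W : ℂ → ℂ, ∀ ζ ∈ ball (0:ℂ) 1, ζ ≠ z0 →
      HasDerivAt W (deriv g z0 * deriv g ζ / ((ζ - z0) * (g ζ - g z0)^2)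
        - schwarzian g z0 / 6 / (ζ - z0)) ζ := by
  have hU : IsOpen (ball (0:ℂ) 1) := isOpen_ball
  obtain ⟨hD, d1, d2, d3, d4⟩ := dslope_derivs hU hg hz0
  set D := dslope g z0 with hDd
  obtain ⟨hE, b1, b2, b3, -⟩ := dslope_derivs hU hD hz0
  set D2 := dslope D z0 with hD2
  have hg0 : deriv g z0 ≠ 0 := univ_deriv_ne hU hg hi hz0
  have eD : ∀ z, g z - g z0 = (z - z0) * D z := fun z => by
    have := sub_smul_dslope g z0 z
    rw [smul_eq_mul] at this
    rw [hDd, this]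
  have eD2 : ∀ z, D z - D z0 = (z - z0) * D2 z := fun z => by
    have := sub_smul_dslope D z0 z
    rw [smul_eq_mul] at this
    rw [hD2, this]
  have hDne : ∀ z ∈ ball (0:ℂ) 1, D z ≠ 0 := fun z hz h0 => by
    by_cases h : z = z0
    · rw [h, d2] at h0; exact hg0 h0
    · apply h
      apply hi hz hz0
      have := eD z
      rw [h0, mul_zero, sub_eq_zero] at this
      exact this
  have hA : DifferentiableOn ℂ (fun z => D2 z / D z) (ball 0 1) := hE.div hD hDne
  set A : ℂ → ℂ := fun z => D2 z / D z with hAd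
  have hA' : DifferentiableOn ℂ (deriv A) (ball 0 1) := hA.deriv hU
  have hda : ∀ {h : ℂ → ℂ}, DifferentiableOn ℂ h (ball 0 1) → ∀ z ∈ ball (0:ℂ) 1, HasDerivAt h (deriv h z) z :=
    fun hh z hz => ((hh z hz).differentiableAt (hU.mem_nhds hz)).hasDerivAt
  have eA' : ∀ z ∈ ball (0:ℂ) 1, deriv A z = (deriv D2 z * D z - D2 z * deriv D z) / D z ^ 2 := fun z hz =>
    ((hda hE z hz).div (hda hD z hz) (hDne z hz)).deriv
  have hc : deriv A z0 = schwarzian g z0 / 6 := by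
    rw [eA' z0 hz0, b2, b3, d2, d4, d3]
    unfold schwarzian
    field_simp
    ring
  have hV : DifferentiableOn ℂ (dslope (deriv A) z0) (ball 0 1) :=
    (Complex.differentiableOn_dslope (hU.mem_nhds hz0)).2 hA'
  obtain ⟨P, hP⟩ := hV.isExactOn_ball
  refine ⟨fun ζ => -(1/2) * ((ζ - z0)^2)⁻¹ + P ζ, fun ζ hζ hne => ?_⟩
  have hx0 : ζ - z0 ≠ 0 := sub_ne_zero.2 hne
  have hx : HasDerivAt (fun z => z - z0) 1 ζ := (hasDerivAt_id ζ).sub_const z0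
  have h1 := (((hx.pow 2).inv (pow_ne_zero 2 hx0)).const_mul (-(1/2) : ℂ)).add (hP ζ hζ)
  refine h1.congr_deriv ?_
  rw [← hc, dslope_of_ne _ hne, slope_def_field, eA' ζ hζ, d1 ζ hζ, eD ζ]
  have e2 := eD2 ζ
  rw [d2] at e2
  have e3 : deriv g z0 = D ζ - (ζ - z0) * D2 ζ := by linear_combination -e2
  have e4 := b1 ζ hζ
  rw [hc, e3, e4]
  have := hDne ζ hζ
  simp
  field_simp
  ring

lemma univ_log {h : ℂ → ℂ} {ρ : ℝ} (hρ : 0 < ρ) (hh : DifferentiableOn ℂ h (ball 0 ρ))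
    (hi : InjOn h (ball 0 ρ)) (h0 : h 0 = 0) :
    ∃ H : ℂ → ℂ, DifferentiableOn ℂ H (ball 0 ρ) ∧ ∀ z ∈ ball (0:ℂ) ρ, h z = z * exp (H z) := by
  have hU : IsOpen (ball (0:ℂ) ρ) := isOpen_ball
  have h0m : (0:ℂ) ∈ ball (0:ℂ) ρ := mem_ball_self hρ
  have hD : DifferentiableOn ℂ (dslope h 0) (ball 0 ρ) :=
    (Complex.differentiableOn_dslope (hU.mem_nhds h0m)).2 hh
  have eD : ∀ z, h z = z * dslope h 0 z := fun z => by
    have := sub_smul_dslope h 0 z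
    rw [smul_eq_mul, h0, sub_zero, sub_zero] at this
    exact this.symm
  set D := dslope h 0 with hDd
  have hDne : ∀ z ∈ ball (0:ℂ) ρ, D z ≠ 0 := fun z hz hz0 => by
    by_cases h : z = 0
    · rw [h, hDd, dslope_same] at hz0; exact univ_deriv_ne hU hh hi h0m hz0
    · apply h
      apply hi hz h0m
      rw [eD z, hz0, mul_zero, h0]
  have hL : DifferentiableOn ℂ (fun z => deriv D z / D z) (ball 0 ρ) := (hD.deriv hU).div hD hDne
  obtain ⟨H, hH0, hH⟩ := hL.isExactOn_ball.with_val_at 0 (log (D 0))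
  have hda : ∀ z ∈ ball (0:ℂ) ρ, HasDerivAt D (deriv D z) z :=
    fun z hz => ((hD z hz).differentiableAt (hU.mem_nhds hz)).hasDerivAt
  refine ⟨H, fun z hz => (hH z hz).differentiableAt.differentiableWithinAt, fun z hz => ?_⟩
  have hc : ∀ z ∈ ball (0:ℂ) ρ, HasDerivWithinAt (fun z => D z * exp (-H z)) 0 (ball 0 ρ) z := fun z hz => by
    have := (hda z hz).mul ((hH z hz).neg.cexp)
    refine (this.congr_deriv ?_).hasDerivWithinAt
    have := hDne z hz
    simp only [Pi.neg_apply]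
    field_simp
    ring
  have hcc := (convex_ball (0:ℂ) ρ).norm_image_sub_le_of_norm_hasDerivWithin_le (C := 0) (𝕜 := ℂ) hc
    (fun z hz => by simp) h0m hz
  rw [zero_mul] at hcc
  have h2 : D z * exp (-H z) = D 0 * exp (-H 0) := by
    rw [← sub_eq_zero]; exact norm_le_zero_iff.1 hcc
  rw [hH0, exp_neg, exp_neg, exp_log (hDne 0 h0m), mul_inv_cancel₀ (hDne 0 h0m)] at h2
  rw [eD z]
  congr 1
  have := exp_ne_zero (H z)
  field_simp at h2
  exact h2

structure ExtData (gt q : ℂ → ℂ) (V : Set ℂ) : Prop where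
  gd : DifferentiableOn ℂ gt (ball 0 1)
  gi : InjOn gt (ball 0 1)
  g0 : gt 0 = 0
  Vo : IsOpen V
  qd : DifferentiableOn ℂ q V
  qi : InjOn q V
  qm : ∀ w ∈ V, q w ∈ ball (0:ℂ) 1 ∧ q w ≠ 0 ∧ w ≠ 0 ∧ gt (q w) = w⁻¹
  gq : ∀ z ∈ ball (0:ℂ) 1, z ≠ 0 → gt z ≠ 0 ∧ (gt z)⁻¹ ∈ V ∧ q ((gt z)⁻¹) = z

lemma curve_residue {gt q φ : ℂ → ℂ} {V : Set ℂ} (X : ExtData gt q V) {ρ : ℝ} (hρ : 1 < ρ)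
    (hφ : DifferentiableOn ℂ φ (ball 0 ρ)) (hφi : InjOn φ (ball 0 ρ)) (hφ0 : φ 0 = 0)
    {z0 : ℂ} (hz0 : z0 ∈ ball (0:ℂ) 1) (hz00 : z0 ≠ 0)
    (hV : ∀ z : ℂ, ‖z‖ = 1 → φ z ∈ V) (hq : ∀ z : ℂ, ‖z‖ = 1 → ‖z0‖ < ‖q (φ z)‖) :
    (∮ z in C(0, 1), (deriv φ z / ((q (φ z) - z0) * (φ z - (gt z0)⁻¹)^2))) * (-deriv gt z0 / (gt z0)^2)
      = -(2 * Real.pi * I) * (schwarzian gt z0 / 6) := by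
  obtain ⟨W, hW⟩ := k_decomp X.gd X.gi hz0
  obtain ⟨H, hH, hHe⟩ := univ_log (by linarith) hφ hφi hφ0
  obtain ⟨h, hh, hhe⟩ := univ_log one_pos X.gd X.gi X.g0
  set c := schwarzian gt z0 / 6 with hc
  set z : ℝ → ℂ := fun θ => circleMap 0 1 θ with hz
  have hzn : ∀ θ, ‖z θ‖ = 1 := fun θ => by simp [hz]
  have hzρ : ∀ θ, z θ ∈ ball (0:ℂ) ρ := fun θ => by rw [mem_ball_zero_iff, hzn]; exact hρ
  set ζ : ℝ → ℂ := fun θ => q (φ (z θ)) with hζ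
  have hd : ∀ {k : ℂ → ℂ} {U : Set ℂ}, IsOpen U → DifferentiableOn ℂ k U → ∀ z ∈ U, HasDerivAt k (deriv k z) z :=
    fun hU hh z hz => ((hh z hz).differentiableAt (hU.mem_nhds hz)).hasDerivAt
  have dz : ∀ θ, HasDerivAt z (z θ * I) θ := fun θ => by
    have := hasDerivAt_circleMap 0 1 θ
    exact this
  have dφ : ∀ θ, HasDerivAt (fun θ => φ (z θ)) (deriv φ (z θ) * (z θ * I)) θ := fun θ =>
    (hd isOpen_ball hφ _ (hzρ θ)).comp_of_eq θ (dz θ) rfl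
  set ζ' : ℝ → ℂ := fun θ => deriv q (φ (z θ)) * (deriv φ (z θ) * (z θ * I)) with hζ'
  have dζ : ∀ θ, HasDerivAt ζ (ζ' θ) θ := fun θ =>
    (hd X.Vo X.qd _ (hV _ (hzn θ))).comp_of_eq θ (dφ θ) rfl
  have hζm : ∀ θ, ζ θ ∈ ball (0:ℂ) 1 ∧ ζ θ ≠ 0 ∧ φ (z θ) ≠ 0 ∧ gt (ζ θ) = (φ (z θ))⁻¹ := fun θ =>
    X.qm _ (hV _ (hzn θ))
  have hζne : ∀ θ, ζ θ ≠ z0 := fun θ he => by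
    have := hq _ (hzn θ)
    change ‖z0‖ < ‖ζ θ‖ at this
    rw [he] at this; exact lt_irrefl _ this
  -- logarithm of ζ
  set L : ℝ → ℂ := fun θ => -h (ζ θ) - H (z θ) - θ * I with hL
  have eL : ∀ θ, exp (L θ) = ζ θ := fun θ => by
    have h1 := (hζm θ).2.2.2
    rw [hhe _ (hζm θ).1, hHe _ (hzρ θ)] at h1
    have hzz : z θ = exp (θ * I) := by simp [hz, circleMap]
    rw [hL]; dsimp only
    rw [exp_sub, exp_sub, exp_neg, ← hzz]
    have a1 := exp_ne_zero (h (ζ θ))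
    have a2 := exp_ne_zero (H (z θ))
    have a3 : z θ ≠ 0 := by rw [hzz]; exact exp_ne_zero _
    field_simp at h1 ⊢
    exact h1.symm
  have dL0 : ∀ θ, ∃ l, HasDerivAt L l θ := fun θ => by
    refine ⟨_, ((HasDerivAt.neg ((hd isOpen_ball hh _ (hζm θ).1).comp_of_eq θ (dζ θ) rfl)).sub
      ((hd isOpen_ball hH _ (hzρ θ)).comp_of_eq θ (dz θ) rfl)).sub ((hasDerivAt_id θ).ofReal_comp.mul_const I)⟩
  have dL : ∀ θ, HasDerivAt L (ζ' θ / ζ θ) θ := fun θ => by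
    obtain ⟨l, hl⟩ := dL0 θ
    have h1 : HasDerivAt ζ (exp (L θ) * l) θ := by
      refine (hl.cexp).congr_of_eventuallyEq (Eventually.of_forall fun x => (eL x).symm)
    have h2 := h1.unique (dζ θ)
    rw [eL] at h2
    rw [← h2, mul_div_cancel_left₀ _ (hζm θ).2.1]
    exact hl
  have dlog : ∀ θ, HasDerivAt (fun θ => log (1 - z0 / ζ θ)) ((z0 * ζ' θ / ζ θ ^ 2) / (1 - z0 / ζ θ)) θ := fun θ => by
    have h1 : HasDerivAt (fun θ => 1 - z0 / ζ θ) (z0 * ζ' θ / ζ θ ^ 2) θ := by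
      have := (((dζ θ).inv (hζm θ).2.1).const_mul z0).const_sub 1
      refine (this.congr_deriv (by ring)).congr_of_eventuallyEq (Eventually.of_forall fun x => ?_)
      simp [div_eq_mul_inv]
    refine h1.clog_real ?_
    left
    have h3 := hq _ (hzn θ)
    change ‖z0‖ < ‖ζ θ‖ at h3
    have h4 : ‖z0 / ζ θ‖ < 1 := by
      rw [norm_div, div_lt_one (norm_pos_iff.2 (hζm θ).2.1)]; exact h3
    have h5 := (Complex.re_le_norm (z0 / ζ θ))
    rw [sub_re, one_re]; linarith
  have dW : ∀ θ, HasDerivAt (fun θ => W (ζ θ)) ((deriv gt z0 * deriv gt (ζ θ) / ((ζ θ - z0) * (gt (ζ θ) - gt z0)^2)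
        - c / (ζ θ - z0)) * ζ' θ) θ := fun θ =>
    (hW _ (hζm θ).1 (hζne θ)).comp_of_eq θ (dζ θ) rfl
  set K : ℝ → ℂ := fun θ => (z θ * I) * (deriv φ (z θ) / ((ζ θ - z0) * (φ (z θ) - (gt z0)⁻¹)^2)) * (-deriv gt z0 / (gt z0)^2)
    with hK
  have hgz0 : gt z0 ≠ 0 := (X.gq z0 hz0 hz00).1
  have hφw : ∀ θ, φ (z θ) - (gt z0)⁻¹ ≠ 0 := fun θ he => by
    apply hζne θ
    rw [sub_eq_zero] at he
    rw [hζ]; dsimp only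
    rw [he]; exact (X.gq z0 hz0 hz00).2.2
  have dP : ∀ θ, HasDerivAt (fun θ => W (ζ θ) + c * (L θ + log (1 - z0 / ζ θ))) (K θ) θ := fun θ => by
    refine ((dW θ).add (((dL θ).add (dlog θ)).const_mul c)).congr_deriv ?_
    have h1 : deriv gt (ζ θ) * ζ' θ = - (deriv φ (z θ) * (z θ * I)) / (φ (z θ))^2 := by
      have a1 := (hd isOpen_ball X.gd _ (hζm θ).1).comp_of_eq θ (dζ θ) rfl
      have a2 := (dφ θ).inv (hζm θ).2.2.1
      refine a1.unique (a2.congr_of_eventuallyEq (Eventually.of_forall fun x => ?_))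
      exact (hζm x).2.2.2
    have h2 := sub_ne_zero.2 (hζne θ)
    have h3 := (hζm θ).2.1
    have h4 := (hζm θ).2.2.1
    have h5 : (ζ θ - z0) ≠ 0 := h2
    have e1 : ζ' θ / ζ θ + z0 * ζ' θ / ζ θ ^ 2 / (1 - z0 / ζ θ) = ζ' θ / (ζ θ - z0) := by
      have : 1 - z0 / ζ θ = (ζ θ - z0) / ζ θ := by field_simp
      rw [this]; field_simp; ring
    rw [e1]
    have e2 : (deriv gt z0 * deriv gt (ζ θ) / ((ζ θ - z0) * (gt (ζ θ) - gt z0)^2) - c / (ζ θ - z0)) * ζ' θ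
        + c * (ζ' θ / (ζ θ - z0)) = deriv gt z0 * (deriv gt (ζ θ) * ζ' θ) / ((ζ θ - z0) * (gt (ζ θ) - gt z0)^2) := by
      ring
    rw [e2, h1, (hζm θ).2.2.2, hK]
    have h6 := hφw θ
    have h7 : (φ (z θ))⁻¹ - gt z0 ≠ 0 := fun h => h6 (by rw [sub_eq_zero] at h; rw [← h, inv_inv, sub_self])
    have h8 : φ (z θ) * gt z0 - 1 ≠ 0 := fun h => h6 (by
      rw [sub_eq_zero] at h
      rw [sub_eq_zero]; exact eq_inv_of_mul_eq_one_left h)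
    have e3 : (φ (z θ))⁻¹ - gt z0 = -(φ (z θ) * gt z0 - 1) / φ (z θ) := by field_simp; ring
    have e4 : φ (z θ) - (gt z0)⁻¹ = (φ (z θ) * gt z0 - 1) / gt z0 := by field_simp
    dsimp only
    rw [e3, e4]
    field_simp
  have cz : Continuous z := continuous_circleMap 0 1
  have cζ : Continuous ζ := continuous_iff_continuousAt.2 fun θ => (dζ θ).continuousAt
  have cφ : Continuous (fun θ => φ (z θ)) := continuous_iff_continuousAt.2 fun θ => (dφ θ).continuousAt
  have cφ' : Continuous (fun θ => deriv φ (z θ)) := by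
    have : ContinuousOn (deriv φ) (ball 0 ρ) := (hφ.deriv isOpen_ball).continuousOn
    exact this.comp_continuous cz hzρ
  have cK : Continuous K := by
    refine Continuous.mul (Continuous.mul (by fun_prop) (cφ'.div ((cζ.sub continuous_const).mul ((cφ.sub continuous_const).pow 2)) fun θ => ?_)) continuous_const
    exact mul_ne_zero (sub_ne_zero.2 (hζne θ)) (pow_ne_zero 2 (hφw θ))
  have hint := intervalIntegral.integral_eq_sub_of_hasDerivAt (a := 0) (b := 2 * Real.pi) (fun θ _ => dP θ)
    (cK.intervalIntegrable _ _)
  have hper : z (2 * Real.pi) = z 0 := by simp [hz, circleMap]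
  have hperζ : ζ (2 * Real.pi) = ζ 0 := by rw [hζ]; dsimp only; rw [hper]
  have hfin : W (ζ (2 * Real.pi)) + c * (L (2 * Real.pi) + log (1 - z0 / ζ (2 * Real.pi))) -
      (W (ζ 0) + c * (L 0 + log (1 - z0 / ζ 0))) = -(2 * Real.pi * I) * c := by
    rw [hL]; dsimp only
    rw [hperζ, hper]; push_cast; ring
  rw [hfin] at hint
  rw [← hint, circleIntegral, ← intervalIntegral.integral_mul_const]
  congr 1
  ext θ
  rw [deriv_circleMap, smul_eq_mul]

lemma annulus_exp {R : ℝ} (hR : 0 < R) {w : ℂ} (h1 : Real.log R ≤ w.re) (h2 : w.re ≤ 0) :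
    R ≤ ‖exp w‖ ∧ ‖exp w‖ ≤ 1 := by
  rw [norm_exp]
  refine ⟨?_, Real.exp_le_one_iff.2 h2⟩
  rw [← Real.log_le_iff_le_exp hR]; exact h1

lemma annulus_stokes {P a b : ℂ → ℂ} {R : ℝ} (hR0 : 0 < R) (hR1 : R < 1)
    (hP : ∀ z : ℂ, R ≤ ‖z‖ → ‖z‖ ≤ 1 → HasFDerivAt P (abL (a z) (b z)) z)
    (hb : ContinuousOn b {z : ℂ | R ≤ ‖z‖ ∧ ‖z‖ ≤ 1}) :
    ‖∮ z in C(0, 1), P z‖ₑ ≤ ‖∮ z in C(0, R), P z‖ₑ + 2 * ∫⁻ z in {z : ℂ | R < ‖z‖ ∧ ‖z‖ < 1}, ‖b z‖ₑ := by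
  set Q : ℂ → ℂ := fun w => P (exp w) * exp w with hQ
  set A : ℂ → ℂ := fun w => a (exp w) * exp w * exp w + P (exp w) * exp w with hA
  set B : ℂ → ℂ := fun w => b (exp w) * (starRingEnd ℂ) (exp w) * exp w with hB
  have hlogR : Real.log R < 0 := Real.log_neg hR0 hR1
  have h2pi : (0:ℝ) < 2 * Real.pi := Real.two_pi_pos
  have hQd : ∀ w : ℂ, Real.log R ≤ w.re → w.re ≤ 0 → HasFDerivAt Q (abL (A w) (B w)) w := by
    intro w h1 h2
    obtain ⟨r1, r2⟩ := annulus_exp hR0 h1 h2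
    have e1 := hasFDerivAt_abL_of_hasDerivAt (hasDerivAt_exp w)
    have e2 := (hP _ r1 r2).comp w e1
    have e3 := e2.mul e1
    refine e3.congr_fderiv (ContinuousLinearMap.ext fun v => ?_)
    simp only [Function.comp_apply, ContinuousLinearMap.add_apply, ContinuousLinearMap.smul_apply,
      ContinuousLinearMap.comp_apply, abL_apply, smul_eq_mul, map_mul, map_add, hA, hB]
    simp
    ring
  have hreR : ∀ w ∈ (uIcc (Real.log R) 0) ×ℂ (uIcc (0:ℝ) (2 * Real.pi)), Real.log R ≤ w.re ∧ w.re ≤ 0 := by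
    intro w hw
    rw [mem_reProdIm, uIcc_of_le hlogR.le, uIcc_of_le h2pi.le] at hw
    exact hw.1
  have hcB : ContinuousOn B ((uIcc (Real.log R) 0) ×ℂ (uIcc (0:ℝ) (2 * Real.pi))) := by
    refine ContinuousOn.mul (ContinuousOn.mul ?_ ?_) continuous_exp.continuousOn
    · exact hb.comp continuous_exp.continuousOn fun w hw => annulus_exp hR0 (hreR w hw).1 (hreR w hw).2
    · exact (Complex.continuous_conj.comp continuous_exp).continuousOn
  have hpt : ∀ w, I • (abL (A w) (B w)) 1 - (abL (A w) (B w)) I = 2 * I * B w := fun w => by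
    rw [abL_apply, abL_apply]; simp; ring
  have hst := integral_boundary_rect_of_hasFDerivAt_real_off_countable Q (fun w => abL (A w) (B w))
    (Real.log R) (0 + (2 * Real.pi : ℝ) * I) ∅ countable_empty
    (fun w hw => by
      simp at hw
      have := hreR w (by simpa using hw)
      exact (hQd w this.1 this.2).continuousAt.continuousWithinAt)
    (fun w hw => by
      have h := hw.1
      simp only [mem_reProdIm] at h
      simp [hlogR.le, h2pi.le] at h
      exact hQd w h.1.1.le h.1.2.le)
    (by
      simp only [hpt]
      simp
      refine ContinuousOn.integrableOn_compact ?_ ?_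
      · exact isCompact_uIcc.reProdIm isCompact_uIcc
      · exact continuousOn_const.mul hcB)
  simp only [hpt] at hst
  simp at hst
  have htop : (∫ x in (Real.log R)..0, Q (x + 2 * Real.pi * I)) = ∫ x in (Real.log R)..0, Q x := by
    congr 1; ext x
    rw [hQ]; dsimp only
    rw [exp_add, exp_two_pi_mul_I, mul_one]
  rw [htop, sub_self, zero_add] at hst
  have hc1 : (∮ z in C(0, 1), P z) = I * ∫ y in (0:ℝ)..(2 * Real.pi), Q (y * I) := by
    rw [circleIntegral, ← intervalIntegral.integral_const_mul]
    congr 1; ext y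
    simp [circleMap, hQ]; ring
  have hcR : (∮ z in C(0, R), P z) = I * ∫ y in (0:ℝ)..(2 * Real.pi), Q (Real.log R + y * I) := by
    rw [circleIntegral, ← intervalIntegral.integral_const_mul]
    congr 1; ext y
    have : exp (Real.log R) = R := by rw [← ofReal_exp, Real.exp_log hR0]
    simp [circleMap, hQ, exp_add, -ofReal_log, this]; ring
  simp only [ofReal_log hR0.le] at hst hcR
  rw [← hc1, ← hcR] at hst
  have hdec : (∮ z in C(0, 1), P z) = (∮ z in C(0, R), P z) +
      ∫ x in (Real.log R)..0, ∫ y in (0:ℝ)..(2 * Real.pi), 2 * I * B (x + y * I) := by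
    have := sub_eq_iff_eq_add'.1 hst
    rw [this]; simp
  rw [hdec]
  refine (enorm_add_le _ _).trans (add_le_add le_rfl ?_)
  rw [intervalIntegral.integral_of_le hlogR.le, integral_Ioc_eq_integral_Ioo]
  have hin : ∀ x : ℝ, (∫ y in (0:ℝ)..(2 * Real.pi), 2 * I * B (x + y * I)) =
      ∫ y in Ioo 0 (2 * Real.pi), 2 * I * B (x + y * I) := fun x => by
    rw [intervalIntegral.integral_of_le h2pi.le, integral_Ioc_eq_integral_Ioo]
  simp only [hin]
  have h1 : ‖∫ x in Ioo (Real.log R) 0, ∫ y in Ioo 0 (2 * Real.pi), 2 * I * B (x + y * I)‖ₑ ≤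
      ∫⁻ x in Ioo (Real.log R) 0, ∫⁻ y in Ioo 0 (2 * Real.pi), ‖2 * I * B (x + y * I)‖ₑ :=
    (enorm_integral_le_lintegral_enorm _).trans
      (lintegral_mono fun x => enorm_integral_le_lintegral_enorm _)
  refine h1.trans ?_
  set U : Set ℂ := Ioo (Real.log R) 0 ×ℂ Ioo 0 (2 * Real.pi) with hU
  have hUo : IsOpen U := isOpen_Ioo.reProdIm isOpen_Ioo
  have hmp := Complex.volume_preserving_equiv_real_prod.symm
  have hpre : (measurableEquivRealProd.symm) ⁻¹' U = Ioo (Real.log R) 0 ×ˢ Ioo 0 (2 * Real.pi) := by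
    ext p; simp [hU, mem_reProdIm]
  have hS : MeasurableSet (Ioo (Real.log R) 0 ×ˢ Ioo 0 (2 * Real.pi)) :=
    measurableSet_Ioo.prod measurableSet_Ioo
  have hcB2 : ContinuousOn (fun p : ℝ × ℝ => ‖2 * I * B (p.1 + p.2 * I)‖ₑ)
      (Ioo (Real.log R) 0 ×ˢ Ioo 0 (2 * Real.pi)) := by
    refine continuous_enorm.comp_continuousOn (continuousOn_const.mul (hcB.comp (by fun_prop) ?_))
    intro p hp
    rw [mem_reProdIm, uIcc_of_le hlogR.le, uIcc_of_le h2pi.le]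
    simp only [mem_prod, mem_Ioo] at hp
    simp
    exact ⟨⟨hp.1.1.le, hp.1.2.le⟩, hp.2.1.le, hp.2.2.le⟩
  have h2 : ∫⁻ x in Ioo (Real.log R) 0, ∫⁻ y in Ioo 0 (2 * Real.pi), ‖2 * I * B (x + y * I)‖ₑ =
      ∫⁻ w in U, ‖2 * I * B w‖ₑ := by
    rw [← hmp.setLIntegral_comp_preimage_emb (measurableEquivRealProd.symm.measurableEmbedding) (fun w => ‖2 * I * B w‖ₑ) U,
      hpre]
    have := setLIntegral_prod (μ := volume) (ν := volume) (s := Ioo (Real.log R) 0) (t := Ioo 0 (2 * Real.pi))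
      (fun p : ℝ × ℝ => ‖2 * I * B (p.1 + p.2 * I)‖ₑ) (hcB2.aemeasurable hS)
    rw [← this, ← Measure.volume_eq_prod]
    refine lintegral_congr fun p => ?_
    congr 3
    simp [Complex.mk_eq_add_mul_I]
  rw [h2]
  have hei : InjOn exp U := by
    intro w hw w' hw' he
    rw [exp_eq_exp_iff_exists_int] at he
    obtain ⟨n, hn⟩ := he
    have him := congrArg Complex.im hn
    simp at him
    rw [hU, mem_reProdIm] at hw hw'
    have a1 := hw.2.1
    have a2 := hw.2.2
    have a3 := hw'.2.1
    have a4 := hw'.2.2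
    have hn0 : n = 0 := by
      have b1 : (n:ℝ) < 1 := by
        by_contra h; push Not at h
        nlinarith
      have b2 : (-1:ℝ) < n := by
        by_contra h; push Not at h
        nlinarith
      have : n < 1 := by exact_mod_cast b1
      have : -1 < n := by exact_mod_cast b2
      lia
    rw [hn, hn0]; simp
  have h3 := cov_lintegral hUo differentiable_exp.differentiableOn hei (fun z => 2 * ‖b z‖ₑ)
  have h4 : ∫⁻ w in U, ‖2 * I * B w‖ₑ = ∫⁻ w in U, ENNReal.ofReal (‖deriv exp w‖^2) * (2 * ‖b (exp w)‖ₑ) := by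
    refine lintegral_congr fun w => ?_
    rw [Complex.deriv_exp, hB]; dsimp only
    simp only [enorm_mul]
    have e1 : ‖(starRingEnd ℂ) (exp w)‖ₑ = ‖exp w‖ₑ := by
      rw [← ofReal_norm, ← ofReal_norm, RCLike.norm_conj]
    have e2 : ‖(2:ℂ)‖ₑ = 2 := by rw [← ofReal_norm]; simp
    have e3 : ‖I‖ₑ = 1 := by rw [← ofReal_norm]; simp
    rw [e1, e2, e3, ENNReal.ofReal_pow (norm_nonneg _), ofReal_norm]; ring
  rw [h4, ← h3, lintegral_const_mul' _ _ (by norm_num)]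
  gcongr
  rintro _ ⟨w, hw, rfl⟩
  rw [hU, mem_reProdIm] at hw
  simp only [mem_ofPred_eq, norm_exp]
  exact ⟨by rw [← Real.log_lt_iff_lt_exp hR0]; exact hw.1.1, Real.exp_lt_one_iff.2 hw.1.2⟩

lemma cs_sq {α : Type*} [MeasurableSpace α] {μ : Measure α} {f g : α → ENNReal} (hf : AEMeasurable f μ) (hg : AEMeasurable g μ) :
    (∫⁻ x, f x * g x ∂μ)^2 ≤ (∫⁻ x, f x ^ 2 ∂μ) * ∫⁻ x, g x ^ 2 ∂μ := by
  have h := ENNReal.lintegral_mul_le_Lp_mul_Lq μ (p := 2) (q := 2) Real.HolderConjugate.two_two hf hg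
  have h2 := pow_le_pow_left₀ (zero_le) h 2
  refine h2.trans (le_of_eq ?_)
  rw [mul_pow, ← ENNReal.rpow_natCast, ← ENNReal.rpow_natCast, ← ENNReal.rpow_mul, ← ENNReal.rpow_mul]
  norm_num

lemma Eext_fderiv {φ : ℂ → ℂ} {U : Set ℂ} (hU : IsOpen U) (hφ : DifferentiableOn ℂ φ U) {z : ℂ} (hz : z ∈ U) (hz0 : z ≠ 0) :
    HasFDerivAt (Eext φ) (abL ((((starRingEnd ℂ) z)⁻¹ - z) * deriv (deriv φ) z)
      (-deriv φ z / ((starRingEnd ℂ) z)^2)) z := by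
  have hd : ∀ {k : ℂ → ℂ}, DifferentiableOn ℂ k U → HasDerivAt k (deriv k z) z :=
    fun hh => ((hh z hz).differentiableAt (hU.mem_nhds hz)).hasDerivAt
  have h1 := hasFDerivAt_abL_of_hasDerivAt (hd hφ)
  have h2 := hasFDerivAt_abL_of_hasDerivAt (hd (hφ.deriv hU))
  have hc0 : (starRingEnd ℂ) z ≠ 0 := by simpa using hz0
  have h3 : HasFDerivAt (fun z : ℂ => (starRingEnd ℂ) z) (abL 0 1) z := by
    refine (conjCLE : ℂ →L[ℝ] ℂ).hasFDerivAt.congr_fderiv (ContinuousLinearMap.ext fun v => ?_)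
    rw [abL_apply]; simp
  have h4 := (hasFDerivAt_abL_of_hasDerivAt (hasDerivAt_inv hc0)).comp z h3
  have h5 := h1.add (((h4.sub (hasFDerivAt_id z))).mul h2)
  refine h5.congr_fderiv (ContinuousLinearMap.ext fun v => ?_)
  simp only [Function.comp_apply, ContinuousLinearMap.add_apply, ContinuousLinearMap.smul_apply,
      ContinuousLinearMap.comp_apply, ContinuousLinearMap.sub_apply, ContinuousLinearMap.id_apply, abL_apply, smul_eq_mul, map_mul, map_add]
  simp
  field_simp
  ring

lemma kernel_area {a : ℂ} (ha : a ∈ ball (0:ℂ) 1) :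
    ∫⁻ ζ in ball (0:ℂ) 1, ENNReal.ofReal (1 / ‖1 - a * (starRingEnd ℂ) ζ‖^4)
      ≤ ENNReal.ofReal (Real.pi / (1 - ‖a‖^2)^2) := by
  have ha1 : ‖a‖ < 1 := by simpa using ha
  have ha2 : 0 < 1 - ‖a‖^2 := by nlinarith [norm_nonneg a]
  set T : ℂ → ℂ := fun ζ => (ζ - a) / (1 - (starRingEnd ℂ) a * ζ) with hT
  have hden : ∀ ζ ∈ ball (0:ℂ) 1, 1 - (starRingEnd ℂ) a * ζ ≠ 0 := fun ζ hζ h => by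
    have h1 : (starRingEnd ℂ) a * ζ = 1 := (sub_eq_zero.1 h).symm
    have h2 := congrArg norm h1
    rw [norm_mul, RCLike.norm_conj, norm_one] at h2
    have : ‖ζ‖ < 1 := by simpa using hζ
    nlinarith [norm_nonneg a, norm_nonneg ζ]
  have haa : (starRingEnd ℂ) a * a = ((‖a‖^2 : ℝ) : ℂ) := by
    rw [← Complex.normSq_eq_conj_mul_self, Complex.normSq_eq_norm_sq]
  have hTd : ∀ ζ ∈ ball (0:ℂ) 1, HasDerivAt T ((1 - ‖a‖^2 : ℝ) / (1 - (starRingEnd ℂ) a * ζ)^2) ζ := fun ζ hζ => by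
    have h1 := ((hasDerivAt_id ζ).sub_const a).div (((hasDerivAt_id ζ).const_mul ((starRingEnd ℂ) a)).const_sub 1) (hden ζ hζ)
    refine h1.congr_deriv ?_
    simp only [id]
    congr 1
    push_cast at haa ⊢
    rw [← haa]; ring
  have hTi : InjOn T (ball 0 1) := fun x hx y hy h => by
    have h1 := hden x hx
    have h2 := hden y hy
    simp only [hT] at h
    rw [div_eq_div_iff h1 h2] at h
    have h3 : (x - y) * ((1 - ‖a‖^2 : ℝ) : ℂ) = 0 := by
      push_cast at haa ⊢
      rw [← haa]; linear_combination h
    rcases mul_eq_zero.1 h3 with h4 | h4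
    · exact sub_eq_zero.1 h4
    · exact absurd (by exact_mod_cast h4) ha2.ne'
  have hTm : T '' ball 0 1 ⊆ ball 0 1 := by
    rintro _ ⟨ζ, hζ, rfl⟩
    have hζ1 : ‖ζ‖ < 1 := by simpa using hζ
    rw [mem_ball_zero_iff, hT]; dsimp only
    rw [norm_div, div_lt_one (norm_pos_iff.2 (hden ζ hζ))]
    rw [← sq_lt_sq₀ (norm_nonneg _) (norm_nonneg _), ← Complex.normSq_eq_norm_sq, ← Complex.normSq_eq_norm_sq]
    have e : normSq (1 - (starRingEnd ℂ) a * ζ) - normSq (ζ - a) = (1 - ‖a‖^2) * (1 - ‖ζ‖^2) := by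
      rw [← Complex.normSq_eq_norm_sq, ← Complex.normSq_eq_norm_sq]
      simp only [normSq_apply]; simp; ring
    have hz2 : 0 < 1 - ‖ζ‖^2 := by nlinarith [norm_nonneg ζ]
    have := mul_pos ha2 hz2
    linarith
  have h1 := cov_lintegral isOpen_ball (fun ζ hζ => (hTd ζ hζ).differentiableAt.differentiableWithinAt) hTi (fun _ => 1)
  have h2 : ∫⁻ w in T '' ball 0 1, 1 ≤ ENNReal.ofReal Real.pi := by
    refine (lintegral_mono_set hTm).trans ?_
    rw [setLIntegral_one, Complex.volume_ball]
    simp only [ENNReal.ofReal_one, one_pow, one_mul]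
    rw [← NNReal.coe_real_pi, ENNReal.ofReal_coe_nnreal]
  rw [h1] at h2
  have h3 : ∀ ζ ∈ ball (0:ℂ) 1, ENNReal.ofReal (1 / ‖1 - a * (starRingEnd ℂ) ζ‖^4) =
      ENNReal.ofReal (1 / (1 - ‖a‖^2)^2) * (ENNReal.ofReal (‖deriv T ζ‖^2) * 1) := fun ζ hζ => by
    rw [mul_one, ← ENNReal.ofReal_mul (by positivity), (hTd ζ hζ).deriv]
    congr 1
    rw [norm_div, Complex.norm_real, norm_pow, Real.norm_of_nonneg ha2.le]
    have : ‖1 - a * (starRingEnd ℂ) ζ‖ = ‖1 - (starRingEnd ℂ) a * ζ‖ := by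
      rw [← RCLike.norm_conj]; simp
    rw [this]
    have := norm_pos_iff.2 (hden ζ hζ)
    field_simp
  rw [setLIntegral_congr_fun measurableSet_ball h3, lintegral_const_mul' _ _ ENNReal.ofReal_ne_top]
  calc _ ≤ ENNReal.ofReal (1 / (1 - ‖a‖^2)^2) * ENNReal.ofReal Real.pi := by gcongr
    _ = _ := by rw [← ENNReal.ofReal_mul (by positivity)]; congr 1; ring

/-- the open collar -/
def ann (R : ℝ) : Set ℂ := {z : ℂ | R < ‖z‖ ∧ ‖z‖ < 1}

lemma isOpen_ann (R : ℝ) : IsOpen (ann R) :=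
  (isOpen_lt continuous_const continuous_norm).inter (isOpen_lt continuous_norm continuous_const)

noncomputable def Pker (φ q : ℂ → ℂ) (z0 w0 : ℂ) (z : ℂ) : ℂ :=
  (starRingEnd ℂ) (q (Eext φ z)) / (1 - z0 * (starRingEnd ℂ) (q (Eext φ z))) * (deriv φ z / (φ z - w0)^2)

lemma den_ne {a ζ : ℂ} (ha : ‖a‖ < 1) (hζ : ‖ζ‖ < 1) : 1 - a * (starRingEnd ℂ) ζ ≠ 0 := fun h => by
  have h1 : a * (starRingEnd ℂ) ζ = 1 := (sub_eq_zero.1 h).symm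
  have h2 := congrArg norm h1
  rw [norm_mul, RCLike.norm_conj, norm_one] at h2
  nlinarith [norm_nonneg a, norm_nonneg ζ]

lemma stokes_bound {gt q φ : ℂ → ℂ} {V : Set ℂ} (X : ExtData gt q V) {ρ ε R : ℝ} (hρ : 1 < ρ)
    (hφ : DifferentiableOn ℂ φ (ball 0 ρ)) (C : CollarMap φ ε R)
    (hE : ∀ z : ℂ, R ≤ ‖z‖ → ‖z‖ ≤ 1 → Eext φ z ∈ V) {z0 w0 : ℂ} (hz0 : z0 ∈ ball (0:ℂ) 1)
    (hw0 : ∀ z : ℂ, ‖z‖ ≤ 1 → φ z ≠ w0) :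
    ‖∮ z in C(0, 1), Pker φ q z0 w0 z‖ₑ ^ 2 ≤ 2 * ‖∮ z in C(0, R), Pker φ q z0 w0 z‖ₑ ^ 2 +
      ENNReal.ofReal (16 * Real.pi / (1 - ‖z0‖^2)^2) *
        ∫⁻ z in ann R, ENNReal.ofReal (4 * (1 - ‖z‖)^2 * ‖deriv (deriv φ) z‖^2 / ‖φ z - w0‖^4) := by
  have hR0 := C.good.hR0
  have hR1 := C.good.hR1
  have hε := C.good.hε
  have hε0 := C.good.hε0
  have hz01 : ‖z0‖ < 1 := by simpa using hz0
  set A : Set ℂ := {z : ℂ | R ≤ ‖z‖ ∧ ‖z‖ ≤ 1} with hA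
  have hAρ : ∀ z ∈ A, z ∈ ball (0:ℂ) ρ := fun z hz => by
    rw [mem_ball_zero_iff]; exact lt_of_le_of_lt hz.2 hρ
  have hA0 : ∀ z ∈ A, z ≠ 0 := fun z hz h => by
    have := hz.1; rw [h, norm_zero] at this; linarith
  have hda : ∀ {k : ℂ → ℂ} {U : Set ℂ}, IsOpen U → DifferentiableOn ℂ k U → ∀ z ∈ U, HasDerivAt k (deriv k z) z :=
    fun hU hh z hz => ((hh z hz).differentiableAt (hU.mem_nhds hz)).hasDerivAt
  have hφ' := hφ.deriv isOpen_ball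
  have hφ'' := hφ'.deriv isOpen_ball
  set Ez : ℂ → ℂ := fun z => (((starRingEnd ℂ) z)⁻¹ - z) * deriv (deriv φ) z with hEz
  set Eb : ℂ → ℂ := fun z => -deriv φ z / ((starRingEnd ℂ) z)^2 with hEb
  have hEd : ∀ z ∈ A, HasFDerivAt (Eext φ) (abL (Ez z) (Eb z)) z := fun z hz =>
    Eext_fderiv isOpen_ball hφ (hAρ z hz) (hA0 z hz)
  have hcE : ContinuousOn (Eext φ) A := fun z hz => (hEd z hz).continuousAt.continuousWithinAt
  have hEV : ∀ z ∈ A, Eext φ z ∈ V := fun z hz => hE z hz.1 hz.2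
  set Q : ℂ → ℂ := fun z => q (Eext φ z) with hQ
  set q' : ℂ → ℂ := fun z => deriv q (Eext φ z) with hq'
  have hQd : ∀ z ∈ A, HasFDerivAt Q (abL (q' z * Ez z) (q' z * Eb z)) z := fun z hz => by
    have := (hasFDerivAt_abL_of_hasDerivAt (hda X.Vo X.qd _ (hEV z hz))).comp z (hEd z hz)
    refine this.congr_fderiv (ContinuousLinearMap.ext fun v => ?_)
    simp only [ContinuousLinearMap.comp_apply, abL_apply]
    simp [hq']; ring
  have hQ1 : ∀ z ∈ A, ‖Q z‖ < 1 := fun z hz => by simpa using (X.qm _ (hEV z hz)).1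
  have hcQ : ContinuousOn Q A := fun z hz => (hQd z hz).continuousAt.continuousWithinAt
  have hcq' : ContinuousOn q' A := (X.qd.deriv X.Vo).continuousOn.comp hcE hEV
  have hcφ : ContinuousOn φ A := hφ.continuousOn.mono hAρ
  have hcφ' : ContinuousOn (deriv φ) A := hφ'.continuousOn.mono hAρ
  have hcφ'' : ContinuousOn (deriv (deriv φ)) A := hφ''.continuousOn.mono hAρ
  have hcconj : ContinuousOn (fun z : ℂ => (starRingEnd ℂ) z) A := Complex.continuous_conj.continuousOn
  have hc0 : ∀ z ∈ A, (starRingEnd ℂ) z ≠ 0 := fun z hz => by simpa using hA0 z hz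
  have hcEz : ContinuousOn Ez A := ((hcconj.inv₀ hc0).sub continuousOn_id).mul hcφ''
  have hcEb : ContinuousOn Eb A := hcφ'.neg.div (hcconj.pow 2) fun z hz => pow_ne_zero 2 (hc0 z hz)
  have hcQb : ContinuousOn (fun z => (starRingEnd ℂ) (Q z)) A := Complex.continuous_conj.comp_continuousOn hcQ
  have hden : ∀ z ∈ A, 1 - z0 * (starRingEnd ℂ) (Q z) ≠ 0 := fun z hz => den_ne hz01 (hQ1 z hz)
  have hw : ∀ z ∈ A, φ z - w0 ≠ 0 := fun z hz => sub_ne_zero.2 (hw0 z hz.2)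
  set m' : ℂ → ℂ := fun z => ((1 - z0 * (starRingEnd ℂ) (Q z))^2)⁻¹ with hm'
  have hcm' : ContinuousOn m' A := ((continuousOn_const.sub (continuousOn_const.mul hcQb)).pow 2).inv₀
    fun z hz => pow_ne_zero 2 (hden z hz)
  set ψ : ℂ → ℂ := fun z => deriv φ z / (φ z - w0)^2 with hψ
  have hcψ : ContinuousOn ψ A := hcφ'.div ((hcφ.sub continuousOn_const).pow 2) fun z hz => pow_ne_zero 2 (hw z hz)
  have hψd : ∀ z ∈ A, ∃ d, HasDerivAt ψ d z := fun z hz =>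
    ⟨_, (hda isOpen_ball hφ' z (hAρ z hz)).div (((hda isOpen_ball hφ z (hAρ z hz)).sub_const w0).pow 2)
      (pow_ne_zero 2 (hw z hz))⟩
  set b : ℂ → ℂ := fun z => m' z * (starRingEnd ℂ) (q' z * Ez z) * ψ z with hb
  have hcb : ContinuousOn b A := (hcm'.mul (Complex.continuous_conj.comp_continuousOn (hcq'.mul hcEz))).mul hcψ
  have hPd : ∀ z ∈ A, ∃ a, HasFDerivAt (Pker φ q z0 w0) (abL a (b z)) z := by
    intro z hz
    obtain ⟨d, hd⟩ := hψd z hz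
    have h1 : HasFDerivAt (fun z => (starRingEnd ℂ) (Q z))
        (abL ((starRingEnd ℂ) (q' z * Eb z)) ((starRingEnd ℂ) (q' z * Ez z))) z := by
      have := (conjCLE : ℂ →L[ℝ] ℂ).hasFDerivAt.comp z (hQd z hz)
      refine this.congr_fderiv (ContinuousLinearMap.ext fun v => ?_)
      simp only [ContinuousLinearMap.comp_apply, abL_apply]
      simp; ring
    have h2 : HasDerivAt (fun u : ℂ => u / (1 - z0 * u)) (m' z) ((starRingEnd ℂ) (Q z)) := by
      have := (hasDerivAt_id ((starRingEnd ℂ) (Q z))).div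
        (((hasDerivAt_id ((starRingEnd ℂ) (Q z))).const_mul z0).const_sub 1) (hden z hz)
      refine this.congr_deriv ?_
      rw [hm']; dsimp only [id]
      rw [div_eq_mul_inv]
      ring
    have h3 := ((hasFDerivAt_abL_of_hasDerivAt h2).comp z h1).mul (hasFDerivAt_abL_of_hasDerivAt hd)
    refine ⟨m' z * (starRingEnd ℂ) (q' z * Eb z) * ψ z +
      (starRingEnd ℂ) (Q z) / (1 - z0 * (starRingEnd ℂ) (Q z)) * d, h3.congr_fderiv (ContinuousLinearMap.ext fun v => ?_)⟩
    simp only [Function.comp_apply, ContinuousLinearMap.add_apply, ContinuousLinearMap.smul_apply,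
      ContinuousLinearMap.comp_apply, abL_apply, smul_eq_mul, hb]
    ring
  choose! a ha using hPd
  have hst := annulus_stokes (by linarith) hR1 (fun z h1 h2 => ha z ⟨h1, h2⟩) hcb
  change _ ≤ _ + 2 * ∫⁻ z in ann R, ‖b z‖ₑ at hst
  -- Cauchy Schwarz
  have hann : ann R ⊆ A := fun z hz => ⟨hz.1.le, hz.2.le⟩
  have hmann : MeasurableSet (ann R) := (isOpen_ann R).measurableSet
  set Tf : ℂ → ℝ := fun z => ‖q' z * Eb z * m' z‖ with hTf
  set gf : ℂ → ℝ := fun z => 2 * (1 - ‖z‖) * ‖deriv (deriv φ) z‖ / ‖φ z - w0‖^2 with hgf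
  have hcTf : ContinuousOn Tf (ann R) := (((hcq'.mul hcEb).mul hcm').norm).mono hann
  have hcgf : ContinuousOn gf (ann R) := by
    refine ContinuousOn.mono ?_ hann
    refine ContinuousOn.div (ContinuousOn.mul (by fun_prop) hcφ''.norm) ((hcφ.sub continuousOn_const).norm.pow 2) ?_
    intro z hz
    exact pow_ne_zero 2 (norm_ne_zero_iff.2 (hw z hz))
  have hbb : ∀ z ∈ ann R, ‖b z‖ₑ ≤ ENNReal.ofReal (Tf z) * ENNReal.ofReal (gf z) := by
    intro z hz
    have hzA := hann hz
    rw [← ENNReal.ofReal_mul (norm_nonneg _), ← ofReal_norm]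
    apply ENNReal.ofReal_le_ofReal
    have hzp : 0 < ‖z‖ := norm_pos_iff.2 (hA0 z hzA)
    have hz1 := hz.2
    have e1 : ‖Ez z‖ ≤ ‖Eb z‖ * (2 * (1 - ‖z‖) * ‖deriv (deriv φ) z‖) / ‖deriv φ z‖ := by
      have hne := C.good.pos hz1
      rw [hEz, hEb]; dsimp only
      rw [norm_mul, norm_div, norm_neg, norm_pow, RCLike.norm_conj]
      have e2 : ‖((starRingEnd ℂ) z)⁻¹ - z‖ ≤ (1 - ‖z‖^2) / ‖z‖ := by
        have : ((starRingEnd ℂ) z)⁻¹ - z = (1 - ‖z‖^2 : ℝ) / (starRingEnd ℂ) z := by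
          have h := Complex.normSq_eq_conj_mul_self (z := z)
          rw [Complex.normSq_eq_norm_sq] at h
          rw [ofReal_sub, h]
          have := hc0 z hzA
          field_simp
          simp
        rw [this, norm_div, Complex.norm_real, RCLike.norm_conj, Real.norm_of_nonneg (by nlinarith)]
      rw [le_div_iff₀ hne]
      calc _ ≤ (1 - ‖z‖^2) / ‖z‖ * ‖deriv (deriv φ) z‖ * ‖deriv φ z‖ := by gcongr
        _ ≤ (2 * (1 - ‖z‖)) / ‖z‖^2 * ‖deriv (deriv φ) z‖ * ‖deriv φ z‖ := by
          have : (1 - ‖z‖^2) / ‖z‖ ≤ (2 * (1 - ‖z‖)) / ‖z‖^2 := by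
            rw [div_le_div_iff₀ hzp (by positivity)]
            have h9 : ‖z‖ * (1 + ‖z‖) ≤ 2 := by nlinarith
            have h10 : 0 ≤ ‖z‖ * (1 - ‖z‖) := mul_nonneg hzp.le (by linarith)
            nlinarith [mul_le_mul_of_nonneg_left h9 h10]
          gcongr
        _ = _ := by ring
    have hne := C.good.pos hz1
    calc ‖b z‖ = ‖m' z‖ * (‖q' z‖ * ‖Ez z‖) * (‖deriv φ z‖ / ‖φ z - w0‖^2) := by
          rw [hb]; dsimp only
          rw [norm_mul, norm_mul, RCLike.norm_conj, norm_mul, hψ]; dsimp only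
          rw [norm_div, norm_pow]
      _ ≤ ‖m' z‖ * (‖q' z‖ * (‖Eb z‖ * (2 * (1 - ‖z‖) * ‖deriv (deriv φ) z‖) / ‖deriv φ z‖)) * (‖deriv φ z‖ / ‖φ z - w0‖^2) := by
          gcongr
      _ = Tf z * gf z := by
          rw [hTf, hgf]; dsimp only
          rw [norm_mul, norm_mul]
          field_simp
  have hint : (∫⁻ z in ann R, ‖b z‖ₑ)^2 ≤ (∫⁻ z in ann R, ENNReal.ofReal (Tf z)^2) * ∫⁻ z in ann R, ENNReal.ofReal (gf z)^2 := by
    refine le_trans (pow_le_pow_left₀ zero_le (setLIntegral_mono' hmann hbb) 2) ?_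
    exact cs_sq (hcTf.aemeasurable hmann).ennreal_ofReal (hcgf.aemeasurable hmann).ennreal_ofReal
  have hgfe : ∫⁻ z in ann R, ENNReal.ofReal (gf z)^2 =
      ∫⁻ z in ann R, ENNReal.ofReal (4 * (1 - ‖z‖)^2 * ‖deriv (deriv φ) z‖^2 / ‖φ z - w0‖^4) := by
    refine setLIntegral_congr_fun hmann fun z hz => ?_
    rw [← ENNReal.ofReal_pow]
    · congr 1; rw [hgf]; dsimp only; rw [div_pow]; ring
    · have : 0 < 1 - ‖z‖ := by linarith [hz.2]
      rw [hgf]; positivity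
  have hTfe : ∫⁻ z in ann R, ENNReal.ofReal (Tf z)^2 ≤ 2 * ENNReal.ofReal (Real.pi / (1 - ‖z0‖^2)^2) := by
    have hQi : InjOn Q (ann R) := fun z hz w hw h => by
      have := X.qi (hEV z (hann hz)) (hEV w (hann hw)) h
      exact C.inj ⟨hz.1.le, hz.2⟩ ⟨hw.1.le, hw.2⟩ this
    have hcov := lintegral_image_eq_lintegral_abs_det_fderiv_mul volume hmann
      (fun z hz => (hQd z (hann hz)).hasFDerivWithinAt) hQi
      (fun ζ => ENNReal.ofReal (1 / ‖1 - z0 * (starRingEnd ℂ) ζ‖^4))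
    have h1 : ∫⁻ ζ in Q '' ann R, ENNReal.ofReal (1 / ‖1 - z0 * (starRingEnd ℂ) ζ‖^4) ≤
        ENNReal.ofReal (Real.pi / (1 - ‖z0‖^2)^2) := by
      refine (lintegral_mono_set ?_).trans (kernel_area hz0)
      rintro _ ⟨z, hz, rfl⟩
      simpa using hQ1 z (hann hz)
    rw [hcov] at h1
    refine le_trans ?_ (mul_le_mul_right h1 2)
    rw [← lintegral_const_mul' _ _ (by norm_num)]
    refine setLIntegral_mono' hmann fun z hz => ?_
    have hzA := hann hz
    rw [← ENNReal.ofReal_pow (norm_nonneg _), ← ENNReal.ofReal_mul (abs_nonneg _),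
      show (2:ENNReal) = ENNReal.ofReal 2 by simp, ← ENNReal.ofReal_mul (by norm_num)]
    apply ENNReal.ofReal_le_ofReal
    rw [abL_det, norm_mul (q' z) (Ez z), norm_mul (q' z) (Eb z), mul_pow, mul_pow, ← mul_sub, abs_mul, abs_of_nonneg (by positivity : 0 ≤ ‖q' z‖^2)]
    have hEE : ‖Eb z‖^2 ≤ 2 * |‖Ez z‖^2 - ‖Eb z‖^2| := by
      have hz1 := hz.2
      have hzp : 0 < ‖z‖ := norm_pos_iff.2 (hA0 z hzA)
      have e1 : ‖deriv φ z‖ ≤ ‖Eb z‖ := by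
        rw [hEb]; dsimp only
        rw [norm_div, norm_neg, norm_pow, RCLike.norm_conj, le_div_iff₀ (by positivity)]
        have : ‖z‖^2 ≤ 1 := by nlinarith
        nlinarith [norm_nonneg (deriv φ z)]
      have e2 : ‖Ez z‖ ≤ 1/2 * ‖deriv φ z‖ := by
        rw [hEz]; dsimp only
        rw [norm_mul]
        have a1 := (GoodMap.refl_norm (hR0.trans hz.1.le) hz1).2.2
        have a2 := C.good.bound2 hz.1.le hz1
        have a3 : 0 < 1 - ‖z‖ := by linarith
        calc _ ≤ 4 * (1 - ‖z‖) * (ε / (1 - ‖z‖) * ‖deriv φ z‖) := by gcongr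
          _ = 4 * ε * ‖deriv φ z‖ := by field_simp
          _ ≤ _ := by gcongr; linarith
      have e3 : ‖Ez z‖^2 ≤ (1/2 * ‖Eb z‖)^2 := by
        apply pow_le_pow_left₀ (norm_nonneg _)
        linarith
      have := neg_abs_le (‖Ez z‖^2 - ‖Eb z‖^2)
      nlinarith
    have hm4 : ‖m' z‖^2 = 1 / ‖1 - z0 * (starRingEnd ℂ) (Q z)‖^4 := by
      rw [hm']; dsimp only
      rw [norm_inv, norm_pow]; ring
    have hTf2 : Tf z ^ 2 = ‖q' z‖^2 * ‖Eb z‖^2 * ‖m' z‖^2 := by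
      rw [hTf]; dsimp only
      rw [norm_mul, norm_mul]; ring
    rw [hTf2, ← hm4]
    calc ‖q' z‖^2 * ‖Eb z‖^2 * ‖m' z‖^2 ≤ ‖q' z‖^2 * (2 * |‖Ez z‖^2 - ‖Eb z‖^2|) * ‖m' z‖^2 := by gcongr
      _ = _ := by ring
  rw [hgfe] at hint
  set J := ∫⁻ z in ann R, ENNReal.ofReal (4 * (1 - ‖z‖)^2 * ‖deriv (deriv φ) z‖^2 / ‖φ z - w0‖^4)
  set x := ∫⁻ z in ann R, ‖b z‖ₑ
  have hx : x^2 ≤ 2 * ENNReal.ofReal (Real.pi / (1 - ‖z0‖^2)^2) * J := hint.trans (by gcongr)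
  have hsq : ∀ u v : ENNReal, (u + v)^2 ≤ 2 * u^2 + 2 * v^2 := fun u v => by
    have := ENNReal.rpow_add_le_mul_rpow_add_rpow u v (p := 2) (by norm_num)
    have h2 : ((2:ENNReal) ^ ((2:ℝ) - 1)) = 2 := by norm_num
    rw [h2] at this
    have h3 : ∀ t : ENNReal, t ^ (2:ℝ) = t^2 := fun t => by rw [← ENNReal.rpow_natCast]; norm_num
    rw [h3, h3, h3, mul_add] at this
    exact this
  refine (pow_le_pow_left₀ zero_le hst 2).trans ((hsq _ _).trans (add_le_add le_rfl ?_))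
  rw [mul_pow]
  calc 2 * (2^2 * x^2) = 8 * x^2 := by ring
    _ ≤ 8 * (2 * ENNReal.ofReal (Real.pi / (1 - ‖z0‖^2)^2) * J) := by gcongr
    _ = (16 * ENNReal.ofReal (Real.pi / (1 - ‖z0‖^2)^2)) * J := by ring
    _ = _ := by
      congr 1
      rw [show (16:ENNReal) = ENNReal.ofReal 16 by simp, ← ENNReal.ofReal_mul (by norm_num)]
      congr 1; ring

lemma exists_extData {Om : Set ℂ} {g : ℂ → ℂ} (hOm : IsOpen Om) (h0 : (0:ℂ) ∈ Om) (hg : DifferentiableOn ℂ g extDisk)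
    (hginj : InjOn g extDisk) (hgim : g '' extDisk = (closure Om)ᶜ) :
    ∃ gt q, ExtData gt q (closure Om)ᶜ ∧ ∀ z ∈ ball (0:ℂ) 1, z ≠ 0 → gt z = (g z⁻¹)⁻¹ ∧ g z⁻¹ ≠ 0 := by
  obtain ⟨G, Gd, Gi, G0, hG⟩ := exists_gt hOm h0 hg hginj hgim
  obtain ⟨Q, Qd, Qi, Qh, Qinj⟩ := univ_exists_inv isOpen_ball Gd Gi
  have hext : ∀ z ∈ ball (0:ℂ) 1, z ≠ 0 → z⁻¹ ∈ extDisk := fun z hz h => by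
    have h1 : ‖z‖ < 1 := by simpa using hz
    show 1 < ‖z⁻¹‖
    rw [norm_inv]; exact (one_lt_inv₀ (norm_pos_iff.2 h)).2 h1
  have key : ∀ w ∈ (closure Om)ᶜ, ∃ z ∈ ball (0:ℂ) 1, z ≠ 0 ∧ w ≠ 0 ∧ G z = w⁻¹ := fun w hw => by
    rw [← hgim] at hw
    obtain ⟨u, hu, rfl⟩ := hw
    have hu1 : 1 < ‖u‖ := hu
    have hu0 : u ≠ 0 := fun h => by rw [h, norm_zero] at hu1; linarith
    have hz : u⁻¹ ∈ ball (0:ℂ) 1 := by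
      rw [mem_ball_zero_iff, norm_inv]; exact inv_lt_one_of_one_lt₀ hu1
    have := hG _ hz (inv_ne_zero hu0)
    rw [inv_inv] at this
    exact ⟨_, hz, inv_ne_zero hu0, this.2, this.1⟩
  have hinvIm : ∀ w ∈ (closure Om)ᶜ, w⁻¹ ∈ G '' ball 0 1 := fun w hw => by
    obtain ⟨z, hz, -, -, h⟩ := key w hw
    exact ⟨z, hz, h⟩
  refine ⟨G, fun w => Q w⁻¹, ⟨Gd, Gi, G0, isClosed_closure.isOpen_compl, ?_, ?_, ?_, ?_⟩, hG⟩
  · refine Qd.comp (fun w hw => ?_) hinvIm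
    obtain ⟨z, hz, -, h, -⟩ := key w hw
    exact (differentiableAt_inv h).differentiableWithinAt
  · intro a ha b hb hab
    exact inv_injective (Qinj (hinvIm a ha) (hinvIm b hb) hab)
  · intro w hw
    obtain ⟨z, hz, h1, h2, h3⟩ := key w hw
    have : Q w⁻¹ = z := by rw [← h3, Qi z hz]
    simp only [this]
    exact ⟨hz, h1, h2, h3⟩
  · intro z hz h
    obtain ⟨h1, h2⟩ := hG z hz h
    refine ⟨by rw [h1]; exact inv_ne_zero h2, ?_, by simp only [inv_inv]; exact Qi z hz⟩
    rw [h1, inv_inv, ← hgim]; exact mem_image_of_mem _ (hext z hz h)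

lemma ext_compare {gt1 q1 gt2 q2 : ℂ → ℂ} {V1 V2 : Set ℂ} (X1 : ExtData gt1 q1 V1) (X2 : ExtData gt2 q2 V2)
    (hV : V1 ⊆ V2) : ∃ p : ℂ → ℂ, DifferentiableOn ℂ p (ball 0 1) ∧ MapsTo p (ball 0 1) (ball 0 1) ∧ p 0 = 0 ∧
      InjOn p (ball 0 1) ∧ ∀ z ∈ ball (0:ℂ) 1, gt2 (p z) = gt1 z := by
  obtain ⟨Q, Qd, Qi, Qh, Qinj⟩ := univ_exists_inv isOpen_ball X2.gd X2.gi
  have him : MapsTo gt1 (ball 0 1) (gt2 '' ball 0 1) := fun z hz => by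
    by_cases h : z = 0
    · exact ⟨0, by simp, by rw [h, X1.g0, X2.g0]⟩
    · obtain ⟨h1, h2, h3⟩ := X1.gq z hz h
      obtain ⟨a1, a2, a3, a4⟩ := X2.qm _ (hV h2)
      exact ⟨_, a1, by rw [a4, inv_inv]⟩
  refine ⟨fun z => Q (gt1 z), Qd.comp X1.gd him, ?_, ?_, ?_, ?_⟩
  · intro z hz
    obtain ⟨u, hu, h⟩ := him hz
    simp only [← h, Qi u hu]; exact hu
  · show Q (gt1 0) = 0
    rw [X1.g0.trans X2.g0.symm]; exact Qi 0 (by simp)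
  · intro a ha b hb hab
    exact X1.gi ha hb (Qinj (him ha) (him hb) hab)
  · intro z hz
    obtain ⟨u, hu, h⟩ := him hz
    simp only [← h, Qi u hu]

lemma ext_compare_norm {gt1 q1 gt2 q2 : ℂ → ℂ} {V1 V2 : Set ℂ} (X1 : ExtData gt1 q1 V1) (X2 : ExtData gt2 q2 V2)
    (hV : V1 ⊆ V2) {w : ℂ} (hw : w ∈ V1) : ‖q2 w‖ ≤ ‖q1 w‖ := by
  obtain ⟨p, pd, pm, p0, pi, hp⟩ := ext_compare X1 X2 hV
  obtain ⟨a1, a2, a3, a4⟩ := X1.qm w hw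
  obtain ⟨b1, b2, b3, b4⟩ := X2.qm w (hV hw)
  have h1 : p (q1 w) = q2 w := X2.gi (pm a1) b1 (by rw [hp _ a1, a4, b4])
  rw [← h1]
  exact Complex.norm_le_norm_of_mapsTo_ball pd (pm.mono_right ball_subset_closedBall) p0 (by simpa using a1)

section
variable {f gt q : ℂ → ℂ} {r : ℝ}

lemma clos_sub (hf : DifferentiableOn ℂ f (ball 0 1)) (hr1 : r < 1) :
    closure (f '' ball 0 r) ⊆ f '' closedBall 0 r :=
  closure_minimal (image_mono ball_subset_closedBall)
    ((isCompact_closedBall 0 r).image_of_continuousOn (hf.continuousOn.mono (closedBall_subset_ball hr1))).isClosed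

lemma sub_clos (hf : DifferentiableOn ℂ f (ball 0 1)) (hr0 : 0 < r) (hr1 : r < 1) :
    f '' closedBall 0 r ⊆ closure (f '' ball 0 r) := by
  rw [← closure_ball (0:ℂ) hr0.ne']
  have hc := hf.continuousOn.mono (closedBall_subset_ball hr1)
  rw [← closure_ball (0:ℂ) hr0.ne'] at hc
  exact hc.image_closure

lemma notin_clos (hf : DifferentiableOn ℂ f (ball 0 1)) (hfi : InjOn f (ball 0 1)) (hr1 : r < 1) {u : ℂ}
    (hu : r < ‖u‖) (hu1 : ‖u‖ < 1) : f u ∈ (closure (f '' ball 0 r))ᶜ := fun h => by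
  obtain ⟨v, hv, hvu⟩ := clos_sub hf hr1 h
  have hv' : ‖v‖ ≤ r := by simpa using hv
  have : v = u := hfi (by simp; linarith) (by simpa using hu1) hvu
  rw [this] at hv'; linarith

/-- tube argument near the circle of radius `r` -/
lemma tube_scale {K : Set ℂ} (hK : IsCompact K) (hK1 : ∀ z ∈ K, ‖z‖ ≤ 1) (hr0 : 0 < r) (hr1 : r < 1) {P : ℂ → Prop}
    (hP : ∀ z ∈ K, ∀ᶠ u in nhds ((r:ℂ) * z), P u) : ∀ᶠ s : ℝ in nhds r, ∀ z ∈ K, P ((s:ℂ) * z) := by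
  refine hK.eventually_forall_of_forall_eventually (P := fun s z => P (((s:ℝ):ℂ) * z)) fun z hz => ?_
  have hc : ContinuousAt (fun x : ℝ × ℂ => (x.1:ℂ) * x.2) (r, z) := by fun_prop
  exact hc.eventually (hP z hz)

lemma outer_q (hf : DifferentiableOn ℂ f (ball 0 1)) (hfi : InjOn f (ball 0 1)) (hf0 : f 0 = 0) (hr0 : 0 < r) (hr1 : r < 1)
    (X : ExtData gt q (closure (f '' ball 0 r))ᶜ) {k : ℝ} (hk : k < 1) :
    ∀ᶠ s : ℝ in nhdsWithin r (Ioi r), ∀ z : ℂ, ‖z‖ = 1 → k < ‖q (f (s * z))‖ := by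
  have hKc : IsClosed (gt '' closedBall 0 k) :=
    ((isCompact_closedBall 0 k).image_of_continuousOn (X.gd.continuousOn.mono (closedBall_subset_ball hk))).isClosed
  have h1 : ∀ᶠ s : ℝ in nhds r, ∀ z ∈ sphere (0:ℂ) 1, (f ((s:ℂ) * z))⁻¹ ∉ gt '' closedBall 0 k := by
    refine tube_scale (P := fun u => (f u)⁻¹ ∉ gt '' closedBall 0 k) (isCompact_sphere 0 1) (fun z hz => le_of_eq (by simpa using hz)) hr0 hr1 fun z hz => ?_
    have hz1 : ‖z‖ = 1 := by simpa using hz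
    have hn : ‖(r:ℂ) * z‖ = r := by rw [norm_mul, hz1, mul_one, Complex.norm_real, Real.norm_eq_abs, abs_of_pos hr0]
    have hmem : (r:ℂ) * z ∈ ball (0:ℂ) 1 := by rw [mem_ball_zero_iff, hn]; exact hr1
    have hne : f ((r:ℂ) * z) ≠ 0 := fun h => by
      have := hfi hmem (by simp) (h.trans hf0.symm)
      rw [this, norm_zero] at hn; linarith
    have hc : ContinuousAt (fun u => (f u)⁻¹) ((r:ℂ) * z) :=
      ((hf.differentiableAt (isOpen_ball.mem_nhds hmem)).continuousAt).inv₀ hne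
    refine hc.eventually (hKc.isOpen_compl.mem_nhds ?_)
    rintro ⟨ζ, hζ, h⟩
    have hζ1 : ζ ∈ ball (0:ℂ) 1 := closedBall_subset_ball hk hζ
    have hζ0 : ζ ≠ 0 := fun h0 => by
      rw [h0, X.g0] at h; exact inv_ne_zero hne h.symm
    have := (X.gq ζ hζ1 hζ0).2.1
    rw [h, inv_inv] at this
    exact this (sub_clos hf hr0 hr1 ⟨_, mem_closedBall_zero_iff.2 hn.le, rfl⟩)
  have h2 : ∀ᶠ s : ℝ in nhdsWithin r (Ioi r), s < 1 :=
    (tendsto_id.mono_left nhdsWithin_le_nhds).eventually (gt_mem_nhds hr1)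
  filter_upwards [nhdsWithin_le_nhds h1, h2, self_mem_nhdsWithin] with s hs hs1 hsr z hz
  by_contra hcon
  have hsr : r < s := hsr
  have hn : ‖(s:ℂ) * z‖ = s := by rw [norm_mul, hz, mul_one, Complex.norm_real, Real.norm_eq_abs, abs_of_pos (hr0.trans hsr)]
  obtain ⟨b1, b2, b3, b4⟩ := X.qm _ (notin_clos hf hfi hr1 (u := (s:ℂ) * z) (by rw [hn]; exact hsr) (by rw [hn]; exact hs1))
  exact hs z (by simpa using hz) ⟨_, by simpa using hcon, b4⟩

lemma outer_w (hf : DifferentiableOn ℂ f (ball 0 1)) (hr0 : 0 < r) (hr1 : r < 1)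
    {w0 : ℂ} (hw0 : w0 ∈ (closure (f '' ball 0 r))ᶜ) :
    ∃ c > 0, ∀ᶠ s : ℝ in nhds r, ∀ z : ℂ, ‖z‖ ≤ 1 → c < ‖f (s * z) - w0‖ := by
  obtain ⟨c, hc, hb⟩ := Metric.isOpen_iff.1 isClosed_closure.isOpen_compl w0 hw0
  refine ⟨c/2, by positivity, ?_⟩
  have := tube_scale (P := fun u => c/2 < ‖f u - w0‖) (isCompact_closedBall 0 1) (fun z hz => (by simpa using hz)) hr0 hr1 fun z hz => ?_
  · filter_upwards [this] with s hs z hz using hs z (by simpa using hz)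
  have hz1 : ‖z‖ ≤ 1 := by simpa using hz
  have hn : ‖(r:ℂ) * z‖ ≤ r := by
    rw [norm_mul, Complex.norm_real, Real.norm_eq_abs, abs_of_pos hr0]; nlinarith
  have hmem : (r:ℂ) * z ∈ ball (0:ℂ) 1 := by rw [mem_ball_zero_iff]; linarith
  have hcc : ContinuousAt (fun u => ‖f u - w0‖) ((r:ℂ) * z) :=
    (((hf.differentiableAt (isOpen_ball.mem_nhds hmem)).continuousAt).sub continuousAt_const).norm
  refine hcc.eventually (lt_mem_nhds ?_)
  by_contra hcon
  push Not at hcon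
  exact hb (by rw [mem_ball, dist_eq_norm]; linarith) (sub_clos hf hr0 hr1 ⟨_, mem_closedBall_zero_iff.2 hn, rfl⟩)

lemma outer_d (hf : DifferentiableOn ℂ f (ball 0 1)) (hr0 : 0 < r) (hr1 : r < 1) :
    ∃ B > 0, ∀ᶠ s : ℝ in nhds r, ∀ z : ℂ, ‖z‖ ≤ 1 → ‖deriv f (s * z)‖ < B := by
  have hd := (hf.deriv isOpen_ball)
  obtain ⟨B, hB⟩ := (isCompact_closedBall (0:ℂ) r).exists_bound_of_continuousOn (hd.continuousOn.mono (closedBall_subset_ball hr1))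
  refine ⟨|B|+1, by positivity, ?_⟩
  have := tube_scale (P := fun u => ‖deriv f u‖ < |B| + 1) (isCompact_closedBall 0 1) (fun z hz => (by simpa using hz)) hr0 hr1 fun z hz => ?_
  · filter_upwards [this] with s hs z hz using hs z (by simpa using hz)
  have hz1 : ‖z‖ ≤ 1 := by simpa using hz
  have hn : ‖(r:ℂ) * z‖ ≤ r := by
    rw [norm_mul, Complex.norm_real, Real.norm_eq_abs, abs_of_pos hr0]; nlinarith
  have hmem : (r:ℂ) * z ∈ ball (0:ℂ) 1 := by rw [mem_ball_zero_iff]; linarith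
  have hcc : ContinuousAt (fun u => ‖deriv f u‖) ((r:ℂ) * z) :=
    ((hd.differentiableAt (isOpen_ball.mem_nhds hmem)).continuousAt).norm
  refine hcc.eventually (gt_mem_nhds ?_)
  have := hB _ (mem_closedBall_zero_iff.2 hn)
  linarith [le_abs_self B]
end

lemma Eext_circle {φ : ℂ → ℂ} {z : ℂ} (hz : ‖z‖ = 1) : Eext φ z = φ z := by
  have h1 : (starRingEnd ℂ) z * z = 1 := by
    rw [mul_comm, Complex.mul_conj, Complex.normSq_eq_norm_sq, hz]; norm_num
  have h2 : ((starRingEnd ℂ) z)⁻¹ = z := inv_eq_of_mul_eq_one_right h1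
  simp [Eext, h2]

lemma cauchy_diff {z0 ζ : ℂ} {k a : ℝ} (ha : ‖z0‖ = a) (hak : a < k) (hk : k < ‖ζ‖) (hζ : ‖ζ‖ < 1) :
    ‖(ζ - z0)⁻¹ - (starRingEnd ℂ) ζ / (1 - z0 * (starRingEnd ℂ) ζ)‖ ≤ (1 - k^2) / ((k - a) * (1 - a)) := by
  have ha0 : 0 ≤ a := ha ▸ norm_nonneg _
  have hne : ζ - z0 ≠ 0 := fun h => by
    rw [sub_eq_zero] at h; rw [h, ha] at hk; linarith
  have hd := den_ne (a := z0) (ζ := ζ) (by linarith) hζ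
  have e : (ζ - z0)⁻¹ - (starRingEnd ℂ) ζ / (1 - z0 * (starRingEnd ℂ) ζ) =
      (1 - ζ * (starRingEnd ℂ) ζ) / ((ζ - z0) * (1 - z0 * (starRingEnd ℂ) ζ)) := by
    field_simp; ring
  have e2 : (1 - ζ * (starRingEnd ℂ) ζ) = ((1 - ‖ζ‖^2 : ℝ) : ℂ) := by
    rw [Complex.mul_conj, Complex.normSq_eq_norm_sq]; push_cast; ring
  rw [e, norm_div, norm_mul, e2, Complex.norm_real, Real.norm_eq_abs, abs_of_nonneg (by nlinarith)]
  have h1 : k - a ≤ ‖ζ - z0‖ := by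
    have := norm_sub_norm_le ζ z0; linarith
  have h2 : 1 - a ≤ ‖1 - z0 * (starRingEnd ℂ) ζ‖ := by
    have := norm_sub_norm_le 1 (z0 * (starRingEnd ℂ) ζ)
    rw [norm_mul, RCLike.norm_conj, norm_one, ha] at this
    nlinarith
  refine div_le_div₀ (by nlinarith) (by nlinarith) (mul_pos (by linarith) (by linarith)) ?_
  exact mul_le_mul h1 h2 (by linarith) (by positivity)

lemma outer_circle {gt q φ : ℂ → ℂ} {V : Set ℂ} (X : ExtData gt q V) {ρ : ℝ} (hρ : 1 < ρ)
    (hφ : DifferentiableOn ℂ φ (ball 0 ρ)) (hφi : InjOn φ (ball 0 ρ)) (hφ0 : φ 0 = 0)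
    {z0 : ℂ} (hz0 : z0 ∈ ball (0:ℂ) 1) (hz00 : z0 ≠ 0) {k B c : ℝ} (hc : 0 < c) (hak : ‖z0‖ < k)
    (hV : ∀ z : ℂ, ‖z‖ = 1 → φ z ∈ V) (hq : ∀ z : ℂ, ‖z‖ = 1 → k < ‖q (φ z)‖)
    (hB : ∀ z : ℂ, ‖z‖ = 1 → ‖deriv φ z‖ ≤ B) (hcw : ∀ z : ℂ, ‖z‖ = 1 → c ≤ ‖φ z - (gt z0)⁻¹‖) :
    ‖schwarzian gt z0‖ ≤ ‖deriv gt z0 / (gt z0)^2‖ * ‖∮ z in C(0, 1), Pker φ q z0 (gt z0)⁻¹ z‖ +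
      ‖deriv gt z0 / (gt z0)^2‖ * (2 * Real.pi * ((1 - k^2) / ((k - ‖z0‖) * (1 - ‖z0‖)) * (B / c^2))) := by
  have hres := curve_residue X hρ hφ hφi hφ0 hz0 hz00 hV (fun z hz => hak.trans (hq z hz))
  set w0 := (gt z0)⁻¹ with hw0
  set P1 : ℂ → ℂ := fun z => (starRingEnd ℂ) (q (φ z)) / (1 - z0 * (starRingEnd ℂ) (q (φ z))) * (deriv φ z / (φ z - w0)^2) with hP1
  set P2 : ℂ → ℂ := fun z => deriv φ z / ((q (φ z) - z0) * (φ z - w0)^2) with hP2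
  have hz01 : ‖z0‖ < 1 := by simpa using hz0
  have hqm : ∀ z : ℂ, ‖z‖ = 1 → ‖q (φ z)‖ < 1 := fun z hz => by simpa using (X.qm _ (hV z hz)).1
  have hsub : sphere (0:ℂ) 1 ⊆ ball 0 ρ := fun z hz => by
    have : ‖z‖ = 1 := by simpa using hz
    rw [mem_ball_zero_iff, this]; exact hρ
  have hs1 : ∀ z ∈ sphere (0:ℂ) 1, ‖z‖ = 1 := fun z hz => by simpa using hz
  have cφ : ContinuousOn φ (sphere 0 1) := hφ.continuousOn.mono hsub
  have cφ' : ContinuousOn (deriv φ) (sphere 0 1) := (hφ.deriv isOpen_ball).continuousOn.mono hsub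
  have cq : ContinuousOn (fun z => q (φ z)) (sphere 0 1) := X.qd.continuousOn.comp cφ (fun z hz => hV z (hs1 z hz))
  have cqb : ContinuousOn (fun z => (starRingEnd ℂ) (q (φ z))) (sphere 0 1) := Complex.continuous_conj.comp_continuousOn cq
  have hwne : ∀ z ∈ sphere (0:ℂ) 1, φ z - w0 ≠ 0 := fun z hz => norm_pos_iff.1 (hc.trans_le (hcw z (hs1 z hz)))
  have hqne : ∀ z ∈ sphere (0:ℂ) 1, q (φ z) - z0 ≠ 0 := fun z hz h => by
    have := hq z (hs1 z hz)
    rw [sub_eq_zero.1 h] at this; linarith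
  have c1 : ContinuousOn P1 (sphere 0 1) :=
    (cqb.div (continuousOn_const.sub (continuousOn_const.mul cqb)) (fun z hz => den_ne hz01 (hqm z (hs1 z hz)))).mul
      (cφ'.div ((cφ.sub continuousOn_const).pow 2) (fun z hz => pow_ne_zero 2 (hwne z hz)))
  have c2 : ContinuousOn P2 (sphere 0 1) :=
    cφ'.div ((cq.sub continuousOn_const).mul ((cφ.sub continuousOn_const).pow 2))
      (fun z hz => mul_ne_zero (hqne z hz) (pow_ne_zero 2 (hwne z hz)))
  have i1 := c1.circleIntegrable zero_le_one
  have i2 := c2.circleIntegrable zero_le_one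
  have e1 : (∮ z in C(0, 1), Pker φ q z0 w0 z) = ∮ z in C(0, 1), P1 z :=
    circleIntegral.integral_congr zero_le_one fun z hz => by
      simp only [Pker, Eext_circle (φ := φ) (hs1 z hz), hP1]
  have e2 : ‖(∮ z in C(0, 1), P2 z) - ∮ z in C(0, 1), P1 z‖ ≤ 2 * Real.pi * 1 * ((1 - k^2) / ((k - ‖z0‖) * (1 - ‖z0‖)) * (B / c^2)) := by
    rw [← circleIntegral.integral_sub i2 i1]
    refine circleIntegral.norm_integral_le_of_norm_le_const zero_le_one fun z hz => ?_
    have hz1 := hs1 z hz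
    have : P2 z - P1 z = ((q (φ z) - z0)⁻¹ - (starRingEnd ℂ) (q (φ z)) / (1 - z0 * (starRingEnd ℂ) (q (φ z)))) * (deriv φ z / (φ z - w0)^2) := by
      simp only [hP1, hP2]
      rw [sub_mul]; congr 1
      have := hwne z hz
      have := hqne z hz
      field_simp
    rw [this, norm_mul]
    have hd := cauchy_diff rfl hak (hq z hz1) (hqm z hz1)
    refine mul_le_mul hd ?_ (norm_nonneg _) ((norm_nonneg _).trans hd)
    rw [norm_div, norm_pow]
    exact div_le_div₀ ((norm_nonneg _).trans (hB z hz1)) (hB z hz1) (by positivity) (pow_le_pow_left₀ hc.le (hcw z hz1) 2)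
  have e3 := congrArg norm hres
  rw [norm_mul, norm_mul, norm_neg, neg_div, norm_neg, norm_div (schwarzian gt z0)] at e3
  have e4 : ‖(2 * (Real.pi:ℂ) * I)‖ = 2 * Real.pi := by
    simp [abs_of_pos Real.pi_pos]
  have e5 : ‖(6:ℂ)‖ = 6 := by simp
  rw [e4, e5] at e3
  set g' := ‖deriv gt z0 / (gt z0)^2‖
  have hg' : 0 ≤ g' := norm_nonneg _
  have e6 : ‖schwarzian gt z0‖ ≤ 2 * Real.pi * (‖schwarzian gt z0‖ / 6) := by
    nlinarith [Real.pi_gt_three, norm_nonneg (schwarzian gt z0)]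
  rw [← e3] at e6
  refine e6.trans ?_
  rw [e1, mul_comm _ g', ← mul_add]
  refine mul_le_mul_of_nonneg_left ?_ hg'
  have := norm_le_norm_add_norm_sub' (∮ z in C(0, 1), P2 z) (∮ z in C(0, 1), P1 z)
  linarith

lemma scale_diff {f : ℂ → ℂ} (hf : DifferentiableOn ℂ f (ball 0 1)) {s : ℝ} (hs : 0 < s) :
    DifferentiableOn ℂ (fun z => f (s * z)) (ball 0 s⁻¹) ∧ (∀ z ∈ ball (0:ℂ) s⁻¹, (s:ℂ) * z ∈ ball (0:ℂ) 1) ∧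
    (∀ z, deriv (fun z => f (s * z)) z = s * deriv f (s * z)) := by
  have hm : ∀ z ∈ ball (0:ℂ) s⁻¹, (s:ℂ) * z ∈ ball (0:ℂ) 1 := fun z hz => by
    have hz : ‖z‖ < s⁻¹ := by simpa using hz
    rw [mem_ball_zero_iff, norm_mul, Complex.norm_real, Real.norm_eq_abs, abs_of_pos hs]
    calc s * ‖z‖ < s * s⁻¹ := by gcongr
      _ = 1 := mul_inv_cancel₀ hs.ne'
  refine ⟨hf.comp (by fun_prop) hm, hm, fun z => ?_⟩
  have := deriv_comp_mul_left (s:ℂ) f z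
  simpa using this

lemma outer_main {f gt q : ℂ → ℂ} {r : ℝ} (hf : DifferentiableOn ℂ f (ball 0 1)) (hfi : InjOn f (ball 0 1)) (hf0 : f 0 = 0)
    (hr0 : 0 < r) (hr1 : r < 1) (X : ExtData gt q (closure (f '' ball 0 r))ᶜ) {z0 : ℂ} (hz0 : z0 ∈ ball (0:ℂ) 1) (hz00 : z0 ≠ 0)
    {η : ℝ} (hη : 0 < η) : ∀ᶠ s : ℝ in nhdsWithin r (Ioi r), (∀ z : ℂ, ‖z‖ ≤ 1 → f (s * z) ≠ (gt z0)⁻¹) ∧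
      ‖schwarzian gt z0‖ ≤ ‖deriv gt z0 / (gt z0)^2‖ *
        ‖∮ z in C(0, 1), Pker (fun z => f (s * z)) q z0 (gt z0)⁻¹ z‖ + η := by
  have hz01 : ‖z0‖ < 1 := by simpa using hz0
  obtain ⟨c, hc, hcw⟩ := outer_w hf hr0 hr1 (X.gq z0 hz0 hz00).2.1
  obtain ⟨B, hB, hBd⟩ := outer_d hf hr0 hr1
  obtain ⟨k, hk1, hk2, hk3⟩ : ∃ k, ‖z0‖ < k ∧ k < 1 ∧ ‖deriv gt z0 / (gt z0)^2‖ * (2 * Real.pi * ((1 - k^2) / ((k - ‖z0‖) * (1 - ‖z0‖)) * (B / c^2))) < η := by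
    have hcont : ContinuousAt (fun k : ℝ => ‖deriv gt z0 / (gt z0)^2‖ * (2 * Real.pi * ((1 - k^2) / ((k - ‖z0‖) * (1 - ‖z0‖)) * (B / c^2)))) 1 := by
      have : (1 - ‖z0‖) * (1 - ‖z0‖) ≠ 0 := mul_ne_zero (by linarith) (by linarith)
      fun_prop (disch := assumption)
    have h1 := hcont.eventually (gt_mem_nhds (a := η) (by dsimp only; rw [one_pow, sub_self, zero_div, zero_mul, mul_zero, mul_zero]; exact hη))
    have h2 := (lt_mem_nhds hz01)
    have h3 : ∀ᶠ k : ℝ in nhdsWithin 1 (Iio 1), k < 1 := self_mem_nhdsWithin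
    obtain ⟨k, a, b, c⟩ := ((h1.filter_mono nhdsWithin_le_nhds).and ((Filter.Eventually.filter_mono nhdsWithin_le_nhds h2).and h3)).exists
    exact ⟨k, b, c, a⟩
  have h2 : ∀ᶠ s : ℝ in nhdsWithin r (Ioi r), s < 1 :=
    (tendsto_id.mono_left nhdsWithin_le_nhds).eventually (gt_mem_nhds hr1)
  filter_upwards [nhdsWithin_le_nhds hcw, nhdsWithin_le_nhds hBd, outer_q hf hfi hf0 hr0 hr1 X hk2, h2, self_mem_nhdsWithin] with s h1 h2 h3 hs1 hsr
  have hsr : r < s := hsr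
  have hs0 : 0 < s := hr0.trans hsr
  obtain ⟨d1, d2, d3⟩ := scale_diff hf hs0
  refine ⟨fun z hz h => ?_, ?_⟩
  · have := h1 z hz
    rw [h, sub_self, norm_zero] at this; linarith
  refine (outer_circle X (one_lt_inv₀ hs0 |>.2 hs1) d1 ?_ (by simp [hf0]) hz0 hz00 hc hk1 ?_ h3 (B := B) ?_ ?_).trans ?_
  · intro a ha b hb hab
    have := hfi (d2 a ha) (d2 b hb) hab
    exact mul_left_cancel₀ (by exact_mod_cast hs0.ne') this
  · intro z hz
    have hn : ‖(s:ℂ) * z‖ = s := by rw [norm_mul, hz, mul_one, Complex.norm_real, Real.norm_eq_abs, abs_of_pos hs0]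
    exact notin_clos hf hfi hr1 (by rw [hn]; exact hsr) (by rw [hn]; exact hs1)
  · intro z hz
    rw [d3, norm_mul, Complex.norm_real, Real.norm_eq_abs, abs_of_pos hs0]
    have := h2 z hz.le
    nlinarith [norm_nonneg (deriv f (s * z))]
  · intro z hz; exact (h1 z hz.le).le
  · linarith

lemma notin_of_out {A : Set ℂ} {w : ℂ} {c : ℝ} (hc : 0 < c) (h : ∀ a ∈ A, c ≤ ‖a - w‖) : w ∈ (closure A)ᶜ := fun hw => by
  obtain ⟨a, ha, hd⟩ := Metric.mem_closure_iff.1 hw c hc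
  have := h a ha
  rw [dist_comm, dist_eq_norm] at hd; linarith

lemma collar_mem {f : ℂ → ℂ} {r s ε R : ℝ} (hf : DifferentiableOn ℂ f (ball 0 1)) (hfi : InjOn f (ball 0 1)) (hr0 : 0 < r) (hr1 : r < 1)
    (hrs : r < s) (hs1 : s < 1) (C : CollarMap (fun z => f (s * z)) ε R) {z : ℂ} (hz : R ≤ ‖z‖) (hz1 : ‖z‖ ≤ 1) :
    Eext (fun z => f (s * z)) z ∈ (closure (f '' ball 0 r))ᶜ := by
  have hs0 := hr0.trans hrs
  rcases hz1.lt_or_eq with h | h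
  · obtain ⟨c, hc, hcc⟩ := C.out z hz h
    refine notin_of_out hc ?_
    rintro a ⟨u, hu, rfl⟩
    have hu : ‖u‖ < r := by simpa using hu
    have e : (s:ℂ) * (u / s) = u := by
      have : (s:ℂ) ≠ 0 := by exact_mod_cast hs0.ne'
      field_simp
    have := hcc (u / s) (by
      rw [norm_div, Complex.norm_real, Real.norm_eq_abs, abs_of_pos hs0, div_lt_one hs0]; linarith)
    rwa [e] at this
  · rw [Eext_circle h]
    have hn : ‖(s:ℂ) * z‖ = s := by rw [norm_mul, h, mul_one, Complex.norm_real, Real.norm_eq_abs, abs_of_pos hs0]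
    exact notin_clos hf hfi hr1 (by rw [hn]; exact hrs) (by rw [hn]; exact hs1)

lemma inner_q {f gt1 q1 : ℂ → ℂ} {ε R : ℝ} (hf : DifferentiableOn ℂ f (ball 0 1))
    (X1 : ExtData gt1 q1 (closure (f '' ball 0 1))ᶜ) (C : CollarMap f ε R) :
    ∃ k, 0 < k ∧ k < 1 ∧ ∃ s1 : ℝ, s1 < 1 ∧ ∀ s : ℝ, s1 < s → s < 1 → ∀ z : ℂ, ‖z‖ = R →
      Eext (fun z => f (s * z)) z ∈ (closure (f '' ball 0 1))ᶜ ∧ ‖q1 (Eext (fun z => f (s * z)) z)‖ < k := by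
  have hR0 := C.good.hR0
  have hR1 := C.good.hR1
  set V := (closure (f '' ball 0 1))ᶜ with hV
  have hmem : ∀ z : ℂ, ‖z‖ = R → Eext f z ∈ V := fun z hz => by
    obtain ⟨c, hc, hcc⟩ := C.out z hz.ge (by linarith)
    refine notin_of_out hc ?_
    rintro a ⟨u, hu, rfl⟩
    exact hcc u (by simpa using hu)
  have hs : ∀ z ∈ sphere (0:ℂ) R, ‖z‖ = R := fun z hz => by simpa using hz
  set Eh : ℝ × ℂ → ℂ := fun x => f (x.1 * x.2) + (((starRingEnd ℂ) x.2)⁻¹ - x.2) * (x.1 * deriv f (x.1 * x.2)) with hEh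
  have hcE : ∀ z : ℂ, ‖z‖ = R → ContinuousAt Eh (1, z) := fun z hz => by
    have hz0 : (starRingEnd ℂ) z ≠ 0 := fun h => by
      rw [map_eq_zero] at h; rw [h, norm_zero] at hz; linarith
    have hb : z ∈ ball (0:ℂ) 1 := by rw [mem_ball_zero_iff]; linarith
    have e : (((1:ℝ), z).1 : ℂ) * ((1:ℝ), z).2 = z := by simp
    have c0 : ContinuousAt (fun x : ℝ × ℂ => (x.1:ℂ) * x.2) (1, z) := by fun_prop
    have c1 : ContinuousAt (fun x : ℝ × ℂ => f (x.1 * x.2)) (1, z) :=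
      ContinuousAt.comp_of_eq (hf.differentiableAt (isOpen_ball.mem_nhds hb)).continuousAt c0 e
    have c2 : ContinuousAt (fun x : ℝ × ℂ => deriv f (x.1 * x.2)) (1, z) :=
      ContinuousAt.comp_of_eq ((hf.deriv isOpen_ball).differentiableAt (isOpen_ball.mem_nhds hb)).continuousAt c0 e
    have c3 : ContinuousAt (fun x : ℝ × ℂ => ((starRingEnd ℂ) x.2)⁻¹) (1, z) :=
      ContinuousAt.inv₀ (Complex.continuous_conj.continuousAt.comp continuousAt_snd) hz0
    have c4 : ContinuousAt (fun x : ℝ × ℂ => (x.1 : ℂ)) (1, z) := by fun_prop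
    exact c1.add ((c3.sub continuousAt_snd).mul (c4.mul c2))
  have hE1 : ∀ z, Eh (1, z) = Eext f z := fun z => by simp [hEh, Eext]
  have hcq : ∀ z : ℂ, ‖z‖ = R → ContinuousAt (fun x => ‖q1 (Eh x)‖) (1, z) := fun z hz => by
    have : ContinuousAt q1 (Eext f z) := (X1.qd.differentiableAt (X1.Vo.mem_nhds (hmem z hz))).continuousAt
    exact (ContinuousAt.comp_of_eq this (hcE z hz) (hE1 z)).norm
  obtain ⟨k, hk0, hk1, hk⟩ : ∃ k, 0 < k ∧ k < 1 ∧ ∀ z : ℂ, ‖z‖ = R → ‖q1 (Eext f z)‖ < k := by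
    have hne : (sphere (0:ℂ) R).Nonempty := NormedSpace.sphere_nonempty.2 (by linarith)
    have hcc : ContinuousOn (fun z => ‖q1 (Eext f z)‖) (sphere 0 R) := fun z hz => by
      have h1 : ContinuousAt (fun z : ℂ => ((1:ℝ), z)) z := by fun_prop
      have := ContinuousAt.comp_of_eq (f := fun z : ℂ => ((1:ℝ), z)) (hcq z (hs z hz)) h1 rfl
      refine ContinuousAt.continuousWithinAt ?_
      refine this.congr (Eventually.of_forall fun u => ?_)
      simp only [Function.comp, hE1]
    obtain ⟨z1, hz1, hmax⟩ := (isCompact_sphere (0:ℂ) R).exists_isMaxOn hne hcc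
    have h1 : ‖q1 (Eext f z1)‖ < 1 := by simpa using (X1.qm _ (hmem z1 (hs z1 hz1))).1
    refine ⟨(‖q1 (Eext f z1)‖ + 1)/2, by positivity, by linarith, fun z hz => ?_⟩
    have : ‖q1 (Eext f z)‖ ≤ ‖q1 (Eext f z1)‖ := hmax (by simpa using hz)
    linarith
  refine ⟨k, hk0, hk1, ?_⟩
  have htube : ∀ᶠ s : ℝ in nhds 1, ∀ z ∈ sphere (0:ℂ) R, Eh (s, z) ∈ V ∧ ‖q1 (Eh (s, z))‖ < k := by
    refine (isCompact_sphere (0:ℂ) R).eventually_forall_of_forall_eventually (P := fun s z => Eh (s, z) ∈ V ∧ ‖q1 (Eh (s, z))‖ < k) fun z hz => ?_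
    have h1 := (hcE z (hs z hz)).eventually (X1.Vo.mem_nhds (by rw [hE1]; exact hmem z (hs z hz)))
    have h2 := (hcq z (hs z hz)).eventually (gt_mem_nhds (a := k) (by dsimp only; rw [hE1]; exact hk z (hs z hz)))
    exact h1.and h2
  obtain ⟨δ, hδ, hb⟩ := Metric.eventually_nhds_iff.1 htube
  refine ⟨1 - δ, by linarith, fun s h1 h2 z hz => ?_⟩
  have := hb (y := s) (by rw [Real.dist_eq, abs_lt]; constructor <;> linarith) z (by simpa using hz)
  have e : Eext (fun z => f (s * z)) z = Eh (s, z) := by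
    have := deriv_comp_mul_left (s:ℂ) f z
    simp only [smul_eq_mul] at this
    simp only [Eext, hEh, this]
  rw [e]; exact this

lemma inner_circle {f gt1 q1 : ℂ → ℂ} {ε R s0 : ℝ} (hf : DifferentiableOn ℂ f (ball 0 1)) (hfi : InjOn f (ball 0 1))
    (X1 : ExtData gt1 q1 (closure (f '' ball 0 1))ᶜ) (hs0 : 1/2 ≤ s0) (hs01 : s0 < 1)
    (C : ∀ s : ℝ, s0 ≤ s → s ≤ 1 → CollarMap (fun z => f (s * z)) ε R) :
    ∃ K s1, 0 < K ∧ s0 ≤ s1 ∧ s1 < 1 ∧ ∀ r s : ℝ, s1 ≤ r → r < s → s < 1 → ∀ gt q, ExtData gt q (closure (f '' ball 0 r))ᶜ →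
      ∀ z0 ∈ ball (0:ℂ) 1, ∀ w0, (∀ z : ℂ, ‖z‖ ≤ 1 → f (s * z) ≠ w0) →
        ‖∮ z in C(0, R), Pker (fun z => f (s * z)) q z0 w0 z‖ ≤ K := by
  have C1 := C 1 hs01.le le_rfl
  have e1 : (fun z => f (((1:ℝ):ℂ) * z)) = f := by ext z; simp
  rw [e1] at C1
  obtain ⟨k, hk0, hk1, s1, hs1, hq⟩ := inner_q hf X1 C1
  have hR0 := C1.good.hR0
  have hR1 := C1.good.hR1
  have hsub : closedBall (0:ℂ) R ⊆ ball 0 1 := closedBall_subset_ball hR1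
  have hd := (hf.deriv isOpen_ball).continuousOn.mono hsub
  obtain ⟨M, hM⟩ := (isCompact_closedBall (0:ℂ) R).exists_bound_of_continuousOn hd
  obtain ⟨u, hu, hmin⟩ := (isCompact_closedBall (0:ℂ) R).exists_isMinOn ⟨0, by simp; linarith⟩ hd.norm
  set m := ‖deriv f u‖ with hm
  have hm0 : 0 < m := norm_pos_iff.2 (univ_deriv_ne isOpen_ball hf hfi (hsub hu))
  have hM0 : 0 < M := hm0.trans_le (hM u hu)
  set c := (1 - R)/40 * (m / 2) with hc
  have hc0 : 0 < c := by have : 0 < 1 - R := by linarith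
                         positivity
  refine ⟨2 * Real.pi * R * (k/(1-k) * (M / c^2)), max s0 s1, ?_, le_max_left _ _, max_lt hs01 hs1, ?_⟩
  · have : 0 < 1 - k := by linarith
    have := Real.pi_pos
    positivity
  intro r s hr hrs hs gt q X z0 hz0 w0 hw0
  have hr0 : s0 ≤ r := (le_max_left _ _).trans hr
  have hr1 : s1 ≤ r := (le_max_right _ _).trans hr
  have hsp : 0 < s := by linarith
  have hz01 : ‖z0‖ < 1 := by simpa using hz0
  refine circleIntegral.norm_integral_le_of_norm_le_const (by linarith) fun z hz => ?_
  have hzR : ‖z‖ = R := by simpa using hz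
  obtain ⟨h1, h2⟩ := hq s (by linarith) hs z hzR
  have hVsub : (closure (f '' ball 0 1))ᶜ ⊆ (closure (f '' ball 0 r))ᶜ :=
    compl_subset_compl.2 (closure_mono (image_mono (ball_subset_ball (by linarith))))
  have h3 := (ext_compare_norm X1 X hVsub h1).trans_lt h2
  have hsz : (s:ℂ) * z ∈ closedBall (0:ℂ) R := by
    rw [mem_closedBall_zero_iff, norm_mul, Complex.norm_real, Real.norm_eq_abs, abs_of_pos hsp, hzR]; nlinarith
  have hder : ‖deriv (fun z => f (s * z)) z‖ = s * ‖deriv f (s * z)‖ := by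
    rw [(scale_diff hf hsp).2.2, norm_mul, Complex.norm_real, Real.norm_eq_abs, abs_of_pos hsp]
  have hlow : m ≤ ‖deriv f (s * z)‖ := hmin hsz
  have hup := hM _ hsz
  have hkoe := (C s (by linarith) hs.le).koebe z hzR.ge (by linarith) w0 (by
    rintro ⟨v, hv, hvw⟩
    exact hw0 v (by have : ‖v‖ < 1 := by simpa using hv
                    exact this.le) hvw)
  rw [hder, hzR] at hkoe
  have hcle : c ≤ ‖f (s * z) - w0‖ := by
    refine le_trans ?_ hkoe
    rw [hc]
    refine mul_le_mul_of_nonneg_left ?_ (by linarith)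
    nlinarith
  unfold Pker
  rw [norm_mul]
  refine mul_le_mul ?_ ?_ (norm_nonneg _) (div_nonneg hk0.le (by linarith))
  · rw [norm_div, RCLike.norm_conj]
    refine div_le_div₀ hk0.le h3.le (by linarith) ?_
    have := norm_sub_norm_le 1 (z0 * (starRingEnd ℂ) (q (Eext (fun z => f (s * z)) z)))
    rw [norm_mul, RCLike.norm_conj, norm_one] at this
    nlinarith [norm_nonneg z0, norm_nonneg (q (Eext (fun z => f (s * z)) z))]
  · rw [norm_div, norm_pow, hder]
    refine div_le_div₀ hM0.le ?_ (by positivity) (pow_le_pow_left₀ hc0.le hcle 2)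
    nlinarith [norm_nonneg (deriv f (s * z))]

lemma vol_le {A : Set ℂ} {b : ℝ} (hb : 0 ≤ b) (hA : ∀ w ∈ A, ‖w‖ ≤ b) : volume A ≤ ENNReal.ofReal (Real.pi * b^2) := by
  calc volume A ≤ volume (closedBall (0:ℂ) b) := measure_mono fun w hw => by simpa using hA w hw
    _ = ENNReal.ofReal (Real.pi * b^2) := by
      rw [Complex.volume_closedBall, ENNReal.ofReal_mul Real.pi_pos.le, ENNReal.ofReal_pow hb, mul_comm, ← NNReal.coe_real_pi, ENNReal.ofReal_coe_nnreal]

lemma gh_deriv {gt q : ℂ → ℂ} {V : Set ℂ} (X : ExtData gt q V) {z0 : ℂ} (hz0 : z0 ∈ ball (0:ℂ) 1) (h : z0 ≠ 0) :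
    HasDerivAt (fun z => (gt z)⁻¹) (-(deriv gt z0 / (gt z0)^2)) z0 := by
  have := ((X.gd.differentiableAt (isOpen_ball.mem_nhds hz0)).hasDerivAt).inv (X.gq z0 hz0 h).1
  exact this.congr_deriv (by ring)

lemma tonelli_inner {gt q : ℂ → ℂ} {V U : Set ℂ} (X : ExtData gt q V) (hU : IsOpen U) (hU1 : U ⊆ ball 0 1) (hU0 : (0:ℂ) ∉ U)
    {p : ℂ} {b : ℝ} (hb : 0 < b) (hp : ∀ z ∈ U, b ≤ ‖p - (gt z)⁻¹‖) :
    ∫⁻ z in U, ENNReal.ofReal (‖deriv gt z / (gt z)^2‖^2 / ‖p - (gt z)⁻¹‖^4) ≤ ENNReal.ofReal (Real.pi / b^2) := by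
  have h0 : ∀ z ∈ U, z ≠ 0 := fun z hz h => hU0 (h ▸ hz)
  set k : ℂ → ℂ := fun z => (p - (gt z)⁻¹)⁻¹ with hk
  have hne : ∀ z ∈ U, p - (gt z)⁻¹ ≠ 0 := fun z hz => norm_pos_iff.1 (hb.trans_le (hp z hz))
  have hd : ∀ z ∈ U, HasDerivAt k (-(deriv gt z / (gt z)^2) / (p - (gt z)⁻¹)^2) z := fun z hz => by
    have := ((gh_deriv X (hU1 hz) (h0 z hz)).const_sub p).inv (hne z hz)
    exact this.congr_deriv (by ring)
  have hkd : DifferentiableOn ℂ k U := fun z hz => (hd z hz).differentiableAt.differentiableWithinAt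
  have hki : InjOn k U := fun a ha c hc hac => by
    have h1 := inv_injective hac
    have h2 : gt a = gt c := inv_injective (sub_right_injective h1)
    exact X.gi (hU1 ha) (hU1 hc) h2
  have := cov_lintegral hU hkd hki (fun _ => 1)
  rw [setLIntegral_one] at this
  have e : ∫⁻ z in U, ENNReal.ofReal (‖deriv gt z / (gt z)^2‖^2 / ‖p - (gt z)⁻¹‖^4) = volume (k '' U) := by
    rw [this]
    refine setLIntegral_congr_fun hU.measurableSet fun z hz => ?_
    simp only [mul_one]
    rw [(hd z hz).deriv, norm_div (-_), norm_neg, norm_pow (p - _), div_pow _ (‖p - _‖ ^ 2), ← pow_mul]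
  rw [e]
  refine (vol_le (b := b⁻¹) (by positivity) ?_).trans (le_of_eq (by congr 1; field_simp))
  rintro _ ⟨z, hz, rfl⟩
  simp only [hk, norm_inv]
  exact inv_anti₀ hb (hp z hz)

lemma gt_low {gt1 q1 gt q : ℂ → ℂ} {V1 V : Set ℂ} {δ : ℝ} (X1 : ExtData gt1 q1 V1) (X : ExtData gt q V) (hV : V1 ⊆ V)
    (hδ0 : 0 < δ) (hδ : ball 0 δ ⊆ gt1 '' ball 0 1) {z : ℂ} (hz : z ∈ ball (0:ℂ) 1) (hz2 : 1/2 ≤ ‖z‖) : δ / 2 ≤ ‖gt z‖ := by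
  obtain ⟨p, pd, pm, p0, pi, hp⟩ := ext_compare X1 X hV
  obtain ⟨Q, Qd, Qi, Qh, Qinj⟩ := univ_exists_inv isOpen_ball X.gd X.gi
  have hsub : ball 0 δ ⊆ gt '' ball 0 1 := fun w hw => by
    obtain ⟨u, hu, rfl⟩ := hδ hw
    exact ⟨p u, pm hu, hp u hu⟩
  by_contra hlt
  push Not at hlt
  have hm : gt z ∈ ball (0:ℂ) δ := by rw [mem_ball_zero_iff]; linarith
  have hQ0 : Q 0 = 0 := by
    have := Qi 0 (by simp)
    rwa [X.g0] at this
  have := dist_le_div_mul_dist_of_mapsTo_ball (R₂ := 1) (Qd.mono hsub) (fun w hw => by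
    obtain ⟨u, hu, rfl⟩ := hsub hw
    rw [Qi u hu, hQ0]; exact ball_subset_closedBall hu) hm
  rw [Qi z hz, hQ0, dist_zero_right, dist_zero_right] at this
  have h3 : 1 / δ * ‖gt z‖ < 1 / δ * (δ / 2) := by gcongr
  have h4 : 1 / δ * (δ / 2) = 1/2 := by field_simp
  linarith

lemma gh_area {gt q : ℂ → ℂ} {V : Set ℂ} (X : ExtData gt q V) {c ρ : ℝ} (hc : 0 < c) (hρ : 1/2 ≤ ρ)
    (hl : ∀ z ∈ ball (0:ℂ) 1, 1/2 ≤ ‖z‖ → c ≤ ‖gt z‖) :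
    ∫⁻ z in ann ρ, ENNReal.ofReal (‖deriv gt z / (gt z)^2‖^2) ≤ ENNReal.ofReal (Real.pi / c^2) := by
  have h0 : ∀ z ∈ ann ρ, z ≠ 0 := fun z hz h => by
    have := hz.1; rw [h, norm_zero] at this; linarith
  have h1 : ∀ z ∈ ann ρ, z ∈ ball (0:ℂ) 1 := fun z hz => by simpa using hz.2
  have hkd : DifferentiableOn ℂ (fun z => (gt z)⁻¹) (ann ρ) := fun z hz =>
    (gh_deriv X (h1 z hz) (h0 z hz)).differentiableAt.differentiableWithinAt
  have hki : InjOn (fun z => (gt z)⁻¹) (ann ρ) := fun a ha c hc hac => X.gi (h1 a ha) (h1 c hc) (inv_injective hac)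
  have := cov_lintegral (isOpen_ann ρ) hkd hki (fun _ => 1)
  rw [setLIntegral_one] at this
  have e : ∫⁻ z in ann ρ, ENNReal.ofReal (‖deriv gt z / (gt z)^2‖^2) = volume ((fun z => (gt z)⁻¹) '' ann ρ) := by
    rw [this]
    refine setLIntegral_congr_fun (isOpen_ann ρ).measurableSet fun z hz => ?_
    simp only [mul_one]
    rw [(gh_deriv X (h1 z hz) (h0 z hz)).deriv, norm_neg]
  rw [e]
  refine (vol_le (b := c⁻¹) (by positivity) ?_).trans (le_of_eq (by congr 1; field_simp))
  rintro _ ⟨z, hz, rfl⟩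
  simp only [norm_inv]
  exact inv_anti₀ hc (hl z (h1 z hz) (by linarith [hz.1]))

lemma N_scale {f : ℂ → ℂ} (hf : DifferentiableOn ℂ f (ball 0 1)) {s R : ℝ} (hR : 0 < R) (hs : R ≤ s) (hs1 : s ≤ 1) :
    ∫⁻ z in ann R, ENNReal.ofReal (‖deriv (deriv (fun z => f (s * z))) z / deriv (fun z => f (s * z)) z‖^2) ≤
    ∫⁻ z in ann (R^2), ENNReal.ofReal (‖deriv (deriv f) z / deriv f z‖^2) := by
  have hs0 : 0 < s := by linarith
  have hsc : (s:ℂ) ≠ 0 := by exact_mod_cast hs0.ne'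
  have d1 : deriv (fun z => f (s * z)) = fun z => s * deriv f (s * z) := funext (scale_diff hf hs0).2.2
  have d2 : ∀ z, deriv (deriv (fun z => f (s * z))) z = s * (s * deriv (deriv f) (s * z)) := fun z => by
    rw [d1, deriv_const_mul_field, deriv_comp_mul_left]; simp
  have hcov := cov_lintegral (f := fun z : ℂ => (s:ℂ) * z) (isOpen_ann R) (by fun_prop)
    (fun a _ b _ h => mul_left_cancel₀ hsc h) (fun z => ENNReal.ofReal (‖deriv (deriv f) z / deriv f z‖^2))
  have e : ∀ z ∈ ann R, ENNReal.ofReal (‖deriv (deriv (fun z => f (s * z))) z / deriv (fun z => f (s * z)) z‖^2) =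
      ENNReal.ofReal (‖deriv (fun z : ℂ => (s:ℂ) * z) z‖^2) * ENNReal.ofReal (‖deriv (deriv f) (s * z) / deriv f (s * z)‖^2) := fun z _ => by
    have e1 : deriv (fun z : ℂ => (s:ℂ) * z) z = s := by
      have := ((hasDerivAt_id z).const_mul (s:ℂ)).deriv
      simpa using this
    rw [← ENNReal.ofReal_mul (by positivity), e1, d2, d1]
    congr 1
    dsimp only
    rw [mul_div_mul_left _ _ hsc, mul_div_assoc, norm_mul, mul_pow]
  rw [setLIntegral_congr_fun (isOpen_ann R).measurableSet e, ← hcov]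
  refine lintegral_mono_set ?_
  rintro _ ⟨z, hz, rfl⟩
  have hz1 := hz.1
  have hz2 := hz.2
  show R^2 < ‖(s:ℂ) * z‖ ∧ ‖(s:ℂ) * z‖ < 1
  rw [norm_mul, Complex.norm_real, Real.norm_eq_abs, abs_of_pos hs0]
  constructor <;> nlinarith [norm_nonneg z]

/-- the set where the point `1/gt z0` is outside the closed region `f(closedBall s)` -/
def Uset (f gt : ℂ → ℂ) (s : ℝ) : Set ℂ := {z0 : ℂ | (z0 ∈ ball (0:ℂ) 1 ∧ z0 ≠ 0) ∧ (gt z0)⁻¹ ∈ (f '' closedBall 0 s)ᶜ}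

lemma Uset_open {f gt q : ℂ → ℂ} {V : Set ℂ} {s : ℝ} (hf : DifferentiableOn ℂ f (ball 0 1)) (hs : s < 1) (X : ExtData gt q V) :
    IsOpen (Uset f gt s) := by
  have hK : IsClosed (f '' closedBall 0 s) :=
    ((isCompact_closedBall 0 s).image_of_continuousOn (hf.continuousOn.mono (closedBall_subset_ball hs))).isClosed
  have hO : IsOpen {z0 : ℂ | z0 ∈ ball (0:ℂ) 1 ∧ z0 ≠ 0} := isOpen_ball.inter isOpen_ne
  have hc : ContinuousOn (fun z => (gt z)⁻¹) {z0 : ℂ | z0 ∈ ball (0:ℂ) 1 ∧ z0 ≠ 0} := fun z hz =>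
    (gh_deriv X hz.1 hz.2).continuousAt.continuousWithinAt
  exact hc.isOpen_inter_preimage hO hK.isOpen_compl

lemma Uset_ne {f gt : ℂ → ℂ} {s : ℝ} (hs : 0 < s) {z0 : ℂ} : (z0 ∈ Uset f gt s ↔ (z0 ∈ ball (0:ℂ) 1 ∧ z0 ≠ 0) ∧ ∀ z : ℂ, ‖z‖ ≤ 1 → f (s * z) ≠ (gt z0)⁻¹) := by
  have hsc : (s:ℂ) ≠ 0 := by exact_mod_cast hs.ne'
  constructor
  · rintro ⟨h1, h2⟩
    refine ⟨h1, fun z hz h => h2 ⟨s * z, ?_, h⟩⟩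
    rw [mem_closedBall_zero_iff, norm_mul, Complex.norm_real, Real.norm_eq_abs, abs_of_pos hs]; nlinarith
  · rintro ⟨h1, h2⟩
    refine ⟨h1, ?_⟩
    rintro ⟨u, hu, h⟩
    have hu : ‖u‖ ≤ s := by simpa using hu
    refine h2 (u / s) ?_ (by rw [mul_div_cancel₀ _ hsc]; exact h)
    rw [norm_div, Complex.norm_real, Real.norm_eq_abs, abs_of_pos hs, div_le_one hs]; exact hu

noncomputable def Gw (gt : ℂ → ℂ) (z0 : ℂ) : ENNReal := ENNReal.ofReal (‖deriv gt z0 / (gt z0)^2‖^2)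

noncomputable def Iw (φ gt : ℂ → ℂ) (R : ℝ) (z0 : ℂ) : ENNReal :=
  ∫⁻ z in ann R, Gw gt z0 * ENNReal.ofReal (4 * (1 - ‖z‖)^2 * ‖deriv (deriv φ) z‖^2 / ‖φ z - (gt z0)⁻¹‖^4)

lemma tail_point {gt q φ : ℂ → ℂ} {V : Set ℂ} (X : ExtData gt q V) {ρ ε R K : ℝ} (hρ : 1 < ρ)
    (hφ : DifferentiableOn ℂ φ (ball 0 ρ)) (C : CollarMap φ ε R)
    (hE : ∀ z : ℂ, R ≤ ‖z‖ → ‖z‖ ≤ 1 → Eext φ z ∈ V) {z0 : ℂ} (hz0 : z0 ∈ ball (0:ℂ) 1)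
    (hw0 : ∀ z : ℂ, ‖z‖ ≤ 1 → φ z ≠ (gt z0)⁻¹) (hK : ‖∮ z in C(0, R), Pker φ q z0 (gt z0)⁻¹ z‖ ≤ K)
    (hS : ‖schwarzian gt z0‖ ≤ 2 * (‖deriv gt z0 / (gt z0)^2‖ * ‖∮ z in C(0, 1), Pker φ q z0 (gt z0)⁻¹ z‖)) :
    ENNReal.ofReal (‖schwarzian gt z0‖^2 * (1 - ‖z0‖^2)^2) ≤
      ENNReal.ofReal (8 * K^2 * (1 - ‖z0‖^2)^2) * Gw gt z0 + ENNReal.ofReal (64 * Real.pi) * Iw φ gt R z0 := by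
  have hb := stokes_bound X hρ hφ C hE hz0 hw0
  have hz01 : ‖z0‖ < 1 := by simpa using hz0
  set w := (1 - ‖z0‖^2)^2 with hw
  have hwp : 0 < w := by have : 0 < 1 - ‖z0‖^2 := by nlinarith [norm_nonneg z0]
                         positivity
  set J := ∮ z in C(0, 1), Pker φ q z0 (gt z0)⁻¹ z
  set JR := ∮ z in C(0, R), Pker φ q z0 (gt z0)⁻¹ z
  set g' := ‖deriv gt z0 / (gt z0)^2‖ with hg'
  have hg0 : 0 ≤ g' := norm_nonneg _
  set I0 := ∫⁻ z in ann R, ENNReal.ofReal (4 * (1 - ‖z‖)^2 * ‖deriv (deriv φ) z‖^2 / ‖φ z - (gt z0)⁻¹‖^4)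
  have eI : Iw φ gt R z0 = Gw gt z0 * I0 := lintegral_const_mul' _ _ ENNReal.ofReal_ne_top
  have h1 : ‖JR‖ₑ^2 ≤ ENNReal.ofReal (K^2) := by
    rw [← ofReal_norm, ← ENNReal.ofReal_pow (norm_nonneg _)]
    exact ENNReal.ofReal_le_ofReal (pow_le_pow_left₀ (norm_nonneg _) hK 2)
  have h2 : ENNReal.ofReal (‖J‖^2) ≤ 2 * ENNReal.ofReal (K^2) + ENNReal.ofReal (16 * Real.pi / w) * I0 := by
    rw [ENNReal.ofReal_pow (norm_nonneg _), ofReal_norm]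
    refine hb.trans ?_
    gcongr
  have hgw : Gw gt z0 = ENNReal.ofReal (g'^2) := rfl
  rw [eI, hgw]
  calc ENNReal.ofReal (‖schwarzian gt z0‖^2 * w) ≤ ENNReal.ofReal (4 * w * g'^2 * ‖J‖^2) := by
        refine ENNReal.ofReal_le_ofReal ?_
        have := pow_le_pow_left₀ (norm_nonneg _) hS 2
        nlinarith
    _ = ENNReal.ofReal (4 * w) * ENNReal.ofReal (g'^2) * ENNReal.ofReal (‖J‖^2) := by
        rw [ENNReal.ofReal_mul (by positivity), ENNReal.ofReal_mul (by positivity)]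
    _ ≤ ENNReal.ofReal (4 * w) * ENNReal.ofReal (g'^2) * (2 * ENNReal.ofReal (K^2) + ENNReal.ofReal (16 * Real.pi / w) * I0) := by
        gcongr
    _ = (ENNReal.ofReal (4 * w) * 2 * ENNReal.ofReal (K^2)) * ENNReal.ofReal (g'^2) +
        (ENNReal.ofReal (4 * w) * ENNReal.ofReal (16 * Real.pi / w)) * (ENNReal.ofReal (g'^2) * I0) := by ring
    _ = _ := by
        have hpi := Real.pi_pos
        congr 2
        · rw [show (2:ENNReal) = ENNReal.ofReal 2 by simp, ← ENNReal.ofReal_mul (by positivity), ← ENNReal.ofReal_mul (by positivity)]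
          congr 1; ring
        · rw [← ENNReal.ofReal_mul (by positivity)]
          congr 1; field_simp; ring

section
variable {gt q φ : ℂ → ℂ} {V U : Set ℂ} {ρ ε R : ℝ}

lemma joint_meas (X : ExtData gt q V) (hφ : DifferentiableOn ℂ φ (ball 0 1))
    (hU : IsOpen U) (hU1 : U ⊆ ball 0 1) (hU0 : (0:ℂ) ∉ U) (hUw : ∀ z0 ∈ U, (gt z0)⁻¹ ∉ φ '' ball 0 1) :
    AEMeasurable (fun x : ℂ × ℂ => Gw gt x.1 * ENNReal.ofReal (4 * (1 - ‖x.2‖)^2 * ‖deriv (deriv φ) x.2‖^2 / ‖φ x.2 - (gt x.1)⁻¹‖^4))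
      ((volume.restrict U).prod (volume.restrict (ann R))) := by
  rw [Measure.prod_restrict]
  have h0 : ∀ z ∈ U, z ≠ 0 := fun z hz h => hU0 (h ▸ hz)
  have ha : ∀ z ∈ ann R, z ∈ ball (0:ℂ) 1 := fun z hz => by simpa using hz.2
  have m1 : MapsTo (Prod.fst : ℂ × ℂ → ℂ) (U ×ˢ ann R) U := fun x hx => hx.1
  have m2 : MapsTo (Prod.snd : ℂ × ℂ → ℂ) (U ×ˢ ann R) (ball 0 1) := fun x hx => ha _ hx.2
  have c1 : ContinuousOn (fun x : ℂ × ℂ => gt x.1) (U ×ˢ ann R) :=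
    (X.gd.continuousOn.mono hU1).comp continuousOn_fst m1
  have c2 : ContinuousOn (fun x : ℂ × ℂ => deriv gt x.1) (U ×ˢ ann R) :=
    ((X.gd.deriv isOpen_ball).continuousOn.mono hU1).comp continuousOn_fst m1
  have c3 : ContinuousOn (fun x : ℂ × ℂ => φ x.2) (U ×ˢ ann R) := hφ.continuousOn.comp continuousOn_snd m2
  have c4 : ContinuousOn (fun x : ℂ × ℂ => deriv (deriv φ) x.2) (U ×ˢ ann R) :=
    ((hφ.deriv isOpen_ball).deriv isOpen_ball).continuousOn.comp continuousOn_snd m2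
  have hg : ∀ x ∈ U ×ˢ ann R, gt x.1 ≠ 0 := fun x hx => (X.gq _ (hU1 hx.1) (h0 _ hx.1)).1
  have c5 : ContinuousOn (fun x : ℂ × ℂ => ‖φ x.2 - (gt x.1)⁻¹‖^4) (U ×ˢ ann R) := ((c3.sub (c1.inv₀ hg)).norm).pow 4
  have c6 : ContinuousOn (fun x : ℂ × ℂ => ‖deriv gt x.1 / (gt x.1)^2‖^2) (U ×ˢ ann R) :=
    ((c2.div (c1.pow 2) fun x hx => pow_ne_zero 2 (hg x hx)).norm).pow 2
  have c8 : ContinuousOn (fun x : ℂ × ℂ => 4 * (1 - ‖x.2‖)^2 * ‖deriv (deriv φ) x.2‖^2) (U ×ˢ ann R) :=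
    ContinuousOn.mul (by fun_prop) (c4.norm.pow 2)
  have c7 : ContinuousOn (fun x : ℂ × ℂ => 4 * (1 - ‖x.2‖)^2 * ‖deriv (deriv φ) x.2‖^2 / ‖φ x.2 - (gt x.1)⁻¹‖^4) (U ×ˢ ann R) :=
    c8.div c5 fun x hx => by
      refine pow_ne_zero 4 (norm_ne_zero_iff.2 (sub_ne_zero.2 fun h => ?_))
      exact hUw _ hx.1 ⟨_, ha _ hx.2, h⟩
  have hm : MeasurableSet (U ×ˢ ann R) := hU.measurableSet.prod (isOpen_ann R).measurableSet
  exact ((c6.aemeasurable hm).ennreal_ofReal).mul ((c7.aemeasurable hm).ennreal_ofReal)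

lemma tonelli_main (X : ExtData gt q V) (C : CollarMap φ ε R)
    (hU : IsOpen U) (hU1 : U ⊆ ball 0 1) (hU0 : (0:ℂ) ∉ U) (hUw : ∀ z0 ∈ U, (gt z0)⁻¹ ∉ φ '' ball 0 1) :
    ∫⁻ z0 in U, Iw φ gt R z0 ≤ ENNReal.ofReal (6400 * Real.pi) * ∫⁻ z in ann R, ENNReal.ofReal (‖deriv (deriv φ) z / deriv φ z‖^2) := by
  unfold Iw
  rw [lintegral_lintegral_swap (joint_meas X C.good.diff hU hU1 hU0 hUw), ← lintegral_const_mul' _ _ ENNReal.ofReal_ne_top]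
  refine setLIntegral_mono' (isOpen_ann R).measurableSet fun z hz => ?_
  have hz1 := hz.1
  have hz2 := hz.2
  have hd : 0 < ‖deriv φ z‖ := norm_pos_iff.2 (univ_deriv_ne isOpen_ball C.good.diff C.good.inj (by simpa using hz.2))
  have h1 : 0 < 1 - ‖z‖ := by linarith
  set A := 4 * (1 - ‖z‖)^2 * ‖deriv (deriv φ) z‖^2 with hA
  have hA0 : 0 ≤ A := by positivity
  have e : ∀ z0, Gw gt z0 * ENNReal.ofReal (A / ‖φ z - (gt z0)⁻¹‖^4) =
      ENNReal.ofReal A * ENNReal.ofReal (‖deriv gt z0 / (gt z0)^2‖^2 / ‖φ z - (gt z0)⁻¹‖^4) := fun z0 => by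
    rw [Gw, ← ENNReal.ofReal_mul (by positivity), ← ENNReal.ofReal_mul (by positivity)]
    congr 1; ring
  simp only [e]
  rw [lintegral_const_mul' _ _ ENNReal.ofReal_ne_top]
  set b := (1 - ‖z‖) / 40 * ‖deriv φ z‖ with hb
  have hb0 : 0 < b := by positivity
  calc _ ≤ ENNReal.ofReal A * ENNReal.ofReal (Real.pi / b^2) := by
        gcongr
        exact tonelli_inner X hU hU1 hU0 hb0 fun z0 hz0 => C.koebe z hz1.le hz2 _ (hUw z0 hz0)
    _ = _ := by
        rw [← ENNReal.ofReal_mul hA0, ← ENNReal.ofReal_mul (by positivity [Real.pi_pos])]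
        congr 1
        rw [hA, hb, norm_div]; field_simp; ring
end

lemma tail_bound {f gt1 q1 : ℂ → ℂ} {ε R s0 δ : ℝ} (hf : DifferentiableOn ℂ f (ball 0 1)) (hfi : InjOn f (ball 0 1)) (hf0 : f 0 = 0)
    (X1 : ExtData gt1 q1 (closure (f '' ball 0 1))ᶜ) (hδ0 : 0 < δ) (hδ : ball 0 δ ⊆ gt1 '' ball 0 1) (hs0 : 1/2 ≤ s0) (hs01 : s0 < 1)
    (C : ∀ s : ℝ, s0 ≤ s → s ≤ 1 → CollarMap (fun z => f (s * z)) ε R) :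
    ∃ K s1 : ℝ, 0 < K ∧ s1 < 1 ∧ ∀ r : ℝ, s1 ≤ r → r < 1 → ∀ gt q, ExtData gt q (closure (f '' ball 0 r))ᶜ →
      ∀ ρ : ℝ, 1/2 ≤ ρ → ρ < 1 → ∫⁻ z in ann ρ, ENNReal.ofReal (‖schwarzian gt z‖^2 * (1 - ‖z‖^2)^2) ≤
        ENNReal.ofReal (K * (1 - ρ^2)^2) +
        ENNReal.ofReal (409600 * Real.pi^2) * ∫⁻ z in ann (R^2), ENNReal.ofReal (‖deriv (deriv f) z / deriv f z‖^2) := by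
  obtain ⟨K, s1, hK, h01, hs1, hin⟩ := inner_circle hf hfi X1 hs0 hs01 C
  have C1 := C 1 hs01.le le_rfl
  have hR0 := C1.good.hR0
  have hR1 := C1.good.hR1
  have hpi := Real.pi_pos
  refine ⟨8 * K^2 * (Real.pi / (δ/2)^2), max s1 R, by positivity, max_lt hs1 hR1, ?_⟩
  intro r hr hr1 gt q X ρ hρ hρ1
  have hrs1 : s1 ≤ r := (le_max_left _ _).trans hr
  have hrR : R ≤ r := (le_max_right _ _).trans hr
  have hr0 : 0 < r := by linarith
  obtain ⟨u, -, hu, hut⟩ := exists_seq_strictAnti_tendsto' hr1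
  have hut' : Tendsto u atTop (nhdsWithin r (Ioi r)) :=
    tendsto_nhdsWithin_iff.2 ⟨hut, Eventually.of_forall fun n => (hu n).1⟩
  have hU : ∀ n, IsOpen (Uset f gt (u n)) := fun n => Uset_open hf (hu n).2 X
  have hup : ∀ n, 0 < u n := fun n => hr0.trans (hu n).1
  have hVsub : (closure (f '' ball 0 1))ᶜ ⊆ (closure (f '' ball 0 r))ᶜ :=
    compl_subset_compl.2 (closure_mono (image_mono (ball_subset_ball hr1.le)))
  have hUw : ∀ n, ∀ z0 ∈ Uset f gt (u n), (gt z0)⁻¹ ∉ (fun z => f (u n * z)) '' ball 0 1 := by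
    rintro n z0 hz0 ⟨z, hz, h⟩
    exact ((Uset_ne (hup n)).1 hz0).2 z (by have : ‖z‖ < 1 := by simpa using hz
                                            exact this.le) h
  have hU1 : ∀ n, Uset f gt (u n) ⊆ ball 0 1 := fun n z hz => hz.1.1
  have hU0 : ∀ n, (0:ℂ) ∉ Uset f gt (u n) := fun n hz => hz.1.2 rfl
  set A : ℂ → ENNReal := fun z0 => ENNReal.ofReal (8 * K^2 * (1 - ‖z0‖^2)^2) * Gw gt z0 with hA
  set B : ℕ → ℂ → ENNReal := fun n z0 => ENNReal.ofReal (64 * Real.pi) * Iw (fun z => f (u n * z)) gt R z0 with hB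
  set Tn : ℕ → ℂ → ENNReal := fun n z0 => A z0 + (Uset f gt (u n)).indicator (B n) z0 with hTn
  have hannb : ∀ z ∈ ann ρ, z ∈ ball (0:ℂ) 1 ∧ z ≠ 0 := fun z hz => by
    refine ⟨by simpa using hz.2, fun h => ?_⟩
    have := hz.1; rw [h, norm_zero] at this; linarith
  have Cn : ∀ n, CollarMap (fun z => f (u n * z)) ε R := fun n => C (u n) (by linarith [(hu n).1]) (hu n).2.le
  -- pointwise
  have hpt : ∀ z0 ∈ ann ρ, ENNReal.ofReal (‖schwarzian gt z0‖^2 * (1 - ‖z0‖^2)^2) ≤ liminf (fun n => Tn n z0) atTop := by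
    intro z0 hz0
    obtain ⟨hb, h0⟩ := hannb z0 hz0
    by_cases hS : ‖schwarzian gt z0‖ = 0
    · rw [hS]; simp
    have hSp : 0 < ‖schwarzian gt z0‖ := lt_of_le_of_ne (norm_nonneg _) (Ne.symm hS)
    have hev := hut'.eventually (outer_main hf hfi hf0 hr0 hr1 X hb h0 (half_pos hSp))
    refine le_liminf_of_le (by isBoundedDefault) ?_
    filter_upwards [hev] with n hn
    have hmem : z0 ∈ Uset f gt (u n) := (Uset_ne (hup n)).2 ⟨⟨hb, h0⟩, hn.1⟩
    simp only [hTn, indicator_of_mem hmem]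
    refine tail_point X (one_lt_inv₀ (hup n) |>.2 (hu n).2) (scale_diff hf (hup n)).1 (Cn n)
      (fun z hz hz1 => collar_mem hf hfi hr0 hr1 (hu n).1 (hu n).2 (Cn n) hz hz1) hb hn.1
      (hin r (u n) hrs1 (hu n).1 (hu n).2 gt q X z0 hb _ hn.1) ?_
    linarith [hn.2]
  have hmA : AEMeasurable A (volume.restrict (ann ρ)) := by
    have hg : ∀ z ∈ ann ρ, gt z ≠ 0 := fun z hz => (X.gq z (hannb z hz).1 (hannb z hz).2).1
    have hs : ann ρ ⊆ ball 0 1 := fun z hz => (hannb z hz).1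
    have c1 : ContinuousOn (fun z => ‖deriv gt z / (gt z)^2‖^2) (ann ρ) :=
      ((((X.gd.deriv isOpen_ball).continuousOn.mono hs).div ((X.gd.continuousOn.mono hs).pow 2) fun x hx => pow_ne_zero 2 (hg x hx)).norm).pow 2
    have c2 : Continuous (fun z : ℂ => 8 * K^2 * (1 - ‖z‖^2)^2) := by fun_prop
    exact c2.measurable.ennreal_ofReal.aemeasurable.mul (c1.aemeasurable (isOpen_ann ρ).measurableSet).ennreal_ofReal
  have hmB : ∀ n, AEMeasurable (B n) (volume.restrict (Uset f gt (u n))) := fun n =>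
    ((joint_meas X (Cn n).good.diff (hU n) (hU1 n) (hU0 n) (hUw n)).lintegral_prod_right').const_mul _
  have hmT : ∀ n, AEMeasurable (Tn n) (volume.restrict (ann ρ)) := fun n => by
    refine hmA.add ?_
    refine AEMeasurable.mono_measure ?_ Measure.restrict_le_self
    exact (aemeasurable_indicator_iff (hU n).measurableSet).2 (hmB n)
  calc ∫⁻ z in ann ρ, ENNReal.ofReal (‖schwarzian gt z‖^2 * (1 - ‖z‖^2)^2)
      ≤ ∫⁻ z in ann ρ, liminf (fun n => Tn n z) atTop := setLIntegral_mono' (isOpen_ann ρ).measurableSet hpt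
    _ ≤ liminf (fun n => ∫⁻ z in ann ρ, Tn n z) atTop := lintegral_liminf_le' hmT
    _ ≤ _ := by
      refine liminf_le_of_frequently_le' (Frequently.of_forall fun n => ?_)
      simp only [hTn]
      rw [lintegral_add_left' hmA]
      refine add_le_add ?_ ?_
      · calc ∫⁻ z in ann ρ, A z ≤ ∫⁻ z in ann ρ, ENNReal.ofReal (8 * K^2 * (1 - ρ^2)^2) * Gw gt z := by
              refine setLIntegral_mono' (isOpen_ann ρ).measurableSet fun z hz => ?_
              simp only [hA]
              gcongr
              · have := hz.2
                nlinarith [norm_nonneg z]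
              · exact hz.1.le
          _ = ENNReal.ofReal (8 * K^2 * (1 - ρ^2)^2) * ∫⁻ z in ann ρ, Gw gt z := lintegral_const_mul' _ _ ENNReal.ofReal_ne_top
          _ ≤ ENNReal.ofReal (8 * K^2 * (1 - ρ^2)^2) * ENNReal.ofReal (Real.pi / (δ/2)^2) := by
              gcongr
              exact gh_area X (by positivity) hρ fun z hz hz2 => gt_low X1 X hVsub hδ0 hδ hz hz2
          _ = _ := by rw [← ENNReal.ofReal_mul (by positivity)]; congr 1; ring
      · calc ∫⁻ z in ann ρ, (Uset f gt (u n)).indicator (B n) z ≤ ∫⁻ z, (Uset f gt (u n)).indicator (B n) z :=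
              setLIntegral_le_lintegral _ _
          _ = ∫⁻ z in Uset f gt (u n), B n z := lintegral_indicator (hU n).measurableSet _
          _ = ENNReal.ofReal (64 * Real.pi) * ∫⁻ z in Uset f gt (u n), Iw (fun z => f (u n * z)) gt R z :=
              lintegral_const_mul' _ _ ENNReal.ofReal_ne_top
          _ ≤ ENNReal.ofReal (64 * Real.pi) * (ENNReal.ofReal (6400 * Real.pi) *
              ∫⁻ z in ann (R^2), ENNReal.ofReal (‖deriv (deriv f) z / deriv f z‖^2)) := by
              gcongr
              refine (tonelli_main X (Cn n) (hU n) (hU1 n) (hU0 n) (hUw n)).trans ?_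
              refine mul_le_mul_right ?_ _
              exact N_scale (s := u n) (R := R) hf (by linarith) (hrR.trans (hu n).1.le) (hu n).2.le
          _ = _ := by
              rw [← mul_assoc, ← ENNReal.ofReal_mul (by positivity)]; congr 2; ring

lemma harnack_low {D : ℂ → ℂ} (hD : DifferentiableOn ℂ D (ball 0 1)) (h0 : D 0 = 1)
    (hne : ∀ z ∈ ball (0:ℂ) 1, D z ≠ 0) {B η : ℝ} (hB : 1 < B) (hb : ∀ z ∈ ball (0:ℂ) 1, ‖D z‖ ≤ B)
    (hη : 0 < η) {z : ℂ} (hz : ‖z‖ ≤ 1 - η) : Real.exp (-(2 * Real.log B / η)) ≤ ‖D z‖ := by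
  have hU : IsOpen (ball (0:ℂ) 1) := isOpen_ball
  have h0m : (0:ℂ) ∈ ball (0:ℂ) 1 := by simp
  have hL : DifferentiableOn ℂ (fun z => deriv D z / D z) (ball 0 1) := (hD.deriv hU).div hD hne
  obtain ⟨H, hH0, hH⟩ := hL.isExactOn_ball.with_val_at 0 0
  have hda : ∀ z ∈ ball (0:ℂ) 1, HasDerivAt D (deriv D z) z :=
    fun z hz => ((hD z hz).differentiableAt (hU.mem_nhds hz)).hasDerivAt
  have hc : ∀ z ∈ ball (0:ℂ) 1, HasDerivWithinAt (fun z => D z * exp (-H z)) 0 (ball 0 1) z := fun z hz => by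
    have := (hda z hz).mul ((hH z hz).neg.cexp)
    refine (this.congr_deriv ?_).hasDerivWithinAt
    have := hne z hz
    simp only [Pi.neg_apply]
    field_simp
    ring
  have hexp : ∀ z ∈ ball (0:ℂ) 1, D z = exp (H z) := fun z hz => by
    have hcc := (convex_ball (0:ℂ) 1).norm_image_sub_le_of_norm_hasDerivWithin_le (C := 0) (𝕜 := ℂ) hc
      (fun z hz => by simp) h0m hz
    rw [zero_mul] at hcc
    have h2 : D z * exp (-H z) = D 0 * exp (-H 0) := by
      rw [← sub_eq_zero]; exact norm_le_zero_iff.1 hcc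
    rw [hH0, exp_neg, h0] at h2
    have := exp_ne_zero (H z)
    field_simp at h2
    simpa using h2
  have hzm : z ∈ ball (0:ℂ) 1 := by rw [mem_ball_zero_iff]; linarith
  have hlB : 0 < Real.log B := Real.log_pos hB
  have hbc := Complex.borelCaratheodory_zero (M := Real.log B) (R := 1) (f := H) (z := z) hlB
    (fun z hz => (hH z hz).differentiableAt.differentiableWithinAt) (fun z hz => by
      have := hb z hz
      rw [hexp z hz, Complex.norm_exp] at this
      exact (Real.le_log_iff_exp_le (by linarith)).2 this) (by norm_num) hzm hH0
  have h3 : ‖H z‖ ≤ 2 * Real.log B / η := by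
    refine hbc.trans ?_
    have : η ≤ 1 - ‖z‖ := by linarith
    have h1 : 2 * Real.log B * ‖z‖ ≤ 2 * Real.log B := by nlinarith [norm_nonneg z]
    gcongr
  rw [hexp z hzm, Complex.norm_exp]
  gcongr
  have := (abs_le.1 (Complex.abs_re_le_norm (H z))).1
  linarith

lemma gt_upper {gt q : ℂ → ℂ} {W : Set ℂ} {c0 : ℝ} (hc0 : 0 < c0) (hc : ball 0 c0 ⊆ W)
    (X : ExtData gt q (closure W)ᶜ) {z : ℂ} (hz : z ∈ ball (0:ℂ) 1) : ‖gt z‖ ≤ 1 / c0 := by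
  by_cases h : z = 0
  · rw [h, X.g0, norm_zero]; positivity
  obtain ⟨h1, h2, -⟩ := X.gq z hz h
  by_contra hlt
  push Not at hlt
  apply h2
  apply subset_closure
  apply hc
  rw [mem_ball_zero_iff, norm_inv]
  rw [one_div] at hlt
  exact inv_lt_of_inv_lt₀ hc0 hlt

lemma one_sub_ne {gt q : ℂ → ℂ} {W : Set ℂ}
    (X : ExtData gt q (closure W)ᶜ) {k : ℂ} (hk : k ∈ W) {z : ℂ} (hz : z ∈ ball (0:ℂ) 1) : 1 - k * gt z ≠ 0 := by
  by_cases h : z = 0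
  · rw [h, X.g0]; simp
  obtain ⟨h1, h2, -⟩ := X.gq z hz h
  intro he
  have : (gt z)⁻¹ = k := by
    field_simp
    linear_combination he
  rw [this] at h2
  exact h2 (subset_closure hk)

lemma near_bdry {gt q : ℂ → ℂ} {W : Set ℂ} {c0 : ℝ} (hc0 : 0 < c0) (hc : ball 0 c0 ⊆ W)
    (X : ExtData gt q (closure W)ᶜ) {κ : ℝ} (hκ : 0 < κ) :
    ∃ τ : ℝ, 0 < τ ∧ τ < 1 ∧ ∀ z : ℂ, ‖z‖ = τ → ∃ k ∈ W, ‖1 - k * gt z‖ < κ := by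
  obtain ⟨Q, Qd, Qi, Qh, Qinj⟩ := univ_exists_inv isOpen_ball X.gd X.gi
  set K : Set ℂ := closedBall 0 (1/c0) ∩ {y | ∀ k ∈ W, κ ≤ ‖1 - k * y‖} with hK
  have hKc : IsCompact K := by
    refine (isCompact_closedBall 0 (1/c0)).inter_right ?_
    simp only [setOf_forall]
    refine isClosed_iInter fun k => isClosed_iInter fun hk => isClosed_le continuous_const (by fun_prop)
  have hKs : K ⊆ gt '' ball 0 1 := fun y hy => by
    by_cases h : y = 0
    · exact ⟨0, by simp, by rw [X.g0, h]⟩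
    have hy2 : y⁻¹ ∈ (closure W)ᶜ := by
      intro hcl
      have hyp : 0 < ‖y‖ := norm_pos_iff.2 h
      obtain ⟨k, hk, hd⟩ := Metric.mem_closure_iff.1 hcl (κ / ‖y‖) (by positivity)
      have h1 := hy.2 k hk
      have : 1 - k * y = (y⁻¹ - k) * y := by field_simp
      rw [this, norm_mul, ← dist_eq_norm] at h1
      rw [lt_div_iff₀ hyp] at hd
      linarith
    obtain ⟨a1, a2, a3, a4⟩ := X.qm _ hy2
    exact ⟨_, a1, by rw [a4, inv_inv]⟩
  have hQK : IsCompact (Q '' K) := hKc.image_of_continuousOn (Qd.continuousOn.mono hKs)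
  have hQs : Q '' K ⊆ ball 0 1 := by
    rintro _ ⟨y, hy, rfl⟩
    obtain ⟨u, hu, rfl⟩ := hKs hy
    rw [Qi u hu]; exact hu
  obtain ⟨τ0, hτ0, hτs⟩ := exists_lt_subset_ball hQK.isClosed hQs
  refine ⟨max τ0 (1/2), by positivity, by simp [hτ0]; norm_num, fun z hz => ?_⟩
  have hz1 : z ∈ ball (0:ℂ) 1 := by rw [mem_ball_zero_iff, hz]; simp [hτ0]; norm_num
  by_contra hcon
  push Not at hcon
  have hm : gt z ∈ K := ⟨by rw [mem_closedBall_zero_iff]; exact gt_upper hc0 hc X hz1, hcon⟩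
  have := hτs ⟨_, hm, rfl⟩
  rw [Qi z hz1, mem_ball_zero_iff, hz] at this
  exact absurd this (not_lt.2 (le_max_left _ _))

lemma p_deriv_lower {f gt q : ℂ → ℂ} (hf : DifferentiableOn ℂ f (ball 0 1)) {c0 M : ℝ} (hc0 : 0 < c0)
    (hc : ball 0 c0 ⊆ f '' ball 0 (1/2)) (hM : ∀ z ∈ ball (0:ℂ) 1, ‖f z‖ ≤ M)
    (X : ExtData gt q (closure (f '' ball 0 1))ᶜ) {η : ℝ} (hη : 0 < η) (hη1 : η < 1) :
    ∃ s1 : ℝ, 1/2 ≤ s1 ∧ s1 < 1 ∧ ∀ r : ℝ, s1 ≤ r → r < 1 → ∀ gr qr p : ℂ → ℂ, ExtData gr qr (closure (f '' ball 0 r))ᶜ →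
      DifferentiableOn ℂ p (ball 0 1) → MapsTo p (ball 0 1) (ball 0 1) → p 0 = 0 → InjOn p (ball 0 1) →
      (∀ z ∈ ball (0:ℂ) 1, gr (p z) = gt z) → 1 - η ≤ ‖deriv p 0‖ := by
  have hM0 : 0 ≤ M := (norm_nonneg _).trans (hM 0 (by simp))
  set B := 2 + M * (1/c0) with hB
  have hB1 : 1 < B := by have : 0 ≤ M * (1/c0) := by positivity
                         linarith
  set κ := Real.exp (-(2 * Real.log B / η)) with hκ
  have hc1 : ball 0 c0 ⊆ f '' ball 0 1 := hc.trans (image_mono (ball_subset_ball (by norm_num)))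
  obtain ⟨τ, hτ0, hτ1, hτ⟩ := near_bdry hc0 hc1 X (Real.exp_pos _ : 0 < κ)
  have hev : ∀ᶠ s : ℝ in nhds 1, ∀ z ∈ sphere (0:ℂ) τ, ∃ u : ℂ, ‖u‖ < s ∧ ‖u‖ < 1 ∧ ‖1 - f u * gt z‖ < κ := by
    refine (isCompact_sphere 0 τ).eventually_forall_of_forall_eventually (P := fun s z => ∃ u : ℂ, ‖u‖ < s ∧ ‖u‖ < 1 ∧ ‖1 - f u * gt z‖ < κ) fun z hz => ?_
    have hz' : ‖z‖ = τ := by simpa using hz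
    obtain ⟨_, ⟨u, hu, rfl⟩, hk⟩ := hτ z hz'
    have hu1 : ‖u‖ < 1 := by simpa using hu
    have hzb : z ∈ ball (0:ℂ) 1 := by rw [mem_ball_zero_iff, hz']; exact hτ1
    have c1 : ∀ᶠ x : ℝ × ℂ in nhds (1, z), ‖u‖ < x.1 := continuousAt_fst.eventually (lt_mem_nhds hu1)
    have hcg : ContinuousAt (fun z => ‖1 - f u * gt z‖) z :=
      (continuousAt_const.sub (continuousAt_const.mul (X.gd.differentiableAt (isOpen_ball.mem_nhds hzb)).continuousAt)).norm
    have c2 : ∀ᶠ x : ℝ × ℂ in nhds (1, z), ‖1 - f u * gt x.2‖ < κ :=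
      (ContinuousAt.comp_of_eq hcg (continuousAt_snd : ContinuousAt Prod.snd ((1:ℝ), z)) rfl).eventually (gt_mem_nhds hk)
    filter_upwards [c1, c2] with x h1 h2 using ⟨u, h1, hu1, h2⟩
  obtain ⟨e, he, hball⟩ := Metric.eventually_nhds_iff.1 hev
  refine ⟨max (1 - e/2) (1/2), le_max_right _ _, by simp [he]; norm_num, fun r hr hr1 gr qr p Xr pd pm p0 pi hp => ?_⟩
  have hr2 : 1/2 ≤ r := (le_max_right _ _).trans hr
  have hre : 1 - e/2 ≤ r := (le_max_left _ _).trans hr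
  have hcr : ball 0 c0 ⊆ f '' ball 0 r := hc.trans (image_mono (ball_subset_ball hr2))
  have hs := hball (y := r) (by rw [Real.dist_eq, abs_sub_comm, abs_of_pos (by linarith)]; linarith)
  have hpz : ∀ z : ℂ, ‖z‖ = τ → 1 - η < ‖p z‖ := fun z hz => by
    obtain ⟨u, hu, hu1, hk⟩ := hs z (by simpa using hz)
    have hzb : z ∈ ball (0:ℂ) 1 := by rw [mem_ball_zero_iff, hz]; exact hτ1
    by_contra hcon
    push Not at hcon
    have := harnack_low (D := fun ζ => 1 - f u * gr ζ) (B := B) (η := η) ((differentiableOn_const _).sub (Xr.gd.const_mul _))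
      (by simp [Xr.g0]) (fun ζ hζ => one_sub_ne Xr ⟨u, by simpa using hu, rfl⟩ hζ) hB1 (fun ζ hζ => by
        have h1 := hM u (by simpa using hu1)
        have h2 := gt_upper hc0 hcr Xr hζ
        calc ‖1 - f u * gr ζ‖ ≤ ‖(1:ℂ)‖ + ‖f u * gr ζ‖ := norm_sub_le _ _
          _ ≤ 1 + M * (1/c0) := by rw [norm_one, norm_mul]; gcongr
          _ ≤ B := by rw [hB]; linarith) hη hcon
    simp only [hp z hzb] at this
    linarith
  have hU : IsOpen (ball (0:ℂ) 1) := isOpen_ball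
  have h0m : (0:ℂ) ∈ ball (0:ℂ) 1 := by simp
  have hD : DifferentiableOn ℂ (dslope p 0) (ball 0 1) :=
    (Complex.differentiableOn_dslope (hU.mem_nhds h0m)).2 pd
  have eD : ∀ z, p z = z * dslope p 0 z := fun z => by
    have := sub_smul_dslope p 0 z
    rw [smul_eq_mul, p0, sub_zero, sub_zero] at this
    exact this.symm
  have hDne : ∀ z ∈ ball (0:ℂ) 1, dslope p 0 z ≠ 0 := fun z hz hz0 => by
    by_cases h : z = 0
    · rw [h, dslope_same] at hz0; exact univ_deriv_ne hU pd pi h0m hz0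
    · apply h
      apply pi hz h0m
      rw [eD z, hz0, mul_zero, p0]
  have hsub : closure (ball (0:ℂ) τ) ⊆ ball 0 1 := by
    rw [closure_ball _ hτ0.ne']; exact closedBall_subset_ball hτ1
  have hmax := Complex.norm_le_of_forall_mem_frontier_norm_le (U := ball (0:ℂ) τ) (f := fun z => (dslope p 0 z)⁻¹)
    (C := (1 - η)⁻¹) isBounded_ball ((hD.inv hDne).mono hsub).diffContOnCl (fun z hz => by
      rw [frontier_ball _ hτ0.ne'] at hz
      have hz' : ‖z‖ = τ := by simpa using hz
      have h1 := hpz z hz'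
      rw [eD z, norm_mul, hz'] at h1
      rw [norm_inv]
      apply inv_anti₀ (by linarith)
      nlinarith [norm_nonneg (dslope p 0 z)]) (z := 0) (subset_closure (by simpa using hτ0))
  simp only [dslope_same, norm_inv] at hmax
  have hpos : 0 < ‖deriv p 0‖ := norm_pos_iff.2 (univ_deriv_ne hU pd pi h0m)
  exact (inv_le_inv₀ hpos (by linarith)).1 hmax

lemma p_close {p : ℂ → ℂ} (pd : DifferentiableOn ℂ p (ball 0 1)) (pm : MapsTo p (ball 0 1) (ball 0 1)) (p0 : p 0 = 0)
    {η : ℝ} (hη : 0 < η) (hη1 : η ≤ 1/2) (ha : 1 - η ≤ ‖deriv p 0‖) {z : ℂ} (hz : z ∈ ball (0:ℂ) 1) :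
    ‖p z - deriv p 0 / ‖deriv p 0‖ * z‖ ≤ 5 * η / (1 - ‖z‖) := by
  set a := deriv p 0 with hadef
  have hU : IsOpen (ball (0:ℂ) 1) := isOpen_ball
  have h0m : (0:ℂ) ∈ ball (0:ℂ) 1 := by simp
  have hD : DifferentiableOn ℂ (dslope p 0) (ball 0 1) :=
    (Complex.differentiableOn_dslope (hU.mem_nhds h0m)).2 pd
  have eD : p z = z * dslope p 0 z := by
    have := sub_smul_dslope p 0 z
    rw [smul_eq_mul, p0, sub_zero, sub_zero] at this
    exact this.symm
  have hk1 : ∀ w ∈ ball (0:ℂ) 1, ‖dslope p 0 w‖ ≤ 1 := fun w hw => by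
    have := norm_dslope_le_div_of_mapsTo_ball (R₁ := 1) (R₂ := 1) pd (by rw [p0]; exact pm.mono_right ball_subset_closedBall) hw
    simpa using this
  have hk0 : dslope p 0 0 = a := dslope_same _ _
  have ha1 : ‖a‖ ≤ 1 := by rw [← hk0]; exact hk1 0 h0m
  have hap : 0 < ‖a‖ := by linarith
  have hane : a ≠ 0 := norm_pos_iff.1 hap
  have hz1 : ‖z‖ < 1 := by simpa using hz
  have hbc := Complex.borelCaratheodory_zero (M := η) (R := 1) (f := fun w => (starRingEnd ℂ) a * (dslope p 0 w - a)) (z := z) hη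
    ((hD.sub_const a).const_mul _) (fun w hw => by
      show ((starRingEnd ℂ) a * (dslope p 0 w - a)).re ≤ η
      rw [mul_sub, ← Complex.normSq_eq_conj_mul_self, Complex.normSq_eq_norm_sq, sub_re, ofReal_re]
      have h1 : ((starRingEnd ℂ) a * dslope p 0 w).re ≤ ‖a‖ := by
        refine (Complex.re_le_norm _).trans ?_
        rw [norm_mul, Complex.norm_conj]
        have := hk1 w hw
        nlinarith
      nlinarith) (by norm_num) hz (by
      show (starRingEnd ℂ) a * (dslope p 0 0 - a) = 0
      rw [hk0, sub_self, mul_zero])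
  simp only [norm_mul, Complex.norm_conj] at hbc
  have hzp : 0 < 1 - ‖z‖ := by linarith
  have h2 : ‖dslope p 0 z - a‖ ≤ 4 * η / (1 - ‖z‖) := by
    rw [le_div_iff₀ hzp] at hbc ⊢
    have : 0 ≤ ‖dslope p 0 z - a‖ * (1 - ‖z‖) := by positivity
    nlinarith
  have h3 : ‖a - a / ‖a‖‖ ≤ η := by
    have : a - a / ‖a‖ = a / ‖a‖ * ((‖a‖ - 1 : ℝ) : ℂ) := by
      have : (‖a‖:ℂ) ≠ 0 := by exact_mod_cast hap.ne'
      push_cast; field_simp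
    rw [this, norm_mul, norm_div, Complex.norm_real, Complex.norm_real, norm_norm, div_self hap.ne', one_mul, Real.norm_eq_abs, abs_le]
    constructor <;> linarith
  have e : p z - a / ‖a‖ * z = z * ((dslope p 0 z - a) + (a - a / ‖a‖)) := by rw [eD]; ring
  rw [e, norm_mul]
  have h4 : η ≤ η / (1 - ‖z‖) := by
    rw [le_div_iff₀ hzp]; nlinarith [norm_nonneg z]
  calc ‖z‖ * ‖(dslope p 0 z - a) + (a - a / ‖a‖)‖ ≤ 1 * (4 * η / (1 - ‖z‖) + η / (1 - ‖z‖)) := by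
        gcongr
        exact (norm_add_le _ _).trans (add_le_add h2 (h3.trans h4))
    _ = _ := by ring

lemma gr_close {gr p : ℂ → ℂ} {u : ℂ} {M' b : ℝ} (hg : DifferentiableOn ℂ gr (ball 0 1)) (hM : ∀ z ∈ ball (0:ℂ) 1, ‖gr z‖ ≤ M')
    {z : ℂ} (hz : ‖z‖ < 1) (hu : ‖u‖ = 1) (hp : ‖p z‖ ≤ ‖z‖) (hb : ‖p z - u * z‖ ≤ b) :
    ‖gr (p z) - gr (u * z)‖ ≤ 2 * M' / (1 - ‖z‖) * b := by
  have hM0 : 0 ≤ M' := (norm_nonneg _).trans (hM 0 (by simp))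
  have hzp : 0 < 1 - ‖z‖ := by linarith
  have := (convex_closedBall (0:ℂ) ‖z‖).norm_image_sub_le_of_norm_deriv_le (𝕜 := ℂ) (f := gr) (C := 2 * M' / (1 - ‖z‖)) (x := u * z) (y := p z)
    (fun w hw => hg.differentiableAt (isOpen_ball.mem_nhds (closedBall_subset_ball hz hw))) (fun w hw => by
      have hw' : ‖w‖ ≤ ‖z‖ := by simpa using hw
      have := cauchy_half hg hM (z := w) (by linarith)
      rw [le_div_iff₀ hzp]
      nlinarith [norm_nonneg (deriv gr w)]) (by simp [hu]) (by simpa using hp)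
  refine this.trans ?_
  gcongr

lemma seq_close {f gt q : ℂ → ℂ} (hf : DifferentiableOn ℂ f (ball 0 1)) {c0 M : ℝ} (hc0 : 0 < c0)
    (hc : ball 0 c0 ⊆ f '' ball 0 (1/2)) (hM : ∀ z ∈ ball (0:ℂ) 1, ‖f z‖ ≤ M)
    (X : ExtData gt q (closure (f '' ball 0 1))ᶜ) {r : ℕ → ℝ} (hr1 : ∀ n, r n < 1) (hrt : Tendsto r atTop (nhds 1))
    {gr qr : ℕ → ℂ → ℂ} (Xr : ∀ n, ExtData (gr n) (qr n) (closure (f '' ball 0 (r n)))ᶜ) :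
    ∃ u : ℕ → ℂ, (∀ n, ‖u n‖ = 1) ∧ TendstoLocallyUniformlyOn (fun n z => gr n (u n * z)) gt atTop (ball 0 1) := by
  have hV : ∀ n, (closure (f '' ball 0 1))ᶜ ⊆ (closure (f '' ball 0 (r n)))ᶜ := fun n =>
    compl_subset_compl.2 (closure_mono (image_mono (ball_subset_ball (hr1 n).le)))
  choose p pd pm p0 pi hp using fun n => ext_compare X (Xr n) (hV n)
  have hpn : ∀ n, deriv (p n) 0 ≠ 0 := fun n => univ_deriv_ne isOpen_ball (pd n) (pi n) (by simp)
  have hu : ∀ n, ‖deriv (p n) 0 / ‖deriv (p n) 0‖‖ = 1 := fun n => by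
    rw [norm_div, Complex.norm_real, norm_norm, div_self (norm_ne_zero_iff.2 (hpn n))]
  refine ⟨fun n => deriv (p n) 0 / ‖deriv (p n) 0‖, hu, ?_⟩
  rw [tendstoLocallyUniformlyOn_iff_forall_isCompact isOpen_ball]
  intro K hK hKc
  obtain ⟨ρ, hρ, hKρ⟩ := exists_lt_subset_ball hKc.isClosed hK
  rw [Metric.tendstoUniformlyOn_iff]
  intro ε hε
  set M' := 1 / c0 with hM'
  have hM'0 : 0 < M' := by positivity
  have hρp : 0 < 1 - ρ := by linarith
  set η := min (1/2) (ε * (1 - ρ)^2 / (20 * M')) with hηd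
  have hη : 0 < η := by positivity
  have hη1 : η ≤ 1/2 := min_le_left _ _
  have hη2 : 10 * M' * η < ε * (1-ρ)^2 := by
    have : η ≤ ε * (1 - ρ)^2 / (20 * M') := min_le_right _ _
    rw [le_div_iff₀ (by positivity)] at this
    have h2 : 0 < M' * η := by positivity
    linarith
  obtain ⟨s1, hs2, hs1, H⟩ := p_deriv_lower hf hc0 hc hM X hη (by linarith)
  filter_upwards [hrt.eventually (lt_mem_nhds hs1)] with n hn z hz
  have hzρ : ‖z‖ < ρ := by simpa using hKρ hz
  have hz1 : ‖z‖ < 1 := by linarith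
  have hzb : z ∈ ball (0:ℂ) 1 := by simpa using hz1
  have hl := H (r n) hn.le (hr1 n) _ _ _ (Xr n) (pd n) (pm n) (p0 n) (pi n) (hp n)
  have h1 := p_close (pd n) (pm n) (p0 n) hη hη1 hl hzb
  have h2 := gr_close (Xr n).gd (fun w hw => gt_upper hc0 (hc.trans (image_mono (ball_subset_ball (by linarith)))) (Xr n) hw) hz1 (hu n)
    (Complex.norm_le_norm_of_mapsTo_ball (pd n) ((pm n).mono_right ball_subset_closedBall) (p0 n) hz1) h1
  rw [hp n z hzb] at h2
  rw [dist_eq_norm]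
  refine h2.trans_lt ?_
  have hzp : 1 - ρ ≤ 1 - ‖z‖ := by linarith
  calc 2 * (1/c0) / (1 - ‖z‖) * (5 * η / (1 - ‖z‖)) ≤ 2 * (1/c0) / (1 - ρ) * (5 * η / (1 - ρ)) := by gcongr
    _ = 10 * M' * η / (1 - ρ)^2 := by rw [hM']; field_simp; ring
    _ < ε := by rw [div_lt_iff₀ (by positivity)]; exact hη2

lemma tlu_prod {F : ℕ → ℂ → ℂ} {f : ℂ → ℂ} {U : Set ℂ} (hU : IsOpen U) (h : TendstoLocallyUniformlyOn F f atTop U)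
    (hf : ContinuousOn f U) {z : ℂ} (hz : z ∈ U) : Tendsto (fun x : ℕ × ℂ => F x.1 x.2) (atTop ×ˢ nhds z) (nhds (f z)) := by
  have h1 := tendstoLocallyUniformlyOn_iff_forall_tendsto.1 h z hz
  rw [hU.nhdsWithin_eq hz] at h1
  have h2 : Tendsto (fun x : ℕ × ℂ => f x.2) (atTop ×ˢ nhds z) (nhds (f z)) :=
    ((hf.continuousAt (hU.mem_nhds hz)).tendsto).comp tendsto_snd
  rw [Uniform.tendsto_nhds_right] at h2 ⊢
  exact h2.uniformity_trans h1

lemma schw_conv {h : ℕ → ℂ → ℂ} {g : ℂ → ℂ} {U : Set ℂ} (hU : IsOpen U) (hh : ∀ n, DifferentiableOn ℂ (h n) U)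
    (hg : DifferentiableOn ℂ g U) (hi : InjOn g U) (hT : TendstoLocallyUniformlyOn h g atTop U) {z : ℂ} (hz : z ∈ U) :
    Tendsto (fun x : ℕ × ℂ => schwarzian (h x.1) x.2) (atTop ×ˢ nhds z) (nhds (schwarzian g z)) := by
  have g1 := hg.deriv hU
  have g2 := g1.deriv hU
  have g3 := g2.deriv hU
  have h1 : ∀ n, DifferentiableOn ℂ (deriv (h n)) U := fun n => (hh n).deriv hU
  have h2 : ∀ n, DifferentiableOn ℂ (deriv (deriv (h n))) U := fun n => (h1 n).deriv hU
  have T1 := hT.deriv (Eventually.of_forall hh) hU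
  have T2 := T1.deriv (Eventually.of_forall h1) hU
  have T3 := T2.deriv (Eventually.of_forall h2) hU
  have l1 := tlu_prod hU T1 g1.continuousOn hz
  have l2 := tlu_prod hU T2 g2.continuousOn hz
  have l3 := tlu_prod hU T3 g3.continuousOn hz
  have hne := univ_deriv_ne hU hg hi hz
  exact (l3.div l1 hne).sub (((l2.div l1 hne).pow 2).const_mul (3/2))

lemma schw_bdd {h : ℕ → ℂ → ℂ} {g : ℂ → ℂ} {U K : Set ℂ} (hU : IsOpen U) (hh : ∀ n, DifferentiableOn ℂ (h n) U)
    (hg : DifferentiableOn ℂ g U) (hi : InjOn g U) (hT : TendstoLocallyUniformlyOn h g atTop U) (hK : IsCompact K) (hKU : K ⊆ U) :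
    ∃ B : ℝ, ∀ᶠ n in atTop, ∀ z ∈ K, ‖schwarzian (h n) z‖ ≤ B := by
  have hc : ContinuousOn (schwarzian g) K := fun z hz =>
    (schwarzian_analyticAt (hg.analyticAt (hU.mem_nhds (hKU hz))) (univ_deriv_ne hU hg hi (hKU hz))).continuousAt.continuousWithinAt
  obtain ⟨B, hB⟩ := hK.exists_bound_of_continuousOn hc
  refine ⟨B + 1, ?_⟩
  have : {x : ℕ × ℂ | ‖schwarzian (h x.1) x.2‖ ≤ B + 1} ∈ (atTop : Filter ℕ) ×ˢ nhdsSet K := by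
    refine hK.mem_prod_nhdsSet_of_forall fun z hz => ?_
    have := (schw_conv hU hh hg hi hT (hKU hz)).norm
    filter_upwards [this.eventually (gt_mem_nhds (a := B + 1) (by linarith [hB z hz]))] with x hx using hx.le
  have h2 : ∀ᶠ x : ℕ × ℂ in (atTop : Filter ℕ) ×ˢ nhdsSet K, ‖schwarzian (h x.1) x.2‖ ≤ B + 1 := this
  filter_upwards [h2.curry] with n hn z hz
  exact hn.self_of_nhdsSet z hz

lemma conv_abstract {F : ℕ → ℂ → ℝ} {F0 : ℂ → ℝ} (hn : ∀ n z, 0 ≤ F n z) (hn0 : ∀ z, 0 ≤ F0 z)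
    (hc : ∀ n, ContinuousOn (F n) (ball 0 1)) (hc0 : ContinuousOn F0 (ball 0 1))
    (hp : ∀ z ∈ ball (0:ℂ) 1, Tendsto (fun n => F n z) atTop (nhds (F0 z)))
    (hb : ∀ ρ : ℝ, ρ < 1 → ∃ B : ℝ, ∀ᶠ n in atTop, ∀ z ∈ closedBall (0:ℂ) ρ, F n z ≤ B)
    (ht : ∀ ε : ℝ, 0 < ε → ∃ ρ : ℝ, ρ < 1 ∧ ∀ᶠ n in atTop, ∫⁻ z in ann ρ, ENNReal.ofReal (F n z) ≤ ENNReal.ofReal ε) :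
    Tendsto (fun n => ∫ z in ball (0:ℂ) 1, F n z) atTop (nhds (∫ z in ball (0:ℂ) 1, F0 z)) := by
  have hmb : MeasurableSet (ball (0:ℂ) 1) := measurableSet_ball
  have hm : ∀ n, AEMeasurable (fun z => ENNReal.ofReal (F n z)) (volume.restrict (ball 0 1)) := fun n =>
    ((hc n).aemeasurable hmb).ennreal_ofReal
  have hm0 : AEMeasurable (fun z => ENNReal.ofReal (F0 z)) (volume.restrict (ball 0 1)) :=
    (hc0.aemeasurable hmb).ennreal_ofReal
  have e : ∀ n, ∫ z in ball (0:ℂ) 1, F n z = (∫⁻ z in ball (0:ℂ) 1, ENNReal.ofReal (F n z)).toReal := fun n =>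
    integral_eq_lintegral_of_nonneg_ae (Eventually.of_forall fun z => hn n z) ((hc n).aestronglyMeasurable hmb)
  have e0 : ∫ z in ball (0:ℂ) 1, F0 z = (∫⁻ z in ball (0:ℂ) 1, ENNReal.ofReal (F0 z)).toReal :=
    integral_eq_lintegral_of_nonneg_ae (Eventually.of_forall fun z => hn0 z) (hc0.aestronglyMeasurable hmb)
  have hsplit : ∀ (G : ℂ → ENNReal) (ρ : ℝ), ρ < 1 →
      ∫⁻ z in ball (0:ℂ) 1, G z = (∫⁻ z in closedBall (0:ℂ) ρ, G z) + ∫⁻ z in ann ρ, G z := fun G ρ hρ => by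
    have hu : ball (0:ℂ) 1 = closedBall 0 ρ ∪ ann ρ := by
      ext z
      simp only [mem_ball_zero_iff, mem_union, mem_closedBall_zero_iff, ann, mem_ofPred_eq]
      constructor
      · intro h
        rcases le_or_gt ‖z‖ ρ with h1 | h1
        · exact Or.inl h1
        · exact Or.inr ⟨h1, h⟩
      · rintro (h | h)
        · linarith
        · exact h.2
    rw [hu, lintegral_union (isOpen_ann ρ).measurableSet]
    rw [Set.disjoint_left]
    intro z hz hz2
    have h1 : ‖z‖ ≤ ρ := by simpa using hz
    exact absurd hz2.1 (not_lt.2 h1)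
  have hlim : ∀ z ∈ ball (0:ℂ) 1, Tendsto (fun n => ENNReal.ofReal (F n z)) atTop (nhds (ENNReal.ofReal (F0 z))) :=
    fun z hz => (ENNReal.continuous_ofReal.tendsto _).comp (hp z hz)
  have hA : ∀ ρ : ℝ, ρ < 1 → Tendsto (fun n => ∫⁻ z in closedBall (0:ℂ) ρ, ENNReal.ofReal (F n z)) atTop
      (nhds (∫⁻ z in closedBall (0:ℂ) ρ, ENNReal.ofReal (F0 z))) := fun ρ hρ => by
    obtain ⟨B, hB⟩ := hb ρ hρ
    have hs : closedBall (0:ℂ) ρ ⊆ ball 0 1 := closedBall_subset_ball hρ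
    refine tendsto_lintegral_filter_of_dominated_convergence' (fun _ => ENNReal.ofReal B)
      ?_ ?_ ?_ ?_
    · exact Eventually.of_forall fun n => (hm n).mono_measure (Measure.restrict_mono hs le_rfl)
    · filter_upwards [hB] with n hn2
      exact (ae_restrict_iff' measurableSet_closedBall).2 (Eventually.of_forall fun z hz => ENNReal.ofReal_le_ofReal (hn2 z hz))
    · rw [setLIntegral_const]
      exact ENNReal.mul_ne_top ENNReal.ofReal_ne_top measure_closedBall_lt_top.ne
    · exact (ae_restrict_iff' measurableSet_closedBall).2 (Eventually.of_forall fun z hz => hlim z (hs hz))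
  have hT : ∀ ρ ε : ℝ, (∀ᶠ n in atTop, ∫⁻ z in ann ρ, ENNReal.ofReal (F n z) ≤ ENNReal.ofReal ε) →
      ∫⁻ z in ann ρ, ENNReal.ofReal (F0 z) ≤ ENNReal.ofReal ε := fun ρ ε h => by
    have hs : ann ρ ⊆ ball 0 1 := fun z hz => by rw [mem_ball_zero_iff]; exact hz.2
    calc ∫⁻ z in ann ρ, ENNReal.ofReal (F0 z) ≤ ∫⁻ z in ann ρ, liminf (fun n => ENNReal.ofReal (F n z)) atTop :=
          setLIntegral_mono' (isOpen_ann ρ).measurableSet fun z hz => (hlim z (hs hz)).liminf_eq.ge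
      _ ≤ liminf (fun n => ∫⁻ z in ann ρ, ENNReal.ofReal (F n z)) atTop :=
          lintegral_liminf_le' fun n => (hm n).mono_measure (Measure.restrict_mono hs le_rfl)
      _ ≤ _ := liminf_le_of_frequently_le' h.frequently
  have hfin : ∫⁻ z in ball (0:ℂ) 1, ENNReal.ofReal (F0 z) ≠ ⊤ := by
    obtain ⟨ρ, hρ, h⟩ := ht 1 one_pos
    rw [hsplit _ ρ hρ]
    refine ENNReal.add_ne_top.2 ⟨?_, ne_top_of_le_ne_top ENNReal.ofReal_ne_top (hT ρ 1 h)⟩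
    have hi : IntegrableOn F0 (closedBall 0 ρ) := (hc0.mono (closedBall_subset_ball hρ)).integrableOn_compact (isCompact_closedBall 0 ρ)
    exact (hi.lintegral_lt_top).ne
  rw [e0]
  simp only [e]
  refine (ENNReal.tendsto_toReal hfin).comp ?_
  rw [ENNReal.tendsto_nhds hfin]
  intro ε hε
  obtain ⟨e1, he1, he1ε⟩ : ∃ e1 : ℝ, 0 < e1 ∧ ENNReal.ofReal e1 + ENNReal.ofReal e1 ≤ ε := by
    have hne : min ε 1 ≠ ⊤ := ne_top_of_le_ne_top ENNReal.one_ne_top (min_le_right _ _)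
    have hpos : 0 < (min ε 1).toReal := ENNReal.toReal_pos (by simp [hε.ne']) hne
    refine ⟨(min ε 1).toReal / 2, by positivity, ?_⟩
    rw [← ENNReal.ofReal_add (by positivity) (by positivity), add_halves, ENNReal.ofReal_toReal hne]
    exact min_le_left _ _
  obtain ⟨ρ, hρ, h⟩ := ht e1 he1
  have hTF := hT ρ e1 h
  have hAfin : ∫⁻ z in closedBall (0:ℂ) ρ, ENNReal.ofReal (F0 z) ≠ ⊤ := by
    intro hh; apply hfin; rw [hsplit _ ρ hρ, hh, top_add]
  have hAe := (ENNReal.tendsto_nhds hAfin).1 (hA ρ hρ) (ENNReal.ofReal e1) (by simpa using he1)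
  filter_upwards [h, hAe] with n h1 h2
  rw [hsplit _ ρ hρ, hsplit _ ρ hρ]
  obtain ⟨h3, h4⟩ := h2
  constructor
  · rw [tsub_le_iff_right] at h3 ⊢
    calc (∫⁻ z in closedBall (0:ℂ) ρ, ENNReal.ofReal (F0 z)) + ∫⁻ z in ann ρ, ENNReal.ofReal (F0 z)
        ≤ (∫⁻ z in closedBall (0:ℂ) ρ, ENNReal.ofReal (F n z)) + ENNReal.ofReal e1 + ENNReal.ofReal e1 := add_le_add h3 hTF
      _ ≤ (∫⁻ z in closedBall (0:ℂ) ρ, ENNReal.ofReal (F n z)) + ε := by rw [add_assoc]; exact add_le_add le_rfl he1ε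
      _ ≤ _ := by gcongr; exact le_self_add
  · calc (∫⁻ z in closedBall (0:ℂ) ρ, ENNReal.ofReal (F n z)) + ∫⁻ z in ann ρ, ENNReal.ofReal (F n z)
        ≤ (∫⁻ z in closedBall (0:ℂ) ρ, ENNReal.ofReal (F0 z)) + ENNReal.ofReal e1 + ENNReal.ofReal e1 := add_le_add h4 h1
      _ ≤ (∫⁻ z in closedBall (0:ℂ) ρ, ENNReal.ofReal (F0 z)) + ε := by rw [add_assoc]; exact add_le_add le_rfl he1ε
      _ ≤ _ := by gcongr; exact le_self_add

lemma rot_image {u : ℂ} (hu : ‖u‖ = 1) {U : Set ℂ} (hU : ∀ z w : ℂ, ‖z‖ = ‖w‖ → z ∈ U → w ∈ U) : (fun z => u * z) '' U = U := by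
  have hu0 : u ≠ 0 := norm_pos_iff.1 (by rw [hu]; norm_num)
  ext w
  constructor
  · rintro ⟨z, hz, rfl⟩
    exact hU z _ (by simp [hu]) hz
  · intro hw
    exact ⟨u⁻¹ * w, hU w _ (by simp [hu]) hw, by field_simp⟩

lemma rot_deriv (u z : ℂ) : deriv (fun z => u * z) z = u := by
  simpa using ((hasDerivAt_id z).const_mul u).deriv

lemma rot_lintegral {u : ℂ} (hu : ‖u‖ = 1) (ρ : ℝ) (F : ℂ → ENNReal) :
    ∫⁻ z in ann ρ, F (u * z) = ∫⁻ z in ann ρ, F z := by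
  have hu0 : u ≠ 0 := norm_pos_iff.1 (by rw [hu]; norm_num)
  have := cov_lintegral (f := fun z => u * z) (isOpen_ann ρ) (by fun_prop) (fun a _ b _ h => mul_left_cancel₀ hu0 h) F
  rw [rot_image hu (U := ann ρ) (fun z w h hz => by simp only [ann, mem_ofPred_eq] at hz ⊢; rw [← h]; exact hz)] at this
  rw [this]
  simp only [rot_deriv, hu]
  simp

lemma rot_integral {u : ℂ} (hu : ‖u‖ = 1) (F : ℂ → ℝ) :
    ∫ z in ball (0:ℂ) 1, F (u * z) = ∫ z in ball (0:ℂ) 1, F z := by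
  have hu0 : u ≠ 0 := norm_pos_iff.1 (by rw [hu]; norm_num)
  have := cov_integral (f := fun z => u * z) (isOpen_ball (x := (0:ℂ)) (ε := 1)) (by fun_prop) (fun a _ b _ h => mul_left_cancel₀ hu0 h) F
  rw [rot_image hu (U := ball 0 1) (fun z w h hz => by rw [mem_ball_zero_iff] at hz ⊢; rw [← h]; exact hz)] at this
  rw [this]
  simp only [rot_deriv, hu]
  simp

lemma tail_unif {f gt q : ℂ → ℂ} (hf : DifferentiableOn ℂ f (ball 0 1)) (hfi : InjOn f (ball 0 1)) (hf0 : f 0 = 0)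
    (hJ : IsJordanCurve (frontier (f '' ball (0:ℂ) 1)))
    (hWP : IntegrableOn (fun z => ‖schwarzian f z‖ ^ 2 * (1 - ‖z‖ ^ 2) ^ 2 / 4) (ball (0:ℂ) 1))
    {M : ℝ} (hM : ∀ z ∈ ball (0:ℂ) 1, ‖f z‖ ≤ M)
    (X : ExtData gt q (closure (f '' ball 0 1))ᶜ) {δ : ℝ} (hδ0 : 0 < δ) (hδ : ball 0 δ ⊆ gt '' ball 0 1) {ε : ℝ} (hε : 0 < ε) :
    ∃ ρ s1 : ℝ, ρ < 1 ∧ s1 < 1 ∧ ∀ r : ℝ, s1 ≤ r → r < 1 → ∀ gr qr : ℂ → ℂ, ExtData gr qr (closure (f '' ball 0 r))ᶜ →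
      ∫⁻ z in ann ρ, ENNReal.ofReal (‖schwarzian gr z‖^2 * (1 - ‖z‖^2)^2) ≤ ENNReal.ofReal ε := by
  obtain ⟨R, hR0, hR1, hb⟩ := little_bloch hf hfi hM hWP (ε := 1/3000) (by norm_num)
  have G : GoodMap f (1/3000) (max R (1/2)) := ⟨hf, hfi, by norm_num, by norm_num, le_max_right _ _, by simp [hR1]; norm_num,
    fun z hz hz1 => hb z ((le_max_left _ _).trans hz) hz1⟩
  obtain ⟨F, hF, hFf, hFi⟩ := G.full hJ
  obtain ⟨R1, s0, hR01, hR11, hs0, hs01, C⟩ := G.collar (by norm_num) hF hFf hFi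
  have hR1h : 1/2 ≤ R1 := (le_max_right _ _).trans hR01
  set ε' := ε / (2 * (409600 * Real.pi^2)) with hε'
  have hpi := Real.pi_pos
  obtain ⟨R2, hR20, hR21, hR2⟩ := tail_small (N_L2 hf hfi hM hWP) (ε := ε') (by positivity)
  set R3 := max R1 (Real.sqrt R2) with hR3
  have hsq : Real.sqrt R2 < 1 := by rw [Real.sqrt_lt' one_pos]; simpa using hR21
  have hR31 : R3 < 1 := max_lt hR11 hsq
  have hR32 : R2 ≤ R3^2 := by
    rw [← Real.sq_sqrt hR20.le]
    exact pow_le_pow_left₀ (Real.sqrt_nonneg _) (le_max_right _ _) 2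
  obtain ⟨K, s1, hK, hs1, H⟩ := tail_bound hf hfi hf0 X hδ0 hδ hs0 hs01 (fun s h1 h2 => C R3 (le_max_left _ _) hR31 s h1 h2)
  have hρ : ∀ᶠ ρ : ℝ in nhdsWithin 1 (Iio 1), K * (1 - ρ^2)^2 < ε / 2 := by
    have hc : ContinuousAt (fun ρ : ℝ => K * (1 - ρ^2)^2) 1 := by fun_prop
    exact (hc.eventually (gt_mem_nhds (by norm_num; positivity))).filter_mono nhdsWithin_le_nhds
  have hρ2 : ∀ᶠ ρ : ℝ in nhdsWithin 1 (Iio 1), 1/2 < ρ :=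
    (lt_mem_nhds (by norm_num : (1/2:ℝ) < 1)).filter_mono nhdsWithin_le_nhds
  obtain ⟨ρ, h1, h2, h3⟩ := (hρ.and (hρ2.and self_mem_nhdsWithin)).exists
  have h3 : ρ < 1 := h3
  refine ⟨ρ, s1, h3, hs1, fun r hr hr1 gr qr Xr => (H r hr hr1 gr qr Xr ρ h2.le h3).trans ?_⟩
  have hN : ∫⁻ z in ann (R3^2), ENNReal.ofReal (‖deriv (deriv f) z / deriv f z‖^2) ≤ ENNReal.ofReal ε' := by
    refine le_trans (lintegral_mono_set ?_) (hR2 _ hR32)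
    intro z hz
    exact ⟨by rw [mem_ball_zero_iff]; exact hz.2, by rw [mem_ball_zero_iff]; exact not_lt.2 hz.1.le⟩
  calc ENNReal.ofReal (K * (1 - ρ^2)^2) + ENNReal.ofReal (409600 * Real.pi^2) * _ ≤
      ENNReal.ofReal (ε/2) + ENNReal.ofReal (409600 * Real.pi^2) * ENNReal.ofReal ε' := by
        gcongr
    _ = ENNReal.ofReal ε := by
        rw [← ENNReal.ofReal_mul (by positivity), ← ENNReal.ofReal_add (by positivity) (by positivity)]
        congr 1
        rw [hε']; field_simp; norm_num

lemma ext_conv {f gt q : ℂ → ℂ} (hf : DifferentiableOn ℂ f (ball 0 1)) (hfi : InjOn f (ball 0 1)) (hf0 : f 0 = 0)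
    (hJ : IsJordanCurve (frontier (f '' ball (0:ℂ) 1)))
    (hWP : IntegrableOn (fun z => ‖schwarzian f z‖ ^ 2 * (1 - ‖z‖ ^ 2) ^ 2 / 4) (ball (0:ℂ) 1))
    (X : ExtData gt q (closure (f '' ball 0 1))ᶜ) {r : ℕ → ℝ} (hr1 : ∀ n, r n < 1) (hrt : Tendsto r atTop (nhds 1))
    {gr qr : ℕ → ℂ → ℂ} (Xr : ∀ n, ExtData (gr n) (qr n) (closure (f '' ball 0 (r n)))ᶜ) :
    Tendsto (fun n => ∫ z in ball (0:ℂ) 1, ‖schwarzian (gr n) z‖ ^ 2 * (1 - ‖z‖ ^ 2) ^ 2 / 4) atTop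
      (nhds (∫ z in ball (0:ℂ) 1, ‖schwarzian gt z‖ ^ 2 * (1 - ‖z‖ ^ 2) ^ 2 / 4)) := by
  have hU : IsOpen (ball (0:ℂ) 1) := isOpen_ball
  obtain ⟨δ, hδ0, hδ⟩ := Metric.isOpen_iff.1 (univ_image_open hU X.gd X.gi hU subset_rfl) 0 ⟨0, by simp, X.g0⟩
  obtain ⟨c0, hc0, hc⟩ := Metric.isOpen_iff.1 (univ_image_open hU hf hfi (isOpen_ball (x := (0:ℂ)) (ε := 1/2))
    (ball_subset_ball (by norm_num))) 0 ⟨0, by simp, hf0⟩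
  have hM : ∀ z ∈ ball (0:ℂ) 1, ‖f z‖ ≤ 1/δ := fun z hz => by
    by_contra hlt
    push Not at hlt
    have hfz : 0 < ‖f z‖ := lt_trans (by positivity) hlt
    have hm : (f z)⁻¹ ∈ ball (0:ℂ) δ := by
      rw [mem_ball_zero_iff, norm_inv]
      rw [one_div] at hlt
      exact inv_lt_of_inv_lt₀ hδ0 hlt
    obtain ⟨w, hw, hwe⟩ := hδ hm
    have hw0 : w ≠ 0 := fun h => by
      rw [h, X.g0] at hwe
      exact inv_ne_zero (norm_pos_iff.1 hfz) hwe.symm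
    have := (X.gq w hw hw0).2.1
    rw [hwe, inv_inv] at this
    exact this (subset_closure ⟨z, hz, rfl⟩)
  obtain ⟨u, hu, hT⟩ := seq_close hf hc0 hc hM X hr1 hrt Xr
  have hu0 : ∀ n, u n ≠ 0 := fun n => norm_pos_iff.1 (by rw [hu n]; norm_num)
  have hum : ∀ n, ∀ z ∈ ball (0:ℂ) 1, u n * z ∈ ball (0:ℂ) 1 := fun n z hz => by
    rw [mem_ball_zero_iff, norm_mul, hu, one_mul]; simpa using hz
  have hdiff : ∀ n, DifferentiableOn ℂ (fun z => gr n (u n * z)) (ball 0 1) := fun n =>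
    (Xr n).gd.comp (by fun_prop) (hum n)
  have hinj : ∀ n, InjOn (fun z => gr n (u n * z)) (ball 0 1) := fun n a ha b hb hab =>
    mul_left_cancel₀ (hu0 n) ((Xr n).gi (hum n a ha) (hum n b hb) hab)
  have hS : ∀ n, ∀ z ∈ ball (0:ℂ) 1, ‖schwarzian (fun z => gr n (u n * z)) z‖ = ‖schwarzian (gr n) (u n * z)‖ := fun n z hz => by
    rw [schwarzian_comp_mul (hu0 n) ((Xr n).gd.analyticAt (hU.mem_nhds (hum n z hz)))
      (univ_deriv_ne hU (Xr n).gd (Xr n).gi (hum n z hz)), norm_mul, norm_pow, hu]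
    simp
  have hSc : ∀ g : ℂ → ℂ, DifferentiableOn ℂ g (ball 0 1) → InjOn g (ball 0 1) →
      ContinuousOn (fun z => ‖schwarzian g z‖ ^ 2 * (1 - ‖z‖ ^ 2) ^ 2 / 4) (ball 0 1) := fun g hg hi => by
    have h1 : ContinuousOn (schwarzian g) (ball 0 1) := fun z hz =>
      (schwarzian_analyticAt (hg.analyticAt (hU.mem_nhds hz)) (univ_deriv_ne hU hg hi hz)).continuousAt.continuousWithinAt
    have h2 : Continuous (fun z : ℂ => (1 - ‖z‖ ^ 2) ^ 2) := by fun_prop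
    exact ((h1.norm.pow 2).mul h2.continuousOn).div_const 4
  have key := conv_abstract (F := fun n z => ‖schwarzian (fun z => gr n (u n * z)) z‖ ^ 2 * (1 - ‖z‖ ^ 2) ^ 2 / 4)
    (F0 := fun z => ‖schwarzian gt z‖ ^ 2 * (1 - ‖z‖ ^ 2) ^ 2 / 4) (fun n z => by positivity) (fun z => by positivity)
    (fun n => hSc _ (hdiff n) (hinj n)) (hSc _ X.gd X.gi) (fun z hz => by
      have h1 := schw_conv hU hdiff X.gd X.gi hT hz
      have h2 : Tendsto (fun n : ℕ => (n, z)) atTop (atTop ×ˢ nhds z) := tendsto_id.prodMk tendsto_const_nhds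
      have h3 := h1.comp h2
      exact ((h3.norm.pow 2).mul_const _).div_const 4) (fun ρ hρ => by
      obtain ⟨B, hB⟩ := schw_bdd hU hdiff X.gd X.gi hT (isCompact_closedBall 0 ρ) (closedBall_subset_ball hρ)
      refine ⟨B^2, ?_⟩
      filter_upwards [hB] with n hn z hz
      have hz1 : ‖z‖ < 1 := by
        have : ‖z‖ ≤ ρ := by simpa using hz
        linarith
      have h1 : ‖schwarzian (fun z => gr n (u n * z)) z‖ ^ 2 ≤ B^2 := pow_le_pow_left₀ (norm_nonneg _) (hn z hz) 2
      have h2 : (1 - ‖z‖^2)^2 ≤ 1 := by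
        have : ‖z‖^2 ≤ 1 := by nlinarith [norm_nonneg z]
        nlinarith [sq_nonneg ‖z‖]
      have h3 : ‖schwarzian (fun z => gr n (u n * z)) z‖ ^ 2 * (1 - ‖z‖ ^ 2) ^ 2 ≤ B^2 * 1 := by gcongr
      have h4 : 0 ≤ ‖schwarzian (fun z => gr n (u n * z)) z‖ ^ 2 * (1 - ‖z‖ ^ 2) ^ 2 := by positivity
      linarith) (fun ε hε => by
      obtain ⟨ρ, s1, hρ, hs1, H⟩ := tail_unif hf hfi hf0 hJ hWP hM X hδ0 hδ hε
      refine ⟨ρ, hρ, ?_⟩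
      filter_upwards [hrt.eventually (lt_mem_nhds hs1)] with n hn
      refine le_trans ?_ (H (r n) hn.le (hr1 n) _ _ (Xr n))
      rw [← rot_lintegral (hu n) ρ (fun z => ENNReal.ofReal (‖schwarzian (gr n) z‖^2 * (1 - ‖z‖^2)^2))]
      refine setLIntegral_mono' (isOpen_ann ρ).measurableSet fun z hz => ENNReal.ofReal_le_ofReal ?_
      rw [hS n z (by rw [mem_ball_zero_iff]; exact hz.2), norm_mul (u n), hu, one_mul]
      have h4 : 0 ≤ ‖schwarzian (gr n) (u n * z)‖ ^ 2 * (1 - ‖z‖ ^ 2) ^ 2 := by positivity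
      linarith)
  refine key.congr fun n => ?_
  rw [← rot_integral (hu n) (fun z => ‖schwarzian (gr n) z‖ ^ 2 * (1 - ‖z‖ ^ 2) ^ 2 / 4)]
  refine setIntegral_congr_fun measurableSet_ball fun z hz => ?_
  simp only [hS n z hz, norm_mul, hu, one_mul]

lemma scaled_image {f gn : ℂ → ℂ} {r : ℝ} (hr : 0 < r) {fn : ℂ → ℂ} (hfn : ∀ z, fn z = (r:ℂ)⁻¹ * f (r * z))
    (hgn : gn '' extDisk = (closure (fn '' ball (0:ℂ) 1))ᶜ) :
    (fun z => (r:ℂ) * gn z) '' extDisk = (closure (f '' ball 0 r))ᶜ := by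
  have hrc : (r:ℂ) ≠ 0 := by exact_mod_cast hr.ne'
  set h := Homeomorph.mulLeft₀ (r:ℂ) hrc with hh
  have e1 : (fun z => (r:ℂ) * gn z) '' extDisk = h '' (gn '' extDisk) := by
    rw [image_image]; rfl
  have e2 : h '' (fn '' ball (0:ℂ) 1) = f '' ball 0 r := by
    rw [image_image]
    ext w
    constructor
    · rintro ⟨z, hz, rfl⟩
      have hz1 : ‖z‖ < 1 := by simpa using hz
      refine ⟨r * z, ?_, ?_⟩
      · rw [mem_ball_zero_iff, norm_mul, Complex.norm_real, Real.norm_eq_abs, abs_of_pos hr]; nlinarith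
      · show f (r * z) = (r:ℂ) * fn z
        rw [hfn]; field_simp
    · rintro ⟨z, hz, rfl⟩
      have hz1 : ‖z‖ < r := by simpa using hz
      refine ⟨(r:ℂ)⁻¹ * z, ?_, ?_⟩
      · rw [mem_ball_zero_iff, norm_mul, norm_inv, Complex.norm_real, Real.norm_eq_abs, abs_of_pos hr, inv_mul_lt_iff₀ hr]; simpa using hz1
      · show (r:ℂ) * fn ((r:ℂ)⁻¹ * z) = f z
        rw [hfn, mul_inv_cancel_left₀ hrc, mul_inv_cancel_left₀ hrc]
  rw [e1, hgn, image_compl_eq h.bijective, h.image_closure, e2]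

/-- Convergence of the total mean curvatures of the Epstein–Poincaré surfaces along the
equipotential approximations `γ_n = f_n(S¹)`, `f_n(z) = (n/(n-1)) f((n-1)z/n)`, of a
Weil–Petersson quasicircle `γ = ∂ f(𝔻)`:
`∫_𝔻 |𝒮(f_n)|² ρ_𝔻⁻¹ → ∫_𝔻 |𝒮(f)|² ρ_𝔻⁻¹` and
`∫_{𝔻*} |𝒮(g_n)|² ρ_{𝔻*}⁻¹ → ∫_{𝔻*} |𝒮(g)|² ρ_{𝔻*}⁻¹`. -/
theorem equipotential_total_mean_curvature_convergence
    (f g : ℂ → ℂ) (fn gn : ℕ → ℂ → ℂ)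
    (hf : DifferentiableOn ℂ f (ball (0:ℂ) 1))
    (hfinj : InjOn f (ball (0:ℂ) 1))
    (hf0 : f 0 = 0) (hf'0 : deriv f 0 = 1) (hf''0 : deriv (deriv f) 0 = 0)
    (hJordan : IsJordanCurve (frontier (f '' ball (0:ℂ) 1)))
    (hWP : IntegrableOn (fun z => ‖schwarzian f z‖ ^ 2 * (1 - ‖z‖ ^ 2) ^ 2 / 4)
      (ball (0:ℂ) 1))
    (hfn : ∀ n : ℕ, 2 ≤ n →
      fn n = fun z => ((n : ℂ) / ((n : ℂ) - 1)) * f ((((n : ℂ) - 1) / (n : ℂ)) * z))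
    (hg : DifferentiableOn ℂ g extDisk)
    (hginj : InjOn g extDisk)
    (hgim : g '' extDisk = (closure (f '' ball (0:ℂ) 1))ᶜ)
    (hgn : ∀ n : ℕ, 2 ≤ n → DifferentiableOn ℂ (gn n) extDisk ∧ InjOn (gn n) extDisk ∧
      gn n '' extDisk = (closure (fn n '' ball (0:ℂ) 1))ᶜ) :
    Tendsto (fun n =>
        ∫ z in ball (0:ℂ) 1, ‖schwarzian (fn n) z‖ ^ 2 * (1 - ‖z‖ ^ 2) ^ 2 / 4)
      atTop (nhds (∫ z in ball (0:ℂ) 1, ‖schwarzian f z‖ ^ 2 * (1 - ‖z‖ ^ 2) ^ 2 / 4)) ∧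
    Tendsto (fun n =>
        ∫ z in extDisk, ‖schwarzian (gn n) z‖ ^ 2 * (‖z‖ ^ 2 - 1) ^ 2 / 4)
      atTop (nhds (∫ z in extDisk, ‖schwarzian g z‖ ^ 2 * (‖z‖ ^ 2 - 1) ^ 2 / 4)) := by
  refine ⟨part1 hf hfinj hWP hfn, ?_⟩
  have hU : IsOpen (ball (0:ℂ) 1) := isOpen_ball
  obtain ⟨gt, q, X, hX⟩ := exists_extData (univ_image_open hU hf hfinj hU subset_rfl) ⟨0, by simp, hf0⟩ hg hginj hgim
  rw [gt_integral hg hginj hX, ← tendsto_add_atTop_iff_nat 2]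
  set r : ℕ → ℝ := fun n => (((n + 2 : ℕ):ℝ) - 1) / ((n + 2 : ℕ):ℝ) with hr
  have hr0 : ∀ n, 0 < r n := fun n => rn_pos (by omega)
  have hr1 : ∀ n, r n < 1 := fun n => rn_lt (by omega)
  have hrt : Tendsto r atTop (nhds 1) := (tendsto_add_atTop_iff_nat (f := fun n : ℕ => ((n:ℝ) - 1) / n) 2).2 rn_tendsto
  have hrc : ∀ n, ((r n : ℝ):ℂ) ≠ 0 := fun n => by exact_mod_cast (hr0 n).ne'
  have hrcast : ∀ n, ((r n : ℝ):ℂ) = (((n + 2 : ℕ):ℂ) - 1) / ((n + 2 : ℕ):ℂ) := fun n => by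
    simp only [hr]; push_cast; ring
  have him : ∀ n, (fun z => ((r n : ℝ):ℂ) * gn (n+2) z) '' extDisk = (closure (f '' ball 0 (r n)))ᶜ := fun n => by
    refine scaled_image (hr0 n) (fn := fn (n+2)) (fun z => ?_) (hgn (n+2) (by omega)).2.2
    rw [hfn (n+2) (by omega), hrcast, inv_div]
  have hd : ∀ n, DifferentiableOn ℂ (fun z => ((r n : ℝ):ℂ) * gn (n+2) z) extDisk := fun n => (hgn (n+2) (by omega)).1.const_mul _
  have hi : ∀ n, InjOn (fun z => ((r n : ℝ):ℂ) * gn (n+2) z) extDisk := fun n a ha b hb hab =>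
    (hgn (n+2) (by omega)).2.1 ha hb (mul_left_cancel₀ (hrc n) hab)
  choose gr qr Xr hXr using fun n => exists_extData (univ_image_open hU hf hfinj (isOpen_ball (x := (0:ℂ)) (ε := r n))
    (ball_subset_ball (hr1 n).le)) ⟨0, by simpa using hr0 n, hf0⟩ (hd n) (hi n) (him n)
  refine (ext_conv hf hfinj hf0 hJordan hWP X hr1 hrt Xr).congr fun n => ?_
  rw [← gt_integral (hd n) (hi n) (hXr n)]
  simp only [schwarzian_const_mul (hrc n)]
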